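/- There exists a constant C > 0 such that the following holds. Let A ≥ 2, let I = [a,b] with a < b, and let (u,p) be a classical solution of the Navier–Stokes equations on I with ‖u(t,·)‖_{L^{3,∞}(ℝ³)} ≤ A for all t ∈ I. Then the total speed over the second half of I is bounded: ∫_{(a+b)/2}^{b} sup_{x∈ℝ³} |u(t,x)| dt ≤ (b−a)^{1/2}·A^C. -/

import Mathlib

noncomputable section
open Real MeasureTheory Filter Metric Set
open scoped ENNReal NNReal Topology FourierTransform

/-- Three-dimensional Euclidean space. -/
abbrev E3 : Type := EuclideanSpace ℝ (Fin 3)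

/-- The `i`-th partial derivative of a scalar function on `ℝ³`. -/
def pd (f : E3 → ℝ) (i : Fin 3) (x : E3) : ℝ :=
  fderiv ℝ f x (EuclideanSpace.single i 1)

/-- The Laplacian of a scalar function on `ℝ³`. -/
def lap (f : E3 → ℝ) (x : E3) : ℝ :=
  ∑ i : Fin 3, pd (fun y => pd f i y) i x

/-- `(u, pr)` is a classical solution of the Navier–Stokes equations on the time interval `I`. -/
def IsNSSol (u : ℝ → E3 → E3) (pr : ℝ → E3 → ℝ) (I : Set ℝ) : Prop :=
  (ContDiff ℝ (⊤:ℕ∞) fun q : ℝ × E3 => u q.1 q.2) ∧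
  (ContDiff ℝ (⊤:ℕ∞) fun q : ℝ × E3 => pr q.1 q.2) ∧
  (∀ t ∈ I, ∀ x : E3, ∀ i : Fin 3,
    deriv (fun s => u s x i) t - lap (fun y => u t y i) x
      + (∑ j : Fin 3, u t x j * pd (fun y => u t y i) j x) + pd (pr t) i x = 0) ∧
  (∀ t ∈ I, ∀ x : E3, (∑ i : Fin 3, pd (fun y => u t y i) i x) = 0)

/-- Rotation by angle `θ` about the `x₃`-axis. -/
def rotZ (θ : ℝ) (x : E3) : E3 :=
  (WithLp.equiv 2 (Fin 3 → ℝ)).symm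
    ![x 0 * Real.cos θ - x 1 * Real.sin θ, x 0 * Real.sin θ + x 1 * Real.cos θ, x 2]

/-- A time-dependent vector field is axisymmetric. -/
def AxiSym (u : ℝ → E3 → E3) : Prop := ∀ θ t x, u t (rotZ θ x) = rotZ θ (u t x)

/-- The weak `L^q` (quasi)norm `sup_{λ>0} λ · vol{|f| ≥ λ}^{1/q}`. -/
def wnorm' {F : Type*} [NormedAddCommGroup F] (f : E3 → F) (q : ℝ) : ℝ≥0∞ :=
  ⨆ (l : ℝ) (_ : 0 < l), ENNReal.ofReal l * (volume {x : E3 | l ≤ ‖f x‖}) ^ (1 / q)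

/-- The weak `L^3` norm. -/
def wnorm3 (f : E3 → E3) : ℝ≥0∞ := wnorm' f 3

/-- Distance to the `x₃`-axis. -/
def rr (x : E3) : ℝ := Real.sqrt (x 0 ^ 2 + x 1 ^ 2)

section

open scoped ContDiff

/-! ### Directional derivatives -/

section

/-- The derivative of `f` in the direction `v`. -/
def dder {V : Type*} [NormedAddCommGroup V] [NormedSpace ℝ V] (v : V) (f : V → ℝ) : V → ℝ :=
  fun x => fderiv ℝ f x v

/-- The standard basis vectors of `E3`. -/
def ee (i : Fin 3) : E3 := EuclideanSpace.single i 1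

section dder
variable {V : Type*} [NormedAddCommGroup V] [NormedSpace ℝ V] {f g : V → ℝ} (v w : V)

lemma dder_smooth (hf : ContDiff ℝ ∞ f) : ContDiff ℝ ∞ (dder v f) := by
  have h := hf.fderiv_right (m := ∞) (by norm_cast)
  exact h.clm_apply contDiff_const

lemma sm_diff (hf : ContDiff ℝ ∞ f) (x : V) : DifferentiableAt ℝ f x :=
  hf.differentiable (by simp) x

lemma dder_add (hf : ContDiff ℝ ∞ f) (hg : ContDiff ℝ ∞ g) :
    dder v (fun x => f x + g x) = fun x => dder v f x + dder v g x := by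
  funext x
  simp only [dder]
  rw [fderiv_fun_add (sm_diff hf x) (sm_diff hg x)]; rfl

lemma dder_sub (hf : ContDiff ℝ ∞ f) (hg : ContDiff ℝ ∞ g) :
    dder v (fun x => f x - g x) = fun x => dder v f x - dder v g x := by
  funext x
  simp only [dder]
  rw [fderiv_fun_sub (sm_diff hf x) (sm_diff hg x)]; rfl

lemma dder_mul (hf : ContDiff ℝ ∞ f) (hg : ContDiff ℝ ∞ g) :
    dder v (fun x => f x * g x) = fun x => dder v f x * g x + f x * dder v g x := by
  funext x
  simp only [dder]
  rw [fderiv_fun_mul (sm_diff hf x) (sm_diff hg x)]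
  simp; ring

lemma dder_const_mul (c : ℝ) (hf : ContDiff ℝ ∞ f) :
    dder v (fun x => c * f x) = fun x => c * dder v f x := by
  funext x
  simp only [dder]
  rw [fderiv_const_mul (sm_diff hf x)]; rfl

lemma dder_neg : dder v (fun x => - f x) = fun x => - dder v f x := by
  funext x
  simp only [dder]
  rw [fderiv_fun_neg]; rfl

lemma dder_sum {ι : Type*} (s : Finset ι) {F : ι → V → ℝ} (hF : ∀ i, ContDiff ℝ ∞ (F i)) :
    dder v (fun x => ∑ i ∈ s, F i x) = fun x => ∑ i ∈ s, dder v (F i) x := by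
  funext x
  simp only [dder]
  rw [fderiv_fun_sum (fun i _ => sm_diff (hF i) x)]
  simp

lemma dder_comm (hf : ContDiff ℝ ∞ f) : dder v (dder w f) = dder w (dder v f) := by
  funext x
  have hs : IsSymmSndFDerivAt ℝ f x :=
    (hf.contDiffAt).isSymmSndFDerivAt (by simp only [minSmoothness_of_isRCLikeNormedField]; exact WithTop.coe_le_coe.2 (le_top : (2 : ℕ∞) ≤ ⊤))
  have h1 : ∀ a : V, fderiv ℝ (dder a f) x = (fderiv ℝ (fderiv ℝ f) x).flip a := by
    intro a
    have hd : DifferentiableAt ℝ (fderiv ℝ f) x :=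
      (hf.fderiv_right (m := ∞) (by norm_cast)).differentiable (by simp) x
    have := fderiv_clm_apply (c := fderiv ℝ f) (u := fun _ => a) hd (differentiableAt_const a)
    change fderiv ℝ (fun y => fderiv ℝ f y a) x = _
    rw [this]; simp
  have e1 : dder v (dder w f) x = fderiv ℝ (fderiv ℝ f) x v w := by
    change fderiv ℝ (dder w f) x v = _
    rw [h1]; rfl
  have e2 : dder w (dder v f) x = fderiv ℝ (fderiv ℝ f) x w v := by
    change fderiv ℝ (dder v f) x w = _
    rw [h1]; rfl
  rw [e1, e2]; exact hs v w

lemma dder_zero (x : V) : dder v (fun _ => (0 : ℝ)) x = 0 := by simp [dder]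

lemma dder_comp_affine {W : Type*} [NormedAddCommGroup W] [NormedSpace ℝ W]
    (L : W →L[ℝ] V) (a : V) (w : W) (hf : ContDiff ℝ ∞ f) (x : W) :
    dder w (fun y => f (a + L y)) x = dder (L w) f (a + L x) := by
  simp only [dder]
  have h1 : HasFDerivAt (fun y : W => a + L y) L x := by
    simpa using (L.hasFDerivAt (x := x)).const_add a
  have := ((sm_diff hf (a + L x)).hasFDerivAt).comp x h1
  have h2 := this.fderiv
  simp only [Function.comp_def] at h2
  rw [h2]; rfl

end dder

lemma pd_eq_dder (f : E3 → ℝ) (i : Fin 3) : pd f i = dder (ee i) f := rfl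

lemma ee_norm (i : Fin 3) : ‖ee i‖ = 1 := by simp [ee]

lemma sum_ee (v : E3) : v = ∑ i, v i • ee i := by
  ext j
  fin_cases j <;> simp [ee, Fin.sum_univ_three]

lemma fderiv_eq_sum (f : E3 → ℝ) (x v : E3) : fderiv ℝ f x v = ∑ i, v i * dder (ee i) f x := by
  conv_lhs => rw [sum_ee v]
  simp [map_sum, dder]

/-! ### Averages of translates -/

section av
variable {V : Type} [NormedAddCommGroup V] [NormedSpace ℝ V] [MeasurableSpace V] [BorelSpace V]
  [FiniteDimensional ℝ V]
  {Ω : Type*} [MeasurableSpace Ω]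

/-- Weighted average of translates of `f`. -/
def av {E : Type} [NormedAddCommGroup E] [NormedSpace ℝ E] (ν : Measure Ω) (T : Ω → V)
    (c : Ω → ℝ) (f : V → E) (x : V) : E := ∫ w, c w • f (x - T w) ∂ν

/-- Data for which averages are well behaved. -/
structure AvOK (ν : Measure Ω) (T : Ω → V) (c : Ω → ℝ) (B : ℝ) : Prop where
  int : Integrable c ν
  meas : Measurable T
  bdd : ∀ᵐ w ∂ν, ‖T w‖ ≤ B

variable {ν : Measure Ω} {T : Ω → V} {c : Ω → ℝ} {B : ℝ}
variable {E : Type} [NormedAddCommGroup E] [NormedSpace ℝ E] 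

omit [NormedSpace ℝ V] [MeasurableSpace V] [BorelSpace V] [FiniteDimensional ℝ V] [NormedSpace ℝ E] in
lemma bdd_on_ball [ProperSpace V] {f : V → E} (hf : Continuous f) (R : ℝ) :
    ∃ M, 0 ≤ M ∧ ∀ x, ‖x‖ ≤ R → ‖f x‖ ≤ M := by
  obtain ⟨M, hM⟩ := (isCompact_closedBall (0 : V) R).exists_bound_of_continuousOn hf.continuousOn
  refine ⟨max M 0, le_max_right _ _, fun x hx => (hM x (by simpa using hx)).trans (le_max_left _ _)⟩

lemma AvOK.integrable (h : AvOK ν T c B) {f : V → E} (hf : Continuous f) (x : V) :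
    Integrable (fun w => c w • f (x - T w)) ν := by
  have : ProperSpace V := FiniteDimensional.proper ℝ V
  obtain ⟨M, hM0, hM⟩ := bdd_on_ball hf (‖x‖ + B)
  have hm : AEStronglyMeasurable (fun w => f (x - T w)) ν :=
    (hf.comp_stronglyMeasurable (h.meas.const_sub x).stronglyMeasurable).aestronglyMeasurable
  have h2 : ∀ᵐ w ∂ν, ‖f (x - T w)‖ ≤ M := by
    filter_upwards [h.bdd] with w hw
    exact hM _ ((norm_sub_le _ _).trans (by linarith))
  exact h.int.smul_bdd _ hm h2

lemma AvOK.hasFDerivAt (h : AvOK ν T c B) {f : V → E} (hf : ContDiff ℝ 1 f) (x : V) :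
    HasFDerivAt (av ν T c f) (av ν T c (fderiv ℝ f) x) x := by
  have : ProperSpace V := FiniteDimensional.proper ℝ V
  have hfc : Continuous (fderiv ℝ f) := hf.continuous_fderiv (by simp)
  obtain ⟨M, hM0, hM⟩ := bdd_on_ball hfc (‖x‖ + 1 + B)
  refine hasFDerivAt_integral_of_dominated_of_fderiv_le (F := fun y w => c w • f (y - T w))
    (F' := fun y w => c w • fderiv ℝ f (y - T w)) (bound := fun w => ‖c w‖ * M)
    (ball_mem_nhds x one_pos) ?_ ?_ ?_ ?_ ?_ ?_
  · exact Eventually.of_forall fun y => (h.integrable hf.continuous y).aestronglyMeasurable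
  · exact h.integrable hf.continuous x
  · exact (h.integrable hfc x).aestronglyMeasurable
  · filter_upwards [h.bdd] with w hw y hy
    rw [norm_smul]
    gcongr
    apply hM
    have h1 : ‖y‖ ≤ ‖x‖ + 1 := by
      have := norm_sub_norm_le y x
      rw [mem_ball, dist_eq_norm] at hy
      linarith
    exact (norm_sub_le _ _).trans (by linarith)
  · exact h.int.norm.mul_const M
  · refine Eventually.of_forall fun w y _ => ?_
    have h1 : HasFDerivAt f (fderiv ℝ f (y - T w)) (y - T w) :=
      (hf.differentiable (by simp) _).hasFDerivAt
    have h2 : HasFDerivAt (fun y => f (y - T w)) (fderiv ℝ f (y - T w)) y := by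
      have := h1.comp y ((hasFDerivAt_id y).sub_const (T w))
      simpa [Function.comp_def] using this
    exact h2.const_smul (c w)

lemma AvOK.contDiff_nat (h : AvOK ν T c B) (n : ℕ) :
    ∀ {E : Type} [NormedAddCommGroup E] [NormedSpace ℝ E]  {f : V → E},
    ContDiff ℝ n f → ContDiff ℝ n (av ν T c f) := by
  have : ProperSpace V := FiniteDimensional.proper ℝ V
  induction n with
  | zero =>
    intro E _ _ f hf
    rw [Nat.cast_zero, contDiff_zero] at hf ⊢
    refine continuous_iff_continuousAt.2 fun x => ?_
    obtain ⟨M, hM0, hM⟩ := bdd_on_ball hf (‖x‖ + 1 + B)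
    refine continuousAt_of_dominated (bound := fun w => ‖c w‖ * M) ?_ ?_ ?_ ?_
    · exact Eventually.of_forall fun y => (h.integrable hf y).aestronglyMeasurable
    · filter_upwards [ball_mem_nhds x one_pos] with y hy
      filter_upwards [h.bdd] with w hw
      rw [norm_smul]
      gcongr
      apply hM
      have h1 : ‖y‖ ≤ ‖x‖ + 1 := by
        have := norm_sub_norm_le y x
        rw [mem_ball, dist_eq_norm] at hy
        linarith
      exact (norm_sub_le _ _).trans (by linarith)
    · exact h.int.norm.mul_const M
    · refine Eventually.of_forall fun w => ?_
      fun_prop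
  | succ n ih =>
    intro E _ _ f hf
    have h1 : ContDiff ℝ 1 f := hf.of_le (by exact_mod_cast Nat.succ_le_succ (Nat.zero_le n))
    have hd : ∀ x, fderiv ℝ (av ν T c f) x = av ν T c (fderiv ℝ f) x := fun x =>
      (h.hasFDerivAt h1 x).fderiv
    push_cast at hf ⊢
    rw [contDiff_succ_iff_fderiv] at hf ⊢
    refine ⟨fun x => (h.hasFDerivAt h1 x).differentiableAt, by simp, ?_⟩
    rw [show fderiv ℝ (av ν T c f) = av ν T c (fderiv ℝ f) from funext hd]
    exact ih hf.2.2

lemma AvOK.contDiff (h : AvOK ν T c B) {f : V → ℝ} (hf : ContDiff ℝ ∞ f) :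
    ContDiff ℝ ∞ (av ν T c f) :=
  contDiff_infty.2 fun n => h.contDiff_nat n (hf.of_le (by exact_mod_cast le_top))

lemma AvOK.dder (h : AvOK ν T c B) {f : V → ℝ} (hf : ContDiff ℝ ∞ f) (v : V) :
    dder v (av ν T c f) = av ν T c (dder v f) := by
  funext x
  have h1 : ContDiff ℝ 1 f := hf.of_le (by simp)
  have hfc : Continuous (fderiv ℝ f) := h1.continuous_fderiv (by simp)
  simp only [_root_.dder]
  rw [(h.hasFDerivAt h1 x).fderiv]
  simp only [av]
  rw [ContinuousLinearMap.integral_apply (h.integrable hfc x)]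
  rfl

end av

end

/-! ### Compactly supported kernels -/

section

/-- Smooth functions supported in the closed ball of radius `R`. -/
structure Bump (k : E3 → ℝ) (R : ℝ) : Prop where
  smooth : ContDiff ℝ ∞ k
  supp : ∀ z, R < ‖z‖ → k z = 0

lemma Bump.compact {k : E3 → ℝ} {R : ℝ} (h : Bump k R) : HasCompactSupport k :=
  HasCompactSupport.intro (isCompact_closedBall (0 : E3) R) fun z hz => h.supp z (by simpa using hz)

lemma Bump.dder {k : E3 → ℝ} {R : ℝ} (h : Bump k R) (v : E3) : Bump (dder v k) R := by
  refine ⟨dder_smooth v h.smooth, fun z hz => ?_⟩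
  have : k =ᶠ[𝓝 z] fun _ => 0 := by
    filter_upwards [(isOpen_lt continuous_const continuous_norm).mem_nhds hz] with y hy
    exact h.supp y hy
  simp only [_root_.dder]
  rw [this.fderiv_eq]; simp

lemma Bump.mul {k g : E3 → ℝ} {R : ℝ} (h : Bump k R) (hg : ContDiff ℝ ∞ g) :
    Bump (fun z => k z * g z) R :=
  ⟨h.smooth.mul hg, fun z hz => by simp [h.supp z hz]⟩

lemma Bump.integrable_mul {k g : E3 → ℝ} {R : ℝ} (h : Bump k R) (hg : Continuous g) :
    Integrable (fun z => k z * g z) :=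
  (h.smooth.continuous.mul hg).integrable_of_hasCompactSupport h.compact.mul_right

lemma Bump.integrable {k : E3 → ℝ} {R : ℝ} (h : Bump k R) : Integrable k :=
  h.smooth.continuous.integrable_of_hasCompactSupport h.compact

lemma Bump.integral_zero_outside {k : E3 → ℝ} {R : ℝ} (h : Bump k R) (g : E3 → ℝ) :
    ∫ z in closedBall (0 : E3) R, k z * g z = ∫ z, k z * g z := by
  refine setIntegral_eq_integral_of_forall_compl_eq_zero fun z hz => ?_
  rw [h.supp z (by simpa using hz), zero_mul]

lemma Bump.ibp {k g : E3 → ℝ} {R : ℝ} (h : Bump k R) (hg : ContDiff ℝ ∞ g) (v : E3) :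
    ∫ z, k z * _root_.dder v g z = - ∫ z, _root_.dder v k z * g z := by
  refine integral_mul_fderiv_eq_neg_fderiv_mul_of_integrable (f := k) (g := g) (v := v) ?_ ?_ ?_ ?_ ?_
  · exact (h.dder v).integrable_mul hg.continuous
  · exact h.integrable_mul (dder_smooth v hg).continuous
  · exact h.integrable_mul hg.continuous
  · exact fun x _ => sm_diff h.smooth x
  · exact fun x _ => sm_diff hg x

/-- Average of `f` over translates by `s • z` with weight `k z`. -/
def mol (s : ℝ) (k f : E3 → ℝ) (x : E3) : ℝ := ∫ z, k z * f (x - s • z)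

lemma smooth_aff {f : E3 → ℝ} (hf : ContDiff ℝ ∞ f) (x : E3) (s : ℝ) :
    ContDiff ℝ ∞ (fun z => f (x - s • z)) := by fun_prop

lemma dder_aff {f : E3 → ℝ} (hf : ContDiff ℝ ∞ f) (x : E3) (s : ℝ) (v : E3) :
    dder v (fun z => f (x - s • z)) = fun z => - s * dder v f (x - s • z) := by
  funext z
  have := dder_comp_affine (-s • ContinuousLinearMap.id ℝ E3) x v hf z
  simp only [neg_smul, _root_.smul_apply, ContinuousLinearMap.id_apply, ← sub_eq_add_neg] at this
  rw [this]
  simp [dder]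

lemma mol_dder {k f : E3 → ℝ} {R s : ℝ} (hk : Bump k R) (hf : ContDiff ℝ ∞ f) (hs : s ≠ 0)
    (v : E3) (x : E3) : mol s k (dder v f) x = s⁻¹ * mol s (dder v k) f x := by
  have h1 := hk.ibp (smooth_aff hf x s) v
  rw [dder_aff hf] at h1
  have h2 : ∫ z, k z * (-s * dder v f (x - s • z)) = -s * mol s k (dder v f) x := by
    rw [mol, ← integral_const_mul]
    congr 1; funext z; ring
  rw [h2] at h1
  have h3 : s * mol s k (dder v f) x = mol s (dder v k) f x := by
    unfold mol at *; linarith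
  rw [← h3]; field_simp

lemma avok_mol {k : E3 → ℝ} {R : ℝ} (s : ℝ) (hk : Bump k R) :
    AvOK (volume.restrict (closedBall (0 : E3) R)) (fun z => s • z) k (|s| * R) := by
  refine ⟨hk.integrable.restrict, by fun_prop, ?_⟩
  refine (ae_restrict_iff' measurableSet_closedBall).2 (Eventually.of_forall fun z hz => ?_)
  rw [norm_smul, Real.norm_eq_abs]
  gcongr
  simpa using hz

lemma mol_eq_av {k : E3 → ℝ} {R : ℝ} (s : ℝ) (hk : Bump k R) (f : E3 → ℝ) :
    mol s k f = av (volume.restrict (closedBall (0 : E3) R)) (fun z => s • z) k f := by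
  funext x
  exact (hk.integral_zero_outside _).symm

lemma mol_smooth {k f : E3 → ℝ} {R : ℝ} (s : ℝ) (hk : Bump k R) (hf : ContDiff ℝ ∞ f) :
    ContDiff ℝ ∞ (mol s k f) := by
  rw [mol_eq_av s hk]; exact (avok_mol s hk).contDiff hf

lemma dder_mol {k f : E3 → ℝ} {R : ℝ} (s : ℝ) (hk : Bump k R) (hf : ContDiff ℝ ∞ f) (v : E3) :
    dder v (mol s k f) = mol s k (dder v f) := by
  rw [mol_eq_av s hk, mol_eq_av s hk, (avok_mol s hk).dder hf]

/-- Integrals against a compactly supported kernel of a smooth family of functions. -/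
lemma param_smooth {k : E3 → ℝ} {R : ℝ} (hk : Bump k R) {H : ℝ × E3 → ℝ} (hH : ContDiff ℝ ∞ H) :
    ContDiff ℝ ∞ (fun s : ℝ => ∫ z, k z * H (s, z)) ∧
    ∀ s, HasDerivAt (fun s : ℝ => ∫ z, k z * H (s, z)) (∫ z, k z * dder (1, 0) H (s, z)) s := by
  have hok : AvOK (volume.restrict (closedBall (0 : E3) R)) (fun z : E3 => ((0 : ℝ), -z)) k R := by
    refine ⟨hk.integrable.restrict, by fun_prop, ?_⟩
    refine (ae_restrict_iff' measurableSet_closedBall).2 (Eventually.of_forall fun z hz => ?_)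
    simpa [Prod.norm_def] using hz
  have h1 : ∀ G : ℝ × E3 → ℝ, (fun s : ℝ => ∫ z, k z * G (s, z)) =
      fun s => av (volume.restrict (closedBall (0 : E3) R)) (fun z : E3 => ((0 : ℝ), -z)) k G (s, 0) := by
    intro G; funext s
    rw [← hk.integral_zero_outside]
    simp [av]
  have hs := hok.contDiff hH
  refine ⟨?_, fun s => ?_⟩
  · rw [h1]; exact hs.comp (contDiff_id.prodMk contDiff_const)
  · rw [h1]
    have e := congrFun (hok.dder hH (1, 0)) (s, 0)
    have e2 := congrFun (h1 (dder (1, 0) H)) s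
    rw [e2, ← e]
    have hp : HasDerivAt (fun s : ℝ => (s, (0 : E3))) (1, 0) s :=
      (hasDerivAt_id s).prodMk (hasDerivAt_const s 0)
    exact ((sm_diff hs (s, 0)).hasFDerivAt).comp_hasDerivAt s hp

/-- The Laplacian in terms of directional derivatives. -/
def lapl (f : E3 → ℝ) (x : E3) : ℝ := ∑ i, dder (ee i) (dder (ee i) f) x

lemma lapl_smooth {f : E3 → ℝ} (hf : ContDiff ℝ ∞ f) : ContDiff ℝ ∞ (lapl f) :=
  ContDiff.sum fun _ _ => dder_smooth _ (dder_smooth _ hf)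

/-- A pair of kernels related by `∇ζ = -xφ`. -/
structure KPair (ζ φ : E3 → ℝ) : Prop where
  bz : Bump ζ 1
  bp : Bump φ 1
  rel : ∀ i x, dder (ee i) ζ x = - (x i * φ x)
  one : ∫ x, φ x = 1
  pos : ∀ x, 0 ≤ φ x

lemma mol_param {k f : E3 → ℝ} {R : ℝ} (hk : Bump k R) (hf : ContDiff ℝ ∞ f) (x : E3) :
    ContDiff ℝ ∞ (fun s => mol s k f x) :=
  (param_smooth hk (H := fun q => f (x - q.1 • q.2)) (by fun_prop)).1

lemma KPair.deriv_mol {ζ φ f : E3 → ℝ} (h : KPair ζ φ) (hf : ContDiff ℝ ∞ f) (x : E3) (s : ℝ) :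
    HasDerivAt (fun s => mol s φ f x) (s * mol s ζ (lapl f) x) s := by
  have hH : ContDiff ℝ ∞ (fun q : ℝ × E3 => f (x - q.1 • q.2)) := by fun_prop
  have h1 := (param_smooth h.bp hH).2 s
  refine h1.congr_deriv ?_
  have h2 : ∀ z : E3, dder (1, 0) (fun q : ℝ × E3 => f (x - q.1 • q.2)) (s, z) =
      - ∑ i, z i * dder (ee i) f (x - s • z) := by
    intro z
    have hg : HasDerivAt (fun r : ℝ => f (x - r • z)) (fderiv ℝ f (x - s • z) (-z)) s := by
      have hd : HasDerivAt (fun r : ℝ => x - r • z) (-z) s := by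
        simpa using ((hasDerivAt_id s).smul_const z).const_sub x
      exact ((sm_diff hf _).hasFDerivAt).comp_hasDerivAt s hd
    have hg2 : HasDerivAt (fun r : ℝ => f (x - r • z))
        (dder (1, 0) (fun q : ℝ × E3 => f (x - q.1 • q.2)) (s, z)) s := by
      have hp : HasDerivAt (fun s : ℝ => (s, z)) (1, 0) s :=
        (hasDerivAt_id s).prodMk (hasDerivAt_const s z)
      exact ((sm_diff hH (s, z)).hasFDerivAt).comp_hasDerivAt s hp
    rw [hg2.unique hg, map_neg, fderiv_eq_sum]
  simp only [h2]
  have h3 : ∀ z, φ z * - ∑ i, z i * dder (ee i) f (x - s • z) =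
      ∑ i, dder (ee i) ζ z * dder (ee i) f (x - s • z) := by
    intro z
    simp only [h.rel, Fin.sum_univ_three]; ring
  simp only [h3]
  have hsm : ∀ i, ContDiff ℝ ∞ (dder (ee i) f) := fun i => dder_smooth _ hf
  rw [integral_finsetSum _ fun i _ => (h.bz.dder _).integrable_mul (smooth_aff (hsm i) x s).continuous]
  have h4 : ∀ i, ∫ z, dder (ee i) ζ z * dder (ee i) f (x - s • z) =
      s * mol s ζ (dder (ee i) (dder (ee i) f)) x := by
    intro i
    have := h.bz.ibp (smooth_aff (hsm i) x s) (ee i)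
    rw [dder_aff (hsm i)] at this
    rw [mol, ← integral_const_mul, ← neg_inj, ← this, ← integral_neg]
    congr 1; funext z; ring
  simp only [h4]
  rw [← Finset.mul_sum]
  congr 1
  simp only [mol, lapl]
  rw [← integral_finsetSum _ fun i _ => h.bz.integrable_mul
    (smooth_aff (dder_smooth _ (hsm i)) x s).continuous]
  simp only [Finset.mul_sum]

lemma mol_zero {k f : E3 → ℝ} (x : E3) : mol 0 k f x = (∫ z, k z) * f x := by
  simp [mol, integral_mul_const]

lemma KPair.identity {ζ φ f : E3 → ℝ} (h : KPair ζ φ) (hf : ContDiff ℝ ∞ f) (x : E3) (a b : ℝ) :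
    mol b φ f x - mol a φ f x = ∫ s in a..b, s * mol s ζ (lapl f) x := by
  symm
  apply intervalIntegral.integral_eq_sub_of_hasDerivAt
  · exact fun s _ => h.deriv_mol hf x s
  · exact (continuous_id.mul (mol_param h.bz (lapl_smooth hf) x).continuous).intervalIntegrable _ _

lemma exists_kpair : ∃ ζ φ : E3 → ℝ, KPair ζ φ := by
  set ψ : ℝ → ℝ := Real.smoothTransition
  have hψ : ContDiff ℝ ∞ ψ := Real.smoothTransition.contDiff
  have hψ' : ContDiff ℝ ∞ (deriv ψ) := by
    have : ContDiff ℝ ((∞ : WithTop ℕ∞) + 1) ψ := Real.smoothTransition.contDiff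
    exact (contDiff_succ_iff_deriv.1 this).2.2
  set z0 : E3 → ℝ := fun x => ψ (1 - ‖x‖ ^ 2)
  set p0 : E3 → ℝ := fun x => 2 * deriv ψ (1 - ‖x‖ ^ 2)
  have hn : ContDiff ℝ ∞ (fun x : E3 => 1 - ‖x‖ ^ 2) := contDiff_const.sub (contDiff_norm_sq ℝ)
  have hz0 : ∀ z : E3, 1 < ‖z‖ → 1 - ‖z‖ ^ 2 < 0 := fun z hz => by nlinarith
  have bz : Bump z0 1 := ⟨hψ.comp hn, fun z hz =>
    Real.smoothTransition.zero_of_nonpos (hz0 z hz).le⟩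
  have bp : Bump p0 1 := by
    refine ⟨contDiff_const.mul (hψ'.comp hn), fun z hz => ?_⟩
    have : ψ =ᶠ[𝓝 (1 - ‖z‖ ^ 2)] fun _ => 0 := by
      filter_upwards [Iio_mem_nhds (hz0 z hz)] with y hy
      exact Real.smoothTransition.zero_of_nonpos (le_of_lt hy)
    simp [p0, this.deriv_eq]
  have rel : ∀ i x, dder (ee i) z0 x = - (x i * p0 x) := by
    intro i x
    have h1 : HasFDerivAt (fun x : E3 => 1 - ‖x‖ ^ 2) (-(2 • (innerSL ℝ x))) x := by
      simpa using ((hasStrictFDerivAt_norm_sq x).hasFDerivAt).const_sub 1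
    have h2 := ((hψ.differentiable (by simp) (1 - ‖x‖ ^ 2)).hasDerivAt).comp_hasFDerivAt x h1
    have h3 : fderiv ℝ z0 x = deriv ψ (1 - ‖x‖ ^ 2) • (-(2 • (innerSL ℝ x))) := h2.fderiv
    simp only [dder, h3, p0]
    have : inner ℝ x (ee i) = x i := by simp [ee, EuclideanSpace.inner_single_right]
    simp [this]; ring
  have hp : ∀ x, 0 ≤ p0 x := fun x => by
    have : Monotone ψ := Real.smoothTransition.monotone
    have := this.deriv_nonneg (x := 1 - ‖x‖ ^ 2)
    simp only [p0]; linarith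
  have hI : 0 < ∫ x, p0 x := by
    rw [integral_pos_iff_support_of_nonneg hp bp.integrable]
    refine (bp.smooth.continuous.isOpen_support).measure_pos volume ?_
    by_contra hne
    rw [not_nonempty_iff_eq_empty, Function.support_eq_empty_iff] at hne
    have hd : ∀ i x, dder (ee i) z0 x = 0 := fun i x => by rw [rel, hne]; simp
    have hf0 : ∀ x, fderiv ℝ z0 x = 0 := fun x => by
      ext v; rw [fderiv_eq_sum]; simp [hd]
    have hc := is_const_of_fderiv_eq_zero (bz.smooth.differentiable (by simp)) hf0 0
      (EuclideanSpace.single 0 2)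
    rw [bz.supp (EuclideanSpace.single 0 2) (by simp)] at hc
    simp only [z0, norm_zero] at hc
    have : ψ (1 - 0 ^ 2) = 1 := Real.smoothTransition.one_of_one_le (by norm_num)
    rw [this] at hc; norm_num at hc
  set c := (∫ x, p0 x)⁻¹
  refine ⟨fun x => c * z0 x, fun x => c * p0 x, ⟨contDiff_const.mul bz.smooth, ?_⟩,
    ⟨contDiff_const.mul bp.smooth, ?_⟩, ?_, ?_, ?_⟩
  · intro z hz; simp [bz.supp z hz]
  · intro z hz; simp [bp.supp z hz]
  · intro i x; rw [dder_const_mul _ _ bz.smooth]; simp only; rw [rel]; ring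
  · rw [integral_const_mul]; exact inv_mul_cancel₀ hI.ne'
  · intro x; exact mul_nonneg (inv_nonneg.2 hI.le) (hp x)

lemma Bump.bound {k : E3 → ℝ} {R : ℝ} (h : Bump k R) : ∃ C, 0 < C ∧ ∀ z, |k z| ≤ C := by
  obtain ⟨C, hC⟩ := h.smooth.continuous.bounded_above_of_compact_support h.compact
  exact ⟨max C 1, by positivity, fun z => (hC z).trans (le_max_left _ _)⟩

end

/-! ### Averages of weak `L³` functions -/

section

/-- Nonnegative measurable functions with weak `L³` norm at most `A`. -/
structure Wk (f : E3 → ℝ) (A : ℝ) : Prop where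
  meas : Measurable f
  nonneg : ∀ x, 0 ≤ f x
  weak : ∀ l : ℝ, 0 < l → volume {x | l ≤ f x} ≤ ENNReal.ofReal ((A / l) ^ 3)

lemma Wk.tail_two {f : E3 → ℝ} {A l : ℝ} (h : Wk f A) (hA : 0 ≤ A) (hl : 0 < l) :
    ∫⁻ x in {x | l ≤ f x}, ENNReal.ofReal (f x) ^ 2 ≤ ENNReal.ofReal (8 * A ^ 3 / l) := by
  have hm : ∀ c : ℝ, MeasurableSet {x | c ≤ f x} := fun c => measurableSet_le measurable_const h.meas
  rw [← lintegral_indicator (hm l)]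
  calc ∫⁻ x, ({x | l ≤ f x}).indicator (fun x => ENNReal.ofReal (f x) ^ 2) x
      ≤ ∫⁻ x, ∑' n : ℕ, ({x | 2 ^ n * l ≤ f x}).indicator
          (fun _ => ENNReal.ofReal ((2 ^ (n + 1) * l) ^ 2)) x := by
        refine lintegral_mono fun x => ?_
        by_cases hx : l ≤ f x
        · have h1 : 1 ≤ f x / l := by rwa [le_div_iff₀ hl, one_mul]
          obtain ⟨n, hn1, hn2⟩ := exists_nat_pow_near h1 (one_lt_two)
          rw [le_div_iff₀ hl] at hn1
          rw [div_lt_iff₀ hl] at hn2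
          refine le_trans ?_ (ENNReal.le_tsum n)
          rw [indicator_of_mem (by exact hx), indicator_of_mem (by exact hn1),
            ← ENNReal.ofReal_pow (h.nonneg x)]
          apply ENNReal.ofReal_le_ofReal
          have := h.nonneg x
          gcongr
        · rw [indicator_of_notMem (by exact hx)]; exact zero_le
    _ = ∑' n : ℕ, ∫⁻ x, ({x | 2 ^ n * l ≤ f x}).indicator
          (fun _ => ENNReal.ofReal ((2 ^ (n + 1) * l) ^ 2)) x := by
        refine lintegral_tsum fun n => ?_
        exact (measurable_const.indicator (hm _)).aemeasurable
    _ ≤ ∑' n : ℕ, ENNReal.ofReal (4 * A ^ 3 / l * (1 / 2) ^ n) := by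
        refine ENNReal.tsum_le_tsum fun n => ?_
        rw [lintegral_indicator_const (hm _)]
        refine (mul_le_mul_right (h.weak _ (by positivity)) _).trans ?_
        rw [← ENNReal.ofReal_mul (by positivity)]
        apply ENNReal.ofReal_le_ofReal
        apply le_of_eq
        have : ((2:ℝ) ^ n) ≠ 0 := by positivity
        rw [one_div, inv_pow]
        field_simp
        ring
    _ = ENNReal.ofReal (8 * A ^ 3 / l) := by
        rw [← ENNReal.ofReal_tsum_of_nonneg (fun n => by positivity)
          (summable_geometric_two.mul_left _), tsum_mul_left, tsum_geometric_two]
        congr 1; ring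

lemma Wk.low_four {f : E3 → ℝ} {A l : ℝ} (h : Wk f A) (hA : 0 ≤ A) (hl : 0 < l) :
    ∫⁻ x in {x | f x < l}, ENNReal.ofReal (f x) ^ 4 ≤ ENNReal.ofReal (16 * A ^ 3 * l) := by
  have hm : ∀ c : ℝ, MeasurableSet {x | c ≤ f x} := fun c => measurableSet_le measurable_const h.meas
  rw [← lintegral_indicator (measurableSet_lt h.meas measurable_const)]
  calc ∫⁻ x, ({x | f x < l}).indicator (fun x => ENNReal.ofReal (f x) ^ 4) x
      ≤ ∫⁻ x, ∑' n : ℕ, ({x | (1 / 2) ^ (n + 1) * l ≤ f x}).indicator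
          (fun _ => ENNReal.ofReal (((1 / 2) ^ n * l) ^ 4)) x := by
        refine lintegral_mono fun x => ?_
        by_cases hx : f x < l
        · rw [indicator_of_mem (by exact hx)]
          rcases (h.nonneg x).eq_or_lt with h0 | h0
          · simp [← h0]
          have h1 : f x / l ≤ 1 := by rw [div_le_iff₀ hl, one_mul]; exact hx.le
          obtain ⟨n, hn1, hn2⟩ := exists_nat_pow_near_of_lt_one (div_pos h0 hl) h1
            (by norm_num : (0:ℝ) < 1 / 2) (by norm_num)
          rw [lt_div_iff₀ hl] at hn1
          rw [div_le_iff₀ hl] at hn2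
          refine le_trans ?_ (ENNReal.le_tsum n)
          rw [indicator_of_mem (by exact hn1.le),
            ← ENNReal.ofReal_pow (h.nonneg x)]
          apply ENNReal.ofReal_le_ofReal
          gcongr
        · rw [indicator_of_notMem (by exact hx)]; exact zero_le
    _ = ∑' n : ℕ, ∫⁻ x, ({x | (1 / 2) ^ (n + 1) * l ≤ f x}).indicator
          (fun _ => ENNReal.ofReal (((1 / 2) ^ n * l) ^ 4)) x := by
        refine lintegral_tsum fun n => ?_
        exact (measurable_const.indicator (hm _)).aemeasurable
    _ ≤ ∑' n : ℕ, ENNReal.ofReal (8 * A ^ 3 * l * (1 / 2) ^ n) := by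
        refine ENNReal.tsum_le_tsum fun n => ?_
        rw [lintegral_indicator_const (hm _)]
        refine (mul_le_mul_right (h.weak _ (by positivity)) _).trans ?_
        rw [← ENNReal.ofReal_mul (by positivity)]
        apply ENNReal.ofReal_le_ofReal
        apply le_of_eq
        have : ((1 / 2:ℝ) ^ n) ≠ 0 := by positivity
        simp only [pow_succ _ n]
        generalize ((1:ℝ) / 2) ^ n = r at *
        field_simp
        ring
    _ = ENNReal.ofReal (16 * A ^ 3 * l) := by
        rw [← ENNReal.ofReal_tsum_of_nonneg (fun n => by positivity)
          (summable_geometric_two.mul_left _), tsum_mul_left, tsum_geometric_two]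
        congr 1; ring

lemma lintegral_sq_le {Ω : Type*} [MeasurableSpace Ω] (μ : Measure Ω) {f : Ω → ℝ≥0∞}
    (hf : AEMeasurable f μ) : (∫⁻ x, f x ∂μ) ^ 2 ≤ μ univ * ∫⁻ x, f x ^ 2 ∂μ := by
  have h := ENNReal.lintegral_mul_le_Lp_mul_Lq μ (p := 2) (q := 2)
    (by exact Real.HolderConjugate.two_two) hf (aemeasurable_const (b := (1 : ℝ≥0∞)))
  simp only [Pi.mul_apply, mul_one, ENNReal.one_rpow, lintegral_const, one_mul] at h
  have h2 : ((∫⁻ x, f x ^ (2:ℝ) ∂μ) ^ (1 / 2 : ℝ) * (μ univ) ^ (1 / 2 : ℝ)) ^ 2 =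
      μ univ * ∫⁻ x, f x ^ 2 ∂μ := by
    rw [mul_pow, ← ENNReal.rpow_natCast, ← ENNReal.rpow_natCast, ← ENNReal.rpow_mul,
      ← ENNReal.rpow_mul]
    simp [mul_comm]
  calc _ ≤ _ := by gcongr
    _ = _ := h2

lemma lintegral_cs {Ω : Type*} [MeasurableSpace Ω] (μ : Measure Ω) {a f : Ω → ℝ≥0∞}
    (ha : Measurable a) (hf : Measurable f) :
    (∫⁻ x, a x * f x ∂μ) ^ 2 ≤ (∫⁻ x, a x ∂μ) * ∫⁻ x, a x * f x ^ 2 ∂μ := by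
  have h := lintegral_sq_le (μ.withDensity a) hf.aemeasurable
  rw [lintegral_withDensity_eq_lintegral_mul _ ha hf,
    lintegral_withDensity_eq_lintegral_mul _ ha (hf.pow_const 2), withDensity_apply _ .univ] at h
  simpa using h

lemma lintegral_minkowski {Ω X : Type*} [MeasurableSpace Ω] [MeasurableSpace X] (ν : Measure Ω)
    (μ : Measure X) [SFinite ν] [SFinite μ] {a : Ω → ℝ≥0∞} {g : Ω → X → ℝ≥0∞}
    (ha : Measurable a) (hg : Measurable (Function.uncurry g)) {K : ℝ≥0∞}
    (b : Ω → ℝ≥0∞) (hK : ∀ᵐ w ∂ν, ∫⁻ x, g w x ^ 2 ∂μ ≤ K * b w ^ 2) (hb : Measurable b)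
    (hb0 : ∀ w, b w ≠ 0) (hbt : ∀ w, b w ≠ ⊤) :
    ∫⁻ x, (∫⁻ w, a w * g w x ∂ν) ^ 2 ∂μ ≤ K * (∫⁻ w, a w * b w ∂ν) ^ 2 := by
  have hgw : ∀ x, Measurable fun w => g w x := fun x => hg.comp (measurable_id.prodMk measurable_const)
  have e : ∀ w x, a w * g w x = a w * b w * (g w x / b w) := fun w x => by
    rw [mul_assoc, ENNReal.mul_div_cancel (hb0 w) (hbt w)]
  calc ∫⁻ x, (∫⁻ w, a w * g w x ∂ν) ^ 2 ∂μ
      ≤ ∫⁻ x, (∫⁻ w, a w * b w ∂ν) * ∫⁻ w, a w * b w * (g w x / b w) ^ 2 ∂ν ∂μ := by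
        refine lintegral_mono fun x => ?_
        simp only [e]
        exact lintegral_cs ν (ha.mul hb) ((hgw x).div hb)
    _ = (∫⁻ w, a w * b w ∂ν) * ∫⁻ w, ∫⁻ x, a w * b w * (g w x / b w) ^ 2 ∂μ ∂ν := by
        have hme : Measurable (Function.uncurry fun x w => a w * b w * (g w x / b w) ^ 2) := by
          have h1 : Measurable fun p : X × Ω => g p.2 p.1 := hg.comp measurable_swap
          exact (((ha.mul hb).comp measurable_snd).mul
            ((h1.div (hb.comp measurable_snd)).pow_const 2))
        rw [lintegral_const_mul _ hme.lintegral_prod_right, lintegral_lintegral_swap hme.aemeasurable]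
    _ ≤ (∫⁻ w, a w * b w ∂ν) * ∫⁻ w, K * (a w * b w) ∂ν := by
        gcongr 1
        refine lintegral_mono_ae ?_
        filter_upwards [hK] with w hw
        have hgx : Measurable fun x => g w x := hg.comp (measurable_const.prodMk measurable_id)
        rw [lintegral_const_mul _ ((hgx.div_const _).pow_const 2), mul_comm K]
        gcongr
        simp only [div_eq_mul_inv, mul_pow]
        rw [lintegral_mul_const _ (hgx.pow_const 2)]
        calc _ ≤ K * b w ^ 2 * (b w)⁻¹ ^ 2 := by gcongr
          _ = K := by
            rw [mul_assoc, ← mul_pow, ENNReal.mul_inv_cancel (hb0 w) (hbt w), one_pow, mul_one]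
    _ = _ := by rw [lintegral_const_mul _ (by fun_prop)]; ring

section tr
variable {Ω : Type*} [MeasurableSpace Ω]

/-- The positive averaging operator with weight `μ`. -/
def tr (μ : Measure Ω) (S : Ω → E3) (g : E3 → ℝ≥0∞) (x : E3) : ℝ≥0∞ := ∫⁻ w, g (x - S w) ∂μ

/-- `tr μ S` has mass at most `m` and density at most `B`. -/
structure TrOK (μ : Measure Ω) (S : Ω → E3) (m B : ℝ≥0∞) : Prop where
  meas : Measurable S
  mass : μ univ ≤ m
  dens : ∀ g : E3 → ℝ≥0∞, Measurable g → ∀ x, tr μ S g x ≤ B * ∫⁻ y, g y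

variable {μ : Measure Ω} {S : Ω → E3} {m B : ℝ≥0∞}

lemma tr_meas (hS : Measurable S) [SFinite μ] {g : E3 → ℝ≥0∞} (hg : Measurable g) :
    Measurable (tr μ S g) := by
  have : Measurable (Function.uncurry fun (x : E3) (w : Ω) => g (x - S w)) :=
    hg.comp (measurable_fst.sub (hS.comp measurable_snd))
  exact this.lintegral_prod_right

lemma TrOK.lintegral_le (h : TrOK μ S m B) [SFinite μ] {g : E3 → ℝ≥0∞} (hg : Measurable g) :
    ∫⁻ x, tr μ S g x ≤ m * ∫⁻ x, g x := by
  have hm : Measurable (Function.uncurry fun (x : E3) (w : Ω) => g (x - S w)) :=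
    hg.comp (measurable_fst.sub (h.meas.comp measurable_snd))
  simp only [tr]
  rw [lintegral_lintegral_swap hm.aemeasurable]
  simp only [lintegral_sub_right_eq_self, lintegral_const]
  rw [mul_comm]
  gcongr
  exact h.mass

lemma TrOK.sq_le (h : TrOK μ S m B) {g : E3 → ℝ≥0∞} (hg : Measurable g) (x : E3) :
    tr μ S g x ^ 2 ≤ m * tr μ S (fun y => g y ^ 2) x := by
  refine (lintegral_sq_le μ (hg.comp (h.meas.const_sub x)).aemeasurable).trans ?_
  gcongr
  · exact h.mass
  · rfl

lemma TrOK.split (h : TrOK μ S m B) [SFinite μ] {g₁ g₂ : E3 → ℝ≥0∞} (hg₁ : Measurable g₁)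
    (hg₂ : Measurable g₂) :
    ∫⁻ x, tr μ S (fun y => g₁ y + g₂ y) x ^ 2 ≤
      2 * (m * B * (∫⁻ y, g₁ y) ^ 2) + 2 * (m ^ 2 * ∫⁻ y, g₂ y ^ 2) := by
  have e : ∀ x, tr μ S (fun y => g₁ y + g₂ y) x = tr μ S g₁ x + tr μ S g₂ x := fun x =>
    lintegral_add_left (hg₁.comp (h.meas.const_sub x)) _
  have hsq : ∀ a b : ℝ≥0∞, (a + b) ^ 2 ≤ 2 * a ^ 2 + 2 * b ^ 2 := fun a b => by
    have := ENNReal.rpow_add_le_mul_rpow_add_rpow a b (p := 2) (by norm_num)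
    norm_num at this
    rwa [← mul_add]
  have hg2 : Measurable fun y => g₂ y ^ 2 := hg₂.pow_const 2
  calc ∫⁻ x, tr μ S (fun y => g₁ y + g₂ y) x ^ 2
      ≤ ∫⁻ x, (2 * (B * (∫⁻ y, g₁ y) * tr μ S g₁ x) + 2 * (m * tr μ S (fun y => g₂ y ^ 2) x)) := by
        refine lintegral_mono fun x => ?_
        rw [e]
        refine (hsq _ _).trans ?_
        gcongr
        · rw [sq]; gcongr; exact h.dens g₁ hg₁ x
        · exact h.sq_le hg₂ x
    _ ≤ _ := by
        rw [lintegral_add_left ((((tr_meas h.meas hg₁).const_mul _)).const_mul _),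
          lintegral_const_mul _ ((tr_meas h.meas hg₁).const_mul _),
          lintegral_const_mul _ (tr_meas h.meas hg₁),
          lintegral_const_mul _ ((tr_meas h.meas hg2).const_mul _),
          lintegral_const_mul _ (tr_meas h.meas hg2)]
        refine add_le_add ?_ ?_
        · gcongr 2 * ?_
          calc _ ≤ B * (∫⁻ y, g₁ y) * (m * ∫⁻ y, g₁ y) := by gcongr; exact h.lintegral_le hg₁
            _ = _ := by ring
        · gcongr 2 * ?_
          calc _ ≤ m * (m * ∫⁻ y, g₂ y ^ 2) := by gcongr; exact h.lintegral_le hg2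
            _ = _ := by ring

lemma Wk.meas_ofReal {f : E3 → ℝ} {A : ℝ} (hf : Wk f A) : Measurable fun x => ENNReal.ofReal (f x) :=
  hf.meas.ennreal_ofReal

lemma TrOK.l2 (h : TrOK μ S m B) [SFinite μ] {f : E3 → ℝ} {A l : ℝ} (hf : Wk f A) (hA : 0 ≤ A)
    (hl : 0 < l) :
    ∫⁻ x, tr μ S (fun y => ENNReal.ofReal (f y) ^ 2) x ^ 2 ≤
      2 * (m * B * ENNReal.ofReal (8 * A ^ 3 / l) ^ 2) +
      2 * (m ^ 2 * ENNReal.ofReal (16 * A ^ 3 * l)) := by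
  have h1 : MeasurableSet {x | l ≤ f x} := measurableSet_le measurable_const hf.meas
  have h2 : MeasurableSet {x | f x < l} := measurableSet_lt hf.meas measurable_const
  have hm2 : Measurable fun x => ENNReal.ofReal (f x) ^ 2 := hf.meas_ofReal.pow_const 2
  have e : (fun y => ENNReal.ofReal (f y) ^ 2) = fun y =>
      ({x | l ≤ f x}).indicator (fun y => ENNReal.ofReal (f y) ^ 2) y +
      ({x | f x < l}).indicator (fun y => ENNReal.ofReal (f y) ^ 2) y := by
    funext y
    by_cases hy : l ≤ f y
    · rw [indicator_of_mem (by exact hy), indicator_of_notMem (by simpa using hy), add_zero]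
    · rw [indicator_of_notMem (by exact hy), indicator_of_mem (by simpa using hy), zero_add]
  rw [e]
  refine (h.split (hm2.indicator h1) (hm2.indicator h2)).trans ?_
  rw [lintegral_indicator h1]
  have e4 : ∀ y, ({x | f x < l}).indicator (fun y => ENNReal.ofReal (f y) ^ 2) y ^ 2 =
      ({x | f x < l}).indicator (fun y => ENNReal.ofReal (f y) ^ 4) y := by
    intro y
    by_cases hy : f y < l
    · rw [indicator_of_mem (by exact hy), indicator_of_mem (by exact hy)]; ring
    · rw [indicator_of_notMem (by exact hy), indicator_of_notMem (by exact hy)]; simp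
  simp only [e4]
  rw [lintegral_indicator h2]
  gcongr
  · exact hf.tail_two hA hl
  · exact hf.low_four hA hl

lemma TrOK.sup (h : TrOK μ S m B) {f : E3 → ℝ} {A l : ℝ} (hf : Wk f A) (hA : 0 ≤ A)
    (hl : 0 < l) (x : E3) :
    tr μ S (fun y => ENNReal.ofReal (f y)) x ≤
      m * ENNReal.ofReal l + B * ENNReal.ofReal (8 * A ^ 3 / l ^ 2) := by
  have h1 : MeasurableSet {x | l ≤ f x} := measurableSet_le measurable_const hf.meas
  set g : E3 → ℝ≥0∞ := ({x | l ≤ f x}).indicator (fun y => ENNReal.ofReal (f y))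
  have hg : Measurable g := hf.meas_ofReal.indicator h1
  have e : ∀ y, ENNReal.ofReal (f y) ≤ ENNReal.ofReal l + g y := by
    intro y
    by_cases hy : l ≤ f y
    · simp only [g]; rw [indicator_of_mem (by exact hy)]; exact le_add_self
    · exact (ENNReal.ofReal_le_ofReal (not_le.1 hy).le).trans le_self_add
  have hI : ∫⁻ y, g y ≤ ENNReal.ofReal (8 * A ^ 3 / l ^ 2) := by
    have h3 : ENNReal.ofReal l * ∫⁻ y, g y ≤ ENNReal.ofReal (8 * A ^ 3 / l) := by
      refine le_trans ?_ (hf.tail_two hA hl)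
      rw [← lintegral_const_mul _ hg, ← lintegral_indicator h1]
      refine lintegral_mono fun y => ?_
      by_cases hy : l ≤ f y
      · simp only [g]; rw [indicator_of_mem (by exact hy), indicator_of_mem (by exact hy), sq]
        gcongr
      · simp only [g]; rw [indicator_of_notMem (by exact hy)]; simp
    have h4 : ENNReal.ofReal l ≠ 0 := by simpa using hl
    have := mul_le_mul_right h3 (ENNReal.ofReal l)⁻¹
    rw [← mul_assoc, ENNReal.inv_mul_cancel h4 ENNReal.ofReal_ne_top, one_mul,
      ← ENNReal.ofReal_inv_of_pos hl, ← ENNReal.ofReal_mul (by positivity)] at this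
    refine this.trans (le_of_eq ?_)
    congr 1; field_simp
  calc tr μ S (fun y => ENNReal.ofReal (f y)) x ≤ ∫⁻ w, (ENNReal.ofReal l + g (x - S w)) ∂μ :=
        lintegral_mono fun w => e _
    _ = ENNReal.ofReal l * μ univ + tr μ S g x := by
        rw [lintegral_add_left measurable_const, lintegral_const]; rfl
    _ ≤ _ := by
        rw [mul_comm m]
        gcongr
        · exact h.mass
        · exact (h.dens g hg x).trans (by gcongr)

lemma TrOK.four (h : TrOK μ S m B) [SFinite μ] {f : E3 → ℝ} {A : ℝ} (hf : Wk f A) :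
    ∫⁻ x, tr μ S (fun y => ENNReal.ofReal (f y)) x ^ 4 ≤
      m ^ 2 * ∫⁻ x, tr μ S (fun y => ENNReal.ofReal (f y) ^ 2) x ^ 2 := by
  rw [← lintegral_const_mul _ ((tr_meas h.meas (hf.meas_ofReal.pow_const 2)).pow_const 2)]
  refine lintegral_mono fun x => ?_
  have := h.sq_le hf.meas_ofReal x
  calc _ = (tr μ S (fun y => ENNReal.ofReal (f y)) x ^ 2) ^ 2 := by ring
    _ ≤ (m * tr μ S (fun y => ENNReal.ofReal (f y) ^ 2) x) ^ 2 := by gcongr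
    _ = _ := by ring

lemma TrOK.l2_scale {M r : ℝ} (hM : 0 ≤ M) (hr : 0 < r)
    (h : TrOK μ S (ENNReal.ofReal M) (ENNReal.ofReal (M * r⁻¹ ^ 3)))
    [SFinite μ] {f : E3 → ℝ} {A : ℝ} (hf : Wk f A) (hA : 1 ≤ A) :
    ∫⁻ x, tr μ S (fun y => ENNReal.ofReal (f y) ^ 2) x ^ 2 ≤
      ENNReal.ofReal (160 * M ^ 2 * A ^ 6 * r⁻¹) := by
  refine (h.l2 hf (by linarith) (inv_pos.2 hr)).trans ?_
  have h2 : (2 : ℝ≥0∞) = ENNReal.ofReal 2 := by simp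
  rw [h2, ← ENNReal.ofReal_pow (by positivity), ← ENNReal.ofReal_mul (by positivity),
    ← ENNReal.ofReal_mul (by positivity), ← ENNReal.ofReal_mul (by positivity),
    ← ENNReal.ofReal_pow (by positivity), ← ENNReal.ofReal_mul (by positivity),
    ← ENNReal.ofReal_mul (by positivity), ← ENNReal.ofReal_add (by positivity) (by positivity)]
  apply ENNReal.ofReal_le_ofReal
  have hA3 : A ^ 3 ≤ A ^ 6 := pow_le_pow_right₀ hA (by norm_num)
  have e : 2 * (M * (M * r⁻¹ ^ 3) * (8 * A ^ 3 / r⁻¹) ^ 2) = 128 * M ^ 2 * A ^ 6 * r⁻¹ := by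
    field_simp; ring
  rw [e]
  have : M ^ 2 * r⁻¹ * A ^ 3 ≤ M ^ 2 * r⁻¹ * A ^ 6 := by gcongr
  nlinarith

end tr

end

/-! ### The heat kernel -/

section

/-- The heat kernel on `ℝ³`. -/
def gam (τ : ℝ) (z : E3) : ℝ := (√(4 * π * τ))⁻¹ ^ 3 * rexp (-(‖z‖ ^ 2 / (4 * τ)))

/-- A Gaussian majorant of the heat kernel and its rescaled derivatives. -/
def gmaj (τ : ℝ) (z : E3) : ℝ := (√τ)⁻¹ ^ 3 * rexp (-(‖z‖ ^ 2 / (8 * τ)))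

lemma gam_smooth {τ : ℝ} (hτ : 0 < τ) (z : E3) :
    ContDiffAt ℝ ∞ (fun q : ℝ × E3 => gam q.1 q.2) (τ, z) := by
  have h1 : ContDiffAt ℝ ∞ (fun q : ℝ × E3 => √(4 * π * q.1)) (τ, z) := by
    refine ContDiffAt.sqrt (by fun_prop) ?_
    positivity
  have h2 : ContDiffAt ℝ ∞ (fun q : ℝ × E3 => (√(4 * π * q.1))⁻¹) (τ, z) := by
    refine h1.inv ?_
    simp only
    positivity
  have h3 : ContDiffAt ℝ ∞ (fun q : ℝ × E3 => ‖q.2‖ ^ 2 / (4 * q.1)) (τ, z) := by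
    refine ContDiffAt.div ?_ (by fun_prop) (by simp only; positivity)
    exact (contDiff_snd.norm_sq ℝ).contDiffAt
  exact (h2.pow 3).mul h3.neg.exp

lemma gam_smooth_slice (τ : ℝ) : ContDiff ℝ ∞ (gam τ) := by
  unfold gam
  exact contDiff_const.mul (((contDiff_norm_sq ℝ).div_const _).neg.exp)

lemma gam_pos {τ : ℝ} (hτ : 0 < τ) (z : E3) : 0 < gam τ z := by unfold gam; positivity

lemma gmaj_pos {τ : ℝ} (hτ : 0 < τ) (z : E3) : 0 < gmaj τ z := by unfold gmaj; positivity

lemma gam_dder {τ : ℝ} (i : Fin 3) :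
    dder (ee i) (gam τ) = fun z => -(z i / (2 * τ)) * gam τ z := by
  funext x
  have h1 : HasFDerivAt (fun x : E3 => -(‖x‖ ^ 2 / (4 * τ)))
      (-((4 * τ)⁻¹ • (2 • (innerSL ℝ x)))) x := by
    have := (((hasStrictFDerivAt_norm_sq x).hasFDerivAt).const_mul (4 * τ)⁻¹).neg
    simpa [div_eq_inv_mul, Pi.neg_def] using this
  have h2 := (h1.exp).const_mul ((√(4 * π * τ))⁻¹ ^ 3)
  have h3 := h2.fderiv
  unfold dder
  change fderiv ℝ (fun y => (√(4 * π * τ))⁻¹ ^ 3 * rexp (-(‖y‖ ^ 2 / (4 * τ)))) x (ee i) = _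
  rw [h3]
  have : inner ℝ x (ee i) = x i := by simp [ee, EuclideanSpace.inner_single_right]
  simp [this, gam]
  ring

lemma gam_deriv {τ : ℝ} (hτ : 0 < τ) (z : E3) :
    HasDerivAt (fun τ => gam τ z) ((‖z‖ ^ 2 / (4 * τ ^ 2) - 3 / (2 * τ)) * gam τ z) τ := by
  have h1 : HasDerivAt (fun τ => √(4 * π * τ)) (4 * π / (2 * √(4 * π * τ))) τ := by
    refine HasDerivAt.sqrt ?_ (by positivity)
    simpa using (hasDerivAt_id τ).const_mul (4 * π)
  have hs : 0 < √(4 * π * τ) := by positivity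
  have h2 := (h1.inv hs.ne').pow 3
  have h3 : HasDerivAt (fun τ => -(‖z‖ ^ 2 / (4 * τ))) (‖z‖ ^ 2 / (4 * τ ^ 2)) τ := by
    have := ((hasDerivAt_inv hτ.ne').const_mul (-(‖z‖ ^ 2 / 4)))
    refine (this.congr_deriv (by field_simp)).congr_of_eventuallyEq (Eventually.of_forall fun y => ?_)
    simp only; rw [div_mul_eq_div_div]; ring
  have h4 := h2.mul h3.exp
  have hss : √(4 * π * τ) ^ 2 = 4 * π * τ := Real.sq_sqrt (by positivity)
  unfold gam
  refine h4.congr_deriv ?_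
  simp only [Pi.pow_apply, Pi.inv_apply]
  generalize hA : √(4 * π * τ) = s at *
  have hπ : 4 * π = s ^ 2 / τ := by field_simp; linarith
  rw [hπ]
  have e1 : s ^ 2 * s⁻¹ ^ 2 = 1 := by field_simp
  field_simp
  norm_num
  linear_combination (-(τ * 12)) * e1

lemma gam_integral {τ : ℝ} (hτ : 0 < τ) : ∫ z, gam τ z = 1 := by
  unfold gam
  rw [integral_const_mul]
  have h := GaussianFourier.integral_rexp_neg_mul_sq_norm (V := E3) (b := (4 * τ)⁻¹) (by positivity)
  have e : ∀ v : E3, rexp (-(‖v‖ ^ 2 / (4 * τ))) = rexp (-(4 * τ)⁻¹ * ‖v‖ ^ 2) := fun v => by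
    congr 1; ring
  simp only [e]
  rw [h]
  have e2 : π / (4 * τ)⁻¹ = 4 * π * τ := by field_simp
  rw [e2, Real.sqrt_eq_rpow, ← Real.rpow_neg (by positivity), ← Real.rpow_natCast,
    ← Real.rpow_mul (by positivity), ← Real.rpow_add (by positivity)]
  norm_num

lemma gmaj_integral {τ : ℝ} (hτ : 0 < τ) : ∫ z, gmaj τ z = √(8 * π) ^ 3 := by
  unfold gmaj
  rw [integral_const_mul]
  have h := GaussianFourier.integral_rexp_neg_mul_sq_norm (V := E3) (b := (8 * τ)⁻¹) (by positivity)
  have e : ∀ v : E3, rexp (-(‖v‖ ^ 2 / (8 * τ))) = rexp (-(8 * τ)⁻¹ * ‖v‖ ^ 2) := fun v => by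
    congr 1; ring
  simp only [e]
  rw [h]
  have e2 : π / (8 * τ)⁻¹ = 8 * π * τ := by field_simp
  have e3 : (8 * π * τ) ^ ((Module.finrank ℝ E3 : ℝ) / 2) = √(8 * π * τ) ^ 3 := by
    rw [Real.sqrt_eq_rpow, ← Real.rpow_natCast, ← Real.rpow_mul (by positivity)]
    congr 1; simp; norm_num
  rw [e2, e3, Real.sqrt_mul (by positivity)]
  have : 0 < √τ := by positivity
  field_simp

lemma gmaj_cont (τ : ℝ) : Continuous (gmaj τ) := by unfold gmaj; fun_prop

lemma gam_integrable {τ : ℝ} (hτ : 0 < τ) : Integrable (gam τ) := by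
  by_contra h
  have := gam_integral hτ
  rw [integral_undef h] at this
  norm_num at this

lemma gmaj_integrable {τ : ℝ} (hτ : 0 < τ) : Integrable (gmaj τ) := by
  by_contra h
  have := gmaj_integral hτ
  rw [integral_undef h] at this
  have : 0 < √(8 * π) ^ 3 := by positivity
  linarith

lemma gmaj_mass {τ : ℝ} (hτ : 0 < τ) : ∫⁻ z, ENNReal.ofReal (gmaj τ z) = ENNReal.ofReal (√(8 * π) ^ 3) := by
  rw [← gmaj_integral hτ, ofReal_integral_eq_lintegral_ofReal (gmaj_integrable hτ)
    (Eventually.of_forall fun z => (gmaj_pos hτ z).le)]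

lemma gmaj_le {τ : ℝ} (hτ : 0 < τ) (z : E3) : gmaj τ z ≤ (√τ)⁻¹ ^ 3 := by
  unfold gmaj
  have : rexp (-(‖z‖ ^ 2 / (8 * τ))) ≤ 1 := Real.exp_le_one_iff.2 (by
    have : 0 ≤ ‖z‖ ^ 2 / (8 * τ) := by positivity
    linarith)
  exact mul_le_of_le_one_right (by positivity) this

lemma gam_pre_le {τ : ℝ} (hτ : 0 < τ) : (√(4 * π * τ))⁻¹ ^ 3 ≤ (√τ)⁻¹ ^ 3 := by
  have : τ ≤ 4 * π * τ := by nlinarith [Real.pi_gt_three]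
  gcongr

lemma gam_bounds {τ : ℝ} (hτ : 0 < τ) (z : E3) :
    gam τ z ≤ gmaj τ z ∧ ‖z‖ ^ 2 / τ * gam τ z ≤ 8 * gmaj τ z ∧
      ‖z‖ / √τ * gam τ z ≤ 9 * gmaj τ z := by
  set E := rexp (-(‖z‖ ^ 2 / (8 * τ)))
  have hE : 0 < E := Real.exp_pos _
  have e : rexp (-(‖z‖ ^ 2 / (4 * τ))) = E * E := by
    rw [← Real.exp_add]; congr 1; field_simp; ring
  set r := ‖z‖ ^ 2 / (8 * τ)
  have hr : 0 ≤ r := by positivity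
  have h1 : r * E ≤ 1 := by
    have h2 : r ≤ rexp r := by linarith [Real.add_one_le_exp r]
    calc r * E ≤ rexp r * E := by gcongr
      _ = 1 := by rw [← Real.exp_add]; simp only [r, add_neg_cancel, Real.exp_zero]
  have hE1 : E ≤ 1 := Real.exp_le_one_iff.2 (by linarith)
  have hc := gam_pre_le hτ
  have hc0 : 0 < (√(4 * π * τ))⁻¹ ^ 3 := by positivity
  have hs : 0 < √τ := by positivity
  have b1 : gam τ z ≤ gmaj τ z := by
    unfold gam gmaj; rw [e]
    calc _ ≤ (√τ)⁻¹ ^ 3 * (E * 1) := by gcongr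
      _ = _ := by rw [mul_one]
  have b2 : ‖z‖ ^ 2 / τ * gam τ z ≤ 8 * gmaj τ z := by
    unfold gam gmaj; rw [e]
    have : ‖z‖ ^ 2 / τ = 8 * r := by simp only [r]; field_simp
    rw [this]
    calc 8 * r * ((√(4 * π * τ))⁻¹ ^ 3 * (E * E)) = 8 * (√(4 * π * τ))⁻¹ ^ 3 * (r * E) * E := by ring
      _ ≤ 8 * (√τ)⁻¹ ^ 3 * 1 * E := by gcongr
      _ = _ := by ring
  refine ⟨b1, b2, ?_⟩
  have h3 : ‖z‖ / √τ ≤ 1 + ‖z‖ ^ 2 / τ := by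
    have : ‖z‖ ^ 2 / τ = (‖z‖ / √τ) ^ 2 := by rw [div_pow, Real.sq_sqrt hτ.le]
    rw [this]
    nlinarith [sq_nonneg (‖z‖ / √τ - 1)]
  have hg := gam_pos hτ z
  calc ‖z‖ / √τ * gam τ z ≤ (1 + ‖z‖ ^ 2 / τ) * gam τ z := by gcongr
    _ = gam τ z + ‖z‖ ^ 2 / τ * gam τ z := by ring
    _ ≤ _ := by linarith

lemma coord_le (z : E3) (i : Fin 3) : |z i| ≤ ‖z‖ := by
  simpa using PiLp.norm_apply_le z i

/-- First and second derivatives of a cut-off heat kernel. -/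
lemma cut_gam_dder {c : E3 → ℝ} (hc : ContDiff ℝ ∞ c) (τ : ℝ) (i : Fin 3) :
    dder (ee i) (fun z => c z * gam τ z) =
      fun z => (dder (ee i) c z - (2 * τ)⁻¹ * (z i * c z)) * gam τ z := by
  rw [dder_mul _ hc (gam_smooth_slice τ), gam_dder]
  funext z
  ring

lemma coord_smooth (i : Fin 3) : ContDiff ℝ ∞ (fun z : E3 => z i) :=
  (EuclideanSpace.proj (𝕜 := ℝ) i).contDiff

lemma dder_coord (i j : Fin 3) : dder (ee j) (fun z : E3 => z i) = fun _ => if i = j then 1 else 0 := by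
  funext z
  have : fderiv ℝ (fun z : E3 => z i) z = EuclideanSpace.proj (𝕜 := ℝ) i :=
    (EuclideanSpace.proj (𝕜 := ℝ) i).fderiv
  unfold dder
  rw [this]
  simp [ee]

lemma cut_gam_bounds {c : E3 → ℝ} {R : ℝ} (hc : Bump c R) : ∃ C, 0 < C ∧ ∀ τ : ℝ, 0 < τ → τ ≤ 1 →
    ∀ z, |c z * gam τ z| ≤ C * gmaj τ z ∧
      (∀ i, |dder (ee i) (fun z => c z * gam τ z) z| ≤ C * (√τ)⁻¹ * gmaj τ z) ∧
      (∀ i j, |dder (ee j) (dder (ee i) (fun z => c z * gam τ z)) z| ≤ C * τ⁻¹ * gmaj τ z) := by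
  obtain ⟨C0, hC0, h0⟩ := hc.bound
  choose C1 hC1 h1 using fun i => (hc.dder (ee i)).bound
  choose C2 hC2 h2 using fun i j => ((hc.dder (ee i)).dder (ee j)).bound
  set K := C0 + ∑ i, C1 i + ∑ i, ∑ j, C2 i j
  have hS1 : 0 ≤ ∑ i, C1 i := Finset.sum_nonneg fun i _ => (hC1 i).le
  have hS2 : 0 ≤ ∑ i, ∑ j, C2 i j := Finset.sum_nonneg fun i _ => Finset.sum_nonneg fun j _ => (hC2 i j).le
  have k0 : C0 ≤ K := by simp only [K]; linarith
  have k1 : ∀ i, C1 i ≤ K := fun i => by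
    have := Finset.single_le_sum (f := C1) (fun i _ => (hC1 i).le) (Finset.mem_univ i)
    simp only [K]; linarith
  have k2 : ∀ i j, C2 i j ≤ K := fun i j => by
    have h := Finset.single_le_sum (f := fun i => ∑ j, C2 i j)
      (fun i _ => Finset.sum_nonneg fun j _ => (hC2 i j).le) (Finset.mem_univ i)
    have h' := Finset.single_le_sum (f := C2 i) (fun j _ => (hC2 i j).le) (Finset.mem_univ j)
    simp only [K]; linarith
  have hK : 0 < K := by linarith
  refine ⟨20 * K, by positivity, fun τ hτ hτ1 z => ?_⟩
  obtain ⟨b0, b2, b1⟩ := gam_bounds hτ z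
  have hg := gam_pos hτ z
  have hG := gmaj_pos hτ z
  set s := √τ with hsdef
  have hs : 0 < s := by positivity
  have hs1 : s ≤ 1 := Real.sqrt_le_one.2 hτ1
  have hss : τ = s ^ 2 := (Real.sq_sqrt hτ.le).symm
  have hi1 : 1 ≤ s⁻¹ := (one_le_inv₀ hs).2 hs1
  have b1' : ∀ i, |z i| * gam τ z ≤ 9 * s * gmaj τ z := fun i => by
    have : ‖z‖ * gam τ z ≤ 9 * s * gmaj τ z := by
      rw [div_mul_eq_mul_div, div_le_iff₀ hs] at b1; linarith
    exact (mul_le_mul_of_nonneg_right (coord_le z i) hg.le).trans this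
  have b2' : ∀ i j, |z i| * |z j| * gam τ z ≤ 8 * τ * gmaj τ z := fun i j => by
    have : ‖z‖ ^ 2 * gam τ z ≤ 8 * τ * gmaj τ z := by
      rw [div_mul_eq_mul_div, div_le_iff₀ hτ] at b2; linarith
    refine le_trans ?_ this
    rw [sq]; gcongr <;> exact coord_le z _
  have c0 : ∀ z, |c z| ≤ K := fun z => (h0 z).trans k0
  have c1 : ∀ i z, |dder (ee i) c z| ≤ K := fun i z => (h1 i z).trans (k1 i)
  have c2 : ∀ i j z, |dder (ee j) (dder (ee i) c) z| ≤ K := fun i j z => (h2 i j z).trans (k2 i j)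
  have f1 : ∀ a : ℝ, |a| ≤ K → ∀ i, |a * ((2 * τ)⁻¹ * z i) * gam τ z| ≤ 5 * K * s⁻¹ * gmaj τ z := by
    intro a ha i
    rw [abs_mul, abs_mul, abs_mul, abs_of_pos hg, abs_of_pos (by positivity : 0 < (2 * τ)⁻¹)]
    calc |a| * ((2 * τ)⁻¹ * |z i|) * gam τ z = |a| * (2 * τ)⁻¹ * (|z i| * gam τ z) := by ring
      _ ≤ K * (2 * τ)⁻¹ * (9 * s * gmaj τ z) :=
        mul_le_mul (by gcongr) (b1' i) (by positivity) (by positivity)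
      _ = 9 / 2 * K * s⁻¹ * gmaj τ z := by rw [hss]; field_simp
      _ ≤ _ := by gcongr; norm_num
  have f0 : ∀ a : ℝ, |a| ≤ K → |a * gam τ z| ≤ K * gmaj τ z := by
    intro a ha
    rw [abs_mul, abs_of_pos hg]
    gcongr
  refine ⟨?_, ?_, ?_⟩
  · refine (f0 _ (c0 z)).trans ?_
    gcongr; linarith
  · intro i
    rw [cut_gam_dder hc.smooth]
    have e : (dder (ee i) c z - (2 * τ)⁻¹ * (z i * c z)) * gam τ z =
      dder (ee i) c z * gam τ z - c z * ((2 * τ)⁻¹ * z i) * gam τ z := by ring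
    simp only [e]
    refine (abs_sub _ _).trans ((add_le_add (f0 _ (c1 i z)) (f1 _ (c0 z) i)).trans ?_)
    have : K * gmaj τ z ≤ K * s⁻¹ * gmaj τ z := by
      gcongr; exact le_mul_of_one_le_right hK.le hi1
    have : 0 ≤ K * s⁻¹ * gmaj τ z := by positivity
    linarith
  · intro i j
    have hci := coord_smooth i
    have hd := dder_smooth (ee i) hc.smooth
    have hsm : ContDiff ℝ ∞ (fun z => dder (ee i) c z - (2 * τ)⁻¹ * (z i * c z)) :=
      hd.sub (contDiff_const.mul (hci.mul hc.smooth))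
    rw [cut_gam_dder hc.smooth, cut_gam_dder hsm, dder_sub _ hd (contDiff_const.mul (hci.mul hc.smooth)),
      dder_const_mul _ _ (hci.mul hc.smooth), dder_mul _ hci hc.smooth, dder_coord]
    set δ : ℝ := if i = j then 1 else 0
    have hδ : |δ| ≤ 1 := by simp only [δ]; split_ifs <;> simp
    have e : (dder (ee j) (dder (ee i) c) z - (2 * τ)⁻¹ * (δ * c z + z i * dder (ee j) c z) -
          (2 * τ)⁻¹ * (z j * (dder (ee i) c z - (2 * τ)⁻¹ * (z i * c z)))) * gam τ z =
        dder (ee j) (dder (ee i) c) z * gam τ z - (2 * τ)⁻¹ * (δ * c z * gam τ z)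
          - dder (ee j) c z * ((2 * τ)⁻¹ * z i) * gam τ z
          - dder (ee i) c z * ((2 * τ)⁻¹ * z j) * gam τ z
          + c z * ((2 * τ)⁻¹ * (2 * τ)⁻¹ * (z i * z j)) * gam τ z := by ring
    simp only [e]
    have t1 := f0 _ (c2 i j z)
    have t2 : |(2 * τ)⁻¹ * (δ * c z * gam τ z)| ≤ (2 * τ)⁻¹ * (K * gmaj τ z) := by
      rw [abs_mul, abs_of_pos (by positivity : 0 < (2 * τ)⁻¹)]
      gcongr
      apply f0
      rw [abs_mul]
      calc |δ| * |c z| ≤ 1 * K := by gcongr; exact c0 z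
        _ = K := one_mul _
    have t3 := f1 _ (c1 j z) i
    have t4 := f1 _ (c1 i z) j
    have t5 : |c z * ((2 * τ)⁻¹ * (2 * τ)⁻¹ * (z i * z j)) * gam τ z| ≤ 2 * K * τ⁻¹ * gmaj τ z := by
      rw [abs_mul, abs_mul, abs_mul, abs_mul (z i), abs_of_pos hg,
        abs_of_pos (by positivity : 0 < (2 * τ)⁻¹ * (2 * τ)⁻¹)]
      calc _ = |c z| * ((2 * τ)⁻¹ * (2 * τ)⁻¹) * (|z i| * |z j| * gam τ z) := by ring
        _ ≤ K * ((2 * τ)⁻¹ * (2 * τ)⁻¹) * (8 * τ * gmaj τ z) :=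
          mul_le_mul (by gcongr; exact c0 z) (b2' i j) (by positivity) (by positivity)
        _ = _ := by field_simp; ring
    have hτs : s⁻¹ ≤ τ⁻¹ := by
      rw [hss]; gcongr; nlinarith
    have hτ1' : 1 ≤ τ⁻¹ := hi1.trans hτs
    have m1 : K * gmaj τ z ≤ K * τ⁻¹ * gmaj τ z := by
      gcongr; exact le_mul_of_one_le_right hK.le hτ1'
    have m2 : 5 * K * s⁻¹ * gmaj τ z ≤ 5 * K * τ⁻¹ * gmaj τ z := by gcongr
    have m3 : (2 * τ)⁻¹ * (K * gmaj τ z) ≤ K * τ⁻¹ * gmaj τ z := by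
      rw [mul_inv]
      have : 0 ≤ K * τ⁻¹ * gmaj τ z := by positivity
      nlinarith
    have m4 : 0 ≤ K * τ⁻¹ * gmaj τ z := by positivity
    rw [abs_le] at *
    constructor <;> linarith [t1.1, t1.2, t2.1, t2.2, t3.1, t3.2, t4.1, t4.2, t5.1, t5.2]

end

/-! ### Regular kernels -/

section

/-- Kernels built from the heat kernel by cutting off the space-time origin. -/
inductive Flat : (ℝ → E3 → ℝ) → Prop
  | base (a : ℝ → ℝ) (c : E3 → ℝ) (m : ℕ) (ha : Continuous a) (hc : Bump c 1)
      (h : (∀ τ, τ < 1 / 16 → a τ = 0) ∨ ∀ z, ‖z‖ < 1 / 2 → c z = 0) :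
      Flat (fun τ z => a τ * (c z * (τ⁻¹ ^ m * gam τ z)))
  | add {K L : ℝ → E3 → ℝ} (hK : Flat K) (hL : Flat L) : Flat (fun τ z => K τ z + L τ z)

lemma Bump.add {k g : E3 → ℝ} {R : ℝ} (h : Bump k R) (hg : Bump g R) :
    Bump (fun z => k z + g z) R :=
  ⟨h.smooth.add hg.smooth, fun z hz => by simp [h.supp z hz, hg.supp z hz]⟩

lemma Bump.const_mul {k : E3 → ℝ} {R : ℝ} (h : Bump k R) (a : ℝ) : Bump (fun z => a * k z) R :=
  ⟨contDiff_const.mul h.smooth, fun z hz => by simp [h.supp z hz]⟩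

lemma gam_meas : Measurable (Function.uncurry gam) := by
  unfold gam Function.uncurry
  fun_prop

lemma Flat.bump {K : ℝ → E3 → ℝ} (h : Flat K) (τ : ℝ) : Bump (K τ) 1 := by
  induction h with
  | base a c m ha hc h =>
    exact (hc.mul (contDiff_const.mul (gam_smooth_slice τ))).const_mul (a τ)
  | add hK hL ihK ihL => exact ihK.add ihL

lemma Flat.meas {K : ℝ → E3 → ℝ} (h : Flat K) : Measurable (Function.uncurry K) := by
  induction h with
  | base a c m ha hc h =>
    have h1 := ha.measurable
    have h2 := hc.smooth.continuous.measurable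
    have h3 := gam_meas
    unfold Function.uncurry at *
    fun_prop
  | add hK hL ihK ihL => exact Measurable.add ihK ihL

lemma gam_flat_bound (m : ℕ) : ∃ C, 0 < C ∧ ∀ τ : ℝ, 0 < τ → τ ≤ 1 → ∀ z, (1 / 16 ≤ τ ∨ 1 / 2 ≤ ‖z‖) →
    τ⁻¹ ^ m * gam τ z ≤ C := by
  refine ⟨((m + 2).factorial : ℝ) * 16 ^ (m + 2), by positivity, fun τ hτ hτ1 z hz => ?_⟩
  have hi : 1 ≤ τ⁻¹ := (one_le_inv₀ hτ).2 hτ1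
  have h1 : gam τ z ≤ τ⁻¹ ^ 2 * rexp (-(‖z‖ ^ 2 / (4 * τ))) := by
    unfold gam
    have h2 := gam_pre_le hτ
    have h3 : (√τ)⁻¹ ^ 3 ≤ τ⁻¹ ^ 2 := by
      have h4 : τ⁻¹ = (√τ)⁻¹ ^ 2 := by rw [inv_pow, Real.sq_sqrt hτ.le]
      have h5 : 1 ≤ (√τ)⁻¹ := (one_le_inv₀ (by positivity)).2 (Real.sqrt_le_one.2 hτ1)
      rw [h4, ← pow_mul]
      exact pow_le_pow_right₀ h5 (by norm_num)
    gcongr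
    exact h2.trans h3
  have hf : (1 : ℝ) ≤ ((m + 2).factorial : ℝ) := by
    exact_mod_cast Nat.one_le_iff_ne_zero.2 (Nat.factorial_ne_zero _)
  have h2 : τ⁻¹ ^ m * gam τ z ≤ τ⁻¹ ^ (m + 2) * rexp (-(‖z‖ ^ 2 / (4 * τ))) := by
    calc _ ≤ τ⁻¹ ^ m * (τ⁻¹ ^ 2 * rexp (-(‖z‖ ^ 2 / (4 * τ)))) := by gcongr
      _ = _ := by ring
  refine h2.trans ?_
  rcases hz with hz | hz
  · have h4 : τ⁻¹ ≤ 16 := by rw [inv_le_comm₀ hτ (by norm_num)]; linarith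
    have h5 : rexp (-(‖z‖ ^ 2 / (4 * τ))) ≤ 1 := Real.exp_le_one_iff.2 (by
      have : 0 ≤ ‖z‖ ^ 2 / (4 * τ) := by positivity
      linarith)
    calc τ⁻¹ ^ (m + 2) * rexp (-(‖z‖ ^ 2 / (4 * τ))) ≤ 16 ^ (m + 2) * 1 := by gcongr
      _ ≤ _ := by rw [mul_comm]; gcongr
  · have h5 : rexp (-(‖z‖ ^ 2 / (4 * τ))) ≤ rexp (-(τ⁻¹ / 16)) := by
      apply Real.exp_le_exp.2
      have : τ⁻¹ / 16 ≤ ‖z‖ ^ 2 / (4 * τ) := by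
        have e : τ⁻¹ / 16 = (1 / 2) ^ 2 / (4 * τ) := by field_simp; norm_num
        rw [e]; gcongr
      linarith
    have h6 := Real.pow_div_factorial_le_exp (τ⁻¹ / 16) (by positivity) (m + 2)
    rw [div_le_iff₀ (by positivity), div_pow, div_le_iff₀ (by positivity)] at h6
    calc τ⁻¹ ^ (m + 2) * rexp (-(‖z‖ ^ 2 / (4 * τ)))
        ≤ (rexp (τ⁻¹ / 16) * (m + 2).factorial * 16 ^ (m + 2)) * rexp (-(τ⁻¹ / 16)) := by gcongr
      _ = (m + 2).factorial * 16 ^ (m + 2) * (rexp (τ⁻¹ / 16) * rexp (-(τ⁻¹ / 16))) := by ring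
      _ = _ := by rw [← Real.exp_add]; simp

lemma Flat.bound {K : ℝ → E3 → ℝ} (h : Flat K) :
    ∃ C, 0 < C ∧ ∀ τ : ℝ, 0 < τ → τ ≤ 1 → ∀ z, |K τ z| ≤ C := by
  induction h with
  | base a c m ha hc h =>
    obtain ⟨Ca, hCa⟩ := (isCompact_Icc (a := (0 : ℝ)) (b := 1)).exists_bound_of_continuousOn ha.continuousOn
    obtain ⟨Cc, hCc0, hCc⟩ := hc.bound
    obtain ⟨C, hC0, hC⟩ := gam_flat_bound m
    have hCa0 : 0 ≤ Ca := (norm_nonneg _).trans (hCa 0 (by simp))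
    refine ⟨Ca * (Cc * C) + 1, by positivity, fun τ hτ hτ1 z => ?_⟩
    by_cases hz : 1 / 16 ≤ τ ∨ 1 / 2 ≤ ‖z‖
    · have hg := gam_pos hτ z
      rw [abs_mul, abs_mul, abs_of_pos (by positivity : 0 < τ⁻¹ ^ m * gam τ z)]
      have h1 := hCa τ ⟨hτ.le, hτ1⟩
      rw [Real.norm_eq_abs] at h1
      have := mul_le_mul h1 (mul_le_mul (hCc z) (hC τ hτ hτ1 z hz) (by positivity) hCc0.le)
        (by positivity) hCa0
      linarith
    · push Not at hz
      have : a τ * (c z * (τ⁻¹ ^ m * gam τ z)) = 0 := by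
        rcases h with h | h
        · rw [h τ hz.1, zero_mul]
        · rw [h z hz.2, zero_mul, mul_zero]
      simp only [this, abs_zero]; positivity
  | add hK hL ihK ihL =>
    obtain ⟨C, hC0, hC⟩ := ihK
    obtain ⟨D, hD0, hD⟩ := ihL
    exact ⟨C + D, by positivity, fun τ hτ hτ1 z =>
      (abs_add_le _ _).trans (add_le_add (hC τ hτ hτ1 z) (hD τ hτ hτ1 z))⟩

lemma dder_zero_near {c : E3 → ℝ} (h : ∀ z, ‖z‖ < 1 / 2 → c z = 0) (v : E3) :
    ∀ z, ‖z‖ < 1 / 2 → dder v c z = 0 := by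
  intro z hz
  have : c =ᶠ[𝓝 z] fun _ => 0 := by
    filter_upwards [(isOpen_lt continuous_norm continuous_const).mem_nhds hz] with y hy
    exact h y hy
  simp only [dder]
  rw [this.fderiv_eq]; simp

lemma Flat.dder {K : ℝ → E3 → ℝ} (h : Flat K) (i : Fin 3) : Flat (fun τ => dder (ee i) (K τ)) := by
  induction h with
  | base a c m ha hc h =>
    have h1 : Flat (fun τ z => a τ * (_root_.dder (ee i) c z * (τ⁻¹ ^ m * gam τ z))) :=
      Flat.base a _ m ha (hc.dder _) (h.imp_right fun h => dder_zero_near h _)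
    have h2 : Flat (fun τ z => (-(1 / 2) * a τ) * ((c z * z i) * (τ⁻¹ ^ (m + 1) * gam τ z))) := by
      refine Flat.base _ _ (m + 1) (continuous_const.mul ha) (hc.mul (coord_smooth i)) ?_
      exact h.imp (fun h τ hτ => by simp [h τ hτ]) fun h z hz => by simp [h z hz]
    convert h1.add h2 using 1
    funext τ z
    have e : (fun z => a τ * (c z * (τ⁻¹ ^ m * gam τ z))) =
        fun z => (a τ * τ⁻¹ ^ m) * (c z * gam τ z) := by funext z; ring
    simp only [e]
    rw [dder_const_mul _ _ (hc.smooth.mul (gam_smooth_slice τ)), cut_gam_dder hc.smooth]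
    simp only [mul_inv, pow_succ]
    ring
  | @add K L hK hL ihK ihL =>
    convert ihK.add ihL using 1
    funext τ z
    exact congrFun (dder_add _ (hK.bump τ).smooth (hL.bump τ).smooth) z

/-! ### The parametrix -/

/-- Smooth temporal cutoff. -/
def tht (τ : ℝ) : ℝ := Real.smoothTransition (2 - 16 * τ)

/-- Smooth spatial cutoff. -/
def chi (z : E3) : ℝ := Real.smoothTransition (4 / 3 * (1 - ‖z‖ ^ 2))

lemma tht_smooth : ContDiff ℝ ∞ tht := by
  unfold tht
  exact Real.smoothTransition.contDiff.comp (by fun_prop)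

lemma tht_one {τ : ℝ} (h : τ ≤ 1 / 16) : tht τ = 1 :=
  Real.smoothTransition.one_of_one_le (by linarith)

lemma tht_zero {τ : ℝ} (h : 1 / 8 ≤ τ) : tht τ = 0 :=
  Real.smoothTransition.zero_of_nonpos (by linarith)

lemma chi_bump : Bump chi 1 := by
  refine ⟨?_, fun z hz => Real.smoothTransition.zero_of_nonpos (by nlinarith)⟩
  unfold chi
  exact Real.smoothTransition.contDiff.comp (contDiff_const.mul (contDiff_const.sub (contDiff_norm_sq ℝ)))

lemma chi_one {z : E3} (h : ‖z‖ ≤ 1 / 2) : chi z = 1 :=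
  Real.smoothTransition.one_of_one_le (by nlinarith [norm_nonneg z])

/-- Compactly supported parametrix for the heat equation. -/
def PK (τ : ℝ) (z : E3) : ℝ := tht τ * (chi z * gam τ z)

/-- The error kernel of the parametrix. -/
def kap (τ : ℝ) (z : E3) : ℝ :=
  (deriv tht τ * (chi z * (τ⁻¹ ^ 0 * gam τ z)) +
    tht τ * ((∑ i, dder (ee i) chi z * z i) * (τ⁻¹ ^ 1 * gam τ z))) +
    -tht τ * (lapl chi z * (τ⁻¹ ^ 0 * gam τ z))

lemma deriv_tht_cont : Continuous (deriv tht) := tht_smooth.continuous_deriv (by simp)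

lemma deriv_tht_zero {τ : ℝ} (h : τ < 1 / 16) : deriv tht τ = 0 := by
  have : tht =ᶠ[𝓝 τ] fun _ => 1 := by
    filter_upwards [Iio_mem_nhds h] with y hy
    exact tht_one (le_of_lt hy)
  rw [this.deriv_eq]; simp

lemma dchi_zero (i : Fin 3) {z : E3} (hz : ‖z‖ < 1 / 2) : dder (ee i) chi z = 0 := by
  have : chi =ᶠ[𝓝 z] fun _ => 1 := by
    filter_upwards [(isOpen_lt continuous_norm continuous_const).mem_nhds hz] with y hy
    exact chi_one (le_of_lt hy)
  simp only [dder]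
  rw [this.fderiv_eq]; simp

lemma Bump.sum {k : Fin 3 → E3 → ℝ} {R : ℝ} (h : ∀ i, Bump (k i) R) : Bump (fun z => ∑ i, k i z) R :=
  ⟨ContDiff.sum fun i _ => (h i).smooth, fun z hz => Finset.sum_eq_zero fun i _ => (h i).supp z hz⟩

lemma kap_flat : Flat kap := by
  have h1 : Flat (fun τ z => deriv tht τ * (chi z * (τ⁻¹ ^ 0 * gam τ z))) :=
    Flat.base _ _ 0 deriv_tht_cont chi_bump (Or.inl fun τ hτ => deriv_tht_zero hτ)
  have h2 : Flat (fun τ z => tht τ * ((∑ i, dder (ee i) chi z * z i) * (τ⁻¹ ^ 1 * gam τ z))) :=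
    Flat.base _ _ 1 tht_smooth.continuous
      (Bump.sum fun i => (chi_bump.dder (ee i)).mul (coord_smooth i))
      (Or.inr fun z hz => Finset.sum_eq_zero fun i _ => by rw [dchi_zero i hz, zero_mul])
  have h3 : Flat (fun τ z => -tht τ * (lapl chi z * (τ⁻¹ ^ 0 * gam τ z))) :=
    Flat.base _ _ 0 tht_smooth.continuous.neg
      (Bump.sum fun i => (chi_bump.dder (ee i)).dder (ee i))
      (Or.inr fun z hz => Finset.sum_eq_zero fun i _ => dder_zero_near (fun z hz => dchi_zero i hz) _ z hz)
  exact (h1.add h2).add h3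

lemma pk_bump (τ : ℝ) : Bump (PK τ) 1 := (chi_bump.mul (gam_smooth_slice τ)).const_mul _

lemma pk_lapl (τ : ℝ) (hτ : 0 < τ) (z : E3) :
    chi z * (deriv tht τ * gam τ z + tht τ * ((‖z‖ ^ 2 / (4 * τ ^ 2) - 3 / (2 * τ)) * gam τ z)) =
      lapl (PK τ) z + kap τ z := by
  have hc := chi_bump.smooth
  have h1 : ∀ i, dder (ee i) (dder (ee i) (PK τ)) z = tht τ *
      ((dder (ee i) (dder (ee i) chi) z - (2 * τ)⁻¹ * (chi z + z i * dder (ee i) chi z) -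
          (2 * τ)⁻¹ * (z i * (dder (ee i) chi z - (2 * τ)⁻¹ * (z i * chi z)))) * gam τ z) := by
    intro i
    have hci := coord_smooth i
    have hd := dder_smooth (ee i) hc
    have hsm : ContDiff ℝ ∞ (fun z => dder (ee i) chi z - (2 * τ)⁻¹ * (z i * chi z)) :=
      hd.sub (contDiff_const.mul (hci.mul hc))
    have e : PK τ = fun z => tht τ * (chi z * gam τ z) := rfl
    rw [e, dder_const_mul _ _ (hc.mul (gam_smooth_slice τ)), cut_gam_dder hc,
      dder_const_mul _ _ (hsm.mul (gam_smooth_slice τ)), cut_gam_dder hsm,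
      dder_sub _ hd (contDiff_const.mul (hci.mul hc)),
      dder_const_mul _ _ (hci.mul hc), dder_mul _ hci hc, dder_coord]
    simp
  simp only [lapl, h1, kap, EuclideanSpace.norm_sq_eq, Fin.sum_univ_three, Real.norm_eq_abs, sq_abs]
  field_simp
  ring

end

/-! ### Functions on space-time -/

section

/-- Time derivative on space-time. -/
def dt (f : ℝ × E3 → ℝ) : ℝ × E3 → ℝ := dder (1, 0) f

/-- Spatial derivative on space-time. -/
def dx (i : Fin 3) (f : ℝ × E3 → ℝ) : ℝ × E3 → ℝ := dder (0, ee i) f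

/-- Time slice. -/
def sl (f : ℝ × E3 → ℝ) (t : ℝ) : E3 → ℝ := fun y => f (t, y)

/-- Spatial convolution on space-time. -/
def jm (k : E3 → ℝ) (f : ℝ × E3 → ℝ) : ℝ × E3 → ℝ := fun q => mol 1 k (sl f q.1) q.2

/-- Space-time convolution with a regular kernel. -/
def cv (K : ℝ → E3 → ℝ) (f : ℝ × E3 → ℝ) : ℝ × E3 → ℝ :=
  fun q => ∫ τ in Ioc 0 (1 / 8), mol 1 (K τ) (sl f (q.1 - τ)) q.2

lemma sl_smooth {f : ℝ × E3 → ℝ} (hf : ContDiff ℝ ∞ f) (t : ℝ) : ContDiff ℝ ∞ (sl f t) :=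
  hf.comp (contDiff_const.prodMk contDiff_id)

lemma dx_smooth {f : ℝ × E3 → ℝ} (hf : ContDiff ℝ ∞ f) (i : Fin 3) : ContDiff ℝ ∞ (dx i f) :=
  dder_smooth _ hf

lemma dt_smooth {f : ℝ × E3 → ℝ} (hf : ContDiff ℝ ∞ f) : ContDiff ℝ ∞ (dt f) :=
  dder_smooth _ hf

lemma sl_dx {f : ℝ × E3 → ℝ} (hf : ContDiff ℝ ∞ f) (i : Fin 3) (t : ℝ) :
    sl (dx i f) t = dder (ee i) (sl f t) := by
  funext x
  have := dder_comp_affine (ContinuousLinearMap.inr ℝ ℝ E3) (t, 0) (ee i) hf x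
  simp only [ContinuousLinearMap.inr_apply, Prod.mk_add_mk, add_zero, zero_add] at this
  unfold sl
  rw [this]; rfl

lemma hasDerivAt_time {f : ℝ × E3 → ℝ} (hf : ContDiff ℝ ∞ f) (t : ℝ) (x : E3) :
    HasDerivAt (fun s => f (s, x)) (dt f (t, x)) t := by
  have hp : HasDerivAt (fun s : ℝ => (s, x)) (1, 0) t :=
    (hasDerivAt_id t).prodMk (hasDerivAt_const t x)
  exact ((sm_diff hf (t, x)).hasFDerivAt).comp_hasDerivAt t hp

lemma jm_eq_av {k : E3 → ℝ} {R : ℝ} (hk : Bump k R) (f : ℝ × E3 → ℝ) :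
    jm k f = av (volume.restrict (closedBall (0 : E3) R)) (fun z => ((0 : ℝ), z)) k f := by
  funext q
  have := (hk.integral_zero_outside (fun z => f (q.1, q.2 - (1 : ℝ) • z))).symm
  simp only [jm, mol, sl, this, av]
  congr 1; funext z; simp
  left; congr 1; ext1 <;> simp

lemma avok_jm {k : E3 → ℝ} {R : ℝ} (hk : Bump k R) :
    AvOK (volume.restrict (closedBall (0 : E3) R)) (fun z => ((0 : ℝ), z)) k R := by
  refine ⟨hk.integrable.restrict, by fun_prop, ?_⟩
  refine (ae_restrict_iff' measurableSet_closedBall).2 (Eventually.of_forall fun z hz => ?_)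
  simpa [Prod.norm_def] using hz

lemma jm_smooth {k : E3 → ℝ} {R : ℝ} (hk : Bump k R) {f : ℝ × E3 → ℝ} (hf : ContDiff ℝ ∞ f) :
    ContDiff ℝ ∞ (jm k f) := by
  rw [jm_eq_av hk]; exact (avok_jm hk).contDiff hf

lemma dder_jm {k : E3 → ℝ} {R : ℝ} (hk : Bump k R) {f : ℝ × E3 → ℝ} (hf : ContDiff ℝ ∞ f)
    (V : ℝ × E3) : dder V (jm k f) = jm k (dder V f) := by
  rw [jm_eq_av hk, jm_eq_av hk, (avok_jm hk).dder hf]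

/-- The domain of integration for regular kernels. -/
def kdom : Set (ℝ × E3) := Ioc (0 : ℝ) (1 / 8) ×ˢ closedBall (0 : E3) 1

lemma kdom_meas : MeasurableSet kdom := measurableSet_Ioc.prod measurableSet_closedBall

lemma kdom_eq : (volume : Measure (ℝ × E3)).restrict kdom =
    ((volume : Measure ℝ).restrict (Ioc (0 : ℝ) (1 / 8))).prod
      ((volume : Measure E3).restrict (closedBall (0 : E3) 1)) := by
  rw [Measure.prod_restrict]; rfl

lemma avok_cv {K : ℝ → E3 → ℝ} (hK : Flat K) :
    AvOK ((volume : Measure (ℝ × E3)).restrict kdom) (fun w => w) (fun w => K w.1 w.2) 1 := by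
  obtain ⟨C, hC0, hC⟩ := hK.bound
  have hfin : (volume : Measure (ℝ × E3)) kdom < ⊤ := by
    have : (volume : Measure (ℝ × E3)) kdom = volume (Ioc (0 : ℝ) (1 / 8)) * volume (closedBall (0 : E3) 1) :=
      Measure.prod_prod _ _
    rw [this]
    exact ENNReal.mul_lt_top (by simp) measure_closedBall_lt_top
  refine ⟨?_, measurable_id, ?_⟩
  · refine Measure.integrableOn_of_bounded (M := C) hfin.ne hK.meas.aestronglyMeasurable ?_
    refine (ae_restrict_iff' kdom_meas).2 (Eventually.of_forall fun w hw => ?_)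
    exact hC _ hw.1.1 (hw.1.2.trans (by norm_num)) _
  · refine (ae_restrict_iff' kdom_meas).2 (Eventually.of_forall fun w hw => ?_)
    rw [Prod.norm_def, max_le_iff]
    refine ⟨?_, by simpa using hw.2⟩
    rw [Real.norm_eq_abs, abs_of_pos hw.1.1]; exact hw.1.2.trans (by norm_num)

lemma cv_eq_av {K : ℝ → E3 → ℝ} (hK : Flat K) {f : ℝ × E3 → ℝ} (hf : Continuous f) :
    cv K f = av ((volume : Measure (ℝ × E3)).restrict kdom) (fun w => w) (fun w => K w.1 w.2) f := by
  funext q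
  have h1 := (avok_cv hK).integrable hf q
  simp only [av]
  rw [kdom_eq] at h1 ⊢
  rw [integral_prod _ h1]
  simp only [cv, mol]
  congr 1; funext τ
  rw [← (hK.bump τ).integral_zero_outside]
  simp [sl, ← Prod.mk_sub_mk]

lemma cv_smooth {K : ℝ → E3 → ℝ} (hK : Flat K) {f : ℝ × E3 → ℝ} (hf : ContDiff ℝ ∞ f) :
    ContDiff ℝ ∞ (cv K f) := by
  rw [cv_eq_av hK hf.continuous]; exact (avok_cv hK).contDiff hf

lemma dder_cv {K : ℝ → E3 → ℝ} (hK : Flat K) {f : ℝ × E3 → ℝ} (hf : ContDiff ℝ ∞ f)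
    (V : ℝ × E3) : dder V (cv K f) = cv K (dder V f) := by
  rw [cv_eq_av hK hf.continuous, cv_eq_av hK (dder_smooth V hf).continuous, (avok_cv hK).dder hf]

lemma cv_dx {K : ℝ → E3 → ℝ} (hK : Flat K) {f : ℝ × E3 → ℝ} (hf : ContDiff ℝ ∞ f)
    (i : Fin 3) : cv K (dx i f) = cv (fun τ => dder (ee i) (K τ)) f := by
  funext q
  simp only [cv]
  congr 1; funext τ
  rw [sl_dx hf, mol_dder (hK.bump τ) (sl_smooth hf _) one_ne_zero]
  simp

lemma jm_dx {k : E3 → ℝ} {R : ℝ} (hk : Bump k R) {f : ℝ × E3 → ℝ} (hf : ContDiff ℝ ∞ f)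
    (i : Fin 3) : jm k (dx i f) = jm (dder (ee i) k) f := by
  funext q
  simp only [jm]
  rw [sl_dx hf, mol_dder hk (sl_smooth hf _) one_ne_zero]
  simp

lemma cv_add {K : ℝ → E3 → ℝ} (hK : Flat K) {f g : ℝ × E3 → ℝ} (hf : Continuous f)
    (hg : Continuous g) : cv K (fun q => f q + g q) = fun q => cv K f q + cv K g q := by
  rw [cv_eq_av hK hf, cv_eq_av hK hg, cv_eq_av hK (f := fun q => f q + g q) (hf.add hg)]
  funext q
  simp only [av, smul_eq_mul, mul_add]
  exact integral_add ((avok_cv hK).integrable hf q) ((avok_cv hK).integrable hg q)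

lemma mol_add {s : ℝ} {k f g : E3 → ℝ} {R : ℝ} (hk : Bump k R) (hf : Continuous f)
    (hg : Continuous g) (x : E3) : mol s k (fun y => f y + g y) x = mol s k f x + mol s k g x := by
  simp only [mol, mul_add]
  exact integral_add (hk.integrable_mul (by fun_prop)) (hk.integrable_mul (by fun_prop))

lemma mol_const_mul {s : ℝ} {k f : E3 → ℝ} (c : ℝ) (x : E3) :
    mol s k (fun y => c * f y) x = c * mol s k f x := by
  simp only [mol]
  rw [← integral_const_mul]
  congr 1; funext z; ring

lemma mol_sub {s : ℝ} {k f g : E3 → ℝ} {R : ℝ} (hk : Bump k R) (hf : Continuous f)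
    (hg : Continuous g) (x : E3) : mol s k (fun y => f y - g y) x = mol s k f x - mol s k g x := by
  simp only [mol, mul_sub]
  exact integral_sub (hk.integrable_mul (by fun_prop)) (hk.integrable_mul (by fun_prop))

lemma mol_sum {ι : Type*} (I : Finset ι) {s : ℝ} {k : E3 → ℝ} {f : ι → E3 → ℝ} {R : ℝ}
    (hk : Bump k R) (hf : ∀ i, Continuous (f i)) (x : E3) :
    mol s k (fun y => ∑ i ∈ I, f i y) x = ∑ i ∈ I, mol s k (f i) x := by
  simp only [mol, Finset.mul_sum]
  exact integral_finsetSum _ fun i _ => hk.integrable_mul (by have := hf i; fun_prop)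

lemma mol_kadd {s : ℝ} {k l f : E3 → ℝ} {R : ℝ} (hk : Bump k R) (hl : Bump l R)
    (hf : Continuous f) (x : E3) :
    mol s (fun y => k y + l y) f x = mol s k f x + mol s l f x := by
  simp only [mol, add_mul]
  exact integral_add (hk.integrable_mul (by fun_prop)) (hl.integrable_mul (by fun_prop))

lemma mol_ksum {s : ℝ} {k : Fin 3 → E3 → ℝ} {f : E3 → ℝ} {R : ℝ} (hk : ∀ i, Bump (k i) R)
    (hf : Continuous f) (x : E3) :
    mol s (fun y => ∑ i, k i y) f x = ∑ i, mol s (k i) f x := by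
  simp only [mol, Finset.sum_mul]
  exact integral_finsetSum _ fun i _ => (hk i).integrable_mul (by fun_prop)

lemma mol_lapl {k f : E3 → ℝ} {R : ℝ} (hk : Bump k R) (hf : ContDiff ℝ ∞ f) (x : E3) :
    mol 1 k (lapl f) x = mol 1 (lapl k) f x := by
  have h1 : mol 1 k (lapl f) x = ∑ i, mol 1 k (dder (ee i) (dder (ee i) f)) x :=
    mol_sum _ hk (fun i => (dder_smooth _ (dder_smooth _ hf)).continuous) x
  have h2 : mol 1 (lapl k) f x = ∑ i, mol 1 (dder (ee i) (dder (ee i) k)) f x :=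
    mol_ksum (fun i => (hk.dder (ee i)).dder (ee i)) hf.continuous x
  rw [h1, h2]
  refine Finset.sum_congr rfl fun i _ => ?_
  rw [mol_dder hk (dder_smooth _ hf) one_ne_zero, mol_dder (hk.dder _) hf one_ne_zero]
  simp

/-- Convolutions with compactly supported kernels commute. -/
lemma mol_comm {s r : ℝ} {k l f : E3 → ℝ} {R R' : ℝ} (hk : Bump k R) (hl : Bump l R')
    (hf : Continuous f) (x : E3) : mol s k (mol r l f) x = mol r l (mol s k f) x := by
  simp only [mol, ← integral_const_mul]
  rw [integral_integral_swap]
  · congr 1; funext y; congr 1; funext z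
    rw [sub_right_comm]; ring
  · have hc : Continuous (Function.uncurry fun (z y : E3) => k z * (l y * f (x - s • z - r • y))) := by
      have := hk.smooth.continuous
      have := hl.smooth.continuous
      unfold Function.uncurry
      fun_prop
    refine hc.integrable_of_hasCompactSupport ?_
    refine HasCompactSupport.intro ((isCompact_closedBall (0 : E3) R).prod (isCompact_closedBall (0 : E3) R'))
      fun q hq => ?_
    simp only [mem_prod, mem_closedBall, dist_zero_right, not_and_or, not_le] at hq
    rcases hq with hq | hq
    · simp [Function.uncurry, hk.supp _ hq]
    · simp [Function.uncurry, hl.supp _ hq]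

end

/-! ### Duhamel's formula -/

section

/-- The heat kernel cut off for times below `ε / 2`. -/
def gcut (ε : ℝ) (q : ℝ × E3) : ℝ := Real.smoothTransition (4 * q.1 / ε - 1) * gam q.1 q.2

lemma gcut_smooth {ε : ℝ} (hε : 0 < ε) : ContDiff ℝ ∞ (gcut ε) := by
  rw [contDiff_iff_contDiffAt]
  rintro ⟨τ, z⟩
  rcases lt_or_ge 0 τ with h | h
  · refine ContDiffAt.mul ?_ (gam_smooth h z)
    have : ContDiff ℝ ∞ fun q : ℝ × E3 => Real.smoothTransition (4 * q.1 / ε - 1) :=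
      Real.smoothTransition.contDiff.comp (by fun_prop)
    exact this.contDiffAt
  · have : gcut ε =ᶠ[𝓝 (τ, z)] fun _ => 0 := by
      have ho : IsOpen {q : ℝ × E3 | q.1 < ε / 4} := isOpen_lt continuous_fst continuous_const
      filter_upwards [ho.mem_nhds (show τ < ε / 4 by linarith)] with q hq
      unfold gcut
      rw [Real.smoothTransition.zero_of_nonpos, zero_mul]
      rw [sub_nonpos, div_le_one hε]
      have : q.1 < ε / 4 := hq
      linarith
    exact contDiffAt_const.congr_of_eventuallyEq this

lemma gcut_eq {ε : ℝ} (hε : 0 < ε) {q : ℝ × E3} (h : ε / 2 ≤ q.1) : gcut ε q = gam q.1 q.2 := by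
  unfold gcut
  rw [Real.smoothTransition.one_of_one_le, one_mul]
  rw [le_sub_iff_add_le, le_div_iff₀ hε]; linarith

section duhamel
variable {v N : ℝ × E3 → ℝ} (hv : ContDiff ℝ ∞ v) (hN : ContDiff ℝ ∞ N)
  (heq : ∀ t ∈ Icc (0 : ℝ) 1, ∀ x, dt v (t, x) = lapl (sl v t) x - N (t, x))

/-- The integrand in Duhamel's formula. -/
def duH (ε t : ℝ) (x : E3) (v : ℝ × E3 → ℝ) (q : ℝ × E3) : ℝ :=
  gcut ε q * tht q.1 * v (t - q.1, x - q.2)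

include hv in
lemma duH_smooth {ε : ℝ} (hε : 0 < ε) (t : ℝ) (x : E3) : ContDiff ℝ ∞ (duH ε t x v) := by
  have h1 := gcut_smooth hε
  have h2 := tht_smooth
  unfold duH
  have h3 : ContDiff ℝ ∞ fun q : ℝ × E3 => tht q.1 := h2.comp contDiff_fst
  have h4 : ContDiff ℝ ∞ fun q : ℝ × E3 => v (t - q.1, x - q.2) := hv.comp (by fun_prop)
  exact (h1.mul h3).mul h4

include hv hN heq in
lemma duh_dder {ε : ℝ} (hε : 0 < ε) {t τ : ℝ} (x : E3) (hτ : ε ≤ τ) (ht : t - τ ∈ Icc (0 : ℝ) 1) :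
    ∫ z, chi z * dder (1, 0) (duH ε t x v) (τ, z) =
      mol 1 (kap τ) (sl v (t - τ)) x + mol 1 (PK τ) (sl N (t - τ)) x := by
  have hτ0 : 0 < τ := by linarith
  have hsv := sl_smooth hv (t - τ)
  have hsN := sl_smooth hN (t - τ)
  have key : ∀ z, chi z * dder (1, 0) (duH ε t x v) (τ, z) =
      (lapl (PK τ) z + kap τ z) * sl v (t - τ) (x - (1 : ℝ) • z) -
        PK τ z * (fun y => lapl (sl v (t - τ)) y - sl N (t - τ) y) (x - (1 : ℝ) • z) := by
    intro z
    have h1 := hasDerivAt_time (duH_smooth hv hε t x) τ z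
    have h2 : HasDerivAt (fun s => v (t - s, x - z)) (-dt v (t - τ, x - z)) τ := by
      have := (hasDerivAt_time hv (t - τ) (x - z)).scomp τ ((hasDerivAt_id τ).const_sub t)
      simpa [Function.comp_def] using this
    have h3 := ((gam_deriv hτ0 z).mul
      ((tht_smooth.differentiable (by simp) τ).hasDerivAt)).mul h2
    have h4 : (fun s => duH ε t x v (s, z)) =ᶠ[𝓝 τ]
        ((fun τ => gam τ z) * tht) * fun s => v (t - s, x - z) := by
      filter_upwards [Ioi_mem_nhds (show ε / 2 < τ by linarith)] with s hs
      simp only [duH, Pi.mul_apply]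
      rw [gcut_eq hε (show ε / 2 ≤ s from le_of_lt hs)]
    have h5 := h1.unique (h3.congr_of_eventuallyEq h4)
    change chi z * dt (duH ε t x v) (τ, z) = _
    rw [h5, heq _ ht, ← pk_lapl τ hτ0]
    simp only [sl, PK, one_smul, Pi.mul_apply]
    ring
  simp only [key]
  have b1 : Bump (lapl (PK τ)) 1 := Bump.sum fun i => ((pk_bump τ).dder (ee i)).dder (ee i)
  have b2 := kap_flat.bump τ
  have hl := lapl_smooth hsv
  rw [integral_sub]
  · have e1 := mol_kadd (s := 1) b1 b2 hsv.continuous x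
    have e2 := mol_sub (s := 1) (pk_bump τ) hl.continuous hsN.continuous x
    have e3 := mol_lapl (pk_bump τ) hsv x
    simp only [mol] at e1 e2 e3 ⊢
    rw [e1, e2, e3]
    ring
  · exact (b1.add b2).integrable_mul (by have := hsv.continuous; fun_prop)
  · exact (pk_bump τ).integrable_mul (by have := hsN.continuous; have := hl.continuous; fun_prop)

lemma duh_eq {ε : ℝ} (hε : 0 < ε) (t : ℝ) (x : E3) {τ : ℝ} (hτ : ε ≤ τ) :
    ∫ z, chi z * duH ε t x v (τ, z) = mol 1 (PK τ) (sl v (t - τ)) x := by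
  simp only [mol]
  congr 1; funext z
  simp only [duH, PK, sl]
  rw [gcut_eq hε (show ε / 2 ≤ τ by linarith), one_smul]
  ring

include hv hN heq in
lemma duh_ftc {ε : ℝ} (hε : 0 < ε) (hε1 : ε ≤ 1 / 8) {t : ℝ} (ht : t ∈ Ioc (1 / 8 : ℝ) 1) (x : E3) :
    mol 1 (PK ε) (sl v (t - ε)) x + ∫ τ in ε..(1 / 8),
      mol 1 (kap τ) (sl v (t - τ)) x = - ∫ τ in ε..(1 / 8), mol 1 (PK τ) (sl N (t - τ)) x ∧
    IntervalIntegrable (fun τ => mol 1 (PK τ) (sl N (t - τ)) x) volume ε (1 / 8) := by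
  obtain ⟨s1, s2⟩ := param_smooth chi_bump (duH_smooth hv hε t x)
  have hd : Continuous fun s => ∫ z, chi z * dder (1, 0) (duH ε t x v) (s, z) :=
    (param_smooth chi_bump (dder_smooth _ (duH_smooth hv hε t x))).1.continuous
  have h1 := intervalIntegral.integral_eq_sub_of_hasDerivAt (a := ε) (b := 1 / 8)
    (fun s _ => s2 s) (hd.intervalIntegrable _ _)
  rw [duh_eq hε t x hε1, duh_eq hε t x le_rfl] at h1
  have h2 : mol 1 (PK (1 / 8)) (sl v (t - 1 / 8)) x = 0 := by
    simp only [mol, PK, tht_zero le_rfl, zero_mul, integral_zero]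
  have hcN : IntervalIntegrable (fun τ => mol 1 (PK τ) (sl N (t - τ)) x) volume ε (1 / 8) := by
    have hc := (param_smooth chi_bump (duH_smooth hN hε t x)).1.continuous
    refine (hc.intervalIntegrable ε (1 / 8)).congr ?_
    intro τ hτ
    rw [uIoc_of_le hε1] at hτ
    exact duh_eq hε t x hτ.1.le
  have h3 : ∫ s in ε..(1 / 8), ∫ z, chi z * dder (1, 0) (duH ε t x v) (s, z) =
      ∫ τ in ε..(1 / 8), (mol 1 (kap τ) (sl v (t - τ)) x + mol 1 (PK τ) (sl N (t - τ)) x) := by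
    refine intervalIntegral.integral_congr fun τ hτ => ?_
    rw [uIcc_of_le hε1] at hτ
    exact duh_dder hv hN heq hε x hτ.1 ⟨by linarith [ht.1, hτ.2], by linarith [ht.2, hτ.1]⟩
  have hck : IntervalIntegrable (fun τ => mol 1 (kap τ) (sl v (t - τ)) x) volume ε (1 / 8) := by
    refine ((hd.intervalIntegrable ε (1 / 8)).sub hcN).congr ?_
    intro τ hτ
    rw [uIoc_of_le hε1] at hτ
    simp only
    rw [duh_dder hv hN heq hε x hτ.1.le ⟨by linarith [ht.1, hτ.2], by linarith [ht.2, hτ.1]⟩]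
    ring
  refine ⟨?_, hcN⟩
  rw [h3, intervalIntegral.integral_add hck hcN, h2] at h1
  linarith

include hv in
lemma duh_lim (t : ℝ) (x : E3) :
    Tendsto (fun ε => mol 1 (PK ε) (sl v (t - ε)) x) (𝓝[>] 0) (𝓝 (v (t, x))) := by
  set G : ℝ × E3 → ℝ := fun q => tht q.1 * tht (-q.1) * (chi q.2 * v (t - q.1, x - q.2))
  have hG : ContDiff ℝ 1 G := by
    have h1 : ContDiff ℝ ∞ fun q : ℝ × E3 => tht q.1 := tht_smooth.comp contDiff_fst
    have h2 : ContDiff ℝ ∞ fun q : ℝ × E3 => tht (-q.1) := tht_smooth.comp contDiff_fst.neg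
    have h3 : ContDiff ℝ ∞ fun q : ℝ × E3 => chi q.2 := chi_bump.smooth.comp contDiff_snd
    have h4 : ContDiff ℝ ∞ fun q : ℝ × E3 => v (t - q.1, x - q.2) := hv.comp (by fun_prop)
    exact ((h1.mul h2).mul (h3.mul h4)).of_le (by simp)
  have hGs : HasCompactSupport G := by
    refine HasCompactSupport.intro ((isCompact_Icc (a := (-1 : ℝ)) (b := 1)).prod
      (isCompact_closedBall (0 : E3) 1)) fun q hq => ?_
    simp only [mem_prod, mem_closedBall, dist_zero_right, not_and_or, not_le, mem_Icc] at hq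
    simp only [G]
    rcases hq with (hq | hq) | hq
    · rw [tht_zero (show 1 / 8 ≤ -q.1 by linarith)]; ring
    · rw [tht_zero (show 1 / 8 ≤ q.1 by linarith)]; ring
    · rw [chi_bump.supp _ hq]; ring
  obtain ⟨L, hL⟩ := ContDiff.lipschitzWith_of_hasCompactSupport hGs hG (by simp)
  have hb : ∀ ε ∈ Ioo (0 : ℝ) (1 / 16), |mol 1 (PK ε) (sl v (t - ε)) x - v (t, x)| ≤
      L * (ε + 9 * √ε * √(8 * π) ^ 3) := by
    intro ε hε
    have hg := gam_integrable hε.1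
    have e0 : G (0, 0) = v (t, x) := by
      simp [G, tht_one (show (0 : ℝ) ≤ 1 / 16 by norm_num), chi_one (z := 0)]
    have e1 : mol 1 (PK ε) (sl v (t - ε)) x = ∫ z, gam ε z * G (ε, z) := by
      simp only [mol]
      congr 1; funext z
      simp only [PK, sl, G, tht_one hε.2.le, tht_one (show -ε ≤ 1 / 16 by linarith [hε.1]), one_smul]
      ring
    have hGi : Integrable fun z => gam ε z * G (ε, z) := by
      refine ((chi_bump.mul (gam_smooth_slice ε)).integrable_mul (g := fun z => v (t - ε, x - z)) ?_).congr ?_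
      · have := hv.continuous; fun_prop
      · refine Eventually.of_forall fun z => ?_
        simp only [G, tht_one hε.2.le, tht_one (show -ε ≤ 1 / 16 by linarith [hε.1])]
        ring
    have e2 : mol 1 (PK ε) (sl v (t - ε)) x - v (t, x) = ∫ z, gam ε z * (G (ε, z) - G (0, 0)) := by
      simp only [mul_sub]
      rw [integral_sub hGi (hg.mul_const _), integral_mul_const, gam_integral hε.1, e1, e0, one_mul]
    rw [e2]
    have hmi := gmaj_integrable hε.1
    have hle : ∀ z, |gam ε z * (G (ε, z) - G (0, 0))| ≤ L * (ε * gam ε z + 9 * √ε * gmaj ε z) := by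
      intro z
      have hgp := gam_pos hε.1 z
      rw [abs_mul, abs_of_pos hgp]
      have h1 := hL.dist_le_mul (ε, z) (0, 0)
      rw [Real.dist_eq] at h1
      have h2 : dist ((ε, z) : ℝ × E3) (0, 0) ≤ ε + ‖z‖ := by
        rw [Prod.dist_eq]
        simp only [dist_zero_right, Real.norm_eq_abs, abs_of_pos hε.1]
        exact max_le (by linarith [norm_nonneg z]) (by linarith [hε.1])
      have h3 := (gam_bounds hε.1 z).2.2
      have hs : 0 < √ε := Real.sqrt_pos.2 hε.1
      rw [div_mul_eq_mul_div, div_le_iff₀ hs] at h3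
      calc gam ε z * |G (ε, z) - G (0, 0)| ≤ gam ε z * (L * (ε + ‖z‖)) := by
            gcongr; exact h1.trans (by gcongr)
        _ = L * (ε * gam ε z + ‖z‖ * gam ε z) := by ring
        _ ≤ _ := mul_le_mul_of_nonneg_left (by linarith) L.coe_nonneg
    calc |∫ z, gam ε z * (G (ε, z) - G (0, 0))|
        ≤ ∫ z, L * (ε * gam ε z + 9 * √ε * gmaj ε z) := by
          rw [← Real.norm_eq_abs]
          exact norm_integral_le_of_norm_le
            (((hg.const_mul ε).add (hmi.const_mul (9 * √ε))).const_mul (L : ℝ))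
            (Eventually.of_forall hle)
      _ = _ := by
          rw [integral_const_mul, integral_add (hg.const_mul ε) (hmi.const_mul (9 * √ε)),
            integral_const_mul, integral_const_mul, gam_integral hε.1, gmaj_integral hε.1]
          ring
  rw [tendsto_iff_dist_tendsto_zero]
  refine squeeze_zero' (g := fun ε => L * (ε + 9 * √ε * √(8 * π) ^ 3))
    (Eventually.of_forall fun _ => dist_nonneg) ?_ ?_
  · filter_upwards [Ioo_mem_nhdsGT (show (0 : ℝ) < 1 / 16 by norm_num)] with ε hε
    rw [Real.dist_eq]; exact hb ε hε
  · have : Continuous fun ε : ℝ => L * (ε + 9 * √ε * √(8 * π) ^ 3) := by fun_prop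
    have h0 := (this.tendsto 0).mono_left (nhdsWithin_le_nhds (s := Ioi 0))
    simpa using h0

include hv in
lemma cv_integrableOn {K : ℝ → E3 → ℝ} (hK : Flat K) (t : ℝ) (x : E3) :
    IntegrableOn (fun τ => mol 1 (K τ) (sl v (t - τ)) x) (Ioc 0 (1 / 8)) := by
  have h1 := (avok_cv hK).integrable hv.continuous (t, x)
  rw [kdom_eq] at h1
  refine h1.integral_prod_left.congr (Eventually.of_forall fun τ => ?_)
  simp only [mol]
  rw [← (hK.bump τ).integral_zero_outside]
  simp [sl, ← Prod.mk_sub_mk]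

include hv hN heq in
/-- Duhamel's inequality. -/
lemma duhamel {t : ℝ} (ht : t ∈ Ioc (1 / 8 : ℝ) 1) (x : E3) :
    ENNReal.ofReal |v (t, x) + cv kap v (t, x)| ≤
      ∫⁻ τ in Ioc (0 : ℝ) (1 / 8), ENNReal.ofReal |mol 1 (PK τ) (sl N (t - τ)) x| := by
  have hk := cv_integrableOn hv kap_flat t x
  have hlim : Tendsto (fun ε : ℝ => mol 1 (PK ε) (sl v (t - ε)) x + ∫ τ in ε..(1 / 8),
      mol 1 (kap τ) (sl v (t - τ)) x) (𝓝[>] 0) (𝓝 (v (t, x) + cv kap v (t, x))) := by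
    refine (duh_lim hv t x).add ?_
    have h0 : cv kap v (t, x) = ∫ τ in (0 : ℝ)..(1 / 8), mol 1 (kap τ) (sl v (t - τ)) x := by
      rw [intervalIntegral.integral_of_le (by norm_num)]; rfl
    rw [h0]
    have hii : IntegrableOn (fun τ => mol 1 (kap τ) (sl v (t - τ)) x) (uIcc (0 : ℝ) (1 / 8)) := by
      rw [uIcc_of_le (by norm_num), integrableOn_Icc_iff_integrableOn_Ioc]; exact hk
    have hc := intervalIntegral.continuousOn_primitive_interval_left hii
    have h1 := hc 0 (by simp)
    rw [ContinuousWithinAt, uIcc_of_le (by norm_num : (0 : ℝ) ≤ 1 / 8)] at h1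
    exact h1.mono_left (nhdsWithin_le_of_mem (Icc_mem_nhdsGT (by norm_num)))
  have hlim2 := (ENNReal.continuous_ofReal.tendsto _).comp (hlim.abs)
  refine le_of_tendsto hlim2 ?_
  filter_upwards [Ioo_mem_nhdsGT (show (0 : ℝ) < 1 / 8 by norm_num)] with ε hε
  obtain ⟨h1, h2⟩ := duh_ftc hv hN heq hε.1 hε.2.le ht x
  simp only [Function.comp]
  rw [h1, abs_neg, intervalIntegral.integral_of_le hε.2.le]
  calc ENNReal.ofReal |∫ τ in Ioc ε (1 / 8), mol 1 (PK τ) (sl N (t - τ)) x|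
      ≤ ∫⁻ τ in Ioc ε (1 / 8), ENNReal.ofReal |mol 1 (PK τ) (sl N (t - τ)) x| := by
        have := enorm_integral_le_lintegral_enorm (μ := volume.restrict (Ioc ε (1 / 8)))
          (fun τ => mol 1 (PK τ) (sl N (t - τ)) x)
        simpa only [← ofReal_norm, Real.norm_eq_abs] using this
    _ ≤ _ := lintegral_mono_set (Ioc_subset_Ioc_left hε.1.le)

end duhamel

end

/-! ### The averaging operators -/

section

/-- Measure underlying the averaging operators. -/
def mu2 (τ : ℝ) : Measure (E3 × E3) :=
  ((volume : Measure E3).restrict (closedBall (0 : E3) 1)).prod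
    ((volume : Measure E3).withDensity fun z => ENNReal.ofReal (gmaj τ z))

/-- Displacement underlying the averaging operators. -/
def sh2 (σ : ℝ) (w : E3 × E3) : E3 := σ • w.1 + w.2

/-- Averages at scale `max (√τ) σ`. -/
def TT (τ σ : ℝ) (g : E3 → ℝ≥0∞) (x : E3) : ℝ≥0∞ := tr (mu2 τ) (sh2 σ) g x

/-- The constant in the bounds for the averaging operators. -/
def MT : ℝ := (volume (closedBall (0 : E3) 1)).toReal * (√(8 * π) ^ 3 + 1) + √(8 * π) ^ 3

lemma MT_pos : 0 < MT := by
  have : 0 < √(8 * π) ^ 3 := by positivity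
  unfold MT; positivity

lemma gmaj_ofReal_meas (τ : ℝ) : Measurable fun z => ENNReal.ofReal (gmaj τ z) :=
  (gmaj_cont τ).measurable.ennreal_ofReal

instance mu2_sfinite (τ : ℝ) : SFinite (mu2 τ) := by unfold mu2; infer_instance

lemma TT_eq (τ σ : ℝ) {g : E3 → ℝ≥0∞} (hg : Measurable g) (x : E3) :
    TT τ σ g x = ∫⁻ y in closedBall (0 : E3) 1, ∫⁻ z, ENNReal.ofReal (gmaj τ z) * g (x - (σ • y + z)) := by
  unfold TT tr mu2 sh2
  rw [lintegral_prod _ (by fun_prop)]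
  congr 1; funext y
  rw [lintegral_withDensity_eq_lintegral_mul _ (gmaj_ofReal_meas τ) (by fun_prop)]
  rfl

lemma lintegral_shift (g : E3 → ℝ≥0∞) (a : E3) : ∫⁻ z, g (a - z) = ∫⁻ z, g z :=
  lintegral_sub_left_eq_self g a

lemma lintegral_dilate {σ : ℝ} (hσ : 0 < σ) {g : E3 → ℝ≥0∞} (hg : Measurable g) (a : E3) :
    ∫⁻ z, g (a - σ • z) = ENNReal.ofReal (σ⁻¹ ^ 3) * ∫⁻ z, g z := by
  have h1 := Measure.map_addHaar_smul (volume : Measure E3) hσ.ne'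
  have h2 : ∫⁻ z, g (a - σ • z) = ∫⁻ y, g (a - y) ∂(Measure.map (σ • ·) volume) := by
    rw [lintegral_map (by fun_prop) (by fun_prop)]
  rw [h2, h1, lintegral_smul_measure, lintegral_shift]
  simp [abs_of_pos hσ]

lemma TT_kernel_meas (τ σ : ℝ) (x : E3) {g : E3 → ℝ≥0∞} (hg : Measurable g) :
    Measurable (Function.uncurry fun (y z : E3) =>
      ENNReal.ofReal (gmaj τ z) * g (x - (σ • y + z))) :=
  ((gmaj_ofReal_meas τ).comp measurable_snd).mul (hg.comp (by fun_prop))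

lemma TT_ok {τ : ℝ} (σ : ℝ) (hτ : 0 < τ) :
    TrOK (mu2 τ) (sh2 σ) (ENNReal.ofReal MT) (ENNReal.ofReal (MT * (max (√τ) σ)⁻¹ ^ 3)) := by
  set b := (volume (closedBall (0 : E3) 1)).toReal
  have hb : volume (closedBall (0 : E3) 1) = ENNReal.ofReal b :=
    (ENNReal.ofReal_toReal measure_closedBall_lt_top.ne).symm
  have hb0 : 0 ≤ b := ENNReal.toReal_nonneg
  have h8 : 0 < √(8 * π) ^ 3 := by positivity
  have hs : 0 < √τ := Real.sqrt_pos.2 hτ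
  refine ⟨by unfold sh2; fun_prop, ?_, fun g hg x => ?_⟩
  · unfold mu2
    rw [← univ_prod_univ, Measure.prod_prod, Measure.restrict_apply_univ, withDensity_apply _ .univ,
      Measure.restrict_univ, gmaj_mass hτ, hb, ← ENNReal.ofReal_mul hb0]
    apply ENNReal.ofReal_le_ofReal
    unfold MT; nlinarith
  · change TT τ σ g x ≤ _
    rw [TT_eq τ σ hg]
    rcases le_total σ (√τ) with h | h
    · rw [max_eq_left h]
      have h1 : ∀ y : E3, ∫⁻ z, ENNReal.ofReal (gmaj τ z) * g (x - (σ • y + z)) ≤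
          ENNReal.ofReal ((√τ)⁻¹ ^ 3) * ∫⁻ z, g z := by
        intro y
        rw [← lintegral_shift g (x - σ • y), ← lintegral_const_mul _ (by fun_prop)]
        refine lintegral_mono fun z => ?_
        rw [sub_add_eq_sub_sub]
        exact mul_le_mul' (ENNReal.ofReal_le_ofReal (gmaj_le hτ z)) le_rfl
      refine (lintegral_mono fun y => h1 y).trans ?_
      rw [lintegral_const, Measure.restrict_apply_univ, hb, mul_right_comm,
        ← ENNReal.ofReal_mul (by positivity)]
      refine mul_le_mul' (ENNReal.ofReal_le_ofReal ?_) le_rfl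
      have : b ≤ MT := by unfold MT; nlinarith
      nlinarith [show 0 < (√τ)⁻¹ ^ 3 by positivity]
    · rw [max_eq_right h]
      have hσ0 : 0 < σ := hs.trans_le h
      have e := TT_kernel_meas τ σ x hg
      rw [lintegral_lintegral_swap e.aemeasurable]
      have h1 : ∀ z : E3, ∫⁻ y in closedBall (0 : E3) 1, ENNReal.ofReal (gmaj τ z) * g (x - (σ • y + z)) ≤
          ENNReal.ofReal (gmaj τ z) * (ENNReal.ofReal (σ⁻¹ ^ 3) * ∫⁻ z, g z) := by
        intro z
        rw [lintegral_const_mul _ (by fun_prop)]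
        gcongr
        rw [← lintegral_dilate hσ0 hg (x - z)]
        refine (setLIntegral_le_lintegral _ _).trans (lintegral_mono fun y => ?_)
        rw [add_comm, sub_add_eq_sub_sub]
      refine (lintegral_mono fun z => h1 z).trans ?_
      rw [lintegral_mul_const _ (gmaj_ofReal_meas τ), gmaj_mass hτ, ← mul_assoc,
        ← ENNReal.ofReal_mul (by positivity)]
      gcongr
      unfold MT; nlinarith

lemma lintegral_abs_mol {s : ℝ} (k f : E3 → ℝ) (x : E3) :
    ENNReal.ofReal |mol s k f x| ≤ ∫⁻ z, ENNReal.ofReal |k z| * ENNReal.ofReal |f (x - s • z)| := by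
  have := enorm_integral_le_lintegral_enorm (μ := volume) fun z => k z * f (x - s • z)
  simp only [← ofReal_norm, Real.norm_eq_abs] at this
  refine this.trans (lintegral_mono fun z => ?_)
  rw [abs_mul, ENNReal.ofReal_mul (abs_nonneg _)]

lemma mol_mol_le {τ σ : ℝ} {h K g : E3 → ℝ} {Ch Ck : ℝ} (hh : Bump h 1)
    (hh0 : ∀ z, |h z| ≤ Ch) (hK : ∀ z, |K z| ≤ Ck * gmaj τ z) (hCk : 0 ≤ Ck)
    {G : E3 → ℝ≥0∞} (hG : Measurable G) (hgG : ∀ y, ENNReal.ofReal |g y| ≤ G y) (x : E3) :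
    ENNReal.ofReal |mol σ h (mol 1 K g) x| ≤ ENNReal.ofReal (Ch * Ck) * TT τ σ G x := by
  have hCh : 0 ≤ Ch := (abs_nonneg _).trans (hh0 0)
  rw [TT_eq τ σ hG]
  have hm1 (y : E3) : Measurable fun z => ENNReal.ofReal (gmaj τ z) * G (x - (σ • y + z)) :=
    (gmaj_ofReal_meas τ).mul (by fun_prop)
  have hm2 : Measurable fun y => ∫⁻ z, ENNReal.ofReal (gmaj τ z) * G (x - (σ • y + z)) :=
    (TT_kernel_meas τ σ x hG).lintegral_prod_right'
  have h1 : ∀ y, ENNReal.ofReal |mol 1 K g (x - σ • y)| ≤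
      ENNReal.ofReal Ck * ∫⁻ z, ENNReal.ofReal (gmaj τ z) * G (x - (σ • y + z)) := by
    intro y
    refine (lintegral_abs_mol _ _ _).trans ?_
    rw [← lintegral_const_mul _ (hm1 y)]
    refine lintegral_mono fun z => ?_
    rw [← mul_assoc, ← ENNReal.ofReal_mul hCk]
    refine mul_le_mul' (ENNReal.ofReal_le_ofReal (hK z)) ?_
    rw [one_smul, ← sub_add_eq_sub_sub]; exact hgG _
  rw [ENNReal.ofReal_mul hCh, mul_assoc, ← lintegral_const_mul _ hm2,
    ← lintegral_const_mul _ (hm2.const_mul _), ← lintegral_indicator measurableSet_closedBall]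
  refine (lintegral_abs_mol _ _ _).trans (lintegral_mono fun y => ?_)
  by_cases hy : y ∈ closedBall (0 : E3) 1
  · rw [indicator_of_mem hy]
    exact mul_le_mul' (ENNReal.ofReal_le_ofReal (hh0 y)) (h1 y)
  · rw [hh.supp y (by simpa using hy)]; simp

lemma mol_le {K g : E3 → ℝ} {Ck : ℝ} (hK : ∀ z, |K z| ≤ Ck * gmaj 1 z) (hCk : 0 ≤ Ck)
    {G : E3 → ℝ≥0∞} (hG : Measurable G) (hgG : ∀ y, ENNReal.ofReal |g y| ≤ G y) (x : E3) :
    ENNReal.ofReal |mol 1 K g x| ≤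
      ENNReal.ofReal ((volume (closedBall (0 : E3) 1)).toReal⁻¹ * Ck) * TT 1 0 G x := by
  set b := (volume (closedBall (0 : E3) 1)).toReal
  have hb : volume (closedBall (0 : E3) 1) = ENNReal.ofReal b :=
    (ENNReal.ofReal_toReal measure_closedBall_lt_top.ne).symm
  have hb0 : 0 < b := ENNReal.toReal_pos (measure_closedBall_pos _ _ one_pos).ne'
    measure_closedBall_lt_top.ne
  have hm : Measurable fun z => ENNReal.ofReal (gmaj 1 z) * G (x - z) :=
    (gmaj_ofReal_meas 1).mul (by fun_prop)
  rw [TT_eq 1 0 hG]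
  simp only [zero_smul, zero_add]
  rw [lintegral_const, Measure.restrict_apply_univ, hb, mul_comm b⁻¹, ENNReal.ofReal_mul hCk]
  have : ENNReal.ofReal b⁻¹ * ENNReal.ofReal b = 1 := by
    rw [← ENNReal.ofReal_mul (by positivity), inv_mul_cancel₀ hb0.ne', ENNReal.ofReal_one]
  rw [mul_assoc, mul_comm (∫⁻ z, _), ← mul_assoc (ENNReal.ofReal b⁻¹), this, one_mul,
    ← lintegral_const_mul _ hm]
  refine (lintegral_abs_mol _ _ _).trans (lintegral_mono fun z => ?_)
  rw [← mul_assoc, ← ENNReal.ofReal_mul hCk, one_smul]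
  exact mul_le_mul' (ENNReal.ofReal_le_ofReal (hK z)) (hgG _)

end

/-! ### The nonlinearity of a slice -/

section

lemma mol_third_le {K ζ F : E3 → ℝ} {c Cz τ σ : ℝ} (hK : Bump K 1) (hζ : Bump ζ 1)
    (hF : ContDiff ℝ ∞ F) (hc : 0 ≤ c) (hτ : 0 < τ) (hσ : 0 < σ)
    (hK1 : ∀ a z, |dder (ee a) K z| ≤ c * gmaj τ z)
    (hK2 : ∀ a b z, |dder (ee b) (dder (ee a) K) z| ≤ c * (√τ)⁻¹ * gmaj τ z)
    (hz1 : ∀ a z, |dder (ee a) ζ z| ≤ Cz) (hz2 : ∀ a b z, |dder (ee b) (dder (ee a) ζ) z| ≤ Cz)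
    {G : E3 → ℝ≥0∞} (hG : Measurable G) (hFG : ∀ y, ENNReal.ofReal |F y| ≤ G y) (i j k : Fin 3)
    (x : E3) :
    ENNReal.ofReal |σ * mol σ ζ (mol 1 K (dder (ee i) (dder (ee j) (dder (ee k) F)))) x| ≤
      ENNReal.ofReal (Cz * c * (max (√τ) σ)⁻¹) * TT τ σ G x := by
  have hs : 0 < √τ := Real.sqrt_pos.2 hτ
  have hk1 : ContDiff ℝ ∞ (dder (ee k) F) := dder_smooth _ hF
  have hj1 : ContDiff ℝ ∞ (dder (ee j) (dder (ee k) F)) := dder_smooth _ hk1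
  have e1 : mol 1 K (dder (ee i) (dder (ee j) (dder (ee k) F))) =
      mol 1 (dder (ee i) K) (dder (ee j) (dder (ee k) F)) := by
    funext y; rw [mol_dder hK hj1 one_ne_zero]; simp
  rcases le_total σ (√τ) with h | h
  · have e2 : mol 1 (dder (ee i) K) (dder (ee j) (dder (ee k) F)) =
        dder (ee k) (mol 1 (dder (ee j) (dder (ee i) K)) F) := by
      rw [dder_mol _ ((hK.dder _).dder _) hF]
      funext y; rw [mol_dder (hK.dder _) hk1 one_ne_zero]; simp
    rw [max_eq_left h, e1, e2, mol_dder hζ (mol_smooth _ ((hK.dder _).dder _) hF) hσ.ne',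
      ← mul_assoc, mul_inv_cancel₀ hσ.ne', one_mul, mul_assoc]
    exact mol_mol_le (hζ.dder _) (hz1 k) (hK2 i j) (by positivity) hG hFG x
  · have e2 : mol 1 (dder (ee i) K) (dder (ee j) (dder (ee k) F)) =
        dder (ee j) (dder (ee k) (mol 1 (dder (ee i) K) F)) := by
      rw [dder_mol _ (hK.dder _) hF, dder_mol _ (hK.dder _) hk1]
    have hm : ContDiff ℝ ∞ (mol 1 (dder (ee i) K) F) := mol_smooth _ (hK.dder _) hF
    rw [max_eq_right h, e1, e2, mol_dder hζ (dder_smooth _ hm) hσ.ne',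
      mol_dder (hζ.dder _) hm hσ.ne', ← mul_assoc, mul_inv_cancel₀ hσ.ne', one_mul, abs_mul,
      ENNReal.ofReal_mul (abs_nonneg _), abs_of_pos (inv_pos.2 hσ), mul_comm (Cz * c),
      ENNReal.ofReal_mul (inv_pos.2 hσ).le, mul_assoc]
    exact mul_le_mul' le_rfl (mol_mol_le ((hζ.dder _).dder _) (hz2 j k) (hK1 i) hc hG hFG x)

/-- A velocity field and its pressure at a fixed time. -/
structure Slice (V : Fin 3 → E3 → ℝ) (P : E3 → ℝ) : Prop where
  sV : ∀ i, ContDiff ℝ ∞ (V i)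
  sP : ContDiff ℝ ∞ P
  press : ∀ x, lapl P x = - ∑ j, ∑ k, dder (ee j) (dder (ee k) fun y => V j y * V k y) x

/-- The length of a vector given by its components. -/
def spd (V : Fin 3 → E3 → ℝ) (x : E3) : ℝ := √(∑ i, V i x ^ 2)

/-- The divergence of the tensor product of a field with itself. -/
def dvt (V : Fin 3 → E3 → ℝ) (i : Fin 3) (x : E3) : ℝ := ∑ j, dder (ee j) (fun y => V i y * V j y) x

/-- The nonlinearity with its pressure. -/
def ffs (V : Fin 3 → E3 → ℝ) (P : E3 → ℝ) (i : Fin 3) (x : E3) : ℝ := dvt V i x + dder (ee i) P x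

lemma abs_le_spd (V : Fin 3 → E3 → ℝ) (i : Fin 3) (x : E3) : |V i x| ≤ spd V x := by
  unfold spd
  rw [← Real.sqrt_sq_eq_abs]
  exact Real.sqrt_le_sqrt (Finset.single_le_sum (f := fun i => V i x ^ 2)
    (fun j _ => sq_nonneg _) (Finset.mem_univ i))

lemma ofReal_mul_le_spd (V : Fin 3 → E3 → ℝ) (i j : Fin 3) (x : E3) :
    ENNReal.ofReal |V i x * V j x| ≤ ENNReal.ofReal (spd V x) ^ 2 := by
  have h0 : 0 ≤ spd V x := Real.sqrt_nonneg _
  rw [← ENNReal.ofReal_pow h0, abs_mul, sq]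
  exact ENNReal.ofReal_le_ofReal (mul_le_mul (abs_le_spd V i x) (abs_le_spd V j x) (abs_nonneg _)
    (Real.sqrt_nonneg _))

variable {V : Fin 3 → E3 → ℝ} {P : E3 → ℝ}

lemma spd_cont (h : ∀ i, ContDiff ℝ ∞ (V i)) : Continuous (spd V) := by
  unfold spd
  have := fun i => (h i).continuous
  fun_prop

lemma dvt_smooth (h : ∀ i, ContDiff ℝ ∞ (V i)) (i : Fin 3) : ContDiff ℝ ∞ (dvt V i) := by
  unfold dvt
  exact ContDiff.sum fun j _ => dder_smooth _ ((h i).mul (h j))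

lemma Slice.ff_smooth (h : Slice V P) (i : Fin 3) : ContDiff ℝ ∞ (ffs V P i) :=
  (dvt_smooth h.sV i).add (dder_smooth _ h.sP)

lemma lapl_dder {f : E3 → ℝ} (hf : ContDiff ℝ ∞ f) (v : E3) :
    lapl (dder v f) = dder v (lapl f) := by
  have : lapl f = fun x => ∑ i, dder (ee i) (dder (ee i) f) x := rfl
  rw [this, dder_sum _ _ fun i => dder_smooth _ (dder_smooth _ hf)]
  funext x
  refine Finset.sum_congr rfl fun i _ => ?_
  rw [dder_comm (ee i) v hf, dder_comm (ee i) v (dder_smooth _ hf)]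

lemma Slice.lapl_ff (h : Slice V P) (i : Fin 3) (x : E3) :
    lapl (ffs V P i) x =
      ∑ j, ∑ l, dder (ee l) (dder (ee l) (dder (ee j) fun y => V i y * V j y)) x -
      ∑ j, ∑ k, dder (ee i) (dder (ee j) (dder (ee k) fun y => V j y * V k y)) x := by
  have hs := fun i j => (h.sV i).mul (h.sV j)
  have e1 : lapl (ffs V P i) x = lapl (dvt V i) x + lapl (dder (ee i) P) x := by
    unfold ffs lapl
    rw [← Finset.sum_add_distrib]
    refine Finset.sum_congr rfl fun l _ => ?_
    rw [dder_add _ (dvt_smooth h.sV i) (dder_smooth _ h.sP),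
      dder_add _ (dder_smooth _ (dvt_smooth h.sV i)) (dder_smooth _ (dder_smooth _ h.sP))]
  have e2 : lapl P = fun x => - ∑ j, ∑ k, dder (ee j) (dder (ee k) fun y => V j y * V k y) x :=
    funext h.press
  have hS : ∀ j, ContDiff ℝ ∞ fun x => ∑ k, dder (ee j) (dder (ee k) fun y => V j y * V k y) x :=
    fun j => ContDiff.sum fun k _ => dder_smooth _ (dder_smooth _ (hs j k))
  rw [e1, lapl_dder h.sP, e2, sub_eq_add_neg]
  congr 1
  · unfold lapl dvt
    rw [Finset.sum_comm]
    refine Finset.sum_congr rfl fun l _ => ?_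
    rw [dder_sum _ _ fun j => dder_smooth _ (hs i j), dder_sum _ _ fun j => dder_smooth _ (dder_smooth _ (hs i j))]
  · rw [dder_neg, dder_sum _ _ fun j => hS j]
    refine congrArg Neg.neg (Finset.sum_congr rfl fun j _ => ?_)
    rw [dder_sum _ _ fun k => dder_smooth _ (dder_smooth _ (hs j k))]

lemma lapl_mol {K f : E3 → ℝ} {R s : ℝ} (hK : Bump K R) (hf : ContDiff ℝ ∞ f) :
    lapl (mol s K f) = mol s K (lapl f) := by
  have h2 : ∀ i, Continuous (dder (ee i) (dder (ee i) f)) := fun i =>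
    (dder_smooth _ (dder_smooth _ hf)).continuous
  funext x
  change _ = mol s K (fun y => ∑ i, dder (ee i) (dder (ee i) f) y) x
  rw [mol_sum _ hK h2]
  refine Finset.sum_congr rfl fun i _ => ?_
  rw [dder_mol _ hK hf, dder_mol _ hK (dder_smooth _ hf)]

lemma ofReal_abs_sum_le {ι : Type*} (s : Finset ι) (f : ι → ℝ) :
    ENNReal.ofReal |∑ i ∈ s, f i| ≤ ∑ i ∈ s, ENNReal.ofReal |f i| := by
  rw [← ENNReal.ofReal_sum_of_nonneg fun i _ => abs_nonneg _]
  exact ENNReal.ofReal_le_ofReal (Finset.abs_sum_le_sum_abs _ _)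

lemma ofReal_abs_add_le (a b : ℝ) :
    ENNReal.ofReal |a + b| ≤ ENNReal.ofReal |a| + ENNReal.ofReal |b| := by
  rw [← ENNReal.ofReal_add (abs_nonneg _) (abs_nonneg _)]
  exact ENNReal.ofReal_le_ofReal (abs_add_le _ _)

lemma ofReal_abs_sub_le (a b : ℝ) :
    ENNReal.ofReal |a - b| ≤ ENNReal.ofReal |a| + ENNReal.ofReal |b| := by
  rw [sub_eq_add_neg, ← abs_neg b]; exact ofReal_abs_add_le _ _

lemma ofReal_abs_intervalIntegral_le {h : ℝ → ℝ} {a b : ℝ} (hab : a ≤ b) :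
    ENNReal.ofReal |∫ s in a..b, h s| ≤ ∫⁻ s in Ioc a b, ENNReal.ofReal |h s| := by
  rw [intervalIntegral.integral_of_le hab]
  have := enorm_integral_le_lintegral_enorm (μ := volume.restrict (Ioc a b)) h
  simpa only [← ofReal_norm, Real.norm_eq_abs] using this

lemma Slice.nn_le {ζ φ K : E3 → ℝ} {c Cz τ : ℝ} (h : Slice V P) (hk : KPair ζ φ) (hK : Bump K 1)
    (hc : 0 ≤ c) (hτ : 0 < τ) (hK1 : ∀ a z, |dder (ee a) K z| ≤ c * gmaj τ z)
    (hK2 : ∀ a b z, |dder (ee b) (dder (ee a) K) z| ≤ c * (√τ)⁻¹ * gmaj τ z)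
    (hz1 : ∀ a z, |dder (ee a) ζ z| ≤ Cz) (hz2 : ∀ a b z, |dder (ee b) (dder (ee a) ζ) z| ≤ Cz)
    (i : Fin 3) (x : E3) :
    ENNReal.ofReal |mol 1 K (fun y => ffs V P i y - mol 1 φ (ffs V P i) y) x| ≤
      ∫⁻ σ in Ioc (0 : ℝ) 1, ENNReal.ofReal (18 * (Cz * c * (max (√τ) σ)⁻¹)) *
        TT τ σ (fun y => ENNReal.ofReal (spd V y) ^ 2) x := by
  have hf := h.ff_smooth i
  have hs := fun i j => (h.sV i).mul (h.sV j)
  have hG : Measurable fun y => ENNReal.ofReal (spd V y) ^ 2 :=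
    (spd_cont h.sV).measurable.ennreal_ofReal.pow_const 2
  have hCz : 0 ≤ Cz := (abs_nonneg _).trans (hz1 0 0)
  have hg : ContDiff ℝ ∞ (mol 1 K (ffs V P i)) := mol_smooth _ hK hf
  have e1 : mol 1 K (fun y => ffs V P i y - mol 1 φ (ffs V P i) y) x =
      - ∫ s in (0 : ℝ)..1, s * mol s ζ (lapl (mol 1 K (ffs V P i))) x := by
    rw [← hk.identity hg x 0 1, mol_zero, hk.one,
      mol_sub hK hf.continuous (mol_smooth _ hk.bp hf).continuous, mol_comm hK hk.bp hf.continuous]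
    ring
  rw [e1, abs_neg]
  refine (ofReal_abs_intervalIntegral_le zero_le_one).trans
    (setLIntegral_mono' measurableSet_Ioc fun σ hσ => ?_)
  have d1 : ∀ j l, ContDiff ℝ ∞ (dder (ee l) (dder (ee l) (dder (ee j) fun y => V i y * V j y))) :=
    fun j l => dder_smooth _ (dder_smooth _ (dder_smooth _ (hs i j)))
  have d2 : ∀ j k, ContDiff ℝ ∞ (dder (ee i) (dder (ee j) (dder (ee k) fun y => V j y * V k y))) :=
    fun j k => dder_smooth _ (dder_smooth _ (dder_smooth _ (hs j k)))
  have m1 := fun j l => mol_smooth 1 hK (d1 j l)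
  have m2 := fun j l => mol_smooth 1 hK (d2 j l)
  have e2 : lapl (mol 1 K (ffs V P i)) = fun y =>
      ∑ j, ∑ l, mol 1 K (dder (ee l) (dder (ee l) (dder (ee j) fun y => V i y * V j y))) y -
      ∑ j, ∑ k, mol 1 K (dder (ee i) (dder (ee j) (dder (ee k) fun y => V j y * V k y))) y := by
    rw [lapl_mol hK hf]
    funext y
    rw [funext (h.lapl_ff i), mol_sub hK (ContDiff.sum fun j _ => ContDiff.sum fun l _ => d1 j l).continuous
      (ContDiff.sum fun j _ => ContDiff.sum fun l _ => d2 j l).continuous,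
      mol_sum _ hK fun j => (ContDiff.sum fun l _ => d1 j l).continuous,
      mol_sum _ hK fun j => (ContDiff.sum fun l _ => d2 j l).continuous]
    congr 1 <;> refine Finset.sum_congr rfl fun j _ => ?_
    · rw [mol_sum _ hK fun l => (d1 j l).continuous]
    · rw [mol_sum _ hK fun l => (d2 j l).continuous]
  have e3 : σ * mol σ ζ (lapl (mol 1 K (ffs V P i))) x =
      ∑ j, ∑ l, σ * mol σ ζ (mol 1 K (dder (ee l) (dder (ee l) (dder (ee j) fun y => V i y * V j y)))) x -
      ∑ j, ∑ k, σ * mol σ ζ (mol 1 K (dder (ee i) (dder (ee j) (dder (ee k) fun y => V j y * V k y)))) x := by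
    rw [e2, mol_sub hk.bz (ContDiff.sum fun j _ => ContDiff.sum fun l _ => m1 j l).continuous
      (ContDiff.sum fun j _ => ContDiff.sum fun l _ => m2 j l).continuous,
      mol_sum _ hk.bz fun j => (ContDiff.sum fun l _ => m1 j l).continuous,
      mol_sum _ hk.bz fun j => (ContDiff.sum fun l _ => m2 j l).continuous, mul_sub,
      Finset.mul_sum, Finset.mul_sum]
    congr 1 <;> refine Finset.sum_congr rfl fun j _ => ?_
    · rw [mol_sum _ hk.bz fun l => (m1 j l).continuous, Finset.mul_sum]
    · rw [mol_sum _ hk.bz fun l => (m2 j l).continuous, Finset.mul_sum]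
  have key : ∀ a b i j k, ENNReal.ofReal
      |σ * mol σ ζ (mol 1 K (dder (ee i) (dder (ee j) (dder (ee k) fun y => V a y * V b y)))) x| ≤ _ :=
    fun a b i j k => mol_third_le hK hk.bz (hs a b) hc hτ hσ.1 hK1 hK2 hz1 hz2 hG
      (ofReal_mul_le_spd V a b) i j k x
  rw [e3]
  refine (ofReal_abs_sub_le _ _).trans ?_
  refine (add_le_add ((ofReal_abs_sum_le _ _).trans (Finset.sum_le_sum fun j _ =>
    (ofReal_abs_sum_le _ _).trans (Finset.sum_le_sum fun l _ => key i j l l j)))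
    ((ofReal_abs_sum_le _ _).trans (Finset.sum_le_sum fun j _ =>
    (ofReal_abs_sum_le _ _).trans (Finset.sum_le_sum fun k _ => key j k i j k)))).trans (le_of_eq ?_)
  rw [ENNReal.ofReal_mul (by norm_num : (0 : ℝ) ≤ 18)]
  simp only [Finset.sum_const, Finset.card_univ, Fintype.card_fin, nsmul_eq_mul]
  rw [show ENNReal.ofReal 18 = 18 by simp]
  push_cast
  ring

end

/-! ### Structure of solutions on the unit time interval -/

section

lemma pk_bounds : ∃ C, 0 < C ∧ ∀ τ ∈ Ioc (0 : ℝ) (1 / 8), ∀ z,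
    (∀ a, |dder (ee a) (PK τ) z| ≤ C * (√τ)⁻¹ * gmaj τ z) ∧
    ∀ a b, |dder (ee b) (dder (ee a) (PK τ)) z| ≤ C * (√τ)⁻¹ * (√τ)⁻¹ * gmaj τ z := by
  obtain ⟨C, hC, h⟩ := cut_gam_bounds chi_bump
  obtain ⟨B, hB, hb⟩ := bdd_on_ball (V := ℝ) tht_smooth.continuous 1
  have hc : ∀ τ, ContDiff ℝ ∞ fun z => chi z * gam τ z := fun τ =>
    chi_bump.smooth.mul (gam_smooth_slice τ)
  have e : ∀ τ a, dder (ee a) (PK τ) = fun z => tht τ * dder (ee a) (fun z => chi z * gam τ z) z :=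
    fun τ a => dder_const_mul _ _ (hc τ)
  refine ⟨(B + 1) * C, by positivity, fun τ hτ z => ?_⟩
  have hs : 0 < √τ := Real.sqrt_pos.2 hτ.1
  obtain ⟨-, h1, h2⟩ := h τ hτ.1 (hτ.2.trans (by norm_num)) z
  have ht : |tht τ| ≤ B + 1 := by
    have := hb τ (by rw [Real.norm_eq_abs, abs_of_pos hτ.1]; linarith [hτ.2])
    rw [Real.norm_eq_abs] at this; linarith
  refine ⟨fun a => ?_, fun a b => ?_⟩
  · rw [e, abs_mul]
    refine (mul_le_mul ht (h1 a) (abs_nonneg _) (by positivity)).trans (le_of_eq (by ring))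
  · rw [e, dder_const_mul _ _ (dder_smooth _ (hc τ)), abs_mul]
    refine (mul_le_mul ht (h2 a b) (abs_nonneg _) (by positivity)).trans (le_of_eq ?_)
    have : τ⁻¹ = (√τ)⁻¹ * (√τ)⁻¹ := by rw [← mul_inv, Real.mul_self_sqrt hτ.1.le]
    rw [this]; ring

lemma one_le_gmaj {z : E3} (hz : ‖z‖ ≤ 1) : 1 ≤ rexp (1 / 8) * gmaj 1 z := by
  unfold gmaj
  simp only [Real.sqrt_one, inv_one, one_pow, one_mul, mul_one]
  rw [← Real.exp_add]
  refine Real.one_le_exp ?_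
  nlinarith [norm_nonneg z]

lemma Flat.gmaj_bound {K : ℝ → E3 → ℝ} (h : Flat K) :
    ∃ C, 0 < C ∧ ∀ τ ∈ Ioc (0 : ℝ) (1 / 8), ∀ z, |K τ z| ≤ C * gmaj 1 z := by
  obtain ⟨C, hC, hb⟩ := h.bound
  refine ⟨C * rexp (1 / 8), by positivity, fun τ hτ z => ?_⟩
  rcases le_or_gt ‖z‖ 1 with hz | hz
  · refine (hb τ hτ.1 (hτ.2.trans (by norm_num)) z).trans ?_
    rw [mul_assoc]
    exact le_mul_of_one_le_right hC.le (one_le_gmaj hz)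
  · rw [(h.bump τ).supp z hz, abs_zero]
    have := gmaj_pos (τ := 1) one_pos z
    positivity

lemma kap_bounds : ∃ C, 0 < C ∧ ∀ τ ∈ Ioc (0 : ℝ) (1 / 8), ∀ z, |kap τ z| ≤ C * gmaj 1 z ∧
    (∀ a, |dder (ee a) (kap τ) z| ≤ C * gmaj 1 z) ∧
    ∀ a b, |dder (ee b) (dder (ee a) (kap τ)) z| ≤ C * gmaj 1 z := by
  obtain ⟨C0, h0, b0⟩ := kap_flat.gmaj_bound
  choose C1 h1 b1 using fun a => (kap_flat.dder a).gmaj_bound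
  choose C2 h2 b2 using fun a b => ((kap_flat.dder a).dder b).gmaj_bound
  have hs1 : ∀ a, C1 a ≤ ∑ a, C1 a := fun a =>
    Finset.single_le_sum (fun a _ => (h1 a).le) (Finset.mem_univ a)
  have hs2 : ∀ a b, C2 a b ≤ ∑ a, ∑ b, C2 a b := fun a b =>
    (Finset.single_le_sum (fun b _ => (h2 a b).le) (Finset.mem_univ b)).trans
    (Finset.single_le_sum (f := fun a => ∑ b, C2 a b)
      (fun a _ => Finset.sum_nonneg fun b _ => (h2 a b).le) (Finset.mem_univ a))
  have n1 : 0 ≤ ∑ a, C1 a := Finset.sum_nonneg fun a _ => (h1 a).le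
  have n2 : 0 ≤ ∑ a, ∑ b, C2 a b := Finset.sum_nonneg fun a _ => Finset.sum_nonneg fun b _ => (h2 a b).le
  refine ⟨C0 + ∑ a, C1 a + ∑ a, ∑ b, C2 a b, by positivity, fun τ hτ z => ?_⟩
  have hg := (gmaj_pos (τ := 1) one_pos z).le
  refine ⟨(b0 τ hτ z).trans (mul_le_mul_of_nonneg_right (by linarith) hg), fun a =>
    (b1 a τ hτ z).trans (mul_le_mul_of_nonneg_right (by linarith [hs1 a]) hg), fun a b =>
    (b2 a b τ hτ z).trans (mul_le_mul_of_nonneg_right (by linarith [hs2 a b]) hg)⟩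

lemma Bump.gmaj_bound {k : E3 → ℝ} (h : Bump k 1) : ∃ C, 0 < C ∧ ∀ z, |k z| ≤ C * gmaj 1 z := by
  obtain ⟨C, hC, hb⟩ := h.bound
  refine ⟨C * rexp (1 / 8), by positivity, fun z => ?_⟩
  rcases le_or_gt ‖z‖ 1 with hz | hz
  · refine (hb z).trans ?_
    rw [mul_assoc]
    exact le_mul_of_one_le_right hC.le (one_le_gmaj hz)
  · rw [h.supp z hz, abs_zero]
    have := gmaj_pos (τ := 1) one_pos z
    positivity

/-- The velocity at a fixed time. -/
def slv (U : Fin 3 → ℝ × E3 → ℝ) (t : ℝ) : Fin 3 → E3 → ℝ := fun k => sl (U k) t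

/-- Solutions on the unit time interval with weak `L³` norm at most `A`. -/
structure NS (U : Fin 3 → ℝ × E3 → ℝ) (p : ℝ × E3 → ℝ) (A : ℝ) : Prop where
  sU : ∀ i, ContDiff ℝ ∞ (U i)
  sp : ContDiff ℝ ∞ p
  hA : 1 ≤ A
  eq : ∀ i, ∀ t ∈ Icc (0 : ℝ) 1, ∀ x,
    dt (U i) (t, x) = lapl (sl (U i) t) x - ffs (slv U t) (sl p t) i x
  div : ∀ t ∈ Icc (0 : ℝ) 1, ∀ x, ∑ i, dx i (U i) (t, x) = 0
  wk : ∀ t ∈ Icc (0 : ℝ) 1, Wk (spd (slv U t)) A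

/-- The divergence of the tensor product, in space-time. -/
def DD (U : Fin 3 → ℝ × E3 → ℝ) (i : Fin 3) (q : ℝ × E3) : ℝ := ∑ j, dx j (fun q => U i q * U j q) q

/-- The nonlinearity, in space-time. -/
def FF (U : Fin 3 → ℝ × E3 → ℝ) (p : ℝ × E3 → ℝ) (i : Fin 3) (q : ℝ × E3) : ℝ := DD U i q + dx i p q

/-- Remove the average at unit scale. -/
def osc (φ : E3 → ℝ) (f : ℝ × E3 → ℝ) (q : ℝ × E3) : ℝ := f q - jm φ f q

variable {U : Fin 3 → ℝ × E3 → ℝ} {p : ℝ × E3 → ℝ} {A : ℝ} {ζ φ : E3 → ℝ}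

lemma DD_smooth (h : ∀ i, ContDiff ℝ ∞ (U i)) (i : Fin 3) : ContDiff ℝ ∞ (DD U i) :=
  ContDiff.sum fun j _ => dx_smooth ((h i).mul (h j)) j

lemma NS.FF_smooth (h : NS U p A) (i : Fin 3) : ContDiff ℝ ∞ (FF U p i) :=
  (DD_smooth h.sU i).add (dx_smooth h.sp i)

lemma sl_DD (h : ∀ i, ContDiff ℝ ∞ (U i)) (i : Fin 3) (t : ℝ) : sl (DD U i) t = dvt (slv U t) i := by
  funext x
  unfold DD dvt
  refine Finset.sum_congr rfl fun j _ => ?_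
  exact congrFun (sl_dx ((h i).mul (h j)) j t) x

lemma NS.sl_FF (h : NS U p A) (i : Fin 3) (t : ℝ) : sl (FF U p i) t = ffs (slv U t) (sl p t) i := by
  funext x
  exact congrArg₂ (· + ·) (congrFun (sl_DD h.sU i t) x) (congrFun (sl_dx h.sp i t) x)

lemma osc_smooth (hk : KPair ζ φ) {f : ℝ × E3 → ℝ} (hf : ContDiff ℝ ∞ f) : ContDiff ℝ ∞ (osc φ f) :=
  hf.sub (jm_smooth hk.bp hf)

lemma dder_osc (hk : KPair ζ φ) {f : ℝ × E3 → ℝ} (hf : ContDiff ℝ ∞ f) (v : ℝ × E3) :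
    dder v (osc φ f) = osc φ (dder v f) := by
  unfold osc
  rw [dder_sub _ hf (jm_smooth hk.bp hf), dder_jm hk.bp hf]

lemma sl_osc (f : ℝ × E3 → ℝ) (t : ℝ) :
    sl (osc φ f) t = fun y => sl f t y - mol 1 φ (sl f t) y := rfl

lemma osc_eq (hk : KPair ζ φ) {u F : ℝ × E3 → ℝ} (hu : ContDiff ℝ ∞ u) (hF : ContDiff ℝ ∞ F) {t : ℝ}
    (h : ∀ x, dt u (t, x) = lapl (sl u t) x - F (t, x)) (x : E3) :
    dt (osc φ u) (t, x) = lapl (sl (osc φ u) t) x - osc φ F (t, x) := by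
  have e : sl (dt u) t = fun y => lapl (sl u t) y - sl F t y := funext h
  have h1 : dt (osc φ u) (t, x) = sl (dt u) t x - mol 1 φ (sl (dt u) t) x := by
    unfold dt; rw [dder_osc hk hu]; rfl
  have hs := sl_smooth hu t
  have h2 : lapl (sl (osc φ u) t) x = lapl (sl u t) x - mol 1 φ (lapl (sl u t)) x := by
    rw [sl_osc, ← lapl_mol hk.bp hs]
    unfold lapl
    rw [← Finset.sum_sub_distrib]
    refine Finset.sum_congr rfl fun i _ => ?_
    change dder (ee i) (dder (ee i) _) x = dder (ee i) (dder (ee i) _) x - dder (ee i) (dder (ee i) _) x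
    have hm := mol_smooth 1 hk.bp hs
    rw [dder_sub _ hs hm, dder_sub _ (dder_smooth _ hs) (dder_smooth _ hm)]
  rw [h1, h2, e, mol_sub hk.bp (lapl_smooth hs).continuous (sl_smooth hF t).continuous]
  change _ = _ - (sl F t x - mol 1 φ (sl F t) x)
  ring

lemma NS.slice (h : NS U p A) {t : ℝ} (ht : t ∈ Ioo (0 : ℝ) 1) : Slice (slv U t) (sl p t) := by
  have ht' : t ∈ Icc (0 : ℝ) 1 := Ioo_subset_Icc_self ht
  have hs : ∀ i, ContDiff ℝ ∞ (slv U t i) := fun i => sl_smooth (h.sU i) t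
  have hs' : ∀ i, ContDiff ℝ ∞ (sl (U i) t) := hs
  refine ⟨hs, sl_smooth h.sp t, fun x => ?_⟩
  have h1 : ∑ i, dx i (dt (U i)) (t, x) = 0 := by
    have e : ∑ i, dx i (dt (U i)) (t, x) = dt (fun q => ∑ i, dx i (U i) q) (t, x) := by
      unfold dt dx
      rw [dder_sum _ _ fun i => dder_smooth _ (h.sU i)]
      exact Finset.sum_congr rfl fun i _ => by rw [dder_comm _ _ (h.sU i)]
    have hd := hasDerivAt_time (f := fun q => ∑ i, dx i (U i) q)
      (ContDiff.sum fun i _ => dx_smooth (h.sU i) i) t x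
    rw [e]
    refine hd.unique ((hasDerivAt_const t (0 : ℝ)).congr_of_eventuallyEq ?_)
    filter_upwards [Ioo_mem_nhds ht.1 ht.2] with s hs
    exact h.div s (Ioo_subset_Icc_self hs) x
  have hf : ∀ i, ContDiff ℝ ∞ (ffs (slv U t) (sl p t) i) := fun i => by
    rw [← h.sl_FF]; exact sl_smooth (h.FF_smooth i) t
  have h2 : ∀ i, dx i (dt (U i)) (t, x) =
      lapl (dder (ee i) (sl (U i) t)) x - dder (ee i) (ffs (slv U t) (sl p t) i) x := fun i => by
    have e : sl (dt (U i)) t = fun y => lapl (sl (U i) t) y - ffs (slv U t) (sl p t) i y :=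
      funext (h.eq i t ht')
    have := congrFun (sl_dx (dt_smooth (h.sU i)) i t) x
    rw [e, dder_sub _ (lapl_smooth (hs' i)) (hf i), ← lapl_dder (hs' i)] at this
    exact this
  have h3 : ∑ i, lapl (dder (ee i) (sl (U i) t)) x = 0 := by
    have e : (fun y => ∑ i, dder (ee i) (sl (U i) t) y) = fun _ => (0 : ℝ) := by
      funext y
      rw [← h.div t ht' y]
      exact Finset.sum_congr rfl fun i _ => (congrFun (sl_dx (h.sU i) i t) y).symm
    have e2 : lapl (fun y => ∑ i, dder (ee i) (sl (U i) t) y) x = ∑ i, lapl (dder (ee i) (sl (U i) t)) x := by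
      unfold lapl
      rw [Finset.sum_comm]
      refine Finset.sum_congr rfl fun j _ => ?_
      change dder (ee j) (dder (ee j) _) x = ∑ i, dder (ee j) (dder (ee j) _) x
      rw [dder_sum _ _ fun i => dder_smooth _ (hs' i),
        dder_sum _ _ fun i => dder_smooth _ (dder_smooth _ (hs' i))]
    rw [← e2, e]
    unfold lapl
    refine Finset.sum_eq_zero fun i _ => ?_
    have : pd (fun _ : E3 => (0 : ℝ)) i = fun _ => 0 := funext fun y => dder_zero _ y
    change pd (pd (fun _ : E3 => (0 : ℝ)) i) i x = 0
    rw [this]; exact dder_zero _ x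
  have h4 : ∑ i, dder (ee i) (ffs (slv U t) (sl p t) i) x = 0 := by
    have := h1
    rw [Finset.sum_congr rfl fun i _ => h2 i, Finset.sum_sub_distrib, h3] at this
    linarith
  have h5 : ∀ i, dder (ee i) (ffs (slv U t) (sl p t) i) x =
      ∑ j, dder (ee i) (dder (ee j) fun y => slv U t i y * slv U t j y) x +
      dder (ee i) (dder (ee i) (sl p t)) x := fun i => by
    have e : ffs (slv U t) (sl p t) i = fun y => dvt (slv U t) i y + dder (ee i) (sl p t) y := rfl
    rw [e, dder_add _ (dvt_smooth hs i) (dder_smooth _ (sl_smooth h.sp t))]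
    have e2 : dvt (slv U t) i =
      fun y => ∑ j, dder (ee j) (fun y => slv U t i y * slv U t j y) y := rfl
    rw [e2, dder_sum _ _ fun j => dder_smooth _ ((hs i).mul (hs j))]
  rw [Finset.sum_congr rfl fun i _ => h5 i, Finset.sum_add_distrib] at h4
  have h6 : lapl (sl p t) x = ∑ i, dder (ee i) (dder (ee i) (sl p t)) x := rfl
  rw [h6]; linarith

lemma NS.osc_eq (h : NS U p A) (hk : KPair ζ φ) (i : Fin 3) : ∀ t ∈ Icc (0 : ℝ) 1, ∀ x,
    dt (osc φ (U i)) (t, x) = lapl (sl (osc φ (U i)) t) x - osc φ (FF U p i) (t, x) :=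
  fun t ht x => _root_.osc_eq hk (h.sU i) (h.FF_smooth i)
    (fun y => by rw [h.eq i t ht y, ← h.sl_FF]; rfl) x

end

/-! ### The decomposition of the velocity -/

section

variable {U : Fin 3 → ℝ × E3 → ℝ} {p : ℝ × E3 → ℝ} {A : ℝ} {ζ φ : E3 → ℝ}

lemma gmaj_joint_meas : Measurable fun q : ℝ × E3 => gmaj q.1 q.2 := by
  unfold gmaj; fun_prop

lemma TT_joint_meas {g : ℝ × E3 → ℝ≥0∞} (hg : Measurable g) :
    Measurable fun q : (ℝ × ℝ) × (ℝ × E3) => TT q.1.1 q.1.2 (fun y => g (q.2.1, y)) q.2.2 := by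
  have e : (fun q : (ℝ × ℝ) × (ℝ × E3) => TT q.1.1 q.1.2 (fun y => g (q.2.1, y)) q.2.2) =
      fun q => ∫⁻ y in closedBall (0 : E3) 1, ∫⁻ z, ENNReal.ofReal (gmaj q.1.1 z) *
        g (q.2.1, q.2.2 - (q.1.2 • y + z)) := by
    funext q
    exact TT_eq _ _ (g := fun y => g (q.2.1, y)) (by fun_prop) _
  rw [e]
  refine Measurable.lintegral_prod_right' (f := fun w : ((ℝ × ℝ) × (ℝ × E3)) × E3 =>
    ∫⁻ z, ENNReal.ofReal (gmaj w.1.1.1 z) * g (w.1.2.1, w.1.2.2 - (w.1.1.2 • w.2 + z))) ?_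
  refine Measurable.lintegral_prod_right' (f := fun w : (((ℝ × ℝ) × (ℝ × E3)) × E3) × E3 =>
    ENNReal.ofReal (gmaj w.1.1.1.1 w.2) * g (w.1.1.2.1, w.1.1.2.2 - (w.1.1.1.2 • w.1.2 + w.2))) ?_
  have h1 : Measurable fun w : (((ℝ × ℝ) × (ℝ × E3)) × E3) × E3 => gmaj w.1.1.1.1 w.2 :=
    gmaj_joint_meas.comp (f := fun w : (((ℝ × ℝ) × (ℝ × E3)) × E3) × E3 => (w.1.1.1.1, w.2))
      (by fun_prop)
  exact h1.ennreal_ofReal.mul (hg.comp (by fun_prop))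

/-- The speed at a given time, as an extended nonnegative real. -/
def GG (U : Fin 3 → ℝ × E3 → ℝ) (t : ℝ) (y : E3) : ℝ≥0∞ := ENNReal.ofReal (spd (slv U t) y)

/-- The part of the velocity produced by the nonlinearity. -/
def ww (φ : E3 → ℝ) (U : Fin 3 → ℝ × E3 → ℝ) (i : Fin 3) (q : ℝ × E3) : ℝ :=
  osc φ (U i) q + cv kap (osc φ (U i)) q

/-- The slowly varying part of the velocity. -/
def ll (φ : E3 → ℝ) (U : Fin 3 → ℝ × E3 → ℝ) (i : Fin 3) (q : ℝ × E3) : ℝ :=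
  jm φ (U i) q - cv kap (osc φ (U i)) q

/-- The slowly varying part of the nonlinearity. -/
def ll2 (φ : E3 → ℝ) (U : Fin 3 → ℝ × E3 → ℝ) (p : ℝ × E3 → ℝ) (i : Fin 3) (q : ℝ × E3) : ℝ :=
  jm φ (DD U i) q - cv kap (osc φ (FF U p i)) q

/-- Majorant of `ww`. -/
def WM (U : Fin 3 → ℝ × E3 → ℝ) (t : ℝ) (x : E3) : ℝ≥0∞ :=
  ∫⁻ τ in Ioc (0 : ℝ) (1 / 8), ∫⁻ σ in Ioc (0 : ℝ) 1,
    ENNReal.ofReal ((√τ)⁻¹ * (max (√τ) σ)⁻¹) * TT τ σ (fun y => GG U (t - τ) y ^ 2) x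

/-- Majorant of `ll2`. -/
def EM (U : Fin 3 → ℝ × E3 → ℝ) (t : ℝ) (x : E3) : ℝ≥0∞ :=
  TT 1 0 (fun y => GG U t y ^ 2) x + ∫⁻ τ in Ioc (0 : ℝ) (1 / 8), ∫⁻ σ in Ioc (0 : ℝ) 1,
    TT 1 σ (fun y => GG U (t - τ) y ^ 2) x

/-- Majorant of `ll`. -/
def LM (U : Fin 3 → ℝ × E3 → ℝ) (t : ℝ) (x : E3) : ℝ≥0∞ :=
  TT 1 0 (GG U t) x + ∫⁻ τ in Ioc (0 : ℝ) (1 / 8),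
    (TT 1 0 (GG U (t - τ)) x + TT 1 1 (GG U (t - τ)) x)

lemma ww_add_ll (i : Fin 3) (q : ℝ × E3) : ww φ U i q + ll φ U i q = U i q := by
  unfold ww ll osc; ring

lemma ww_smooth (hk : KPair ζ φ) (h : ∀ i, ContDiff ℝ ∞ (U i)) (i : Fin 3) : ContDiff ℝ ∞ (ww φ U i) :=
  (osc_smooth hk (h i)).add (cv_smooth kap_flat (osc_smooth hk (h i)))

lemma ll_smooth (hk : KPair ζ φ) (h : ∀ i, ContDiff ℝ ∞ (U i)) (i : Fin 3) : ContDiff ℝ ∞ (ll φ U i) :=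
  (jm_smooth hk.bp (h i)).sub (cv_smooth kap_flat (osc_smooth hk (h i)))

lemma ll2_smooth (hk : KPair ζ φ) (h : NS U p A) (i : Fin 3) : ContDiff ℝ ∞ (ll2 φ U p i) :=
  (jm_smooth hk.bp (DD_smooth h.sU i)).sub (cv_smooth kap_flat (osc_smooth hk (h.FF_smooth i)))

lemma GG_meas (h : ∀ i, ContDiff ℝ ∞ (U i)) : Measurable fun q : ℝ × E3 => GG U q.1 q.2 := by
  have := fun i => (h i).continuous
  have e : (fun q : ℝ × E3 => GG U q.1 q.2) = fun q => ENNReal.ofReal √(∑ i, U i q ^ 2) := rfl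
  rw [e]
  fun_prop

lemma GG_meas' (h : ∀ i, ContDiff ℝ ∞ (U i)) (t : ℝ) : Measurable (GG U t) :=
  (spd_cont fun i => sl_smooth (h i) t).measurable.ennreal_ofReal

lemma abs_le_GG (i : Fin 3) (t : ℝ) (y : E3) : ENNReal.ofReal |sl (U i) t y| ≤ GG U t y :=
  ENNReal.ofReal_le_ofReal (abs_le_spd (slv U t) i y)

/-- The structural constants attached to the kernels. -/
structure KC (ζ φ : E3 → ℝ) (C : ℝ) : Prop where
  pair : KPair ζ φ
  pos : 1 ≤ C
  z0 : ∀ z, |ζ z| ≤ C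
  z1 : ∀ a z, |dder (ee a) ζ z| ≤ C
  z2 : ∀ a b z, |dder (ee b) (dder (ee a) ζ) z| ≤ C
  f0 : ∀ z, |φ z| ≤ C
  f1 : ∀ a z, |dder (ee a) φ z| ≤ C
  g0 : ∀ z, |φ z| ≤ C * gmaj 1 z
  g1 : ∀ a z, |dder (ee a) φ z| ≤ C * gmaj 1 z
  k0 : ∀ τ ∈ Ioc (0 : ℝ) (1 / 8), ∀ z, |kap τ z| ≤ C * gmaj 1 z
  k1 : ∀ τ ∈ Ioc (0 : ℝ) (1 / 8), ∀ a z, |dder (ee a) (kap τ) z| ≤ C * gmaj 1 z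
  k2 : ∀ τ ∈ Ioc (0 : ℝ) (1 / 8), ∀ a b z, |dder (ee b) (dder (ee a) (kap τ)) z| ≤ C * gmaj 1 z
  p1 : ∀ τ ∈ Ioc (0 : ℝ) (1 / 8), ∀ a z, |dder (ee a) (PK τ) z| ≤ C * (√τ)⁻¹ * gmaj τ z
  p2 : ∀ τ ∈ Ioc (0 : ℝ) (1 / 8), ∀ a b z,
    |dder (ee b) (dder (ee a) (PK τ)) z| ≤ C * (√τ)⁻¹ * (√τ)⁻¹ * gmaj τ z
  vol : (volume (closedBall (0 : E3) 1)).toReal⁻¹ ≤ C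

lemma exists_KC : ∃ ζ φ C, KC ζ φ C := by
  obtain ⟨ζ, φ, hk⟩ := exists_kpair
  obtain ⟨c1, p1, b1⟩ := hk.bz.bound
  choose c2 p2 b2 using fun a => (hk.bz.dder (ee a)).bound
  choose c3 p3 b3 using fun a b => ((hk.bz.dder (ee a)).dder (ee b)).bound
  obtain ⟨c4, p4, b4⟩ := hk.bp.bound
  choose c5 p5 b5 using fun a => (hk.bp.dder (ee a)).bound
  obtain ⟨c6, p6, b6⟩ := hk.bp.gmaj_bound
  choose c7 p7 b7 using fun a => (hk.bp.dder (ee a)).gmaj_bound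
  obtain ⟨c8, p8, b8⟩ := kap_bounds
  obtain ⟨c9, p9, b9⟩ := pk_bounds
  have hs : ∀ f : Fin 3 → ℝ, (∀ a, 0 < f a) → ∀ a, f a ≤ ∑ a, f a := fun f hf a =>
    Finset.single_le_sum (fun a _ => (hf a).le) (Finset.mem_univ a)
  have hn : ∀ f : Fin 3 → ℝ, (∀ a, 0 < f a) → 0 < ∑ a, f a := fun f hf =>
    Finset.sum_pos (fun a _ => hf a) Finset.univ_nonempty
  have h2 := hn c2 p2
  have h3 := hn _ fun a => hn (c3 a) (p3 a)
  have h5 := hn c5 p5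
  have h7 := hn c7 p7
  set v := (volume (closedBall (0 : E3) 1)).toReal⁻¹
  have hv : 0 ≤ v := inv_nonneg.2 ENNReal.toReal_nonneg
  set C := 1 + c1 + (∑ a, c2 a) + (∑ a, ∑ b, c3 a b) + c4 + (∑ a, c5 a) + c6 + (∑ a, c7 a) + c8 + c9 + v
    with hC
  have hg : ∀ τ z, 0 < τ → 0 ≤ gmaj τ z := fun τ z h => (gmaj_pos h z).le
  have l2 : ∀ a, c2 a ≤ C := fun a => by linarith [hs c2 p2 a]
  have l3 : ∀ a b, c3 a b ≤ C := fun a b => by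
    linarith [hs (c3 a) (p3 a) b, hs _ (fun a => hn (c3 a) (p3 a)) a]
  have l5 : ∀ a, c5 a ≤ C := fun a => by linarith [hs c5 p5 a]
  have l7 : ∀ a, c7 a ≤ C := fun a => by linarith [hs c7 p7 a]
  refine ⟨ζ, φ, C, hk, by linarith, fun z => (b1 z).trans (by linarith),
    fun a z => (b2 a z).trans (l2 a), fun a b z => (b3 a b z).trans (l3 a b),
    fun z => (b4 z).trans (by linarith), fun a z => (b5 a z).trans (l5 a),
    fun z => (b6 z).trans (mul_le_mul_of_nonneg_right (by linarith) (hg 1 z one_pos)),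
    fun a z => (b7 a z).trans (mul_le_mul_of_nonneg_right (l7 a) (hg 1 z one_pos)),
    fun τ hτ z => (b8 τ hτ z).1.trans (mul_le_mul_of_nonneg_right (by linarith) (hg 1 z one_pos)),
    fun τ hτ a z => ((b8 τ hτ z).2.1 a).trans
      (mul_le_mul_of_nonneg_right (by linarith) (hg 1 z one_pos)),
    fun τ hτ a b z => ((b8 τ hτ z).2.2 a b).trans
      (mul_le_mul_of_nonneg_right (by linarith) (hg 1 z one_pos)),
    fun τ hτ a z => ((b9 τ hτ z).1 a).trans (mul_le_mul_of_nonneg_right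
      (mul_le_mul_of_nonneg_right (by linarith) (by positivity)) (hg τ z hτ.1)),
    fun τ hτ a b z => ((b9 τ hτ z).2 a b).trans (mul_le_mul_of_nonneg_right
      (mul_le_mul_of_nonneg_right (mul_le_mul_of_nonneg_right (by linarith) (by positivity))
        (by positivity)) (hg τ z hτ.1)), by linarith⟩

end

/-! ### Pointwise bounds for the decomposition -/

section

variable {U : Fin 3 → ℝ × E3 → ℝ} {p : ℝ × E3 → ℝ} {A : ℝ} {ζ φ : E3 → ℝ}

variable {C : ℝ}

lemma mol_le_sq {C k : ℝ} {K g : E3 → ℝ} (hC : 1 ≤ C) (hv : (volume (closedBall (0 : E3) 1)).toReal⁻¹ ≤ C)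
    (hK : ∀ z, |K z| ≤ C * gmaj 1 z) {G : E3 → ℝ≥0∞} (hG : Measurable G)
    (hgG : ∀ y, ENNReal.ofReal |g y| ≤ G y) (hk : C ^ 2 ≤ k) (x : E3) :
    ENNReal.ofReal |mol 1 K g x| ≤ ENNReal.ofReal k * TT 1 0 G x := by
  refine (mol_le hK (by linarith) hG hgG x).trans (mul_le_mul' (ENNReal.ofReal_le_ofReal ?_) le_rfl)
  nlinarith

lemma ofReal_abs_cv_le (K : ℝ → E3 → ℝ) (f : ℝ × E3 → ℝ) (t : ℝ) (x : E3) :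
    ENNReal.ofReal |cv K f (t, x)| ≤
      ∫⁻ τ in Ioc (0 : ℝ) (1 / 8), ENNReal.ofReal |mol 1 (K τ) (sl f (t - τ)) x| := by
  have := enorm_integral_le_lintegral_enorm (μ := volume.restrict (Ioc (0 : ℝ) (1 / 8)))
    fun τ => mol 1 (K τ) (sl f (t - τ)) x
  simp only [← ofReal_norm, Real.norm_eq_abs] at this
  exact this

lemma sub_mem_unit {t τ : ℝ} (ht : t ∈ Ioc (1 / 8 : ℝ) 1) (hτ : τ ∈ Ioc (0 : ℝ) (1 / 8)) :
    t - τ ∈ Ioo (0 : ℝ) 1 := ⟨by linarith [ht.1, hτ.2], by linarith [ht.2, hτ.1]⟩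

lemma KC.ww_le (hC : KC ζ φ C) (h : NS U p A) (i : Fin 3) {t : ℝ} (ht : t ∈ Ioc (1 / 8 : ℝ) 1) (x : E3) :
    ENNReal.ofReal |ww φ U i (t, x)| ≤ ENNReal.ofReal (18 * C ^ 2) * WM U t x := by
  have hk := hC.pair
  have hC0 : 0 < C := by linarith [hC.pos]
  refine (duhamel (osc_smooth hk (h.sU i)) (osc_smooth hk (h.FF_smooth i)) (h.osc_eq hk i) ht x).trans ?_
  unfold WM
  rw [← lintegral_const_mul' _ _ ENNReal.ofReal_ne_top]
  refine setLIntegral_mono' measurableSet_Ioc fun τ hτ => ?_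
  rw [sl_osc, h.sl_FF]
  refine ((h.slice (sub_mem_unit ht hτ)).nn_le hk (pk_bump τ) (by positivity) hτ.1 (hC.p1 τ hτ)
    (hC.p2 τ hτ) hC.z1 hC.z2 i x).trans ?_
  rw [← lintegral_const_mul' _ _ ENNReal.ofReal_ne_top]
  refine lintegral_mono fun σ => le_of_eq ?_
  rw [← mul_assoc (ENNReal.ofReal (18 * C ^ 2)), ← ENNReal.ofReal_mul (by positivity)]
  congr 2
  ring

lemma KC.ll2_le (hC : KC ζ φ C) (h : NS U p A) (i : Fin 3) {t : ℝ} (ht : t ∈ Ioc (1 / 8 : ℝ) 1) (x : E3) :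
    ENNReal.ofReal |ll2 φ U p i (t, x)| ≤ ENNReal.ofReal (18 * C ^ 2) * EM U t x := by
  have hk := hC.pair
  have hC0 : 0 < C := by linarith [hC.pos]
  have hG : ∀ s, Measurable fun y => GG U s y ^ 2 := fun s => (GG_meas' h.sU s).pow_const 2
  unfold ll2 EM
  refine (ofReal_abs_sub_le _ _).trans ?_
  rw [mul_add]
  refine add_le_add ?_ ?_
  · have hs : ∀ j, ContDiff ℝ ∞ fun y => slv U t i y * slv U t j y := fun j =>
      (sl_smooth (h.sU i) t).mul (sl_smooth (h.sU j) t)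
    have e : jm φ (DD U i) (t, x) = ∑ j, mol 1 (dder (ee j) φ) (fun y => slv U t i y * slv U t j y) x := by
      change mol 1 φ (sl (DD U i) t) x = _
      rw [sl_DD h.sU]
      change mol 1 φ (fun y => ∑ j, dder (ee j) (fun y => slv U t i y * slv U t j y) y) x = _
      rw [mol_sum _ hk.bp fun j => (dder_smooth _ (hs j)).continuous]
      refine Finset.sum_congr rfl fun j _ => ?_
      rw [mol_dder hk.bp (hs j) one_ne_zero]; simp
    rw [e]
    refine (ofReal_abs_sum_le _ _).trans ((Finset.sum_le_sum fun j _ =>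
      mol_le_sq hC.pos hC.vol (hC.g1 j) (hG t) (ofReal_mul_le_spd (slv U t) i j) le_rfl x).trans ?_)
    rw [Finset.sum_const, Finset.card_univ, Fintype.card_fin, nsmul_eq_mul, ← mul_assoc]
    refine mul_le_mul' ?_ le_rfl
    rw [show ((3 : ℕ) : ℝ≥0∞) = ENNReal.ofReal 3 by simp, ← ENNReal.ofReal_mul (by norm_num)]
    exact ENNReal.ofReal_le_ofReal (by nlinarith)
  · refine (ofReal_abs_cv_le _ _ _ _).trans ?_
    rw [← lintegral_const_mul' _ _ ENNReal.ofReal_ne_top]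
    refine setLIntegral_mono' measurableSet_Ioc fun τ hτ => ?_
    rw [sl_osc, h.sl_FF]
    refine ((h.slice (sub_mem_unit ht hτ)).nn_le hk (kap_flat.bump τ) hC0.le one_pos (hC.k1 τ hτ)
      (fun a b z => by simpa using hC.k2 τ hτ a b z) hC.z1 hC.z2 i x).trans ?_
    rw [← lintegral_const_mul' _ _ ENNReal.ofReal_ne_top]
    refine setLIntegral_mono' measurableSet_Ioc fun σ hσ => le_of_eq ?_
    rw [Real.sqrt_one, max_eq_left hσ.2, inv_one, mul_one, sq C]
    rfl

lemma KC.cv_osc_le (hC : KC ζ φ C) (h : NS U p A) (i : Fin 3) {L : ℝ → E3 → ℝ} (hL : Flat L)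
    (hb : ∀ τ ∈ Ioc (0 : ℝ) (1 / 8), ∀ z, |L τ z| ≤ C * gmaj 1 z) (t : ℝ) (x : E3) :
    ENNReal.ofReal |cv L (osc φ (U i)) (t, x)| ≤ ENNReal.ofReal (C ^ 2) *
      ∫⁻ τ in Ioc (0 : ℝ) (1 / 8), (TT 1 0 (GG U (t - τ)) x + TT 1 1 (GG U (t - τ)) x) := by
  have hk := hC.pair
  refine (ofReal_abs_cv_le _ _ _ _).trans ?_
  rw [← lintegral_const_mul' _ _ ENNReal.ofReal_ne_top]
  refine setLIntegral_mono' measurableSet_Ioc fun τ hτ => ?_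
  have hs := sl_smooth (h.sU i) (t - τ)
  rw [sl_osc, mol_sub (hL.bump τ) hs.continuous (mol_smooth _ hk.bp hs).continuous,
    mol_comm (hL.bump τ) hk.bp hs.continuous, mul_add]
  refine (ofReal_abs_sub_le _ _).trans (add_le_add ?_ ?_)
  · exact mol_le_sq hC.pos hC.vol (hb τ hτ) (GG_meas' h.sU _) (abs_le_GG i _) le_rfl x
  · rw [sq]
    exact mol_mol_le hk.bp hC.f0 (hb τ hτ) (by linarith [hC.pos]) (GG_meas' h.sU _) (abs_le_GG i _) x

lemma KC.ll_le (hC : KC ζ φ C) (h : NS U p A) (i : Fin 3) (t : ℝ) (x : E3) :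
    ENNReal.ofReal |ll φ U i (t, x)| ≤ ENNReal.ofReal (C ^ 2) * LM U t x := by
  unfold ll LM
  rw [mul_add]
  exact (ofReal_abs_sub_le _ _).trans (add_le_add
    (mol_le_sq hC.pos hC.vol hC.g0 (GG_meas' h.sU t) (abs_le_GG i t) le_rfl x)
    (hC.cv_osc_le h i kap_flat hC.k0 t x))

lemma KC.dx_ll_le (hC : KC ζ φ C) (h : NS U p A) (i j : Fin 3) (t : ℝ) (x : E3) :
    ENNReal.ofReal |dx j (ll φ U i) (t, x)| ≤ ENNReal.ofReal (C ^ 2) * LM U t x := by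
  have hk := hC.pair
  have ho := osc_smooth hk (h.sU i)
  have e : dx j (ll φ U i) = fun q => jm (dder (ee j) φ) (U i) q -
      cv (fun τ => dder (ee j) (kap τ)) (osc φ (U i)) q := by
    unfold ll
    rw [← jm_dx hk.bp (h.sU i), ← cv_dx kap_flat ho]
    unfold dx
    rw [dder_sub _ (jm_smooth hk.bp (h.sU i)) (cv_smooth kap_flat ho), dder_jm hk.bp (h.sU i),
      dder_cv kap_flat ho]
  rw [e]
  unfold LM
  rw [mul_add]
  exact (ofReal_abs_sub_le _ _).trans (add_le_add
    (mol_le_sq hC.pos hC.vol (hC.g1 j) (GG_meas' h.sU t) (abs_le_GG i t) le_rfl x)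
    (hC.cv_osc_le h i (kap_flat.dder j) (fun τ hτ => hC.k1 τ hτ j) t x))

end

/-! ### Integral bounds for the majorants -/

section

variable {U : Fin 3 → ℝ × E3 → ℝ} {p : ℝ × E3 → ℝ} {A : ℝ} {ζ φ : E3 → ℝ}

lemma ennreal_add_sq_le (a b : ℝ≥0∞) : (a + b) ^ 2 ≤ 2 * (a ^ 2 + b ^ 2) := by
  have := ENNReal.rpow_add_le_mul_rpow_add_rpow a b (p := 2) (by norm_num)
  norm_num at this
  exact_mod_cast this

lemma ennreal_add_four_le (a b : ℝ≥0∞) : (a + b) ^ 4 ≤ 8 * (a ^ 4 + b ^ 4) := by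
  have := ENNReal.rpow_add_le_mul_rpow_add_rpow a b (p := 4) (by norm_num)
  norm_num at this
  exact_mod_cast this

lemma lintegral_rpow {s c : ℝ} (hs : -1 < s) (hc : 0 ≤ c) :
    ∫⁻ x in Ioc (0 : ℝ) c, ENNReal.ofReal (x ^ s) = ENNReal.ofReal (c ^ (s + 1) / (s + 1)) := by
  rw [← ofReal_integral_eq_lintegral_ofReal
    ((intervalIntegrable_iff_integrableOn_Ioc_of_le hc).1 (intervalIntegral.intervalIntegrable_rpow' hs)),
    ← intervalIntegral.integral_of_le hc, integral_rpow (Or.inl hs),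
    Real.zero_rpow (by linarith), sub_zero]
  filter_upwards [self_mem_ae_restrict measurableSet_Ioc] with x hx
  exact Real.rpow_nonneg hx.1.le _

lemma NS.TT_sq (h : NS U p A) {τ : ℝ} (σ : ℝ) (hτ : 0 < τ) {s : ℝ} (hs : s ∈ Icc (0 : ℝ) 1) :
    ∫⁻ x, TT τ σ (fun y => GG U s y ^ 2) x ^ 2 ≤
      ENNReal.ofReal (160 * MT ^ 2 * A ^ 6 * (max (√τ) σ)⁻¹) :=
  TrOK.l2_scale MT_pos.le (lt_max_of_lt_left (Real.sqrt_pos.2 hτ)) (TT_ok σ hτ) (h.wk s hs) h.hA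

lemma NS.TT_sq_one (h : NS U p A) {σ : ℝ} (hσ : σ ≤ 1) {s : ℝ} (hs : s ∈ Icc (0 : ℝ) 1) :
    ∫⁻ x, TT 1 σ (fun y => GG U s y ^ 2) x ^ 2 ≤ ENNReal.ofReal (160 * MT ^ 2 * A ^ 6) := by
  refine (h.TT_sq σ one_pos hs).trans (le_of_eq ?_)
  rw [Real.sqrt_one, max_eq_left hσ, inv_one, mul_one]

lemma TT_sq_joint_meas (h : ∀ i, ContDiff ℝ ∞ (U i)) (t : ℝ) :
    Measurable fun q : (ℝ × ℝ) × E3 => TT q.1.1 q.1.2 (fun y => GG U (t - q.1.1) y ^ 2) q.2 :=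
  (TT_joint_meas ((GG_meas h).pow_const 2)).comp
    (f := fun q : (ℝ × ℝ) × E3 => (q.1, (t - q.1.1, q.2))) (by fun_prop)

lemma inv_max_le {a b : ℝ} (ha : 0 < a) (hb : 0 < b) :
    (max a b)⁻¹ ≤ a ^ (-(1 / 2) : ℝ) * b ^ (-(1 / 2) : ℝ) := by
  have hm : 0 < max a b := lt_max_of_lt_left ha
  rw [← Real.mul_rpow ha.le hb.le, Real.rpow_neg (by positivity), ← Real.sqrt_eq_rpow]
  refine inv_anti₀ (by positivity) (Real.sqrt_le_iff.2 ⟨hm.le, ?_⟩)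
  rw [sq]
  exact mul_le_mul (le_max_left _ _) (le_max_right _ _) hb.le hm.le

lemma NS.WM_sq (h : NS U p A) {t : ℝ} (ht : t ∈ Ioc (1 / 8 : ℝ) 1) :
    ∫⁻ x, WM U t x ^ 2 ≤ ENNReal.ofReal (160 * 32 ^ 2 * MT ^ 2 * A ^ 6) := by
  set ν := (volume.restrict (Ioc (0 : ℝ) (1 / 8))).prod (volume.restrict (Ioc (0 : ℝ) 1)) with hν
  have hm := TT_sq_joint_meas h.sU t
  set a : ℝ × ℝ → ℝ≥0∞ := fun q => ENNReal.ofReal ((√q.1)⁻¹ * (max (√q.1) q.2)⁻¹) with ha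
  have ham : Measurable a := by fun_prop
  set b : ℝ × ℝ → ℝ≥0∞ := fun q => if 0 < q.1 ∧ 0 < q.2 then
    ENNReal.ofReal (q.1 ^ (-(1 / 8) : ℝ) * q.2 ^ (-(1 / 4) : ℝ)) else 1 with hb
  have hbm : Measurable b := by
    refine Measurable.ite ?_ (by fun_prop) measurable_const
    exact (measurableSet_lt measurable_const measurable_fst).inter
      (measurableSet_lt measurable_const measurable_snd)
  have hae : ∀ᵐ q ∂ν, q ∈ Ioc (0 : ℝ) (1 / 8) ×ˢ Ioc (0 : ℝ) 1 := by
    rw [hν, Measure.prod_restrict]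
    exact self_mem_ae_restrict (measurableSet_Ioc.prod measurableSet_Ioc)
  have e : ∀ x, WM U t x =
      ∫⁻ q, a q * TT q.1 q.2 (fun y => GG U (t - q.1) y ^ 2) x ∂ν := fun x => by
    rw [hν, lintegral_prod]
    · rfl
    · exact (ham.mul (hm.comp (measurable_id.prodMk measurable_const))).aemeasurable
  simp only [e]
  have hrp : ∀ q : ℝ × ℝ, 0 < q.1 → 0 < q.2 →
      (max (√q.1) q.2)⁻¹ ≤ q.1 ^ (-(1 / 4) : ℝ) * q.2 ^ (-(1 / 2) : ℝ) := fun q h1 h2 => by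
    refine (inv_max_le (Real.sqrt_pos.2 h1) h2).trans (le_of_eq ?_)
    rw [Real.sqrt_eq_rpow, ← Real.rpow_mul h1.le]
    norm_num
  refine (lintegral_minkowski ν volume ham (g := fun q x =>
    TT q.1 q.2 (fun y => GG U (t - q.1) y ^ 2) x) hm (K := ENNReal.ofReal (160 * MT ^ 2 * A ^ 6)) b
    ?_ hbm ?_ ?_).trans ?_
  · filter_upwards [hae] with q hq
    refine (h.TT_sq q.2 hq.1.1 (Ioo_subset_Icc_self (sub_mem_unit ht hq.1))).trans ?_
    have hA := h.hA
    rw [ENNReal.ofReal_mul (by positivity)]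
    refine mul_le_mul' le_rfl ?_
    simp only [hb, if_pos (And.intro hq.1.1 hq.2.1)]
    rw [← ENNReal.ofReal_pow (by have := hq.1.1; have := hq.2.1; positivity)]
    refine ENNReal.ofReal_le_ofReal ((hrp q hq.1.1 hq.2.1).trans (le_of_eq ?_))
    rw [mul_pow, ← Real.rpow_natCast, ← Real.rpow_natCast, ← Real.rpow_mul hq.1.1.le,
      ← Real.rpow_mul hq.2.1.le]
    norm_num
  · intro q
    simp only [hb]
    split_ifs with hq
    · have := hq.1; have := hq.2
      exact (ENNReal.ofReal_pos.2 (by positivity)).ne'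
    · exact one_ne_zero
  · intro q
    simp only [hb]
    split_ifs with hq
    · exact ENNReal.ofReal_ne_top
    · exact ENNReal.one_ne_top
  · have hI : ∫⁻ q, a q * b q ∂ν ≤ ENNReal.ofReal 32 := by
      calc ∫⁻ q, a q * b q ∂ν
          ≤ ∫⁻ q, ENNReal.ofReal (q.1 ^ (-(7 / 8) : ℝ)) * ENNReal.ofReal (q.2 ^ (-(3 / 4) : ℝ)) ∂ν := by
            refine lintegral_mono_ae ?_
            filter_upwards [hae] with q hq
            have h1 := hq.1.1
            have h2 := hq.2.1
            simp only [ha, hb, if_pos (And.intro hq.1.1 hq.2.1)]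
            rw [← ENNReal.ofReal_mul (by positivity), ← ENNReal.ofReal_mul (by positivity)]
            refine ENNReal.ofReal_le_ofReal ?_
            calc _ ≤ q.1 ^ (-(1 / 2) : ℝ) * (q.1 ^ (-(1 / 4) : ℝ) * q.2 ^ (-(1 / 2) : ℝ)) *
                  (q.1 ^ (-(1 / 8) : ℝ) * q.2 ^ (-(1 / 4) : ℝ)) := by
                  refine mul_le_mul_of_nonneg_right (mul_le_mul (le_of_eq ?_) (hrp q h1 h2)
                    (by positivity) (by positivity)) (by positivity)
                  rw [Real.sqrt_eq_rpow, ← Real.rpow_neg h1.le]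
              _ = (q.1 ^ (-(1 / 2) : ℝ) * q.1 ^ (-(1 / 4) : ℝ) * q.1 ^ (-(1 / 8) : ℝ)) *
                  (q.2 ^ (-(1 / 2) : ℝ) * q.2 ^ (-(1 / 4) : ℝ)) := by ring
              _ = _ := by
                  rw [← Real.rpow_add h1, ← Real.rpow_add h1, ← Real.rpow_add h2]
                  norm_num
        _ = (∫⁻ τ in Ioc (0 : ℝ) (1 / 8), ENNReal.ofReal (τ ^ (-(7 / 8) : ℝ))) *
            ∫⁻ σ in Ioc (0 : ℝ) 1, ENNReal.ofReal (σ ^ (-(3 / 4) : ℝ)) :=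
            lintegral_prod_mul (f := fun τ : ℝ => ENNReal.ofReal (τ ^ (-(7 / 8) : ℝ)))
              (g := fun σ : ℝ => ENNReal.ofReal (σ ^ (-(3 / 4) : ℝ))) (by fun_prop) (by fun_prop)
        _ ≤ _ := by
            rw [lintegral_rpow (by norm_num) (by norm_num), lintegral_rpow (by norm_num) (by norm_num),
              ← ENNReal.ofReal_mul (by positivity)]
            refine ENNReal.ofReal_le_ofReal ?_
            have : (1 / 8 : ℝ) ^ (-(7 / 8) + 1 : ℝ) ≤ 1 :=
              Real.rpow_le_one (by norm_num) (by norm_num) (by norm_num)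
            rw [Real.one_rpow]
            norm_num at this ⊢
            linarith
    have hA := h.hA
    refine (mul_le_mul' le_rfl (pow_le_pow_left' hI 2)).trans (le_of_eq ?_)
    rw [← ENNReal.ofReal_pow (by norm_num), ← ENNReal.ofReal_mul (by positivity)]
    congr 1
    ring

lemma NS.EM_sq (h : NS U p A) {t : ℝ} (ht : t ∈ Ioc (1 / 8 : ℝ) 1) :
    ∫⁻ x, EM U t x ^ 2 ≤ ENNReal.ofReal (160 * 4 * MT ^ 2 * A ^ 6) := by
  set ν := (volume.restrict (Ioc (0 : ℝ) (1 / 8))).prod (volume.restrict (Ioc (0 : ℝ) 1)) with hν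
  have hm : Measurable fun q : (ℝ × ℝ) × E3 => TT 1 q.1.2 (fun y => GG U (t - q.1.1) y ^ 2) q.2 :=
    (TT_joint_meas ((GG_meas h.sU).pow_const 2)).comp
      (f := fun q : (ℝ × ℝ) × E3 => (((1 : ℝ), q.1.2), (t - q.1.1, q.2))) (by fun_prop)
  have hae : ∀ᵐ q ∂ν, q ∈ Ioc (0 : ℝ) (1 / 8) ×ˢ Ioc (0 : ℝ) 1 := by
    rw [hν, Measure.prod_restrict]
    exact self_mem_ae_restrict (measurableSet_Ioc.prod measurableSet_Ioc)
  have hm0 : Measurable fun x => TT 1 0 (fun y => GG U t y ^ 2) x :=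
    (TT_joint_meas ((GG_meas h.sU).pow_const 2)).comp
      (f := fun x : E3 => (((1 : ℝ), (0 : ℝ)), (t, x))) (by fun_prop)
  have e : ∀ x, EM U t x = TT 1 0 (fun y => GG U t y ^ 2) x +
      ∫⁻ q, 1 * TT 1 q.2 (fun y => GG U (t - q.1) y ^ 2) x ∂ν := fun x => by
    rw [hν, lintegral_prod]
    · simp only [one_mul]; rfl
    · simp only [one_mul]
      exact (hm.comp (measurable_id.prodMk measurable_const)).aemeasurable
  simp only [e]
  have hA := h.hA
  have h2 : ∫⁻ x, (∫⁻ q, 1 * TT 1 q.2 (fun y => GG U (t - q.1) y ^ 2) x ∂ν) ^ 2 ≤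
      ENNReal.ofReal (160 * MT ^ 2 * A ^ 6) := by
    refine (lintegral_minkowski ν volume (a := fun _ => 1) measurable_const (g := fun q x =>
      TT 1 q.2 (fun y => GG U (t - q.1) y ^ 2) x) hm (K := ENNReal.ofReal (160 * MT ^ 2 * A ^ 6))
      (fun _ => 1) ?_ measurable_const (fun _ => one_ne_zero) (fun _ => ENNReal.one_ne_top)).trans ?_
    · filter_upwards [hae] with q hq
      rw [one_pow, mul_one]
      exact h.TT_sq_one hq.2.2 (Ioo_subset_Icc_self (sub_mem_unit ht hq.1))
    · simp only [mul_one, lintegral_one]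
      have : ν univ ≤ 1 := by
        rw [hν, Measure.prod_apply MeasurableSet.univ]
        simp
      calc _ ≤ ENNReal.ofReal (160 * MT ^ 2 * A ^ 6) * 1 ^ 2 :=
            mul_le_mul' le_rfl (pow_le_pow_left' this 2)
        _ = _ := by simp
  calc _ ≤ ∫⁻ x, 2 * (TT 1 0 (fun y => GG U t y ^ 2) x ^ 2 +
        (∫⁻ q, 1 * TT 1 q.2 (fun y => GG U (t - q.1) y ^ 2) x ∂ν) ^ 2) :=
        lintegral_mono fun x => ennreal_add_sq_le _ _
    _ ≤ 2 * (ENNReal.ofReal (160 * MT ^ 2 * A ^ 6) + ENNReal.ofReal (160 * MT ^ 2 * A ^ 6)) := by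
        rw [lintegral_const_mul' _ _ (by norm_num), lintegral_add_left (hm0.pow_const 2)]
        exact mul_le_mul' le_rfl (add_le_add (h.TT_sq_one zero_le_one ⟨by linarith [ht.1], ht.2⟩) h2)
    _ = _ := by
        rw [← ENNReal.ofReal_add (by positivity) (by positivity),
          show (2 : ℝ≥0∞) = ENNReal.ofReal 2 by simp, ← ENNReal.ofReal_mul (by norm_num)]
        congr 1
        ring

lemma NS.TT_sup (h : NS U p A) {σ : ℝ} (hσ : σ ≤ 1) {s : ℝ} (hs : s ∈ Icc (0 : ℝ) 1) (x : E3) :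
    TT 1 σ (GG U s) x ≤ ENNReal.ofReal (9 * MT * A) := by
  have hA : 0 < A := by linarith [h.hA]
  have := MT_pos
  refine (TrOK.sup (TT_ok σ one_pos) (h.wk s hs) hA.le hA x).trans (le_of_eq ?_)
  rw [Real.sqrt_one, max_eq_left hσ, ← ENNReal.ofReal_mul (by positivity),
    ← ENNReal.ofReal_mul (by positivity), ← ENNReal.ofReal_add (by positivity) (by positivity)]
  congr 1
  field_simp
  ring

lemma NS.LM_sup (h : NS U p A) {t : ℝ} (ht : t ∈ Ioc (1 / 8 : ℝ) 1) (x : E3) :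
    LM U t x ≤ ENNReal.ofReal (27 * MT * A) := by
  have hA : 0 < A := by linarith [h.hA]
  have := MT_pos
  unfold LM
  have h1 : ∫⁻ τ in Ioc (0 : ℝ) (1 / 8), (TT 1 0 (GG U (t - τ)) x + TT 1 1 (GG U (t - τ)) x) ≤
      ENNReal.ofReal (18 * MT * A) := by
    calc _ ≤ ∫⁻ τ in Ioc (0 : ℝ) (1 / 8), ENNReal.ofReal (18 * MT * A) := by
          refine setLIntegral_mono' measurableSet_Ioc fun τ hτ => ?_
          have hs := Ioo_subset_Icc_self (sub_mem_unit ht hτ)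
          refine (add_le_add (h.TT_sup zero_le_one hs x) (h.TT_sup le_rfl hs x)).trans (le_of_eq ?_)
          rw [← ENNReal.ofReal_add (by positivity) (by positivity)]
          congr 1; ring
      _ ≤ ENNReal.ofReal (18 * MT * A) * 1 := by
          rw [setLIntegral_const, Real.volume_Ioc]
          refine mul_le_mul' le_rfl ?_
          rw [← ENNReal.ofReal_one]
          exact ENNReal.ofReal_le_ofReal (by norm_num)
      _ = _ := mul_one _
  refine (add_le_add (h.TT_sup zero_le_one ⟨by linarith [ht.1], ht.2⟩ x) h1).trans (le_of_eq ?_)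
  rw [← ENNReal.ofReal_add (by positivity) (by positivity)]
  congr 1; ring

lemma NS.TT_four (h : NS U p A) {σ : ℝ} (hσ : σ ≤ 1) {s : ℝ} (hs : s ∈ Icc (0 : ℝ) 1) :
    ∫⁻ x, TT 1 σ (GG U s) x ^ 4 ≤ ENNReal.ofReal (160 * MT ^ 4 * A ^ 6) := by
  have hA := h.hA
  have := MT_pos
  refine (TrOK.four (TT_ok σ one_pos) (h.wk s hs)).trans
    ((mul_le_mul' le_rfl (h.TT_sq_one hσ hs)).trans (le_of_eq ?_))
  rw [← ENNReal.ofReal_pow (by positivity), ← ENNReal.ofReal_mul (by positivity)]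
  congr 1; ring

lemma lintegral_four_minkowski {g : ℝ → E3 → ℝ≥0∞} (hgm : Measurable (Function.uncurry g)) {K : ℝ≥0∞}
    (hK : ∀ τ ∈ Ioc (0 : ℝ) (1 / 8), ∫⁻ x, g τ x ^ 4 ≤ K) :
    ∫⁻ x, (∫⁻ τ in Ioc (0 : ℝ) (1 / 8), g τ x) ^ 4 ≤ K := by
  have hv : (volume.restrict (Ioc (0 : ℝ) (1 / 8))) univ ≤ 1 := by
    rw [Measure.restrict_apply_univ, Real.volume_Ioc, ← ENNReal.ofReal_one]
    exact ENNReal.ofReal_le_ofReal (by norm_num)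
  have h4 : ∀ f : ℝ → ℝ≥0∞, Measurable f →
      (∫⁻ τ in Ioc (0 : ℝ) (1 / 8), f τ) ^ 4 ≤ ∫⁻ τ in Ioc (0 : ℝ) (1 / 8), f τ ^ 4 := by
    intro f hx
    have a1 := lintegral_sq_le (volume.restrict (Ioc (0 : ℝ) (1 / 8))) hx.aemeasurable
    have a2 := lintegral_sq_le (volume.restrict (Ioc (0 : ℝ) (1 / 8))) (hx.pow_const 2).aemeasurable
    simp only [← pow_mul] at a2
    calc _ = ((∫⁻ τ in Ioc (0 : ℝ) (1 / 8), f τ) ^ 2) ^ 2 := by rw [← pow_mul]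
      _ ≤ (1 * ∫⁻ τ in Ioc (0 : ℝ) (1 / 8), f τ ^ 2) ^ 2 :=
          pow_le_pow_left' (a1.trans (mul_le_mul' hv le_rfl)) 2
      _ ≤ 1 * ∫⁻ τ in Ioc (0 : ℝ) (1 / 8), f τ ^ 4 := by
          rw [one_mul]
          exact a2.trans (mul_le_mul' hv le_rfl)
      _ = _ := one_mul _
  calc _ ≤ ∫⁻ x, ∫⁻ τ in Ioc (0 : ℝ) (1 / 8), g τ x ^ 4 := lintegral_mono fun x =>
        h4 _ (hgm.comp (measurable_id.prodMk measurable_const))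
      _ = ∫⁻ τ in Ioc (0 : ℝ) (1 / 8), ∫⁻ x, g τ x ^ 4 :=
          lintegral_lintegral_swap ((hgm.comp measurable_swap).pow_const 4).aemeasurable
      _ ≤ ∫⁻ τ in Ioc (0 : ℝ) (1 / 8), K := setLIntegral_mono' measurableSet_Ioc hK
      _ ≤ K * 1 := by
          rw [lintegral_const]
          exact mul_le_mul' le_rfl hv
      _ = _ := mul_one _

lemma NS.LM_four (h : NS U p A) {t : ℝ} (ht : t ∈ Ioc (1 / 8 : ℝ) 1) :
    ∫⁻ x, LM U t x ^ 4 ≤ ENNReal.ofReal (160 * 200 * MT ^ 4 * A ^ 6) := by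
  have hA := h.hA
  have hM := MT_pos
  have hm : ∀ σ, Measurable fun q : ℝ × E3 => TT 1 σ (GG U (t - q.1)) q.2 := fun σ =>
    (TT_joint_meas (GG_meas h.sU)).comp
      (f := fun q : ℝ × E3 => (((1 : ℝ), σ), (t - q.1, q.2))) (by fun_prop)
  have hm0 : Measurable fun x => TT 1 0 (GG U t) x :=
    (TT_joint_meas (GG_meas h.sU)).comp
      (f := fun x : E3 => (((1 : ℝ), (0 : ℝ)), (t, x))) (by fun_prop)
  set g : ℝ → E3 → ℝ≥0∞ := fun τ x => TT 1 0 (GG U (t - τ)) x + TT 1 1 (GG U (t - τ)) x with hg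
  have hgm : Measurable (Function.uncurry g) := (hm 0).add (hm 1)
  set L := ENNReal.ofReal (160 * MT ^ 4 * A ^ 6) with hL
  have hI : ∫⁻ x, (∫⁻ τ in Ioc (0 : ℝ) (1 / 8), g τ x) ^ 4 ≤ 16 * L := by
    refine lintegral_four_minkowski hgm fun τ hτ => ?_
    have hs := Ioo_subset_Icc_self (sub_mem_unit ht hτ)
    have hx : Measurable fun x => TT 1 0 (GG U (t - τ)) x :=
      (hm 0).comp (f := fun x : E3 => (τ, x)) (by fun_prop)
    calc _ ≤ ∫⁻ x, 8 * (TT 1 0 (GG U (t - τ)) x ^ 4 + TT 1 1 (GG U (t - τ)) x ^ 4) :=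
          lintegral_mono fun x => ennreal_add_four_le _ _
      _ ≤ 8 * (L + L) := by
          rw [lintegral_const_mul' _ _ (by norm_num), lintegral_add_left (hx.pow_const 4)]
          exact mul_le_mul' le_rfl (add_le_add (h.TT_four zero_le_one hs) (h.TT_four le_rfl hs))
      _ = _ := by ring
  calc _ ≤ ∫⁻ x, 8 * (TT 1 0 (GG U t) x ^ 4 + (∫⁻ τ in Ioc (0 : ℝ) (1 / 8), g τ x) ^ 4) :=
        lintegral_mono fun x => ennreal_add_four_le _ _
    _ ≤ 8 * (L + 16 * L) := by
        rw [lintegral_const_mul' _ _ (by norm_num), lintegral_add_left (hm0.pow_const 4)]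
        exact mul_le_mul' le_rfl (add_le_add (h.TT_four zero_le_one ⟨by linarith [ht.1], ht.2⟩) hI)
    _ = ENNReal.ofReal 136 * L := by
        rw [show ENNReal.ofReal 136 = 136 by simp]; ring
    _ ≤ _ := by
        rw [hL, ← ENNReal.ofReal_mul (by norm_num)]
        refine ENNReal.ofReal_le_ofReal ?_
        have : 0 ≤ MT ^ 4 * A ^ 6 := by positivity
        nlinarith

end

/-! ### The equation for the oscillating part -/

section

variable {U : Fin 3 → ℝ × E3 → ℝ} {p : ℝ × E3 → ℝ} {A : ℝ} {ζ φ : E3 → ℝ}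

lemma lapl_sl {f : ℝ × E3 → ℝ} (hf : ContDiff ℝ ∞ f) (t : ℝ) (x : E3) :
    lapl (sl f t) x = ∑ i, dx i (dx i f) (t, x) := by
  unfold lapl
  refine Finset.sum_congr rfl fun i _ => ?_
  rw [← sl_dx hf, ← sl_dx (dx_smooth hf i)]
  rfl

lemma cv_sum {K : ℝ → E3 → ℝ} (hK : Flat K) {f : Fin 3 → ℝ × E3 → ℝ} (hf : ∀ i, Continuous (f i))
    (q : ℝ × E3) : cv K (fun q => ∑ i, f i q) q = ∑ i, cv K (f i) q := by
  simp only [Fin.sum_univ_three]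
  rw [cv_add hK (f := fun q => f 0 q + f 1 q) ((hf 0).add (hf 1)) (hf 2), cv_add hK (hf 0) (hf 1)]

lemma cv_heat {K : ℝ → E3 → ℝ} (hK : Flat K) {f F : ℝ × E3 → ℝ} (hf : ContDiff ℝ ∞ f)
    (hF : ContDiff ℝ ∞ F) (h : ∀ t ∈ Icc (0 : ℝ) 1, ∀ x, dt f (t, x) = lapl (sl f t) x - F (t, x))
    {t : ℝ} (ht : t ∈ Ioc (1 / 8 : ℝ) 1) (x : E3) :
    dt (cv K f) (t, x) = lapl (sl (cv K f) t) x - cv K F (t, x) := by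
  have hdd : ∀ i, ContDiff ℝ ∞ (dx i (dx i f)) := fun i => dx_smooth (dx_smooth hf i) i
  have e1 : dt (cv K f) = cv K (dt f) := dder_cv hK hf _
  have e2 : ∀ i, dx i (dx i (cv K f)) = cv K (dx i (dx i f)) := fun i => by
    unfold dx
    rw [dder_cv hK hf, dder_cv hK (dder_smooth _ hf)]
  have e3 : cv K (fun q => dt f q + F q) (t, x) = cv K (fun q => ∑ i, dx i (dx i f) q) (t, x) := by
    unfold cv
    refine setIntegral_congr_fun measurableSet_Ioc fun τ hτ => ?_
    have : sl (fun q => dt f q + F q) (t - τ) = sl (fun q => ∑ i, dx i (dx i f) q) (t - τ) := by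
      funext y
      change dt f (t - τ, y) + F (t - τ, y) = ∑ i, dx i (dx i f) (t - τ, y)
      rw [h _ (Ioo_subset_Icc_self (sub_mem_unit ht hτ)), lapl_sl hf, sub_add_cancel]
    simp only [this]
  rw [lapl_sl (cv_smooth hK hf), e1]
  simp only [e2]
  rw [cv_add hK (dt_smooth hf).continuous hF.continuous] at e3
  rw [cv_sum hK fun i => (hdd i).continuous] at e3
  linarith

lemma NS.ww_eq (h : NS U p A) (hk : KPair ζ φ) (i : Fin 3) {t : ℝ} (ht : t ∈ Ioc (1 / 8 : ℝ) 1)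
    (x : E3) : dt (ww φ U i) (t, x) = lapl (sl (ww φ U i) t) x - DD U i (t, x) -
      dx i (osc φ p) (t, x) + ll2 φ U p i (t, x) := by
  have ho := osc_smooth hk (h.sU i)
  have hc := cv_smooth kap_flat ho
  have e1 := h.osc_eq hk i t ⟨by linarith [ht.1], ht.2⟩ x
  have e2 := cv_heat kap_flat ho (osc_smooth hk (h.FF_smooth i)) (h.osc_eq hk i) ht x
  have e3 : dt (ww φ U i) (t, x) = dt (osc φ (U i)) (t, x) + dt (cv kap (osc φ (U i))) (t, x) := by
    unfold ww dt
    rw [dder_add _ ho hc]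
  have e4 : lapl (sl (ww φ U i) t) x = lapl (sl (osc φ (U i)) t) x +
      lapl (sl (cv kap (osc φ (U i))) t) x := by
    rw [lapl_sl (ww_smooth hk h.sU i), lapl_sl ho, lapl_sl hc, ← Finset.sum_add_distrib]
    refine Finset.sum_congr rfl fun j _ => ?_
    unfold ww dx
    rw [dder_add _ ho hc, dder_add _ (dder_smooth _ ho) (dder_smooth _ hc)]
  have e5 : dx i (osc φ p) = osc φ (dx i p) := dder_osc hk h.sp _
  have e6 : mol 1 φ (sl (FF U p i) t) x = mol 1 φ (sl (DD U i) t) x + mol 1 φ (sl (dx i p) t) x :=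
    mol_add hk.bp (sl_smooth (DD_smooth h.sU i) t).continuous
      (sl_smooth (dx_smooth h.sp i) t).continuous x
  rw [e3, e4, e1, e2, e5]
  unfold ll2
  have o1 : osc φ (FF U p i) (t, x) = DD U i (t, x) + dx i p (t, x) - mol 1 φ (sl (FF U p i) t) x := rfl
  have o2 : osc φ (dx i p) (t, x) = dx i p (t, x) - mol 1 φ (sl (dx i p) t) x := rfl
  have o3 : jm φ (DD U i) (t, x) = mol 1 φ (sl (DD U i) t) x := rfl
  rw [o1, o2, o3, e6]
  ring

lemma mol_sum_zero {k : E3 → ℝ} {f : Fin 3 → E3 → ℝ} {R s : ℝ} (hk : Bump k R)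
    (hf : ∀ i, Continuous (f i)) (h : ∀ y, ∑ i, f i y = 0) (x : E3) : ∑ i, mol s k (f i) x = 0 := by
  rw [← mol_sum _ hk hf]
  simp [h, mol]

lemma NS.div_osc (h : NS U p A) (hk : KPair ζ φ) {t : ℝ} (ht : t ∈ Icc (0 : ℝ) 1) (x : E3) :
    ∑ i, dx i (osc φ (U i)) (t, x) = 0 := by
  have e : ∀ i, dx i (osc φ (U i)) (t, x) = dx i (U i) (t, x) - mol 1 φ (sl (dx i (U i)) t) x :=
    fun i => by
      unfold dx
      rw [dder_osc hk (h.sU i)]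
      rfl
  simp only [e, Finset.sum_sub_distrib]
  rw [h.div t ht, mol_sum_zero hk.bp
    (fun i => (sl_smooth (dx_smooth (h.sU i) i) t).continuous) (fun y => h.div t ht y), sub_zero]

lemma NS.div_ww (h : NS U p A) (hk : KPair ζ φ) {t : ℝ} (ht : t ∈ Ioc (1 / 8 : ℝ) 1) (x : E3) :
    ∑ i, dx i (ww φ U i) (t, x) = 0 := by
  have ho := fun i => osc_smooth hk (h.sU i)
  have hd := fun i => dx_smooth (ho i) i
  have e : ∀ i, dx i (ww φ U i) (t, x) = dx i (osc φ (U i)) (t, x) +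
      cv kap (dx i (osc φ (U i))) (t, x) := fun i => by
    unfold ww dx
    rw [dder_add _ (ho i) (cv_smooth kap_flat (ho i)), dder_cv kap_flat (ho i)]
  simp only [e, Finset.sum_add_distrib]
  rw [h.div_osc hk ⟨by linarith [ht.1], ht.2⟩, zero_add, ← cv_sum kap_flat fun i => (hd i).continuous]
  unfold cv
  rw [setIntegral_congr_fun (g := fun _ => (0 : ℝ)) measurableSet_Ioc, integral_zero]
  intro τ hτ
  have : sl (fun q => ∑ i, dx i (osc φ (U i)) q) (t - τ) =
      fun _ => 0 := by
    funext y
    exact h.div_osc hk (Ioo_subset_Icc_self (sub_mem_unit ht hτ)) y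
  simp [this, mol]

end

/-! ### Local bounds for the pressure -/

section

variable {U : Fin 3 → ℝ × E3 → ℝ} {p : ℝ × E3 → ℝ} {A : ℝ} {ζ φ : E3 → ℝ}

/-- Near part of the resolvent of the Laplacian. -/
def nk (δ : ℝ) (ζ b : E3 → ℝ) (x : E3) : ℝ := ∫ s in (0 : ℝ)..δ, s * mol s ζ b x

/-- The measure attached to `nk`. -/
def nkm (δ : ℝ) : Measure (ℝ × E3) :=
  (volume.restrict (Ioc (0 : ℝ) δ)).prod (volume.restrict (closedBall (0 : E3) 1))

lemma avok_nk {δ : ℝ} (hδ : 0 ≤ δ) (hz : Bump ζ 1) :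
    AvOK (nkm δ) (fun w => w.1 • w.2) (fun w => w.1 * ζ w.2) δ := by
  have hfin : (volume : Measure (ℝ × E3)) (Ioc (0 : ℝ) δ ×ˢ closedBall (0 : E3) 1) < ⊤ := by
    have : (volume : Measure (ℝ × E3)) (Ioc (0 : ℝ) δ ×ˢ closedBall (0 : E3) 1) =
      volume (Ioc (0 : ℝ) δ) * volume (closedBall (0 : E3) 1) := Measure.prod_prod _ _
    rw [this]
    exact ENNReal.mul_lt_top (by simp) measure_closedBall_lt_top
  obtain ⟨C, hC0, hC⟩ := hz.bound
  have hm : MeasurableSet (Ioc (0 : ℝ) δ ×ˢ closedBall (0 : E3) 1) :=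
    measurableSet_Ioc.prod measurableSet_closedBall
  have hzc := hz.smooth.continuous
  unfold nkm
  rw [Measure.prod_restrict]
  refine ⟨?_, by fun_prop, ?_⟩
  · refine Measure.integrableOn_of_bounded (M := δ * C) hfin.ne
      (Continuous.aestronglyMeasurable (by fun_prop)) ?_
    refine (ae_restrict_iff' hm).2 (Eventually.of_forall fun w hw => ?_)
    rw [norm_mul]
    refine mul_le_mul ?_ (hC _) (norm_nonneg _) hδ
    rw [Real.norm_eq_abs, abs_of_pos hw.1.1]
    exact hw.1.2
  · refine (ae_restrict_iff' hm).2 (Eventually.of_forall fun w hw => ?_)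
    rw [norm_smul, Real.norm_eq_abs, abs_of_pos hw.1.1]
    have : ‖w.2‖ ≤ 1 := by simpa using hw.2
    calc _ ≤ δ * 1 := mul_le_mul hw.1.2 this (norm_nonneg _) hδ
      _ = δ := mul_one _

lemma nk_eq_av {δ : ℝ} (hδ : 0 ≤ δ) (hz : Bump ζ 1) {b : E3 → ℝ} (hb : Continuous b) :
    nk δ ζ b = av (nkm δ) (fun w => w.1 • w.2) (fun w => w.1 * ζ w.2) b := by
  funext x
  have h1 := (avok_nk hδ hz).integrable hb x
  simp only [av]
  unfold nkm at h1 ⊢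
  rw [integral_prod _ h1]
  simp only [nk, mol]
  rw [intervalIntegral.integral_of_le hδ]
  congr 1; funext s
  rw [← hz.integral_zero_outside, ← integral_const_mul]
  simp [mul_assoc]

lemma nk_smooth {δ : ℝ} (hδ : 0 ≤ δ) (hz : Bump ζ 1) {b : E3 → ℝ} (hb : ContDiff ℝ ∞ b) :
    ContDiff ℝ ∞ (nk δ ζ b) := by
  rw [nk_eq_av hδ hz hb.continuous]
  exact (avok_nk hδ hz).contDiff hb

lemma dder_nk {δ : ℝ} (hδ : 0 ≤ δ) (hz : Bump ζ 1) {b : E3 → ℝ} (hb : ContDiff ℝ ∞ b) (v : E3) :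
    dder v (nk δ ζ b) = nk δ ζ (dder v b) := by
  rw [nk_eq_av hδ hz hb.continuous, nk_eq_av hδ hz (dder_smooth v hb).continuous]
  exact (avok_nk hδ hz).dder hb v

lemma mol_eq_zero {s R : ℝ} {b : E3 → ℝ} (hz : Bump ζ 1) (hs : 0 ≤ s) (hb : ∀ z, R < ‖z‖ → b z = 0)
    {x : E3} (hx : R + s < ‖x‖) : mol s ζ b x = 0 := by
  unfold mol
  rw [integral_eq_zero_of_ae]
  refine Eventually.of_forall fun z => ?_
  by_cases h : 1 < ‖z‖
  · simp [hz.supp z h]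
  · have : R < ‖x - s • z‖ := by
      have h1 := norm_sub_norm_le x (s • z)
      rw [norm_smul, Real.norm_eq_abs, abs_of_nonneg hs] at h1
      have h2 : s * ‖z‖ ≤ s * 1 := mul_le_mul_of_nonneg_left (not_lt.1 h) hs
      linarith
    simp [hb _ this]

lemma nk_bump {δ R : ℝ} (hδ : 0 ≤ δ) (hz : Bump ζ 1) {b : E3 → ℝ} (hb : Bump b R) :
    Bump (nk δ ζ b) (R + δ) := by
  refine ⟨nk_smooth hδ hz hb.smooth, fun x hx => ?_⟩
  unfold nk
  rw [intervalIntegral.integral_of_le hδ]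
  refine setIntegral_eq_zero_of_forall_eq_zero fun s hs => ?_
  rw [mol_eq_zero hz hs.1.le hb.supp (by linarith [hs.2]), mul_zero]

lemma lapl_nk {δ : ℝ} (hδ : 0 ≤ δ) (hk : KPair ζ φ) {b : E3 → ℝ} (hb : ContDiff ℝ ∞ b) (x : E3) :
    lapl (nk δ ζ b) x = mol δ φ b x - b x := by
  have h := hk.identity hb x 0 δ
  rw [mol_zero, hk.one, one_mul] at h
  rw [h]
  have e : lapl (nk δ ζ b) = fun x => ∑ i, nk δ ζ (dder (ee i) (dder (ee i) b)) x := by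
    funext y
    unfold lapl
    refine Finset.sum_congr rfl fun i _ => ?_
    rw [dder_nk hδ hk.bz hb, dder_nk hδ hk.bz (dder_smooth _ hb)]
  rw [e]
  have hd := fun i => dder_smooth (ee i) (dder_smooth (ee i) hb)
  unfold nk
  beta_reduce
  rw [← intervalIntegral.integral_finsetSum]
  · refine intervalIntegral.integral_congr fun s _ => ?_
    unfold lapl
    rw [mol_sum _ hk.bz fun i => (hd i).continuous, Finset.mul_sum]
  · intro i _
    exact (continuous_id.mul (mol_param hk.bz (hd i) x).continuous).intervalIntegrable _ _

lemma Bump.hessian_le {H : E3 → ℝ} {R : ℝ} (h : Bump H R) (a b : Fin 3) :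
    ∫⁻ x, ENNReal.ofReal (_root_.dder (ee a) (_root_.dder (ee b) H) x ^ 2) ≤
      ∫⁻ x, ENNReal.ofReal (lapl H x ^ 2) := by
  have hd := fun i => dder_smooth (ee i) h.smooth
  have hdd := fun i j => dder_smooth (ee i) (hd j)
  have bd : ∀ i j, Bump (_root_.dder (ee i) (_root_.dder (ee j) H)) R := fun i j => (h.dder _).dder _
  have e : ∀ i j, ∫ x, _root_.dder (ee i) (_root_.dder (ee j) H) x ^ 2 =
      ∫ x, _root_.dder (ee i) (_root_.dder (ee i) H) x * _root_.dder (ee j) (_root_.dder (ee j) H) x := by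
    intro i j
    have h1 := (bd i j).ibp (hd j) (ee i)
    have h2 := (bd i i).ibp (hd j) (ee j)
    rw [h2, dder_comm (ee j) (ee i) (hd i), dder_comm (ee j) (ee i) h.smooth, ← h1]
    congr 1; funext x; ring
  have i2 : ∀ i j k l, Integrable fun x => _root_.dder (ee i) (_root_.dder (ee j) H) x *
      _root_.dder (ee k) (_root_.dder (ee l) H) x := fun i j k l =>
    (bd i j).integrable_mul (hdd k l).continuous
  have i1 : ∀ i j, Integrable fun x => _root_.dder (ee i) (_root_.dder (ee j) H) x ^ 2 := fun i j => by
    simpa only [sq] using i2 i j i j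
  have bl : Bump (lapl H) R := ⟨lapl_smooth h.smooth, fun z hz => by
    unfold lapl; exact Finset.sum_eq_zero fun i _ => (bd i i).supp z hz⟩
  have il : Integrable fun x => lapl H x ^ 2 := by
    simpa only [sq] using bl.integrable_mul bl.smooth.continuous
  rw [← ofReal_integral_eq_lintegral_ofReal (i1 a b) (Eventually.of_forall fun _ => sq_nonneg _),
    ← ofReal_integral_eq_lintegral_ofReal il (Eventually.of_forall fun _ => sq_nonneg _)]
  refine ENNReal.ofReal_le_ofReal ?_
  have e2 : ∫ x, lapl H x ^ 2 = ∑ i, ∑ j, ∫ x, _root_.dder (ee i) (_root_.dder (ee j) H) x ^ 2 := by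
    simp only [e]
    simp only [← integral_finsetSum _ fun j _ => i2 _ _ _ _]
    rw [← integral_finsetSum _ fun i _ => integrable_finsetSum _ fun j _ => i2 i i j j]
    congr 1; funext x
    unfold lapl
    rw [sq, Finset.sum_mul_sum]
  rw [e2]
  have hn : ∀ i j, 0 ≤ ∫ x, _root_.dder (ee i) (_root_.dder (ee j) H) x ^ 2 := fun i j =>
    integral_nonneg fun _ => sq_nonneg _
  exact (Finset.single_le_sum (f := fun j => ∫ x, _root_.dder (ee a) (_root_.dder (ee j) H) x ^ 2)
    (fun j _ => hn a j) (Finset.mem_univ b)).trans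
    (Finset.single_le_sum (f := fun i => ∑ j, ∫ x, _root_.dder (ee i) (_root_.dder (ee j) H) x ^ 2)
      (fun i _ => Finset.sum_nonneg fun j _ => hn i j) (Finset.mem_univ a))

/-- Averages over balls. -/
def AA (σ : ℝ) (g : E3 → ℝ≥0∞) (x : E3) : ℝ≥0∞ :=
  tr (volume.restrict (closedBall (0 : E3) 1)) (fun z => σ • z) g x

/-- The mass of the averages over balls. -/
def MB : ℝ := 1 + (volume (closedBall (0 : E3) 1)).toReal

lemma MB_pos : 0 < MB := add_pos_of_pos_of_nonneg one_pos ENNReal.toReal_nonneg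

lemma AA_ok {σ : ℝ} (hσ : 0 < σ) : TrOK (volume.restrict (closedBall (0 : E3) 1)) (fun z => σ • z)
    (ENNReal.ofReal MB) (ENNReal.ofReal (MB * σ⁻¹ ^ 3)) := by
  have h0 : (0 : ℝ) ≤ (volume (closedBall (0 : E3) 1)).toReal := ENNReal.toReal_nonneg
  refine ⟨by fun_prop, ?_, fun g hg x => ?_⟩
  · rw [Measure.restrict_apply_univ, ← ENNReal.ofReal_toReal (measure_closedBall_lt_top (μ := volume)
      (x := (0 : E3)) (r := 1)).ne]
    exact ENNReal.ofReal_le_ofReal (by unfold MB; linarith)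
  · unfold tr
    refine (lintegral_mono' Measure.restrict_le_self le_rfl).trans ?_
    rw [lintegral_dilate hσ hg]
    refine mul_le_mul' (ENNReal.ofReal_le_ofReal ?_) le_rfl
    have : 0 ≤ σ⁻¹ ^ 3 := by positivity
    unfold MB
    nlinarith

lemma mol_le_AA {σ Cz : ℝ} {K f : E3 → ℝ} (hK : Bump K 1) (hC : ∀ z, |K z| ≤ Cz) {G : E3 → ℝ≥0∞}
    (hfG : ∀ y, ENNReal.ofReal |f y| ≤ G y) (x : E3) :
    ENNReal.ofReal |mol σ K f x| ≤ ENNReal.ofReal Cz * AA σ G x := by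
  unfold AA tr
  rw [← lintegral_const_mul' _ _ ENNReal.ofReal_ne_top]
  refine (lintegral_abs_mol K f x).trans ?_
  rw [← lintegral_indicator measurableSet_closedBall]
  refine lintegral_mono fun z => ?_
  by_cases hz : z ∈ closedBall (0 : E3) 1
  · rw [indicator_of_mem hz]
    exact mul_le_mul' (ENNReal.ofReal_le_ofReal (hC z)) (hfG _)
  · rw [hK.supp z (by simpa using hz)]
    simp

end

section

variable {U : Fin 3 → ℝ × E3 → ℝ} {p : ℝ × E3 → ℝ} {A : ℝ} {ζ φ : E3 → ℝ}

lemma smoothTransition_deriv_bound : ∃ M, 0 < M ∧ ∀ y, |deriv Real.smoothTransition y| ≤ M := by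
  have hs : ContDiff ℝ 1 Real.smoothTransition := Real.smoothTransition.contDiff (n := 1)
  obtain ⟨M, hM⟩ := isCompact_Icc.exists_bound_of_continuousOn (s := Icc (0 : ℝ) 1)
    (hs.continuous_deriv le_rfl).continuousOn
  refine ⟨max M 1, lt_max_of_lt_right one_pos, fun y => ?_⟩
  by_cases hy : y ∈ Icc (0 : ℝ) 1
  · exact (hM y hy).trans (le_max_left _ _)
  · have h0 : deriv Real.smoothTransition y = 0 := by
      rcases lt_or_ge y 0 with h | h
      · have : Real.smoothTransition =ᶠ[𝓝 y] fun _ => 0 := by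
          filter_upwards [gt_mem_nhds h] with z hz
          exact Real.smoothTransition.zero_of_nonpos hz.le
        rw [this.deriv_eq, deriv_const]
      · have h1 : 1 < y := by
          by_contra hc
          exact hy ⟨h, not_lt.1 hc⟩
        have : Real.smoothTransition =ᶠ[𝓝 y] fun _ => 1 := by
          filter_upwards [lt_mem_nhds h1] with z hz
          exact Real.smoothTransition.one_of_one_le hz.le
        rw [this.deriv_eq, deriv_const]
    rw [h0, abs_zero]
    positivity

/-- A cutoff function equal to one on the ball of radius `r`, with support in the ball of radius
`r + δ` and slope bounded by `M / δ`. -/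
structure Cut (M r δ : ℝ) (χ : E3 → ℝ) : Prop where
  bump : Bump χ (r + δ)
  one : ∀ x, ‖x‖ ≤ r → χ x = 1
  nonneg : ∀ x, 0 ≤ χ x
  le_one : ∀ x, χ x ≤ 1
  slope : ∀ i x, |dder (ee i) χ x| ≤ M * δ⁻¹

lemma exists_cutoff : ∃ M, 1 ≤ M ∧ ∀ r δ, 0 ≤ r → 0 < δ → ∃ χ, Cut M r δ χ := by
  obtain ⟨M, hM, hb⟩ := smoothTransition_deriv_bound
  refine ⟨max (2 * M) 1, le_max_right _ _, fun r δ hr hδ => ?_⟩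
  set c : ℝ := (δ * (2 * r + δ))⁻¹ with hc
  have hc0 : 0 < c := by positivity
  set χ : E3 → ℝ := fun x => Real.smoothTransition (c * ((r + δ) ^ 2 - ‖x‖ ^ 2)) with hχ
  have hbump : Bump χ (r + δ) := by
    refine ⟨(Real.smoothTransition.contDiff (n := ⊤)).comp (contDiff_const.mul
      (contDiff_const.sub (contDiff_norm_sq ℝ))), fun z hz => Real.smoothTransition.zero_of_nonpos ?_⟩
    have : (r + δ) ^ 2 ≤ ‖z‖ ^ 2 := pow_le_pow_left₀ (by positivity) hz.le 2
    nlinarith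
  refine ⟨χ, hbump, fun x hx => Real.smoothTransition.one_of_one_le ?_,
    fun x => Real.smoothTransition.nonneg _, fun x => Real.smoothTransition.le_one _, fun i x => ?_⟩
  · have : ‖x‖ ^ 2 ≤ r ^ 2 := pow_le_pow_left₀ (norm_nonneg _) hx 2
    rw [hc, inv_mul_eq_div, le_div_iff₀ (by positivity)]
    nlinarith
  · by_cases hx : ‖x‖ ≤ r + δ
    · have h1 : HasFDerivAt (fun x : E3 => c * ((r + δ) ^ 2 - ‖x‖ ^ 2)) (c • -((2 : ℕ) • innerSL ℝ x) : E3 →L[ℝ] ℝ) x :=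
        (((hasStrictFDerivAt_norm_sq x).hasFDerivAt).const_sub _).const_mul c
      have h0 := ((Real.smoothTransition.contDiff (n := 1)).differentiable
        one_ne_zero (c * ((r + δ) ^ 2 - ‖x‖ ^ 2))).hasDerivAt
      have h2 := h0.comp_hasFDerivAt x h1
      have h5 : χ = Real.smoothTransition ∘ fun x : E3 => c * ((r + δ) ^ 2 - ‖x‖ ^ 2) := rfl
      unfold dder
      rw [h5, h2.fderiv]
      simp only [smul_apply, neg_apply, innerSL_apply_apply,
        smul_eq_mul, nsmul_eq_mul, Nat.cast_ofNat]
      have h3 : |inner ℝ x (ee i)| ≤ r + δ := by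
        refine (abs_real_inner_le_norm _ _).trans ?_
        rwa [ee_norm, mul_one]
      rw [abs_mul, abs_mul, abs_neg, abs_mul, abs_of_pos hc0, abs_two]
      have h4 : c * (2 * |inner ℝ x (ee i)|) ≤ 2 * δ⁻¹ := by
        have : c * (r + δ) ≤ δ⁻¹ := by
          rw [hc, mul_inv, mul_assoc]
          refine mul_le_of_le_one_right (by positivity) ?_
          rw [inv_mul_le_one₀ (by positivity)]
          linarith
        nlinarith
      calc _ ≤ M * (2 * δ⁻¹) := mul_le_mul (hb _) h4 (by positivity) hM.le
        _ ≤ _ := by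
          rw [← mul_assoc]
          exact mul_le_mul_of_nonneg_right ((mul_comm _ _).le.trans (le_max_left _ _)) (by positivity)
    · rw [(hbump.dder _).supp x (not_le.1 hx), abs_zero]
      positivity

lemma ofReal_sq_eq (a : ℝ) : ENNReal.ofReal (a ^ 2) = ENNReal.ofReal |a| ^ 2 := by
  rw [← ENNReal.ofReal_pow (abs_nonneg a), sq_abs]

lemma ennreal_sum_sq_le {ι : Type*} (s : Finset ι) (f : ι → ℝ≥0∞) :
    (∑ i ∈ s, f i) ^ 2 ≤ s.card * ∑ i ∈ s, f i ^ 2 := by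
  have h := ENNReal.inner_le_Lp_mul_Lq s (fun _ => 1) f (p := 2) (q := 2) ⟨by norm_num, by norm_num, by norm_num⟩
  simp only [one_mul, ENNReal.one_rpow, Finset.sum_const, nsmul_eq_mul, mul_one] at h
  calc _ ≤ ((s.card : ℝ≥0∞) ^ (1 / 2 : ℝ) * (∑ i ∈ s, f i ^ (2 : ℝ)) ^ (1 / 2 : ℝ)) ^ 2 :=
        pow_le_pow_left' h 2
    _ = _ := by
        rw [mul_pow, ← ENNReal.rpow_natCast, ← ENNReal.rpow_natCast, ← ENNReal.rpow_mul,
          ← ENNReal.rpow_mul]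
        norm_num

variable {C : ℝ}

lemma KC.near_le (hC : KC ζ φ C) {δ R : ℝ} (hδ : 0 < δ) {b : E3 → ℝ} (hb : Bump b R) {G : E3 → ℝ≥0∞}
    (hG : Measurable G) (hbG : ∀ y, ENNReal.ofReal |b y| ≤ G y) (i j : Fin 3) :
    ∫⁻ x, ENNReal.ofReal (nk δ ζ (dder (ee i) (dder (ee j) b)) x ^ 2) ≤
      ENNReal.ofReal (2 * (C ^ 2 * MB ^ 2 + 1)) * ∫⁻ x, G x ^ 2 := by
  have hz := hC.pair.bz
  have hC0 : 0 ≤ C := zero_le_one.trans hC.pos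
  have hM := MB_pos
  rw [← dder_nk hδ.le hz (dder_smooth _ hb.smooth), ← dder_nk hδ.le hz hb.smooth]
  refine ((nk_bump hδ.le hz hb).hessian_le i j).trans ?_
  have hAm : Measurable (AA δ G) := tr_meas (AA_ok hδ).meas hG
  calc _ ≤ ∫⁻ x, 2 * ((ENNReal.ofReal C * AA δ G x) ^ 2 + G x ^ 2) := by
        refine lintegral_mono fun x => ?_
        rw [lapl_nk hδ.le hC.pair hb.smooth, ofReal_sq_eq]
        refine (pow_le_pow_left' ((ofReal_abs_sub_le _ _).trans
          (add_le_add (mol_le_AA hC.pair.bp hC.f0 hbG x) (hbG x))) 2).trans (ennreal_add_sq_le _ _)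
    _ ≤ 2 * (ENNReal.ofReal C ^ 2 * (ENNReal.ofReal MB * (ENNReal.ofReal MB * ∫⁻ x, G x ^ 2)) +
          ∫⁻ x, G x ^ 2) := by
        rw [lintegral_const_mul' _ _ (by norm_num), lintegral_add_right _ (hG.pow_const 2)]
        refine mul_le_mul' le_rfl (add_le_add ?_ le_rfl)
        simp only [mul_pow]
        rw [lintegral_const_mul' _ _ (by finiteness)]
        refine mul_le_mul' le_rfl ?_
        calc _ ≤ ∫⁻ x, ENNReal.ofReal MB * AA δ (fun y => G y ^ 2) x :=
              lintegral_mono fun x => (AA_ok hδ).sq_le hG x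
          _ ≤ _ := by
              rw [lintegral_const_mul' _ _ ENNReal.ofReal_ne_top]
              exact mul_le_mul' le_rfl ((AA_ok hδ).lintegral_le (hG.pow_const 2))
    _ = _ := by
        rw [ENNReal.ofReal_mul (by norm_num), ENNReal.ofReal_add (by positivity) (by norm_num),
          ENNReal.ofReal_mul (by positivity), ENNReal.ofReal_pow hC0, ENNReal.ofReal_pow hM.le,
          ENNReal.ofReal_one, show ENNReal.ofReal 2 = 2 by simp]
        ring

lemma KC.far_le (hC : KC ζ φ C) {δ : ℝ} (hδ : 0 < δ) (hδ1 : δ ≤ 1) {F : E3 → ℝ} (hF : ContDiff ℝ ∞ F)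
    {G : E3 → ℝ≥0∞} (hFG : ∀ y, ENNReal.ofReal |F y| ≤ G y) (i j : Fin 3) (x : E3) :
    ENNReal.ofReal |∫ s in δ..1, s * mol s ζ (dder (ee i) (dder (ee j) F)) x| ≤
      ENNReal.ofReal (C * δ⁻¹) * ∫⁻ σ in Ioc δ 1, AA σ G x := by
  have hz := hC.pair.bz
  refine (ofReal_abs_intervalIntegral_le hδ1).trans ?_
  rw [← lintegral_const_mul' _ _ ENNReal.ofReal_ne_top]
  refine setLIntegral_mono' measurableSet_Ioc fun σ hσ => ?_
  have hσ0 : 0 < σ := hδ.trans hσ.1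
  rw [mol_dder hz (dder_smooth _ hF) hσ0.ne', mol_dder (hz.dder _) hF hσ0.ne', abs_mul, abs_mul,
    abs_mul, abs_of_pos hσ0, abs_of_pos (inv_pos.2 hσ0), mul_inv_cancel_left₀ hσ0.ne',
    ENNReal.ofReal_mul (by positivity)]
  have h1 := mol_le_AA (σ := σ) ((hz.dder (ee i)).dder (ee j)) (hC.z2 i j) hFG x
  refine (mul_le_mul' (ENNReal.ofReal_le_ofReal (inv_anti₀ hδ hσ.1.le)) h1).trans (le_of_eq ?_)
  rw [mul_comm C, ENNReal.ofReal_mul (by positivity), mul_assoc]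

end

section

variable {U : Fin 3 → ℝ × E3 → ℝ} {p : ℝ × E3 → ℝ} {A : ℝ} {ζ φ : E3 → ℝ}

variable {C : ℝ} {V : Fin 3 → E3 → ℝ} {P : E3 → ℝ}

lemma AA_joint_meas {G : E3 → ℝ≥0∞} (hG : Measurable G) :
    Measurable fun q : ℝ × E3 => AA q.1 G q.2 := by
  unfold AA tr
  exact (hG.comp (f := fun q : (ℝ × E3) × E3 => q.1.2 - q.1.1 • q.2) (by fun_prop)).lintegral_prod_right'

lemma Wk.far_sq {f : E3 → ℝ} (hf : Wk f A) (hA : 1 ≤ A) {δ : ℝ} (hδ : 0 < δ) :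
    ∫⁻ x, (∫⁻ σ in Ioc δ 1, AA σ (fun y => ENNReal.ofReal (f y) ^ 2) x) ^ 2 ≤
      ENNReal.ofReal (160 * MB ^ 2 * A ^ 6 * δ⁻¹) := by
  have hG := hf.meas_ofReal.pow_const 2
  have hM := MB_pos
  have h := lintegral_minkowski (volume.restrict (Ioc δ 1)) volume (a := fun _ => 1) measurable_const
    (g := fun σ x => AA σ (fun y => ENNReal.ofReal (f y) ^ 2) x) (AA_joint_meas hG)
    (K := ENNReal.ofReal (160 * MB ^ 2 * A ^ 6 * δ⁻¹)) (fun _ => 1) ?_ measurable_const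
    (fun _ => one_ne_zero) (fun _ => ENNReal.one_ne_top)
  · simp only [one_mul, lintegral_one, Measure.restrict_apply_univ, Real.volume_Ioc] at h
    refine h.trans ?_
    calc _ ≤ ENNReal.ofReal (160 * MB ^ 2 * A ^ 6 * δ⁻¹) * 1 ^ 2 := by
          refine mul_le_mul' le_rfl (pow_le_pow_left' ?_ 2)
          rw [ENNReal.ofReal_le_one]
          linarith
      _ = _ := by simp
  · filter_upwards [self_mem_ae_restrict measurableSet_Ioc] with σ hσ
    have hσ0 : 0 < σ := hδ.trans hσ.1
    refine ((AA_ok hσ0).l2_scale hM.le hσ0 hf hA).trans ?_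
    rw [one_pow, mul_one]
    exact ENNReal.ofReal_le_ofReal (mul_le_mul_of_nonneg_left (inv_anti₀ hδ hσ.1.le) (by positivity))

lemma dder_congr_ball {f g : E3 → ℝ} {r : ℝ} (h : ∀ x, ‖x‖ < r → f x = g x) (v : E3) :
    ∀ x, ‖x‖ < r → dder v f x = dder v g x := fun x hx => by
  unfold dder
  have : f =ᶠ[𝓝 x] g := by
    filter_upwards [(isOpen_ball (x := (0 : E3)) (ε := r)).mem_nhds (by simpa using hx)] with y hy
    exact h y (by simpa using hy)
  rw [this.fderiv_eq]

lemma mol_congr_ball {f g : E3 → ℝ} {r s : ℝ} (hz : Bump ζ 1) (h : ∀ x, ‖x‖ < r → f x = g x)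
    (hs : 0 ≤ s) {x : E3} (hx : ‖x‖ + s < r) : mol s ζ f x = mol s ζ g x := by
  unfold mol
  congr 1; funext z
  by_cases hz1 : ‖z‖ ≤ 1
  · rw [h]
    refine (norm_sub_le _ _).trans_lt (lt_of_le_of_lt ?_ hx)
    rw [norm_smul, Real.norm_of_nonneg hs]
    nlinarith
  · rw [hz.supp z (not_le.1 hz1), zero_mul, zero_mul]

lemma Slice.osc_split (hk : KPair ζ φ) (h : Slice V P) {δ r ρ M δ' : ℝ} (hδ : 0 < δ)
    {χ : E3 → ℝ} (hχ : Cut M r δ' χ) (hr : ρ + δ < r) {x : E3} (hx : ‖x‖ ≤ ρ) :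
    P x - mol 1 φ P x = ∑ j, ∑ k,
      (nk δ ζ (dder (ee j) (dder (ee k) fun y => χ y * (V j y * V k y))) x +
        ∫ s in δ..1, s * mol s ζ (dder (ee j) (dder (ee k) fun y => V j y * V k y)) x) := by
  have hz := hk.bz
  have hs := fun i j => (h.sV i).mul (h.sV j)
  have hd := fun j k => dder_smooth (ee j) (dder_smooth (ee k) (hs j k))
  have ci : ∀ j k a b, IntervalIntegrable
      (fun s => s * mol s ζ (dder (ee j) (dder (ee k) fun y => V j y * V k y)) x) volume a b :=
    fun j k a b => (continuous_id.mul (mol_param hz (hd j k) x).continuous).intervalIntegrable _ _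
  have e1 : ∀ s, s * mol s ζ (lapl P) x =
      -∑ j, ∑ k, s * mol s ζ (dder (ee j) (dder (ee k) fun y => V j y * V k y)) x := fun s => by
    have : lapl P = fun x => (-1) * ∑ j, ∑ k, dder (ee j) (dder (ee k) fun y => V j y * V k y) x := by
      funext y; rw [h.press y]; ring
    rw [this, mol_const_mul, mol_sum _ hz fun j => (ContDiff.sum fun k _ => hd j k).continuous]
    simp only [Finset.mul_sum, ← Finset.sum_neg_distrib]
    refine Finset.sum_congr rfl fun j _ => ?_
    rw [mol_sum _ hz fun k => (hd j k).continuous]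
    simp only [Finset.mul_sum]
    refine Finset.sum_congr rfl fun k _ => ?_
    ring
  have e2 : P x - mol 1 φ P x = ∑ j, ∑ k, ∫ s in (0 : ℝ)..1,
      s * mol s ζ (dder (ee j) (dder (ee k) fun y => V j y * V k y)) x := by
    have h1 := hk.identity h.sP x 0 1
    rw [mol_zero, hk.one, one_mul] at h1
    rw [← neg_sub, h1]
    simp only [e1]
    rw [intervalIntegral.integral_neg, neg_neg, intervalIntegral.integral_finsetSum]
    · refine Finset.sum_congr rfl fun j _ => ?_
      rw [intervalIntegral.integral_finsetSum fun k _ => ci j k 0 1]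
    · intro j _
      refine ((continuous_finsetSum _ fun k _ => continuous_id.mul
        (mol_param hz (hd j k) x).continuous)).intervalIntegrable _ _
  rw [e2]
  refine Finset.sum_congr rfl fun j _ => Finset.sum_congr rfl fun k _ => ?_
  rw [← intervalIntegral.integral_add_adjacent_intervals (ci j k 0 δ) (ci j k δ 1)]
  congr 1
  unfold nk
  refine intervalIntegral.integral_congr fun s hs' => ?_
  rw [uIcc_of_le hδ.le] at hs'
  congr 1
  refine mol_congr_ball hz (r := r) ?_ hs'.1 (by linarith [hs'.2])
  refine dder_congr_ball (dder_congr_ball (fun y hy => ?_) _) _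
  rw [hχ.one y hy.le, one_mul]

lemma KC.press_le (hC : KC ζ φ C) (h : Slice V P) (hw : Wk (spd V) A) (hA : 1 ≤ A) {δ r ρ M δ' : ℝ}
    (hδ : 0 < δ) (hδ1 : δ ≤ 1) {χ : E3 → ℝ} (hχ : Cut M r δ' χ) (hr : ρ + δ < r) :
    ∫⁻ x in closedBall (0 : E3) ρ, ENNReal.ofReal ((P x - mol 1 φ P x) ^ 2) ≤
      ENNReal.ofReal (324 * (C ^ 2 * MB ^ 2 + 1)) *
        (∫⁻ x in closedBall (0 : E3) (r + δ'), ENNReal.ofReal (spd V x) ^ 4) +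
      ENNReal.ofReal (162 * 160 * C ^ 2 * MB ^ 2 * A ^ 6 * δ⁻¹ ^ 3) := by
  have hz := hC.pair.bz
  have hC0 : 0 ≤ C := zero_le_one.trans hC.pos
  have hM := MB_pos
  have hs := fun i j => (h.sV i).mul (h.sV j)
  have hg := hw.meas_ofReal
  set G : E3 → ℝ≥0∞ := (closedBall (0 : E3) (r + δ')).indicator
    fun y => ENNReal.ofReal (spd V y) ^ 2 with hGd
  have hG : Measurable G := (hg.pow_const 2).indicator measurableSet_closedBall
  have hG2 : ∫⁻ x, G x ^ 2 = ∫⁻ x in closedBall (0 : E3) (r + δ'), ENNReal.ofReal (spd V x) ^ 4 := by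
    rw [← lintegral_indicator measurableSet_closedBall]
    congr 1; funext x
    by_cases hx : x ∈ closedBall (0 : E3) (r + δ')
    · rw [hGd, indicator_of_mem hx, indicator_of_mem hx, ← pow_mul]
    · rw [hGd, indicator_of_notMem hx, indicator_of_notMem hx]; simp
  have hbG : ∀ j k y, ENNReal.ofReal |χ y * (V j y * V k y)| ≤ G y := fun j k y => by
    by_cases hx : y ∈ closedBall (0 : E3) (r + δ')
    · rw [hGd, indicator_of_mem hx]
      refine (ENNReal.ofReal_le_ofReal ?_).trans (ofReal_mul_le_spd V j k y)
      rw [abs_mul, abs_of_nonneg (hχ.nonneg y)]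
      exact mul_le_of_le_one_left (abs_nonneg _) (hχ.le_one y)
    · rw [hχ.bump.supp y (by simpa using hx), zero_mul, abs_zero, ENNReal.ofReal_zero]
      exact bot_le
  have hb : ∀ j k, Bump (fun y => χ y * (V j y * V k y)) (r + δ') := fun j k => hχ.bump.mul (hs j k)
  set N : Fin 3 → Fin 3 → E3 → ℝ := fun j k =>
    nk δ ζ (dder (ee j) (dder (ee k) fun y => χ y * (V j y * V k y))) with hN
  have hNm : ∀ j k, Measurable fun x => ENNReal.ofReal (N j k x ^ 2) := fun j k =>
    ((nk_smooth hδ.le hz (dder_smooth _ (dder_smooth _ (hb j k).smooth))).continuous.measurable.pow_const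
      2).ennreal_ofReal
  set Fa : E3 → ℝ≥0∞ := fun x => ∫⁻ σ in Ioc δ 1, AA σ (fun y => ENNReal.ofReal (spd V y) ^ 2) x with hFa
  have key : ∀ x ∈ closedBall (0 : E3) ρ, ENNReal.ofReal ((P x - mol 1 φ P x) ^ 2) ≤
      2 * (9 * ∑ p : Fin 3 × Fin 3, ENNReal.ofReal (N p.1 p.2 x ^ 2) +
        (9 * (ENNReal.ofReal (C * δ⁻¹) * Fa x)) ^ 2) := fun x hx => by
    have h9 : ((Finset.univ : Finset (Fin 3 × Fin 3)).card : ℝ≥0∞) = 9 := by simp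
    rw [ofReal_sq_eq, h.osc_split hC.pair hδ hχ hr (by simpa using hx), ← Fintype.sum_prod_type']
    calc _ ≤ (∑ p : Fin 3 × Fin 3, ENNReal.ofReal |N p.1 p.2 x| +
          9 * (ENNReal.ofReal (C * δ⁻¹) * Fa x)) ^ 2 := by
          refine pow_le_pow_left' ((ofReal_abs_sum_le _ _).trans ?_) 2
          refine (Finset.sum_le_sum fun p _ => (ofReal_abs_add_le _ _).trans (add_le_add le_rfl
            (hC.far_le hδ hδ1 (hs p.1 p.2) (ofReal_mul_le_spd V p.1 p.2) p.1 p.2 x))).trans ?_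
          rw [Finset.sum_add_distrib, Finset.sum_const, nsmul_eq_mul, h9]
      _ ≤ _ := by
          refine (ennreal_add_sq_le _ _).trans ?_
          refine mul_le_mul' le_rfl (add_le_add ?_ le_rfl)
          refine (ennreal_sum_sq_le _ _).trans ?_
          rw [h9]
          simp only [ofReal_sq_eq]
          exact le_rfl
  refine (setLIntegral_mono' measurableSet_closedBall key).trans ((setLIntegral_le_lintegral _ _).trans ?_)
  have hNs : ∫⁻ x, ∑ p : Fin 3 × Fin 3, ENNReal.ofReal (N p.1 p.2 x ^ 2) ≤
      9 * (ENNReal.ofReal (2 * (C ^ 2 * MB ^ 2 + 1)) * ∫⁻ x, G x ^ 2) := by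
    rw [lintegral_finsetSum _ fun p _ => hNm p.1 p.2]
    refine (Finset.sum_le_sum fun p _ => hC.near_le hδ (hb p.1 p.2) hG (hbG p.1 p.2) p.1 p.2).trans ?_
    rw [Finset.sum_const, nsmul_eq_mul]
    refine le_of_eq ?_
    simp
  have hFs := hw.far_sq hA hδ
  have hms : Measurable fun x => ∑ p : Fin 3 × Fin 3, ENNReal.ofReal (N p.1 p.2 x ^ 2) :=
    Finset.measurable_fun_sum _ fun p _ => hNm p.1 p.2
  rw [lintegral_const_mul' _ _ (by norm_num), lintegral_add_left (hms.const_mul _),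
    lintegral_const_mul' _ _ (by norm_num)]
  simp only [mul_pow]
  rw [lintegral_const_mul' _ _ (by norm_num), lintegral_const_mul' _ _ (by finiteness), mul_add, ← hG2]
  refine add_le_add ?_ ?_
  · refine (mul_le_mul' le_rfl (mul_le_mul' le_rfl hNs)).trans (le_of_eq ?_)
    rw [show (324 : ℝ) * (C ^ 2 * MB ^ 2 + 1) = 162 * (2 * (C ^ 2 * MB ^ 2 + 1)) by ring,
      ENNReal.ofReal_mul (by norm_num : (0 : ℝ) ≤ 162), show ENNReal.ofReal 162 = 162 by simp]
    ring
  · refine (mul_le_mul' le_rfl (mul_le_mul' le_rfl (mul_le_mul' le_rfl hFs))).trans (le_of_eq ?_)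
    rw [← ENNReal.ofReal_pow (by positivity), ← ENNReal.ofReal_mul (by positivity),
      show (162 : ℝ) * 160 * C ^ 2 * MB ^ 2 * A ^ 6 * δ⁻¹ ^ 3 =
        162 * ((C * δ⁻¹) ^ 2 * (160 * MB ^ 2 * A ^ 6 * δ⁻¹)) by ring,
      ENNReal.ofReal_mul (by norm_num : (0 : ℝ) ≤ 162), show ENNReal.ofReal 162 = 162 by simp, ← mul_assoc]
    norm_num

end

section

variable {U : Fin 3 → ℝ × E3 → ℝ} {p : ℝ × E3 → ℝ} {A : ℝ} {ζ φ : E3 → ℝ}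

/-- The squared length of the gradient. -/
def gsq (f : E3 → ℝ) (x : E3) : ℝ := ∑ i, dder (ee i) f x ^ 2

lemma gsq_nonneg (f : E3 → ℝ) (x : E3) : 0 ≤ gsq f x := Finset.sum_nonneg fun _ _ => sq_nonneg _

lemma gsq_cont {f : E3 → ℝ} (hf : ContDiff ℝ ∞ f) : Continuous (gsq f) :=
  continuous_finsetSum _ fun i _ => (dder_smooth (ee i) hf).continuous.pow 2

lemma norm_fderiv_sq_le (f : E3 → ℝ) (x : E3) : ‖fderiv ℝ f x‖ ^ 2 ≤ gsq f x := by
  have h : ‖fderiv ℝ f x‖ ≤ √(gsq f x) := by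
    refine ContinuousLinearMap.opNorm_le_bound _ (Real.sqrt_nonneg _) fun v => ?_
    rw [fderiv_eq_sum, Real.norm_eq_abs, EuclideanSpace.norm_eq, mul_comm, ← Real.sqrt_mul
      (Finset.sum_nonneg fun _ _ => sq_nonneg _)]
    refine Real.abs_le_sqrt ((Finset.sum_mul_sq_le_sq_mul_sq _ _ _).trans (le_of_eq ?_))
    simp [gsq]
  calc _ ≤ √(gsq f x) ^ 2 := pow_le_pow_left₀ (norm_nonneg _) h 2
    _ = _ := Real.sq_sqrt (gsq_nonneg f x)

/-- The Sobolev inequality in three dimensions. -/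
lemma exists_sobolev : ∃ C : ℝ, 1 ≤ C ∧ ∀ (f : E3 → ℝ) (R : ℝ), Bump f R →
    ∫⁻ x, ENNReal.ofReal |f x| ^ 6 ≤ ENNReal.ofReal C * (∫⁻ x, ENNReal.ofReal (gsq f x)) ^ 3 := by
  set S := SNormLESNormFDerivOfEqConst ℝ (volume : Measure E3) (2 : ℝ≥0) with hS
  refine ⟨max ((S : ℝ) ^ 6) 1, le_max_right _ _, fun f R hf => ?_⟩
  have h := eLpNorm_le_eLpNorm_fderiv_of_eq (μ := (volume : Measure E3)) (hf.smooth.of_le (by simp))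
    hf.compact (p := 2) (p' := 6) (by norm_num) (by simp) (by simp; norm_num)
  rw [eLpNorm_nnreal_eq_lintegral (by norm_num), eLpNorm_nnreal_eq_lintegral (by norm_num)] at h
  have h6 := pow_le_pow_left' h 6
  rw [mul_pow, ← ENNReal.rpow_natCast, ← ENNReal.rpow_natCast (_ ^ (1 / ((2 : ℝ≥0) : ℝ))),
    ← ENNReal.rpow_mul, ← ENNReal.rpow_mul] at h6
  norm_num at h6
  have e1 : ∀ x, ‖f x‖ₑ ^ 6 = ENNReal.ofReal |f x| ^ 6 := fun x => by
    rw [← Real.norm_eq_abs, ofReal_norm]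
  have e2 : ∀ x, ‖fderiv ℝ f x‖ₑ ^ 2 ≤ ENNReal.ofReal (gsq f x) := fun x => by
    rw [← ofReal_norm, ← ENNReal.ofReal_pow (norm_nonneg _)]
    exact ENNReal.ofReal_le_ofReal (norm_fderiv_sq_le f x)
  simp only [e1] at h6
  refine h6.trans (mul_le_mul' ?_ ?_)
  · rw [← ENNReal.ofReal_coe_nnreal, ← ENNReal.ofReal_pow (by positivity)]
    exact ENNReal.ofReal_le_ofReal (le_max_left _ _)
  · exact pow_le_pow_left' (lintegral_mono e2) 3

lemma lintegral_holder_sq {Ω : Type*} [MeasurableSpace Ω] (μ : Measure Ω) {f g : Ω → ℝ≥0∞}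
    (hf : AEMeasurable f μ) (hg : AEMeasurable g μ) :
    (∫⁻ x, f x * g x ∂μ) ^ 2 ≤ (∫⁻ x, f x ^ 2 ∂μ) * ∫⁻ x, g x ^ 2 ∂μ := by
  have h := ENNReal.lintegral_mul_le_Lp_mul_Lq μ (p := 2) (q := 2)
    ⟨by norm_num, by norm_num, by norm_num⟩ hf hg
  refine (pow_le_pow_left' h 2).trans (le_of_eq ?_)
  rw [mul_pow, ← ENNReal.rpow_natCast, ← ENNReal.rpow_natCast, ← ENNReal.rpow_mul,
    ← ENNReal.rpow_mul]
  norm_num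

/-- Ladyzhenskaya's inequality in three dimensions. -/
lemma exists_ladyzhenskaya : ∃ C : ℝ, 1 ≤ C ∧ ∀ (f : E3 → ℝ) (R : ℝ), Bump f R →
    (∫⁻ x, ENNReal.ofReal |f x| ^ 4) ^ 2 ≤
      ENNReal.ofReal C * ((∫⁻ x, ENNReal.ofReal |f x| ^ 2) * (∫⁻ x, ENNReal.ofReal (gsq f x)) ^ 3) := by
  obtain ⟨C, h1, h⟩ := exists_sobolev
  refine ⟨C, h1, fun f R hf => ?_⟩
  have hm : Measurable fun x => ENNReal.ofReal |f x| :=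
    (continuous_abs.comp hf.smooth.continuous).measurable.ennreal_ofReal
  have h2 := lintegral_holder_sq volume hm.aemeasurable (hm.pow_const 3).aemeasurable
  simp only [← pow_succ', ← pow_mul] at h2
  norm_num at h2
  refine h2.trans ?_
  rw [mul_left_comm]
  exact mul_le_mul' le_rfl (h f R hf)

end

section

variable {U : Fin 3 → ℝ × E3 → ℝ} {p : ℝ × E3 → ℝ} {A : ℝ} {ζ φ : E3 → ℝ}

lemma Bump.integral_dder {k : E3 → ℝ} {R : ℝ} (h : Bump k R) (v : E3) :
    ∫ z, _root_.dder v k z = 0 := by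
  have := h.ibp (g := fun _ => 1) contDiff_const v
  have h1 : ∀ z, _root_.dder v (fun _ : E3 => (1 : ℝ)) z = 0 := fun z => by simp [_root_.dder]
  simp only [h1, mul_zero, integral_zero, mul_one] at this
  linarith

lemma energy_algebra (χ q : ℝ) (c w l e qd : Fin 3 → ℝ) (W Lg H : Fin 3 → Fin 3 → ℝ)
    (hw : ∑ j, W j j = 0) (hl : ∑ j, Lg j j = 0) :
    χ ^ 2 * ∑ i, w i * (∑ j, H i j - ∑ j, (w j + l j) * (W i j + Lg i j) - qd i + e i) -
      ∑ j, ((χ * c j + c j * χ) * (∑ i, w i * W i j - 1 / 2 * (∑ i, w i ^ 2) * (w j + l j) - q * w j) +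
        χ ^ 2 * (∑ i, (W i j * W i j + w i * H i j) - (1 / 2 * (∑ i, 2 * (w i * W i j)) * (w j + l j) +
          1 / 2 * (∑ i, w i ^ 2) * (W j j + Lg j j)) - (qd j * w j + q * W j j))) =
    -(χ ^ 2 * ∑ i, ∑ j, W i j ^ 2) + ∑ i, ∑ j, -(2 * χ * c j * w i * W i j) +
      ∑ j, χ * c j * (w j + l j) * (∑ i, w i ^ 2) - ∑ i, ∑ j, χ ^ 2 * (w i * (w j + l j) * Lg i j) +
      ∑ j, 2 * χ * c j * q * w j + ∑ i, χ ^ 2 * (w i * e i) := by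
  simp only [Fin.sum_univ_three] at *
  linear_combination (χ ^ 2 * (1 / 2 * (w 0 ^ 2 + w 1 ^ 2 + w 2 ^ 2) + q)) * hw +
    (χ ^ 2 * (1 / 2 * (w 0 ^ 2 + w 1 ^ 2 + w 2 ^ 2))) * hl

lemma energy_pointwise {χ q g K μ : ℝ} {c w l e : Fin 3 → ℝ} {W Lg : Fin 3 → Fin 3 → ℝ} (h0 : 0 ≤ χ)
    (h1 : χ ≤ 1) (hμ : 0 < μ) (hg : 0 ≤ g) (hK : 0 ≤ K) (hc : ∀ j, |c j| ≤ g) (hl : ∀ j, |l j| ≤ K)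
    (hL : ∀ i j, |Lg i j| ≤ K) :
    -(χ ^ 2 * ∑ i, ∑ j, W i j ^ 2) + ∑ i, ∑ j, -(2 * χ * c j * w i * W i j) +
      ∑ j, χ * c j * (w j + l j) * (∑ i, w i ^ 2) - ∑ i, ∑ j, χ ^ 2 * (w i * (w j + l j) * Lg i j) +
      ∑ j, 2 * χ * c j * q * w j + ∑ i, χ ^ 2 * (w i * e i) ≤
    -(1 / 2 * (χ ^ 2 * ∑ i, ∑ j, W i j ^ 2)) + ((6 * g ^ 2 + 3 * g * K + 4 * g ^ 2 / μ + 3 * K + 2) *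
      (∑ i, w i ^ 2) + 2 * μ * (∑ i, w i ^ 2) ^ 2 + μ * q ^ 2 +
      (∑ j, l j ^ 4 + ∑ i, ∑ j, Lg i j ^ 4) + ∑ i, e i ^ 2) := by
  set s := ∑ i, w i ^ 2 with hs
  have hs0 : 0 ≤ s := Finset.sum_nonneg fun _ _ => sq_nonneg _
  have hχ2 : χ ^ 2 ≤ 1 := pow_le_one₀ h0 h1
  have hc2 : ∀ j, c j ^ 2 ≤ g ^ 2 := fun j => by
    rw [← sq_abs]; exact pow_le_pow_left₀ (abs_nonneg _) (hc j) 2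
  have a1 : ∀ i j, -(2 * χ * c j * w i * W i j) ≤ 1 / 2 * (χ ^ 2 * W i j ^ 2) + 2 * g ^ 2 * w i ^ 2 := by
    intro i j
    have := mul_le_mul_of_nonneg_right (hc2 j) (sq_nonneg (w i))
    nlinarith [sq_nonneg (χ * W i j + 2 * c j * w i)]
  have hχc : ∀ j, |χ * c j| ≤ g := fun j => by
    rw [abs_mul, abs_of_nonneg h0]
    exact (mul_le_of_le_one_left (abs_nonneg _) h1).trans (hc j)
  have young : ∀ a b η : ℝ, 0 < η → a * b ≤ η / 2 * a ^ 2 + b ^ 2 / (2 * η) := fun a b η hη => by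
    have h3 : η / 2 * a ^ 2 + b ^ 2 / (2 * η) - a * b = (η * a - b) ^ 2 / (2 * η) := by
      field_simp; ring
    have : 0 ≤ (η * a - b) ^ 2 / (2 * η) := by positivity
    linarith
  have a2 : ∀ j, χ * c j * (w j + l j) * s ≤ μ / 2 * s ^ 2 + g ^ 2 * w j ^ 2 / (2 * μ) + g * K * s := by
    intro j
    have b1 : χ * c j * l j * s ≤ g * K * s := by
      refine mul_le_mul_of_nonneg_right ((le_abs_self _).trans ?_) hs0
      rw [abs_mul]
      exact mul_le_mul (hχc j) (hl j) (abs_nonneg _) hg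
    have b2 := young s (χ * c j * w j) μ hμ
    have b3 : (χ * c j * w j) ^ 2 / (2 * μ) ≤ g ^ 2 * w j ^ 2 / (2 * μ) := by
      refine div_le_div_of_nonneg_right ?_ (by positivity)
      rw [mul_pow]
      refine mul_le_mul_of_nonneg_right ?_ (sq_nonneg _)
      rw [← sq_abs]; exact pow_le_pow_left₀ (abs_nonneg _) (hχc j) 2
    nlinarith
  have a3 : ∀ i j, -(χ ^ 2 * (w i * (w j + l j) * Lg i j)) ≤
      K / 2 * (w i ^ 2 + w j ^ 2) + 1 / 2 * w i ^ 2 + 1 / 4 * (l j ^ 4 + Lg i j ^ 4) := by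
    intro i j
    have b1 : -(w i * (w j + l j) * Lg i j) ≤
        K / 2 * (w i ^ 2 + w j ^ 2) + 1 / 2 * w i ^ 2 + 1 / 4 * (l j ^ 4 + Lg i j ^ 4) := by
      have c1 : -(w i * w j * Lg i j) ≤ K / 2 * (w i ^ 2 + w j ^ 2) := by
        have d1 : |w i * w j| ≤ 1 / 2 * (w i ^ 2 + w j ^ 2) := by
          rw [abs_le]; constructor <;> nlinarith [sq_nonneg (w i + w j), sq_nonneg (w i - w j)]
        calc _ ≤ |w i * w j| * |Lg i j| := by rw [← abs_mul]; exact neg_le_abs _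
          _ ≤ (1 / 2 * (w i ^ 2 + w j ^ 2)) * K := mul_le_mul d1 (hL i j) (abs_nonneg _) (by positivity)
          _ = _ := by ring
      nlinarith [sq_nonneg (w i + l j * Lg i j), sq_nonneg (l j ^ 2 - Lg i j ^ 2)]
    have b0 : 0 ≤ K / 2 * (w i ^ 2 + w j ^ 2) + 1 / 2 * w i ^ 2 + 1 / 4 * (l j ^ 4 + Lg i j ^ 4) := by
      positivity
    nlinarith [sq_nonneg χ]
  have a4 : ∀ j, 2 * χ * c j * q * w j ≤ μ / 3 * q ^ 2 + 3 * g ^ 2 * w j ^ 2 / μ := by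
    intro j
    have b2 := young q (2 * (χ * c j * w j)) (2 * μ / 3) (by positivity)
    have b3 : (2 * (χ * c j * w j)) ^ 2 / (2 * (2 * μ / 3)) ≤ 3 * g ^ 2 * w j ^ 2 / μ := by
      rw [div_le_div_iff₀ (by positivity) hμ]
      have : (χ * c j) ^ 2 ≤ g ^ 2 := by
        rw [← sq_abs]; exact pow_le_pow_left₀ (abs_nonneg _) (hχc j) 2
      have h3 := mul_le_mul_of_nonneg_right this (mul_nonneg (sq_nonneg (w j)) hμ.le)
      nlinarith
    nlinarith
  have a5 : ∀ i, χ ^ 2 * (w i * e i) ≤ 1 / 2 * w i ^ 2 + 1 / 2 * e i ^ 2 := fun i => by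
    have : w i * e i ≤ 1 / 2 * w i ^ 2 + 1 / 2 * e i ^ 2 := by nlinarith [sq_nonneg (w i - e i)]
    have b0 : 0 ≤ 1 / 2 * w i ^ 2 + 1 / 2 * e i ^ 2 := by positivity
    nlinarith [sq_nonneg χ]
  have s1 := Finset.sum_le_sum fun i (_ : i ∈ Finset.univ) => Finset.sum_le_sum
    fun j (_ : j ∈ Finset.univ) => a1 i j
  have s2 := Finset.sum_le_sum fun j (_ : j ∈ Finset.univ) => a2 j
  have s3 := Finset.sum_le_sum fun i (_ : i ∈ Finset.univ) => Finset.sum_le_sum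
    fun j (_ : j ∈ Finset.univ) => a3 i j
  have s4 := Finset.sum_le_sum fun j (_ : j ∈ Finset.univ) => a4 j
  have s5 := Finset.sum_le_sum fun i (_ : i ∈ Finset.univ) => a5 i
  have hl4 : ∀ j, 0 ≤ l j ^ 4 := fun j => by positivity
  have hL4 : ∀ i j, 0 ≤ Lg i j ^ 4 := fun i j => by positivity
  have he2 : ∀ i, 0 ≤ e i ^ 2 := fun i => sq_nonneg _
  have hgm : 0 ≤ g ^ 2 * s / μ := by positivity
  have e1 : g ^ 2 * w 0 ^ 2 / (2 * μ) + g ^ 2 * w 1 ^ 2 / (2 * μ) + g ^ 2 * w 2 ^ 2 / (2 * μ) =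
      1 / 2 * (g ^ 2 * s / μ) := by
    rw [hs, Fin.sum_univ_three]; field_simp
  have e2 : 3 * g ^ 2 * w 0 ^ 2 / μ + 3 * g ^ 2 * w 1 ^ 2 / μ + 3 * g ^ 2 * w 2 ^ 2 / μ =
      3 * (g ^ 2 * s / μ) := by
    rw [hs, Fin.sum_univ_three]; field_simp
  have e3 : (6 * g ^ 2 + 3 * g * K + 4 * g ^ 2 / μ + 3 * K + 2) * s =
    (6 * g ^ 2 + 3 * g * K + 3 * K + 2) * s + 4 * (g ^ 2 * s / μ) := by ring
  have hws : w 0 ^ 2 + w 1 ^ 2 + w 2 ^ 2 = s := by rw [hs, Fin.sum_univ_three]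
  have hμs : 0 ≤ μ * s ^ 2 := by positivity
  have hKs : 0 ≤ K * s := by positivity
  rw [e3]
  simp only [Fin.sum_univ_three, Finset.sum_neg_distrib] at s1 s2 s3 s4 s5 ⊢
  have m1 : g ^ 2 * (w 0 ^ 2 + w 1 ^ 2 + w 2 ^ 2) = g ^ 2 * s := by rw [hws]
  have m2 : K * (w 0 ^ 2 + w 1 ^ 2 + w 2 ^ 2) = K * s := by rw [hws]
  linarith [hl4 0, hl4 1, hl4 2, hL4 0 0, hL4 0 1, hL4 0 2, hL4 1 0, hL4 1 1, hL4 1 2, hL4 2 0,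
    hL4 2 1, hL4 2 2, he2 0, he2 1, he2 2]

end

section

variable {U : Fin 3 → ℝ × E3 → ℝ} {p : ℝ × E3 → ℝ} {A : ℝ} {ζ φ : E3 → ℝ}

lemma dder_sq {f : E3 → ℝ} (v : E3) (hf : ContDiff ℝ ∞ f) :
    dder v (fun x => f x ^ 2) = fun x => 2 * (f x * dder v f x) := by
  have : (fun x => f x ^ 2) = fun x => f x * f x := by funext x; ring
  rw [this, dder_mul _ hf hf]
  funext x; ring

/-- A time slice of the perturbed system satisfied by the rough part `w` of the velocity, together
with the bounds on the mild part `l`, the remainder `e` and the pressure `q`. -/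
structure ESl (w l e : Fin 3 → E3 → ℝ) (q : E3 → ℝ) (K : ℝ) : Prop where
  sw : ∀ i, ContDiff ℝ ∞ (w i)
  sl : ∀ i, ContDiff ℝ ∞ (l i)
  se : ∀ i, ContDiff ℝ ∞ (e i)
  sq : ContDiff ℝ ∞ q
  K1 : 1 ≤ K
  dw : ∀ x, ∑ j, dder (ee j) (w j) x = 0
  dl : ∀ x, ∑ j, dder (ee j) (l j) x = 0
  w2 : ∀ i, ∫⁻ x, ENNReal.ofReal (w i x ^ 2) ≤ ENNReal.ofReal K
  l0 : ∀ i x, |l i x| ≤ K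
  l1 : ∀ i j x, |dder (ee j) (l i) x| ≤ K
  l4 : ∀ i, ∫⁻ x, ENNReal.ofReal (l i x ^ 4) ≤ ENNReal.ofReal K
  m4 : ∀ i j, ∫⁻ x, ENNReal.ofReal (dder (ee j) (l i) x ^ 4) ≤ ENNReal.ofReal K
  e2 : ∀ i, ∫⁻ x, ENNReal.ofReal (e i x ^ 2) ≤ ENNReal.ofReal K
  q2 : ∀ ρ δ, 0 ≤ ρ → 0 < δ → δ ≤ 1 → ∫⁻ x in closedBall (0 : E3) ρ, ENNReal.ofReal (q x ^ 2) ≤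
    ENNReal.ofReal K * (∫⁻ x in closedBall (0 : E3) (ρ + 2 * δ), ENNReal.ofReal ((∑ i, w i x ^ 2) ^ 2)) +
      ENNReal.ofReal (K * δ⁻¹ ^ 3)

/-- The right-hand side of the perturbed system. -/
def rhs (w l e : Fin 3 → E3 → ℝ) (q : E3 → ℝ) (i : Fin 3) (x : E3) : ℝ :=
  lapl (w i) x - ∑ j, (w j x + l j x) * (dder (ee j) (w i) x + dder (ee j) (l i) x) -
    dder (ee i) q x + e i x

variable {w l e : Fin 3 → E3 → ℝ} {q : E3 → ℝ} {K : ℝ}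

/-- The flux in the local energy balance. -/
def flux (χ : E3 → ℝ) (w l : Fin 3 → E3 → ℝ) (q : E3 → ℝ) (j : Fin 3) (x : E3) : ℝ :=
  χ x * χ x * (∑ i, w i x * dder (ee j) (w i) x - 1 / 2 * (∑ i, w i x ^ 2) * (w j x + l j x) -
    q x * w j x)

lemma ESl.s_smooth (h : ESl w l e q K) : ContDiff ℝ ∞ fun x => ∑ i, w i x ^ 2 :=
  ContDiff.sum fun i _ => (h.sw i).pow 2

lemma ESl.rhs_cont (h : ESl w l e q K) (i : Fin 3) : Continuous (rhs w l e q i) := by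
  have c1 := (lapl_smooth (h.sw i)).continuous
  have c2 := fun j => (dder_smooth (ee j) (h.sw i)).continuous
  have c3 := fun j => (dder_smooth (ee j) (h.sl i)).continuous
  have c4 := (dder_smooth (ee i) h.sq).continuous
  have c5 := (h.se i).continuous
  have c6 := fun j => (h.sw j).continuous
  have c7 := fun j => (h.sl j).continuous
  unfold rhs
  fun_prop

lemma ESl.dder_flux (h : ESl w l e q K) {χ : E3 → ℝ} (hχ : ContDiff ℝ ∞ χ) (j : Fin 3) (x : E3) :
    dder (ee j) (flux χ w l q j) x =
      (χ x * dder (ee j) χ x + dder (ee j) χ x * χ x) * (∑ i, w i x * dder (ee j) (w i) x -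
        1 / 2 * (∑ i, w i x ^ 2) * (w j x + l j x) - q x * w j x) +
      χ x ^ 2 * (∑ i, (dder (ee j) (w i) x * dder (ee j) (w i) x +
        w i x * dder (ee j) (dder (ee j) (w i)) x) -
        (1 / 2 * (∑ i, 2 * (w i x * dder (ee j) (w i) x)) * (w j x + l j x) +
          1 / 2 * (∑ i, w i x ^ 2) * (dder (ee j) (w j) x + dder (ee j) (l j) x)) -
        (dder (ee j) q x * w j x + q x * dder (ee j) (w j) x)) := by
  have hd := fun i => dder_smooth (ee j) (h.sw i)
  have s1 : ∀ i, ContDiff ℝ ∞ fun x => w i x * dder (ee j) (w i) x := fun i => (h.sw i).mul (hd i)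
  have s1' : ContDiff ℝ ∞ fun x => ∑ i, w i x * dder (ee j) (w i) x := ContDiff.sum fun i _ => s1 i
  have s2 : ContDiff ℝ ∞ fun x => 1 / 2 * ∑ i, w i x ^ 2 := contDiff_const.mul h.s_smooth
  have s3 : ContDiff ℝ ∞ fun x => w j x + l j x := (h.sw j).add (h.sl j)
  have s4 : ContDiff ℝ ∞ fun x => 1 / 2 * (∑ i, w i x ^ 2) * (w j x + l j x) := s2.mul s3
  have s5 : ContDiff ℝ ∞ fun x => q x * w j x := h.sq.mul (h.sw j)
  unfold flux
  rw [dder_mul _ (hχ.mul hχ) ((s1'.sub s4).sub s5), dder_mul _ hχ hχ, dder_sub _ (s1'.sub s4) s5,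
    dder_sub _ s1' s4, dder_sum _ _ s1, dder_mul _ s2 s3, dder_add _ (h.sw j) (h.sl j),
    dder_const_mul _ _ h.s_smooth, dder_sum _ _ fun i => (h.sw i).pow 2, dder_mul _ h.sq (h.sw j)]
  simp only [dder_mul _ (h.sw _) (hd _), dder_sq _ (h.sw _)]
  ring

lemma ESl.integral_energy (h : ESl w l e q K) {χ : E3 → ℝ} {R : ℝ} (hχ : Bump χ R) :
    ∫ x, χ x ^ 2 * ∑ i, w i x * rhs w l e q i x =
      ∫ x, (χ x ^ 2 * ∑ i, w i x * rhs w l e q i x - ∑ j, dder (ee j) (flux χ w l q j) x) := by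
  have hb : ∀ j, Bump (flux χ w l q j) R := fun j => by
    have hd := fun i => dder_smooth (ee j) (h.sw i)
    refine (hχ.mul hχ.smooth).mul (((ContDiff.sum fun i _ => (h.sw i).mul (hd i)).sub
      ((contDiff_const.mul h.s_smooth).mul ((h.sw j).add (h.sl j)))).sub (h.sq.mul (h.sw j)))
  have i1 : Integrable fun x => χ x ^ 2 * ∑ i, w i x * rhs w l e q i x := by
    have := hχ.integrable_mul (g := fun x => χ x * ∑ i, w i x * rhs w l e q i x)
      (hχ.smooth.continuous.mul (continuous_finsetSum _ fun i _ => (h.sw i).continuous.mul (h.rhs_cont i)))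
    refine this.congr (Eventually.of_forall fun x => ?_)
    beta_reduce; ring
  rw [integral_sub i1 (integrable_finsetSum _ fun j _ => ((hb j).dder _).integrable),
    integral_finsetSum _ fun j _ => ((hb j).dder _).integrable]
  simp only [(hb _).integral_dder, Finset.sum_const_zero, sub_zero]

/-- The energy dissipated in a ball. -/
def dis (w : Fin 3 → E3 → ℝ) (r : ℝ) : ℝ := ∫ x in closedBall (0 : E3) r, ∑ i, gsq (w i) x

lemma ESl.dis_cont (h : ESl w l e q K) : Continuous fun x => ∑ i, gsq (w i) x :=
  continuous_finsetSum _ fun i _ => gsq_cont (h.sw i)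

lemma integrableOn_ball {f : E3 → ℝ} (hf : Continuous f) (r : ℝ) :
    IntegrableOn f (closedBall (0 : E3) r) :=
  hf.continuousOn.integrableOn_compact (isCompact_closedBall _ _)

lemma ESl.energy_le (h : ESl w l e q K) {χ : E3 → ℝ} {M ρ δ μ : ℝ} (hχ : Cut M ρ δ χ) (hM : 0 ≤ M)
    (hδ : 0 < δ) (hμ : 0 < μ) :
    ∫ x, χ x ^ 2 * ∑ i, w i x * rhs w l e q i x ≤ -(1 / 2 * dis w ρ) +
      ((6 * (M * δ⁻¹) ^ 2 + 3 * (M * δ⁻¹) * K + 4 * (M * δ⁻¹) ^ 2 / μ + 3 * K + 2) *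
        (∫ x in closedBall (0 : E3) (ρ + δ), ∑ i, w i x ^ 2) +
      2 * μ * (∫ x in closedBall (0 : E3) (ρ + δ), (∑ i, w i x ^ 2) ^ 2) +
      μ * (∫ x in closedBall (0 : E3) (ρ + δ), q x ^ 2) +
      (∫ x in closedBall (0 : E3) (ρ + δ), (∑ j, l j x ^ 4 + ∑ i, ∑ j, dder (ee j) (l i) x ^ 4)) +
      ∫ x in closedBall (0 : E3) (ρ + δ), ∑ i, e i x ^ 2) := by
  have hK : 0 ≤ K := zero_le_one.trans h.K1
  have hg : 0 ≤ M * δ⁻¹ := by positivity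
  set B := closedBall (0 : E3) (ρ + δ) with hB
  have key := fun x => energy_algebra (χ x) (q x) (fun j => dder (ee j) χ x) (fun i => w i x)
    (fun i => l i x) (fun i => e i x) (fun i => dder (ee i) q x) (fun i j => dder (ee j) (w i) x)
    (fun i j => dder (ee j) (l i) x) (fun i j => dder (ee j) (dder (ee j) (w i)) x) (h.dw x) (h.dl x)
  have pw := fun x => energy_pointwise (q := q x) (w := fun i => w i x) (e := fun i => e i x)
    (W := fun i j => dder (ee j) (w i) x)
    (hχ.nonneg x) (hχ.le_one x) hμ hg hK (fun j => hχ.slope j x)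
    (fun j => h.l0 j x) fun i j => h.l1 i j x
  have cc := hχ.bump.smooth.continuous
  have c1 := fun i => (h.sw i).continuous
  have c2 := fun i => (h.sl i).continuous
  have c3 := fun i j => (dder_smooth (ee j) (h.sl i)).continuous
  have c4 := h.sq.continuous
  have c5 := fun i => (h.se i).continuous
  have c6 := h.dis_cont
  have c7 := fun i j => (dder_smooth (ee j) (h.sw i)).continuous
  have I := fun {f : E3 → ℝ} (hf : Continuous f) => integrableOn_ball hf (ρ + δ)
  rw [h.integral_energy hχ.bump]
  have ef : (fun x => χ x ^ 2 * ∑ i, w i x * rhs w l e q i x - ∑ j, dder (ee j) (flux χ w l q j) x) =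
      fun x => _ := funext fun x => by
    simp only [h.dder_flux hχ.bump.smooth]
    exact key x
  rw [ef]
  have hout : ∀ x ∉ B, χ x = 0 ∧ ∀ j, dder (ee j) χ x = 0 := fun x hx => by
    have : ρ + δ < ‖x‖ := by simpa [hB] using hx
    exact ⟨hχ.bump.supp x this, fun j => (hχ.bump.dder _).supp x this⟩
  rw [← setIntegral_eq_integral_of_forall_compl_eq_zero (s := B) fun x hx => by
    simp [(hout x hx).1]]
  have cd := fun j => (dder_smooth (ee j) hχ.bump.smooth).continuous
  refine (setIntegral_mono_on (I (by fun_prop)) (I (by fun_prop)) measurableSet_closedBall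
    fun x _ => pw x).trans ?_
  have i1 : Continuous fun x => -(1 / 2 * (χ x ^ 2 * ∑ i, ∑ j, dder (ee j) (w i) x ^ 2)) := by fun_prop
  have i2 : Continuous fun x => (6 * (M * δ⁻¹) ^ 2 + 3 * (M * δ⁻¹) * K + 4 * (M * δ⁻¹) ^ 2 / μ + 3 * K + 2) *
    ∑ i, w i x ^ 2 := by fun_prop
  have i3 : Continuous fun x => 2 * μ * (∑ i, w i x ^ 2) ^ 2 := by fun_prop
  have i4 : Continuous fun x => μ * q x ^ 2 := by fun_prop
  have i5 : Continuous fun x => ∑ j, l j x ^ 4 + ∑ i, ∑ j, dder (ee j) (l i) x ^ 4 := by fun_prop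
  have i6 : Continuous fun x => ∑ i, e i x ^ 2 := by fun_prop
  have i23 := i2.add i3
  have i24 := i23.add i4
  have i25 := i24.add i5
  have i26 := i25.add i6
  simp only [Pi.add_def] at i23 i24 i25 i26
  rw [integral_add (I i1) (I i26), integral_add (I i25) (I i6), integral_add (I i24) (I i5),
    integral_add (I i23) (I i4), integral_add (I i2) (I i3), integral_const_mul,
    integral_const_mul, integral_const_mul, integral_neg, integral_const_mul]
  refine add_le_add ?_ le_rfl
  have hd : dis w ρ ≤ ∫ x in B, χ x ^ 2 * ∑ i, ∑ j, dder (ee j) (w i) x ^ 2 := by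
    have hsub : closedBall (0 : E3) ρ ⊆ B := closedBall_subset_closedBall (by linarith)
    have i0 : Continuous fun x => χ x ^ 2 * ∑ i, ∑ j, dder (ee j) (w i) x ^ 2 := by fun_prop
    calc dis w ρ = ∫ x in closedBall (0 : E3) ρ, χ x ^ 2 * ∑ i, ∑ j, dder (ee j) (w i) x ^ 2 := by
          refine setIntegral_congr_fun measurableSet_closedBall fun x hx => ?_
          simp only [hχ.one x (by simpa using hx), one_pow, one_mul, gsq]
      _ ≤ _ := setIntegral_mono_set (I i0) (Eventually.of_forall fun x => by
            have := Finset.sum_nonneg fun (i : Fin 3) (_ : i ∈ Finset.univ) => gsq_nonneg (w i) x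
            exact mul_nonneg (sq_nonneg _) this) hsub.eventuallyLE
  linarith

end

section

variable {U : Fin 3 → ℝ × E3 → ℝ} {p : ℝ × E3 → ℝ} {A : ℝ} {ζ φ : E3 → ℝ}

variable {w l e : Fin 3 → E3 → ℝ} {q : E3 → ℝ} {K : ℝ}

lemma setIntegral_le_of_lintegral {f : E3 → ℝ} (hf : Continuous f) (h0 : ∀ x, 0 ≤ f x) {s : Set E3}
    {k : ℝ} (hk : 0 ≤ k) (h : ∫⁻ x in s, ENNReal.ofReal (f x) ≤ ENNReal.ofReal k) :
    ∫ x in s, f x ≤ k := by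
  rw [integral_eq_lintegral_of_nonneg_ae (Eventually.of_forall h0) hf.aestronglyMeasurable]
  exact ENNReal.toReal_le_of_le_ofReal hk h

lemma lintegral_ball_eq {f : E3 → ℝ} (hf : Continuous f) (h0 : ∀ x, 0 ≤ f x) (r : ℝ) :
    ∫⁻ x in closedBall (0 : E3) r, ENNReal.ofReal (f x) =
      ENNReal.ofReal (∫ x in closedBall (0 : E3) r, f x) :=
  (ofReal_integral_eq_lintegral_ofReal (integrableOn_ball hf r) (Eventually.of_forall h0)).symm

lemma slice_energy_numeric {K L g r D X Y Y' Q t E E' : ℝ} (hK : 1 ≤ K) (hL : 1 ≤ L) (hg : 1 ≤ g)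
    (hr : 1 ≤ r) (hrD : r ^ 2 = 2 * D + 6 * g ^ 2 * K + 1)
    (hX : X ≤ 3 * K) (hY' : Y' ≤ Y) (hY : Y ≤ 9 * (L * K * r ^ 3)) (hQ : Q ≤ K * Y + K * t)
    (ht : t ≤ g ^ 4) (hE : E ≤ 12 * K) (hE' : E' ≤ 3 * K) :
    (6 * g ^ 2 + 3 * g * K + 4 * g ^ 2 / (1 / (6912 * L * K ^ 2 * r)) + 3 * K + 2) * X +
      2 * (1 / (6912 * L * K ^ 2 * r)) * Y' + 1 / (6912 * L * K ^ 2 * r) * Q + E + E' ≤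
      1 / 64 * D + (100 + 36 * 6912 ^ 2 * 256 * L ^ 2) * K ^ 6 * g ^ 4 := by
  have hK0 : 0 < K := by linarith
  have hL0 : 0 < L := by linarith
  have hr0 : 0 < r := by linarith
  have hg0 : 0 < g := by linarith
  set m := 1 / (6912 * L * K ^ 2 * r) with hm
  have hm0 : 0 < m := by positivity
  have hm1 : m ≤ 1 := by
    rw [hm, div_le_one (by positivity)]
    have h1 : 1 ≤ L * K ^ 2 := one_le_mul_of_one_le_of_one_le hL (one_le_pow₀ hK)
    have h2 := one_le_mul_of_one_le_of_one_le h1 hr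
    linarith
  have hd : 4 * g ^ 2 / m = 4 * g ^ 2 * (6912 * L * K ^ 2 * r) := by rw [hm, div_div_eq_mul_div, div_one]
  have e1 : m * (3 * K * (9 * (L * K * r ^ 3))) = 1 / 256 * r ^ 2 := by
    rw [hm]; field_simp; ring
  have e2 : 2 * m * Y' + m * Q ≤ 1 / 256 * r ^ 2 + K * g ^ 4 := by
    have h1 : 2 * m * Y' ≤ 2 * m * (K * (9 * (L * K * r ^ 3))) := by
      refine mul_le_mul_of_nonneg_left ((hY'.trans hY).trans ?_) (by positivity)
      exact le_mul_of_one_le_left (by positivity) hK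
    have h2 : m * Q ≤ m * (K * (9 * (L * K * r ^ 3))) + m * (K * g ^ 4) := by
      rw [← mul_add]
      exact mul_le_mul_of_nonneg_left (hQ.trans (by gcongr)) hm0.le
    have h3 : m * (K * g ^ 4) ≤ K * g ^ 4 := mul_le_of_le_one_left (by positivity) hm1
    linarith
  have e3 : (6 * g ^ 2 + 3 * g * K + 4 * g ^ 2 / m + 3 * K + 2) * X ≤
      (6 * g ^ 2 + 3 * g * K + 4 * g ^ 2 * (6912 * L * K ^ 2 * r) + 3 * K + 2) * (3 * K) := by
    rw [hd]
    exact mul_le_mul_of_nonneg_left hX (by positivity)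
  have e4 : 4 * g ^ 2 * (6912 * L * K ^ 2 * r) * (3 * K) ≤
      1 / 256 * r ^ 2 + 36 * 6912 ^ 2 * 256 * L ^ 2 * K ^ 6 * g ^ 4 := by
    nlinarith [sq_nonneg (1 / 16 * r - 16 * (6 * 6912 * g ^ 2 * L * K ^ 3))]
  have k1 : K ≤ K ^ 6 := le_self_pow₀ hK (by norm_num)
  have k2 : K ^ 2 ≤ K ^ 6 := pow_le_pow_right₀ hK (by norm_num)
  have g1 : g ≤ g ^ 4 := le_self_pow₀ hg (by norm_num)
  have g2 : g ^ 2 ≤ g ^ 4 := pow_le_pow_right₀ hg (by norm_num)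
  have g0 : 1 ≤ g ^ 4 := one_le_pow₀ hg
  have k0 : 1 ≤ K ^ 6 := one_le_pow₀ hK
  have m1 : K * g ^ 2 ≤ K ^ 6 * g ^ 4 := by gcongr
  have m2 : K ^ 2 * g ≤ K ^ 6 * g ^ 4 := by gcongr
  have m3 : K ^ 2 * 1 ≤ K ^ 6 * g ^ 4 := by gcongr
  have m4 : K * 1 ≤ K ^ 6 * g ^ 4 := by gcongr
  have m5 : K * g ^ 4 ≤ K ^ 6 * g ^ 4 := by gcongr
  have m6 : 1 * 1 ≤ K ^ 6 * g ^ 4 := by gcongr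
  nlinarith

lemma dder_bump_mul_sq_le {χ f : E3 → ℝ} {g : ℝ} (hχ : ContDiff ℝ ∞ χ) (hf : ContDiff ℝ ∞ f) {x : E3}
    (h0 : 0 ≤ χ x) (h1 : χ x ≤ 1) (hg : ∀ i, |dder (ee i) χ x| ≤ g) :
    gsq (fun x => χ x * f x) x ≤ 2 * gsq f x + 6 * g ^ 2 * f x ^ 2 := by
  have key : ∀ i, dder (ee i) (fun x => χ x * f x) x ^ 2 ≤
      2 * dder (ee i) f x ^ 2 + 2 * g ^ 2 * f x ^ 2 := fun i => by
    rw [dder_mul _ hχ hf]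
    beta_reduce
    have a1 : χ x ^ 2 ≤ 1 := pow_le_one₀ h0 h1
    have a2 : dder (ee i) χ x ^ 2 ≤ g ^ 2 := sq_le_sq' (abs_le.1 (hg i)).1 (abs_le.1 (hg i)).2
    have a3 := mul_le_mul_of_nonneg_right a1 (sq_nonneg (dder (ee i) f x))
    have a4 := mul_le_mul_of_nonneg_right a2 (sq_nonneg (f x))
    nlinarith [sq_nonneg (dder (ee i) χ x * f x - χ x * dder (ee i) f x)]
  calc gsq (fun x => χ x * f x) x ≤ ∑ i, (2 * dder (ee i) f x ^ 2 + 2 * g ^ 2 * f x ^ 2) :=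
        Finset.sum_le_sum fun i _ => key i
    _ = _ := by
        rw [Finset.sum_add_distrib, ← Finset.mul_sum, Finset.sum_const]
        simp [gsq]; ring

/-- The constant of the Ladyzhenskaya inequality. -/
def Lad (L : ℝ) : Prop := ∀ (f : E3 → ℝ) (R : ℝ), Bump f R →
  (∫⁻ x, ENNReal.ofReal |f x| ^ 4) ^ 2 ≤
    ENNReal.ofReal L * ((∫⁻ x, ENNReal.ofReal |f x| ^ 2) * (∫⁻ x, ENNReal.ofReal (gsq f x)) ^ 3)

lemma dis_nonneg (w : Fin 3 → E3 → ℝ) (r : ℝ) : 0 ≤ dis w r :=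
  integral_nonneg fun _ => Finset.sum_nonneg fun _ _ => gsq_nonneg _ _

lemma ESl.four_le (h : ESl w l e q K) {L M ρ δ r : ℝ} {χ : E3 → ℝ} (hL1 : 1 ≤ L) (hL : Lad L)
    (hχ : Cut M ρ δ χ) (hr : 0 ≤ r)
    (hrD : 2 * dis w (ρ + δ) + 6 * (M * δ⁻¹) ^ 2 * K ≤ r ^ 2) :
    ∫⁻ x in closedBall (0 : E3) ρ, ENNReal.ofReal ((∑ i, w i x ^ 2) ^ 2) ≤
      ENNReal.ofReal (9 * (L * K * r ^ 3)) := by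
  have hK := h.K1
  have hB := fun i => hχ.bump.mul (h.sw i)
  have cg := fun i => gsq_cont (h.sw i)
  have l2 : ∀ i, ∫⁻ x, ENNReal.ofReal |χ x * w i x| ^ 2 ≤ ENNReal.ofReal K := fun i => by
    refine (lintegral_mono fun x => ?_).trans (h.w2 i)
    rw [← ofReal_sq_eq]
    refine ENNReal.ofReal_le_ofReal ?_
    rw [mul_pow]
    exact mul_le_of_le_one_left (sq_nonneg _) (pow_le_one₀ (hχ.nonneg x) (hχ.le_one x))
  have lg : ∀ i, ∫⁻ x, ENNReal.ofReal (gsq (fun x => χ x * w i x) x) ≤ ENNReal.ofReal (r ^ 2) := fun i => by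
    have hz : ∀ x ∉ closedBall (0 : E3) (ρ + δ), gsq (fun x => χ x * w i x) x = 0 := fun x hx => by
      have : ρ + δ < ‖x‖ := by simpa using hx
      simp only [gsq, ((hB i).dder _).supp x this]
      norm_num
    rw [← setLIntegral_eq_of_support_subset (s := closedBall (0 : E3) (ρ + δ)) (μ := volume) fun x hx => by
      by_contra hxx
      exact hx (by simp [hz x hxx])]
    have c0 : Continuous fun x => 2 * gsq (w i) x := continuous_const.mul (cg i)
    calc ∫⁻ x in closedBall (0 : E3) (ρ + δ), ENNReal.ofReal (gsq (fun x => χ x * w i x) x)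
        ≤ ∫⁻ x in closedBall (0 : E3) (ρ + δ), (ENNReal.ofReal (2 * ∑ i, gsq (w i) x) +
          ENNReal.ofReal (6 * (M * δ⁻¹) ^ 2) * ENNReal.ofReal (w i x ^ 2)) := lintegral_mono fun x => by
            rw [← ENNReal.ofReal_mul (by positivity), ← ENNReal.ofReal_add (by
              have := Finset.sum_nonneg fun (i : Fin 3) (_ : i ∈ Finset.univ) => gsq_nonneg (w i) x
              positivity) (by positivity)]
            refine ENNReal.ofReal_le_ofReal ?_
            have h1 := dder_bump_mul_sq_le hχ.bump.smooth (h.sw i) (hχ.nonneg x) (hχ.le_one x)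
              fun j => hχ.slope j x
            have h2 := Finset.single_le_sum (fun j _ => gsq_nonneg (w j) x) (Finset.mem_univ i)
            linarith
      _ ≤ ENNReal.ofReal (2 * dis w (ρ + δ)) + ENNReal.ofReal (6 * (M * δ⁻¹) ^ 2) * ENNReal.ofReal K := by
            have cc : Continuous fun x => 2 * ∑ i, gsq (w i) x := continuous_const.mul h.dis_cont
            rw [lintegral_add_left (by fun_prop), lintegral_const_mul' _ _ ENNReal.ofReal_ne_top,
              lintegral_ball_eq cc fun x => by
                have := Finset.sum_nonneg fun (i : Fin 3) (_ : i ∈ Finset.univ) => gsq_nonneg (w i) x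
                positivity]
            rw [integral_const_mul]
            exact add_le_add le_rfl (mul_le_mul' le_rfl ((setLIntegral_le_lintegral _ _).trans (h.w2 i)))
      _ ≤ ENNReal.ofReal (r ^ 2) := by
            rw [← ENNReal.ofReal_mul (by positivity), ← ENNReal.ofReal_add (by
              have := dis_nonneg w (ρ + δ); positivity) (by positivity)]
            exact ENNReal.ofReal_le_ofReal hrD
  have l4 : ∀ i, ∫⁻ x, ENNReal.ofReal |χ x * w i x| ^ 4 ≤ ENNReal.ofReal (L * K * r ^ 3) := fun i => by
    have hLK : 1 ≤ L * K := one_le_mul_of_one_le_of_one_le hL1 hK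
    refine (ENNReal.pow_le_pow_left_iff two_ne_zero).1 ((hL _ _ (hB i)).trans ?_)
    calc _ ≤ ENNReal.ofReal L * (ENNReal.ofReal K * ENNReal.ofReal (r ^ 2) ^ 3) :=
          mul_le_mul' le_rfl (mul_le_mul' (l2 i) (pow_le_pow_left' (lg i) 3))
      _ = ENNReal.ofReal (L * (K * (r ^ 2) ^ 3)) := by
          rw [ENNReal.ofReal_mul (by positivity), ENNReal.ofReal_mul (by positivity),
            ENNReal.ofReal_pow (sq_nonneg r)]
      _ ≤ _ := by
          rw [← ENNReal.ofReal_pow (by positivity)]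
          refine ENNReal.ofReal_le_ofReal ?_
          have : (L * K * r ^ 3) ^ 2 = (L * K) * (L * (K * (r ^ 2) ^ 3)) := by ring
          rw [this]
          exact le_mul_of_one_le_left (by positivity) hLK
  calc ∫⁻ x in closedBall (0 : E3) ρ, ENNReal.ofReal ((∑ i, w i x ^ 2) ^ 2)
      ≤ ∫⁻ x in closedBall (0 : E3) ρ, 3 * ∑ i, ENNReal.ofReal |χ x * w i x| ^ 4 := by
        refine setLIntegral_mono' measurableSet_closedBall fun x hx => ?_
        rw [ofReal_sq_eq, abs_of_nonneg (Finset.sum_nonneg fun i _ => sq_nonneg _),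
          ENNReal.ofReal_sum_of_nonneg fun i _ => sq_nonneg _]
        refine (ennreal_sum_sq_le _ _).trans (le_of_eq ?_)
        simp only [hχ.one x (by simpa using hx), one_mul, ofReal_sq_eq, ← pow_mul]
        norm_num
    _ ≤ 3 * ∑ i, ∫⁻ x, ENNReal.ofReal |χ x * w i x| ^ 4 := by
        have cc := hχ.bump.smooth.continuous
        have cw := fun i => (h.sw i).continuous
        rw [lintegral_const_mul' _ _ (by norm_num), ← lintegral_finsetSum _ fun i _ => by fun_prop]
        exact mul_le_mul' le_rfl (setLIntegral_le_lintegral _ _)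
    _ ≤ 3 * ∑ i : Fin 3, ENNReal.ofReal (L * K * r ^ 3) :=
        mul_le_mul' le_rfl (Finset.sum_le_sum fun i _ => l4 i)
    _ = _ := by
        rw [ENNReal.ofReal_mul (p := 9) (by norm_num)]
        simp only [Finset.sum_const, Finset.card_univ, Fintype.card_fin, nsmul_eq_mul, ← mul_assoc]
        norm_num

/-- The prefactor in the slice energy inequality. -/
def ZE (L M : ℝ) : ℝ := (100 + 36 * 6912 ^ 2 * 256 * L ^ 2) * M ^ 4

lemma ESl.slice_energy (h : ESl w l e q K) {L M ρ δ : ℝ} {χ χ' : E3 → ℝ} (hL1 : 1 ≤ L) (hL : Lad L)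
    (hM : 1 ≤ M) (hρ : 0 ≤ ρ) (hδ : 0 < δ) (hδ1 : δ ≤ 1)
    (hχ : Cut M ρ δ χ) (hχ' : Cut M (ρ + 3 * δ) δ χ') :
    ∫ x, χ x ^ 2 * ∑ i, w i x * rhs w l e q i x ≤ -(1 / 2 * dis w ρ) +
      (1 / 64 * dis w (ρ + 4 * δ) + ZE L M * K ^ 6 * δ⁻¹ ^ 4) := by
  have hK := h.K1
  have hi : 1 ≤ δ⁻¹ := (one_le_inv₀ hδ).2 hδ1
  have hg : 1 ≤ M * δ⁻¹ := one_le_mul_of_one_le_of_one_le hM hi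
  have e4 : ρ + 3 * δ + δ = ρ + 4 * δ := by ring
  have hD := dis_nonneg w (ρ + 4 * δ)
  set G := 2 * dis w (ρ + 4 * δ) + 6 * (M * δ⁻¹) ^ 2 * K + 1 with hG
  have hG1 : 1 ≤ G := by
    have : 0 ≤ 6 * (M * δ⁻¹) ^ 2 * K := by positivity
    linarith
  have hr1 : 1 ≤ √G := Real.one_le_sqrt.2 hG1
  have hr2 : √G ^ 2 = G := Real.sq_sqrt (by linarith)
  have c1 := fun i => (h.sw i).continuous
  have c2 := fun i => (h.sl i).continuous
  have c3 := fun i j => (dder_smooth (ee j) (h.sl i)).continuous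
  have c4 := h.sq.continuous
  have c5 := fun i => (h.se i).continuous
  have hS : ∀ x, 0 ≤ ∑ i, w i x ^ 2 := fun x => Finset.sum_nonneg fun i _ => sq_nonneg _
  have cs2 : Continuous fun x => (∑ i, w i x ^ 2) ^ 2 := by fun_prop
  have hfour := h.four_le hL1 hL hχ' (r := √G) (by positivity) (by rw [e4, hr2]; linarith)
  refine (h.energy_le hχ (by positivity) hδ (μ := 1 / (6912 * L * K ^ 2 * √G)) (by positivity)).trans ?_
  refine add_le_add le_rfl ?_
  have hsum : ∀ {f : Fin 3 → E3 → ℝ} {s : Set E3}, (∀ i, Continuous (f i)) → (∀ i x, 0 ≤ f i x) →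
      (∀ i, ∫⁻ x, ENNReal.ofReal (f i x) ≤ ENNReal.ofReal K) →
      ∫⁻ x in s, ENNReal.ofReal (∑ i, f i x) ≤ ENNReal.ofReal (3 * K) := fun {f s} hc h0 hb => by
    simp only [ENNReal.ofReal_sum_of_nonneg fun i _ => h0 i _]
    rw [lintegral_finsetSum _ fun i _ => by have := hc i; fun_prop]
    refine (Finset.sum_le_sum fun i _ => (setLIntegral_le_lintegral _ _).trans (hb i)).trans (le_of_eq ?_)
    rw [ENNReal.ofReal_mul (by norm_num)]
    simp
  have hX := setIntegral_le_of_lintegral (s := closedBall (0 : E3) (ρ + δ)) (f := fun x => ∑ i, w i x ^ 2)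
    (by fun_prop) hS (by positivity)
    (hsum (f := fun i x => w i x ^ 2) (fun i => by fun_prop) (fun i x => sq_nonneg _) h.w2)
  have hE' := setIntegral_le_of_lintegral (s := closedBall (0 : E3) (ρ + δ)) (f := fun x => ∑ i, e i x ^ 2)
    (by fun_prop) (fun x => Finset.sum_nonneg fun i _ => sq_nonneg _) (by positivity)
    (hsum (f := fun i x => e i x ^ 2) (fun i => by fun_prop) (fun i x => sq_nonneg _) h.e2)
  have n4 : ∀ a : ℝ, 0 ≤ a ^ 4 := fun a => by positivity
  have hE := setIntegral_le_of_lintegral (s := closedBall (0 : E3) (ρ + δ))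
    (f := fun x => ∑ j, l j x ^ 4 + ∑ i, ∑ j, dder (ee j) (l i) x ^ 4) (k := 12 * K)
    (by fun_prop) (fun x => add_nonneg (Finset.sum_nonneg fun i _ => n4 _)
      (Finset.sum_nonneg fun i _ => Finset.sum_nonneg fun j _ => n4 _)) (by positivity) (by
      have hh := hsum (f := fun i x => l i x ^ 4) (s := closedBall (0 : E3) (ρ + δ))
        (fun i => by fun_prop) (fun i x => n4 _) h.l4
      have hm := fun i => hsum (f := fun j x => dder (ee j) (l i) x ^ 4)
        (s := closedBall (0 : E3) (ρ + δ)) (fun j => by fun_prop) (fun j x => n4 _) (h.m4 i)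
      have e1 : ∀ x, ENNReal.ofReal (∑ j, l j x ^ 4 + ∑ i, ∑ j, dder (ee j) (l i) x ^ 4) =
          ENNReal.ofReal (∑ j, l j x ^ 4) + ∑ i, ENNReal.ofReal (∑ j, dder (ee j) (l i) x ^ 4) := fun x => by
        rw [ENNReal.ofReal_add (Finset.sum_nonneg fun i _ => n4 _)
          (Finset.sum_nonneg fun i _ => Finset.sum_nonneg fun j _ => n4 _),
          ENNReal.ofReal_sum_of_nonneg (s := Finset.univ)
            (f := fun i => ∑ j, dder (ee j) (l i) x ^ 4) fun i _ => Finset.sum_nonneg fun j _ => n4 _]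
      simp only [e1]
      rw [lintegral_add_left (by fun_prop), lintegral_finsetSum _ fun i _ => by fun_prop]
      refine (add_le_add hh (Finset.sum_le_sum fun i _ => hm i)).trans (le_of_eq ?_)
      rw [Finset.sum_const, Finset.card_univ, Fintype.card_fin, nsmul_eq_mul,
        ENNReal.ofReal_mul (by norm_num), ENNReal.ofReal_mul (by norm_num)]
      rw [ENNReal.ofReal_ofNat, ENNReal.ofReal_ofNat]
      push_cast
      ring)
  have hY := setIntegral_le_of_lintegral (s := closedBall (0 : E3) (ρ + 3 * δ)) cs2
    (fun x => sq_nonneg _) (by positivity) hfour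
  have hYY : ∫ x in closedBall (0 : E3) (ρ + δ), (∑ i, w i x ^ 2) ^ 2 ≤
      ∫ x in closedBall (0 : E3) (ρ + 3 * δ), (∑ i, w i x ^ 2) ^ 2 :=
    setIntegral_mono_set (integrableOn_ball cs2 _) (Eventually.of_forall fun x => sq_nonneg _)
      (closedBall_subset_closedBall (by linarith)).eventuallyLE
  have hY0 : 0 ≤ ∫ x in closedBall (0 : E3) (ρ + 3 * δ), (∑ i, w i x ^ 2) ^ 2 :=
    integral_nonneg fun x => sq_nonneg _
  have hQ := setIntegral_le_of_lintegral (s := closedBall (0 : E3) (ρ + δ)) (f := fun x => q x ^ 2)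
    (k := K * (∫ x in closedBall (0 : E3) (ρ + 3 * δ), (∑ i, w i x ^ 2) ^ 2) + K * δ⁻¹ ^ 3)
    (by fun_prop) (fun x => sq_nonneg _) (by positivity) (by
      have := h.q2 (ρ + δ) δ (by linarith) hδ hδ1
      rw [show ρ + δ + 2 * δ = ρ + 3 * δ by ring, lintegral_ball_eq cs2 fun x => sq_nonneg _,
        ← ENNReal.ofReal_mul (by positivity), ← ENNReal.ofReal_add (by positivity) (by positivity)] at this
      exact this)
  have ht : δ⁻¹ ^ 3 ≤ (M * δ⁻¹) ^ 4 := (pow_le_pow_right₀ hi (by norm_num)).trans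
    (pow_le_pow_left₀ (by positivity) (le_mul_of_one_le_left (by positivity) hM) 4)
  have := slice_energy_numeric hK hL1 hg hr1 (hr2.trans hG) hX hYY hY hQ ht hE hE'
  refine this.trans (le_of_eq ?_)
  unfold ZE
  ring

end

section

variable {U : Fin 3 → ℝ × E3 → ℝ} {p : ℝ × E3 → ℝ} {A : ℝ} {ζ φ : E3 → ℝ}

lemma hole_filling {E : ℝ → ℝ} {c : ℝ} (hc : 0 ≤ c) (hmono : Monotone E)
    (h : ∀ ρ δ, 0 ≤ ρ → 0 < δ → δ ≤ 1 → E ρ ≤ 1 / 32 * E (ρ + 4 * δ) + c * δ⁻¹ ^ 4) {ρ : ℝ}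
    (hρ : 0 ≤ ρ) : E ρ ≤ 8192 * c := by
  have key : ∀ n : ℕ, E ρ ≤ (1 / 32) ^ n * E (ρ + (1 - (1 / 2) ^ n)) + 8192 * c * (1 - (1 / 2) ^ n) := by
    intro n
    induction n with
    | zero => simp
    | succ n ih =>
      have hp : (0 : ℝ) < (1 / 2) ^ n := by positivity
      have hp1 : ((1 : ℝ) / 2) ^ n ≤ 1 := pow_le_one₀ (by norm_num) (by norm_num)
      have := h (ρ + (1 - (1 / 2) ^ n)) (1 / 8 * (1 / 2) ^ n) (by linarith) (by positivity) (by linarith)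
      have e1 : ρ + (1 - (1 / 2) ^ n) + 4 * (1 / 8 * (1 / 2) ^ n) = ρ + (1 - (1 / 2 : ℝ) ^ (n + 1)) := by ring
      have e2 : (1 / 32 : ℝ) ^ n * (1 / 8 * (1 / 2) ^ n)⁻¹ ^ 4 = 4096 * (1 / 2) ^ n := by
        have : ((1 : ℝ) / 32) ^ n = (1 / 2) ^ n * ((1 / 2) ^ n) ^ 4 := by
          rw [← pow_mul, ← pow_add, ← mul_comm 4, show n + 4 * n = 5 * n by ring, pow_mul]; norm_num
        rw [this]
        generalize ((1 : ℝ) / 2) ^ n = r at hp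
        field_simp; norm_num
      rw [e1] at this
      have h2 := mul_le_mul_of_nonneg_left this (show (0 : ℝ) ≤ (1 / 32) ^ n by positivity)
      rw [mul_add, mul_left_comm _ c, e2] at h2
      rw [pow_succ (1 / 32 : ℝ)]
      have e3 : (1 / 2 : ℝ) ^ (n + 1) = (1 / 2) ^ n * (1 / 2) := pow_succ _ _
      rw [e3] at h2 ⊢
      nlinarith
  have lim : Tendsto (fun n : ℕ => (1 / 32 : ℝ) ^ n * |E (ρ + 1)| + 8192 * c) atTop (𝓝 (0 * |E (ρ + 1)| + 8192 * c)) :=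
    ((tendsto_pow_atTop_nhds_zero_of_lt_one (by norm_num) (by norm_num)).mul_const _).add_const _
  rw [zero_mul, zero_add] at lim
  refine ge_of_tendsto lim (Eventually.of_forall fun n => (key n).trans ?_)
  have hp : (0 : ℝ) < (1 / 2) ^ n := by positivity
  have h1 : E (ρ + (1 - (1 / 2) ^ n)) ≤ |E (ρ + 1)| :=
    (hmono (by linarith)).trans (le_abs_self _)
  refine add_le_add (mul_le_mul_of_nonneg_left h1 (by positivity)) ?_
  refine mul_le_of_le_one_right (by positivity) (by linarith)

variable {W : Fin 3 → ℝ × E3 → ℝ} {l e : ℝ → Fin 3 → E3 → ℝ} {q : ℝ → E3 → ℝ} {K : ℝ}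

lemma gsq_sl_joint_cont {f : ℝ × E3 → ℝ} (hf : ContDiff ℝ ∞ f) :
    Continuous fun x : ℝ × E3 => gsq (sl f x.1) x.2 := by
  have : (fun x : ℝ × E3 => gsq (sl f x.1) x.2) = fun x => ∑ i, dx i f x ^ 2 := by
    funext x
    simp only [gsq, ← sl_dx hf]
    rfl
  rw [this]
  have := fun i => (dx_smooth hf i).continuous
  fun_prop

lemma dis_time_cont (hW : ∀ i, ContDiff ℝ ∞ (W i)) (r : ℝ) : Continuous fun t => dis (slv W t) r := by
  refine continuous_parametric_integral_of_continuous (f := fun t x => ∑ i, gsq (slv W t i) x) ?_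
    (isCompact_closedBall _ _)
  exact continuous_finsetSum _ fun i _ => gsq_sl_joint_cont (hW i)

lemma dis_mono (hW : ∀ i, ContDiff ℝ ∞ (W i)) (t : ℝ) : Monotone (dis (slv W t)) := fun r r' hr => by
  have hc : Continuous fun x => ∑ i, gsq (slv W t i) x :=
    continuous_finsetSum _ fun i _ => gsq_cont (sl_smooth (hW i) t)
  exact setIntegral_mono_set (integrableOn_ball hc _) (Eventually.of_forall fun x =>
    Finset.sum_nonneg fun i _ => gsq_nonneg _ _) (closedBall_subset_closedBall hr).eventuallyLE

/-- The local energy bound: the dissipation of the rough part is controlled on every ball. -/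
lemma dissipation_le {L M : ℝ} (hL1 : 1 ≤ L) (hL : Lad L) (hM : 1 ≤ M)
    (hcut : ∀ r δ, 0 ≤ r → 0 < δ → ∃ χ, Cut M r δ χ) (hW : ∀ i, ContDiff ℝ ∞ (W i))
    (hS : ∀ t ∈ Ioo (1 / 8 : ℝ) 1, ESl (slv W t) (l t) (e t) (q t) K)
    (heq : ∀ t ∈ Ioo (1 / 8 : ℝ) 1, ∀ i x, dt (W i) (t, x) = rhs (slv W t) (l t) (e t) (q t) i x)
    {a b : ℝ} (ha : 1 / 8 < a) (hab : a ≤ b) (hb : b < 1) {ρ : ℝ} (hρ : 0 ≤ ρ) :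
    ∫ t in a..b, dis (slv W t) ρ ≤ 8192 * (3 * K + 2 * (ZE L M * K ^ 6)) := by
  have hin : ∀ t ∈ Icc a b, t ∈ Ioo (1 / 8 : ℝ) 1 := fun t ht => ⟨ha.trans_le ht.1, ht.2.trans_lt hb⟩
  have hK := (hS a (hin a ⟨le_rfl, hab⟩)).K1
  have hZ : 0 ≤ ZE L M := by unfold ZE; positivity
  have hii := fun r => ((dis_time_cont hW r).intervalIntegrable (μ := volume) a b)
  refine hole_filling (E := fun ρ => ∫ t in a..b, dis (slv W t) ρ) (by positivity)
    (fun r r' hr => intervalIntegral.integral_mono_on hab (hii r) (hii r')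
      fun t _ => dis_mono hW t hr) ?_ hρ
  intro ρ δ hρ hδ hδ1
  obtain ⟨χ, hχ⟩ := hcut ρ δ hρ hδ
  obtain ⟨χ', hχ'⟩ := hcut (ρ + 3 * δ) δ (by positivity) hδ
  have hH : ContDiff ℝ ∞ fun q => ∑ i, W i q ^ 2 := ContDiff.sum fun i _ => (hW i).pow 2
  have hbk := hχ.bump.mul hχ.bump.smooth
  obtain ⟨ys, yd⟩ := param_smooth hbk hH
  set y := fun s : ℝ => ∫ z, χ z * χ z * ∑ i, W i (s, z) ^ 2 with hy
  have hder : ∀ t ∈ Icc a b, deriv y t ≤ -dis (slv W t) ρ +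
      (1 / 32 * dis (slv W t) (ρ + 4 * δ) + 2 * (ZE L M * K ^ 6 * δ⁻¹ ^ 4)) := fun t ht => by
    rw [(yd t).deriv]
    have h1 := (hS t (hin t ht)).slice_energy hL1 hL hM hρ hδ hδ1 hχ hχ'
    have h2 : ∫ z, χ z * χ z * dder (1, 0) (fun q => ∑ i, W i q ^ 2) (t, z) =
        2 * ∫ x, χ x ^ 2 * ∑ i, slv W t i x * rhs (slv W t) (l t) (e t) (q t) i x := by
      rw [← integral_const_mul]
      refine integral_congr_ae (Eventually.of_forall fun z => ?_)
      beta_reduce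
      have e0 : ∀ i, dder (1, 0) (fun q => W i q ^ 2) (t, z) =
          2 * (slv W t i z * rhs (slv W t) (l t) (e t) (q t) i z) := fun i => by
        have : (fun q => W i q ^ 2) = fun q => W i q * W i q := by funext q; ring
        rw [this, dder_mul _ (hW i) (hW i), ← heq t (hin t ht)]
        simp only [dt, slv, sl]; ring
      rw [dder_sum _ _ fun i => (hW i).pow 2]
      simp only [e0, ← Finset.mul_sum]
      ring
    linarith
  have hftc : ∫ t in a..b, deriv y t = y b - y a :=
    intervalIntegral.integral_deriv_eq_sub (fun t _ => (yd t).differentiableAt)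
      ((ys.continuous_deriv (by simp)).intervalIntegrable _ _)
  have hci := ((hii (ρ + 4 * δ)).const_mul (1 / 32)).add
    (intervalIntegrable_const (c := 2 * (ZE L M * K ^ 6 * δ⁻¹ ^ 4)) (μ := volume) (a := a) (b := b))
  have hle := intervalIntegral.integral_mono_on hab
    ((ys.continuous_deriv (by simp)).intervalIntegrable a b) ((hii ρ).neg.add hci) hder
  have hyb : 0 ≤ y b := integral_nonneg fun z => mul_nonneg (mul_self_nonneg _)
    (Finset.sum_nonneg fun i _ => sq_nonneg _)
  have hya : y a ≤ 3 * K := by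
    have hc : Continuous fun z => χ z * χ z * ∑ i, W i (a, z) ^ 2 := by
      have c1 := hχ.bump.smooth.continuous
      have c2 := fun i => (hW i).continuous
      fun_prop
    have hs : ∀ z, 0 ≤ ∑ i, W i (a, z) ^ 2 := fun z => Finset.sum_nonneg fun i _ => sq_nonneg _
    rw [hy]
    beta_reduce
    rw [← setIntegral_univ]
    refine setIntegral_le_of_lintegral hc (fun z => mul_nonneg (mul_self_nonneg _) (hs z))
      (by positivity) ?_
    rw [setLIntegral_univ]
    calc _ ≤ ∫⁻ z, ∑ i, ENNReal.ofReal (slv W a i z ^ 2) := lintegral_mono fun z => by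
          rw [← ENNReal.ofReal_sum_of_nonneg fun i _ => sq_nonneg _]
          refine ENNReal.ofReal_le_ofReal (mul_le_of_le_one_left (hs z) ?_)
          exact mul_le_one₀ (hχ.le_one z) (hχ.nonneg z) (hχ.le_one z)
      _ ≤ ∑ i : Fin 3, ENNReal.ofReal K := by
          have c := fun i => (sl_smooth (hW i) a).continuous
          rw [lintegral_finsetSum _ fun i _ => by have := c i; simp only [slv]; fun_prop]
          exact Finset.sum_le_sum fun i _ => (hS a (hin a ⟨le_rfl, hab⟩)).w2 i
      _ = _ := by
          rw [ENNReal.ofReal_mul (by norm_num)]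
          simp
  have hl1 : b - a ≤ 1 := by linarith
  rw [hftc, intervalIntegral.integral_add (hii ρ).neg hci] at hle
  simp only [Pi.neg_apply] at hle
  rw [intervalIntegral.integral_neg,
    intervalIntegral.integral_add ((hii (ρ + 4 * δ)).const_mul (1 / 32)) intervalIntegrable_const,
    intervalIntegral.integral_const_mul, intervalIntegral.integral_const, smul_eq_mul] at hle
  have hQ : (b - a) * (2 * (ZE L M * K ^ 6 * δ⁻¹ ^ 4)) ≤ 2 * (ZE L M * K ^ 6 * δ⁻¹ ^ 4) :=
    mul_le_of_le_one_left (by positivity) hl1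
  have hd1 : 1 ≤ δ⁻¹ ^ 4 := one_le_pow₀ ((one_le_inv₀ hδ).2 hδ1)
  have hK3 : 3 * K ≤ 3 * K * δ⁻¹ ^ 4 := le_mul_of_one_le_right (by positivity) hd1
  nlinarith

end

section

variable {U : Fin 3 → ℝ × E3 → ℝ} {p : ℝ × E3 → ℝ} {A : ℝ} {ζ φ : E3 → ℝ}

variable {C : ℝ}

lemma lintegral_pow_le {f : E3 → ℝ} {g : E3 → ℝ≥0∞} {c k : ℝ} (n : ℕ) (hn : Even n) (hc : 0 ≤ c)
    (h : ∀ x, ENNReal.ofReal |f x| ≤ ENNReal.ofReal c * g x) (hg : ∫⁻ x, g x ^ n ≤ ENNReal.ofReal k) :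
    ∫⁻ x, ENNReal.ofReal (f x ^ n) ≤ ENNReal.ofReal (c ^ n * k) := by
  calc ∫⁻ x, ENNReal.ofReal (f x ^ n) ≤ ∫⁻ x, ENNReal.ofReal (c ^ n) * g x ^ n :=
        lintegral_mono fun x => by
          rw [← hn.pow_abs, ENNReal.ofReal_pow (abs_nonneg _), ENNReal.ofReal_pow hc, ← mul_pow]
          exact pow_le_pow_left' (h x) n
    _ ≤ _ := by
        rw [lintegral_const_mul' _ _ ENNReal.ofReal_ne_top, ENNReal.ofReal_mul (by positivity)]
        exact mul_le_mul' le_rfl hg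

/-- The constant controlling all the data of the perturbed system. -/
def KK (C A : ℝ) : ℝ :=
  ((18 * C ^ 2) ^ 2 * (160 * 32 ^ 2 * MT ^ 2) + C ^ 2 * (27 * MT) +
    (C ^ 2) ^ 4 * (160 * 200 * MT ^ 4) * (1 + 72 * (324 * (C ^ 2 * MB ^ 2 + 1))) +
    8 * (324 * (C ^ 2 * MB ^ 2 + 1)) + 162 * 160 * C ^ 2 * MB ^ 2 + 1) * A ^ 6

lemma spd_four_le {V w l : Fin 3 → E3 → ℝ} (x : E3) (h : ∀ i, V i x = w i x + l i x) :
    spd V x ^ 4 ≤ 8 * (∑ i, w i x ^ 2) ^ 2 + 24 * ∑ i, l i x ^ 4 := by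
  have hs : spd V x ^ 2 = ∑ i, V i x ^ 2 := Real.sq_sqrt (Finset.sum_nonneg fun i _ => sq_nonneg _)
  have h1 : ∑ i, V i x ^ 2 ≤ 2 * ∑ i, w i x ^ 2 + 2 * ∑ i, l i x ^ 2 := by
    rw [Finset.mul_sum, Finset.mul_sum, ← Finset.sum_add_distrib]
    refine Finset.sum_le_sum fun i _ => ?_
    rw [h i]
    nlinarith [sq_nonneg (w i x - l i x)]
  have h2 : (∑ i, l i x ^ 2) ^ 2 ≤ 3 * ∑ i, l i x ^ 4 := by
    refine (sq_sum_le_card_mul_sum_sq).trans (le_of_eq ?_)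
    simp only [← pow_mul]
    norm_num
  have h0 : 0 ≤ ∑ i, V i x ^ 2 := Finset.sum_nonneg fun i _ => sq_nonneg _
  have h3 := pow_le_pow_left₀ h0 h1 2
  rw [show spd V x ^ 4 = (spd V x ^ 2) ^ 2 by ring, hs]
  nlinarith [sq_nonneg (∑ i, w i x ^ 2 - ∑ i, l i x ^ 2)]

lemma NS.rough_eq (h : NS U p A) (hk : KPair ζ φ) (i : Fin 3) {t : ℝ} (ht : t ∈ Ioo (1 / 8 : ℝ) 1)
    (x : E3) : dt (ww φ U i) (t, x) = rhs (slv (ww φ U) t) (slv (ll φ U) t) (slv (ll2 φ U p) t)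
      (sl (osc φ p) t) i x := by
  have hw := fun i => ww_smooth hk h.sU i
  have hl := fun i => ll_smooth hk h.sU i
  rw [h.ww_eq hk i ⟨ht.1, ht.2.le⟩ x]
  have e1 : DD U i (t, x) = ∑ j, U j (t, x) * dx j (U i) (t, x) := by
    have : ∀ j, dx j (fun q => U i q * U j q) (t, x) =
        U j (t, x) * dx j (U i) (t, x) + U i (t, x) * dx j (U j) (t, x) := fun j => by
      simp only [dx]
      rw [dder_mul _ (h.sU i) (h.sU j)]
      ring
    simp only [DD, this]
    rw [Finset.sum_add_distrib, ← Finset.mul_sum,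
      h.div t ⟨by linarith [ht.1], ht.2.le⟩, mul_zero, add_zero]
  have e2 : ∀ j, dx j (U i) (t, x) = dder (ee j) (sl (ww φ U i) t) x + dder (ee j) (sl (ll φ U i) t) x := by
    intro j
    rw [← sl_dx (hw i), ← sl_dx (hl i)]
    have : U i = fun q => ww φ U i q + ll φ U i q := funext fun q => (ww_add_ll i q).symm
    conv_lhs => rw [this]
    simp only [dx, sl]
    rw [dder_add _ (hw i) (hl i)]
  rw [e1, rhs]
  simp only [e2, slv, ← sl_dx (osc_smooth hk h.sp)]
  simp only [sl, ww_add_ll]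

lemma KC.eSl (hC : KC ζ φ C) (h : NS U p A) {t : ℝ} (ht : t ∈ Ioo (1 / 8 : ℝ) 1) :
    ESl (slv (ww φ U) t) (slv (ll φ U) t) (slv (ll2 φ U p) t) (sl (osc φ p) t) (KK C A) := by
  have hk := hC.pair
  have hw := fun i => ww_smooth hk h.sU i
  have hl := fun i => ll_smooth hk h.sU i
  have hA := h.hA
  have ht1 : t ∈ Ioc (1 / 8 : ℝ) 1 := ⟨ht.1, ht.2.le⟩
  have ht2 : t ∈ Icc (0 : ℝ) 1 := ⟨by linarith [ht.1], ht.2.le⟩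
  have ht3 : t ∈ Ioo (0 : ℝ) 1 := ⟨by linarith [ht.1], ht.2⟩
  have hMT := MT_pos
  have hMB := MB_pos
  have hA6 : 1 ≤ A ^ 6 := one_le_pow₀ hA
  have hC0 := hC.pos
  have hAA : A ≤ A ^ 6 := le_self_pow₀ hA (by norm_num)
  set c1 := (18 * C ^ 2) ^ 2 * (160 * 32 ^ 2 * MT ^ 2) with hc1
  set c2 := C ^ 2 * (27 * MT) with hc2
  set c3 := (C ^ 2) ^ 4 * (160 * 200 * MT ^ 4) with hc3
  set c4 := 324 * (C ^ 2 * MB ^ 2 + 1) with hc4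
  set c5 := 162 * 160 * C ^ 2 * MB ^ 2 with hc5
  have p1 : 0 ≤ c1 := by positivity
  have p2 : 0 ≤ c2 := by positivity
  have p3 : 0 ≤ c3 := by positivity
  have p4 : 0 ≤ c4 := by positivity
  have p5 : 0 ≤ c5 := by positivity
  have p34 : 0 ≤ c3 * (72 * c4) := by positivity
  have eK : KK C A = (c1 + c2 + c3 * (1 + 72 * c4) + 8 * c4 + c5 + 1) * A ^ 6 := rfl
  have hsup : ∀ {f : E3 → ℝ}, (∀ x, ENNReal.ofReal |f x| ≤ ENNReal.ofReal (C ^ 2) * LM U t x) →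
      ∀ x, |f x| ≤ KK C A := fun {f} hf x => by
    have h1 := (hf x).trans (mul_le_mul' le_rfl (h.LM_sup ht1 x))
    rw [← ENNReal.ofReal_mul (by positivity), ENNReal.ofReal_le_ofReal_iff (by positivity)] at h1
    refine h1.trans ?_
    have h2 : C ^ 2 * (27 * MT * A) = c2 * A := by rw [hc2]; ring
    rw [h2, eK]
    exact mul_le_mul (by nlinarith) hAA (by positivity) (by positivity)
  have h4 : ∀ {f : E3 → ℝ}, (∀ x, ENNReal.ofReal |f x| ≤ ENNReal.ofReal (C ^ 2) * LM U t x) →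
      ∫⁻ x, ENNReal.ofReal (f x ^ 4) ≤ ENNReal.ofReal (c3 * A ^ 6) := fun {f} hf => by
    refine (lintegral_pow_le 4 (by decide) (by positivity) hf (h.LM_four ht1)).trans (le_of_eq ?_)
    rw [hc3]; ring_nf
  have hc3K : ENNReal.ofReal (c3 * A ^ 6) ≤ ENNReal.ofReal (KK C A) := by
    rw [eK]
    exact ENNReal.ofReal_le_ofReal (mul_le_mul_of_nonneg_right (by nlinarith) (by positivity))
  refine ⟨fun i => sl_smooth (hw i) t, fun i => sl_smooth (hl i) t,
    fun i => sl_smooth (ll2_smooth hk h i) t, sl_smooth (osc_smooth hk h.sp) t, ?_, fun x => ?_, fun x => ?_,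
    fun i => ?_, fun i => hsup fun x => hC.ll_le h i t x, fun i j => hsup fun x => ?_,
    fun i => (h4 fun x => hC.ll_le h i t x).trans hc3K, fun i j => (h4 fun x => ?_).trans hc3K,
    fun i => ?_, ?_⟩
  · rw [eK]
    exact one_le_mul_of_one_le_of_one_le (by nlinarith) hA6
  · simp only [slv, ← sl_dx (hw _)]
    exact h.div_ww hk ht1 x
  · have e1 := h.div t ht2 x
    have e2 := h.div_ww hk ht1 x
    have e3 : ∀ i, dx i (U i) (t, x) = dx i (ww φ U i) (t, x) + dx i (ll φ U i) (t, x) := fun i => by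
      have : U i = fun q => ww φ U i q + ll φ U i q := funext fun q => (ww_add_ll i q).symm
      conv_lhs => rw [this]
      simp only [dx]
      rw [dder_add _ (hw i) (hl i)]
    simp only [slv, ← sl_dx (hl _)]
    simp only [e3, Finset.sum_add_distrib, e2, zero_add] at e1
    exact e1
  · refine (lintegral_pow_le 2 (by decide) (by positivity) (fun x => hC.ww_le h i ht1 x)
      (h.WM_sq ht1)).trans (ENNReal.ofReal_le_ofReal ?_)
    rw [← mul_assoc, ← hc1, eK]
    exact mul_le_mul_of_nonneg_right (by nlinarith) (by positivity)
  · simp only [slv, ← sl_dx (hl _)]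
    exact hC.dx_ll_le h i j t x
  · simp only [slv, ← sl_dx (hl _)]
    exact hC.dx_ll_le h i j t x
  · refine (lintegral_pow_le 2 (by decide) (by positivity) (fun x => hC.ll2_le h i ht1 x)
      (h.EM_sq ht1)).trans (ENNReal.ofReal_le_ofReal ?_)
    calc (18 * C ^ 2) ^ 2 * (160 * 4 * MT ^ 2 * A ^ 6) ≤ c1 * A ^ 6 := by
          have hp : 0 ≤ (18 * C ^ 2) ^ 2 * (MT ^ 2 * A ^ 6) := by positivity
          rw [hc1]
          nlinarith
      _ ≤ _ := by
          rw [eK]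
          exact mul_le_mul_of_nonneg_right (by nlinarith) (by positivity)
  · intro ρ δ hρ hδ hδ1
    obtain ⟨M, -, hM⟩ := exists_cutoff
    obtain ⟨χ, hχ⟩ := hM (ρ + 3 / 2 * δ) (δ / 2) (by positivity) (by positivity)
    have hpr := hC.press_le (h.slice ht3) (h.wk t ht2) hA hδ hδ1 hχ (ρ := ρ) (by linarith)
    rw [show ρ + 3 / 2 * δ + δ / 2 = ρ + 2 * δ by ring, ← hc4, ← hc5] at hpr
    rw [sl_osc]
    refine hpr.trans ?_
    have cw := fun i => (sl_smooth (hw i) t).continuous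
    have cl := fun i => (sl_smooth (hl i) t).continuous
    have hcS : Continuous fun x => (∑ i, slv (ww φ U) t i x ^ 2) ^ 2 := by
      simp only [slv]
      fun_prop
    have hI4 : ∫⁻ x in closedBall (0 : E3) (ρ + 2 * δ), ENNReal.ofReal (spd (slv U t) x) ^ 4 ≤
        8 * (∫⁻ x in closedBall (0 : E3) (ρ + 2 * δ), ENNReal.ofReal ((∑ i, slv (ww φ U) t i x ^ 2) ^ 2)) +
          ENNReal.ofReal (72 * (c3 * A ^ 6)) := by
      calc _ ≤ ∫⁻ x in closedBall (0 : E3) (ρ + 2 * δ),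
            (8 * ENNReal.ofReal ((∑ i, slv (ww φ U) t i x ^ 2) ^ 2) +
              24 * ∑ i, ENNReal.ofReal (slv (ll φ U) t i x ^ 4)) := lintegral_mono fun x => by
            have n4 : ∀ i, 0 ≤ slv (ll φ U) t i x ^ 4 := fun i => by positivity
            rw [← ENNReal.ofReal_sum_of_nonneg fun i _ => n4 i]
            have e8 : (8 : ℝ≥0∞) = ENNReal.ofReal 8 := by norm_num
            have e24 : (24 : ℝ≥0∞) = ENNReal.ofReal 24 := by norm_num
            rw [e8, e24, ← ENNReal.ofReal_mul (by norm_num), ← ENNReal.ofReal_mul (by norm_num),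
              ← ENNReal.ofReal_add (by positivity) (mul_nonneg (by norm_num)
                (Finset.sum_nonneg fun i _ => n4 i)), ← ENNReal.ofReal_pow (p := spd _ x) (Real.sqrt_nonneg _)]
            exact ENNReal.ofReal_le_ofReal (spd_four_le x fun i => (ww_add_ll i (t, x)).symm)
        _ ≤ _ := by
            rw [lintegral_add_left (by have := hcS.measurable; fun_prop), lintegral_const_mul' _ _ (by norm_num),
              lintegral_const_mul' _ _ (by norm_num),
              lintegral_finsetSum _ fun i _ => by have := cl i; simp only [slv]; fun_prop]
            refine add_le_add le_rfl ?_
            calc _ ≤ 24 * ∑ i : Fin 3, ENNReal.ofReal (c3 * A ^ 6) :=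
                  mul_le_mul' le_rfl (Finset.sum_le_sum fun i _ =>
                    (setLIntegral_le_lintegral _ _).trans (h4 fun x => hC.ll_le h i t x))
              _ = _ := by
                  rw [ENNReal.ofReal_mul (p := 72) (by norm_num), Finset.sum_const, Finset.card_univ,
                    Fintype.card_fin, nsmul_eq_mul, ← mul_assoc]
                  norm_num
    refine (add_le_add (mul_le_mul' le_rfl hI4) le_rfl).trans ?_
    have e8 : (8 : ℝ≥0∞) = ENNReal.ofReal 8 := by norm_num
    have hd1 : 1 ≤ δ⁻¹ ^ 3 := one_le_pow₀ ((one_le_inv₀ hδ).2 hδ1)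
    rw [mul_add, add_assoc, ← mul_assoc, e8, ← ENNReal.ofReal_mul p4, ← ENNReal.ofReal_mul p4,
      ← ENNReal.ofReal_add (by positivity) (by positivity)]
    refine add_le_add (mul_le_mul' (ENNReal.ofReal_le_ofReal ?_) le_rfl) (ENNReal.ofReal_le_ofReal ?_)
    · rw [eK]
      calc c4 * 8 = c4 * 8 * 1 := (mul_one _).symm
        _ ≤ _ := mul_le_mul (by nlinarith) hA6 (by norm_num) (by positivity)
    · calc c4 * (72 * (c3 * A ^ 6)) + c5 * A ^ 6 * δ⁻¹ ^ 3
          ≤ c4 * (72 * (c3 * A ^ 6)) * δ⁻¹ ^ 3 + c5 * A ^ 6 * δ⁻¹ ^ 3 :=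
            add_le_add (le_mul_of_one_le_right (by positivity) hd1) le_rfl
        _ = (c3 * (72 * c4) + c5) * A ^ 6 * δ⁻¹ ^ 3 := by ring
        _ ≤ _ := by
            rw [eK]
            refine mul_le_mul_of_nonneg_right (mul_le_mul_of_nonneg_right ?_ (by positivity)) (by positivity)
            nlinarith

end

section

variable {U : Fin 3 → ℝ × E3 → ℝ} {p : ℝ × E3 → ℝ} {A : ℝ} {ζ φ : E3 → ℝ}

lemma lintegral_exhaust {g : ℝ × E3 → ℝ≥0∞} (hg : Measurable g) {B : ℝ≥0∞}
    (h : ∀ n : ℕ, (∫⁻ t in Ioc (3 / 8 : ℝ) (1 - 1 / ((n : ℝ) + 2)), ∫⁻ x in closedBall (0 : E3) n,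
      g (t, x)) ≤ B) : (∫⁻ t in Ioo (3 / 8 : ℝ) 1, ∫⁻ x, g (t, x)) ≤ B := by
  set s : ℕ → Set (ℝ × E3) := fun n =>
    Ioc (3 / 8 : ℝ) (1 - 1 / ((n : ℝ) + 2)) ×ˢ closedBall (0 : E3) n with hs
  have hmono : Monotone s := by
    intro m n hmn
    have hc : (m : ℝ) ≤ n := by exact_mod_cast hmn
    refine prod_mono (Ioc_subset_Ioc_right ?_) (closedBall_subset_closedBall hc)
    have : 1 / ((n : ℝ) + 2) ≤ 1 / ((m : ℝ) + 2) := by gcongr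
    linarith
  have hun : ⋃ n, s n = Ioo (3 / 8 : ℝ) 1 ×ˢ (univ : Set E3) := by
    ext ⟨t, x⟩
    simp only [hs, mem_iUnion, mem_prod, mem_Ioc, mem_Ioo, mem_closedBall, dist_zero_right, mem_univ,
      and_true]
    constructor
    · rintro ⟨n, ⟨h1, h2⟩, -⟩
      refine ⟨h1, h2.trans_lt ?_⟩
      have : 0 < 1 / ((n : ℝ) + 2) := by positivity
      linarith
    · rintro ⟨h1, h2⟩
      obtain ⟨n, hn⟩ := exists_nat_ge (max ‖x‖ (1 / (1 - t)))
      have h3 := (le_max_left _ _).trans hn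
      have h4 := (le_max_right _ _).trans hn
      refine ⟨n, ⟨h1, ?_⟩, h3⟩
      have h5 : 0 < 1 - t := by linarith
      have : 1 / ((n : ℝ) + 2) ≤ 1 - t := by
        rw [div_le_comm₀ (by positivity) h5]
        linarith
      linarith
  have e1 : (∫⁻ t in Ioo (3 / 8 : ℝ) 1, ∫⁻ x, g (t, x)) = ∫⁻ z in ⋃ n, s n, g z := by
    rw [hun, Measure.volume_eq_prod, setLIntegral_prod _ hg.aemeasurable, Measure.restrict_univ]
  rw [e1, setLIntegral_iUnion_of_directed _ hmono.directed_le]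
  refine iSup_le fun n => le_trans (le_of_eq ?_) (h n)
  rw [Measure.volume_eq_prod, setLIntegral_prod _ hg.aemeasurable]

lemma dis_lintegral {W : Fin 3 → ℝ × E3 → ℝ} (hW : ∀ i, ContDiff ℝ ∞ (W i)) (t r : ℝ) :
    ∫⁻ x in closedBall (0 : E3) r, ENNReal.ofReal (∑ i, gsq (sl (W i) t) x) =
      ENNReal.ofReal (dis (slv W t) r) := by
  refine lintegral_ball_eq (continuous_finsetSum _ fun i _ => gsq_cont (sl_smooth (hW i) t))
    (fun x => Finset.sum_nonneg fun i _ => gsq_nonneg _ x) r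

/-- The bound on the total dissipation of the rough part. -/
def DB (L M K : ℝ) : ℝ := 8192 * (3 * K + 2 * (ZE L M * K ^ 6))

lemma KC.dissipation {C L M : ℝ} (hC : KC ζ φ C) (h : NS U p A) (hL1 : 1 ≤ L) (hL : Lad L)
    (hM : 1 ≤ M) (hcut : ∀ r δ, 0 ≤ r → 0 < δ → ∃ χ, Cut M r δ χ) :
    (∫⁻ t in Ioo (3 / 8 : ℝ) 1, ∫⁻ x, ENNReal.ofReal (∑ i, gsq (sl (ww φ U i) t) x)) ≤
      ENNReal.ofReal (DB L M (KK C A)) := by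
  have hW := fun i => ww_smooth hC.pair h.sU i
  have hg : Continuous fun z : ℝ × E3 => ∑ i, gsq (sl (ww φ U i) z.1) z.2 :=
    continuous_finsetSum _ fun i _ => gsq_sl_joint_cont (hW i)
  refine lintegral_exhaust (g := fun z => ENNReal.ofReal (∑ i, gsq (sl (ww φ U i) z.1) z.2))
    hg.measurable.ennreal_ofReal fun n => ?_
  have hb : 0 < 1 / ((n : ℝ) + 2) := by positivity
  have hb' : 1 / ((n : ℝ) + 2) ≤ 1 / 2 := by
    refine one_div_le_one_div_of_le two_pos ?_
    have : (0 : ℝ) ≤ n := n.cast_nonneg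
    linarith
  have key := dissipation_le hL1 hL hM hcut hW (fun t ht => hC.eSl h ht)
    (fun t ht i x => h.rough_eq hC.pair i ht x) (a := 3 / 8) (b := 1 - 1 / ((n : ℝ) + 2))
    (by norm_num) (by linarith) (by linarith) n.cast_nonneg
  simp only [dis_lintegral hW]
  rw [← ofReal_integral_eq_lintegral_ofReal
    (((dis_time_cont hW n).integrableOn_Icc).mono_set Ioc_subset_Icc_self)
    (Eventually.of_forall fun t => dis_nonneg _ _),
    ← intervalIntegral.integral_of_le (by linarith)]
  exact ENNReal.ofReal_le_ofReal key

end

section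

variable {U : Fin 3 → ℝ × E3 → ℝ} {p : ℝ × E3 → ℝ} {A : ℝ} {ζ φ : E3 → ℝ}

lemma deriv_smoothTransition_eq_zero {y : ℝ} (hy : y ≤ 0 ∨ 1 ≤ y) :
    deriv Real.smoothTransition y = 0 := by
  rcases hy with hy | hy
  · refine IsLocalMin.deriv_eq_zero (Eventually.of_forall fun z => ?_)
    rw [Real.smoothTransition.zero_of_nonpos hy]
    exact Real.smoothTransition.nonneg z
  · refine IsLocalMax.deriv_eq_zero (Eventually.of_forall fun z => ?_)
    rw [Real.smoothTransition.one_of_one_le hy]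
    exact Real.smoothTransition.le_one z

lemma dder_smoothTransition {g : E3 → ℝ} (hg : ContDiff ℝ ∞ g) (v x : E3) :
    dder v (fun x => Real.smoothTransition (g x)) x = deriv Real.smoothTransition (g x) * dder v g x := by
  have h0 := ((Real.smoothTransition.contDiff (n := 1)).differentiable
    one_ne_zero (g x)).hasDerivAt
  have h2 := h0.comp_hasFDerivAt x (sm_diff hg x).hasFDerivAt
  have h5 : (fun x => Real.smoothTransition (g x)) = Real.smoothTransition ∘ g := rfl
  unfold dder
  rw [h5, h2.fderiv]
  simp

/-- A smooth truncation at the level `q`, vanishing where `|F| ≤ q / 2`. -/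
def trunc (q : ℝ) (F : E3 → ℝ) (x : E3) : ℝ :=
  q * Real.smoothTransition (4 / 3 * (q⁻¹ ^ 2 * F x ^ 2) - 1 / 3)

section truncation

variable {F : E3 → ℝ} {q R : ℝ}

lemma trunc_bump (hF : Bump F R) (q : ℝ) : Bump (trunc q F) R := by
  have := hF.smooth
  refine ⟨contDiff_const.mul ((Real.smoothTransition.contDiff (n := ⊤)).comp (by fun_prop)),
    fun z hz => ?_⟩
  rw [trunc, hF.supp z hz, Real.smoothTransition.zero_of_nonpos (by norm_num), mul_zero]

lemma trunc_eq (hq : 0 < q) {x : E3} (hx : q ≤ |F x|) : trunc q F x = q := by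
  have h1 : q ^ 2 ≤ F x ^ 2 := by rw [← sq_abs (F x)]; exact pow_le_pow_left₀ hq.le hx 2
  have h2 : 1 ≤ q⁻¹ ^ 2 * F x ^ 2 := by
    rwa [inv_pow, inv_mul_eq_div, one_le_div (by positivity)]
  rw [trunc, Real.smoothTransition.one_of_one_le (by linarith), mul_one]

lemma gsq_trunc_le {D : ℝ} (hD : ∀ y, |deriv Real.smoothTransition y| ≤ D) (hF : ContDiff ℝ ∞ F)
    (hq : 0 < q) (x : E3) : gsq (trunc q F) x ≤
      {x | q / 2 ≤ |F x| ∧ |F x| < q}.indicator (fun x => 8 * D ^ 2 * gsq F x) x := by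
  have hd : ∀ v, dder v (trunc q F) x = q * (deriv Real.smoothTransition
      (4 / 3 * (q⁻¹ ^ 2 * F x ^ 2) - 1 / 3) * (8 / 3 * (q⁻¹ ^ 2 * (F x * dder v F x)))) := fun v => by
    have hg : ContDiff ℝ ∞ fun x => 4 / 3 * (q⁻¹ ^ 2 * F x ^ 2) - 1 / 3 := by fun_prop
    have hs : ContDiff ℝ ∞ fun x => Real.smoothTransition (4 / 3 * (q⁻¹ ^ 2 * F x ^ 2) - 1 / 3) :=
      (Real.smoothTransition.contDiff (n := ⊤)).comp hg
    have e : trunc q F = fun x => q * Real.smoothTransition (4 / 3 * (q⁻¹ ^ 2 * F x ^ 2) - 1 / 3) := rfl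
    rw [e, dder_const_mul _ _ hs]
    beta_reduce
    rw [dder_smoothTransition hg, dder_sub _ (by fun_prop) contDiff_const,
      dder_const_mul _ _ (by fun_prop), dder_const_mul _ _ (by fun_prop), dder_sq _ hF]
    beta_reduce
    rw [(show dder v (fun _ : E3 => (1 / 3 : ℝ)) x = 0 by simp [dder])]
    ring
  by_cases hx : x ∈ {x | q / 2 ≤ |F x| ∧ |F x| < q}
  · rw [indicator_of_mem hx]
    have hq2 : q⁻¹ * |F x| ≤ 1 := by
      rw [inv_mul_le_one₀ hq]
      exact hx.2.le
    unfold gsq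
    rw [Finset.mul_sum]
    refine Finset.sum_le_sum fun i _ => ?_
    have hD0 : 0 ≤ D := (abs_nonneg _).trans (hD 0)
    have h1 : |dder (ee i) (trunc q F) x| ≤ 8 / 3 * D * |dder (ee i) F x| := by
      rw [hd, abs_mul, abs_mul, abs_mul, abs_mul, abs_mul, abs_of_pos hq, abs_of_pos (by norm_num : (0 : ℝ) < 8 / 3),
        abs_of_pos (by positivity : 0 < q⁻¹ ^ 2)]
      set d := |deriv Real.smoothTransition (4 / 3 * (q⁻¹ ^ 2 * F x ^ 2) - 1 / 3)| with hd'
      have e : q * (d * (8 / 3 * (q⁻¹ ^ 2 * (|F x| * |dder (ee i) F x|)))) =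
        8 / 3 * (d * (q⁻¹ * |F x|)) * |dder (ee i) F x| := by field_simp
      rw [e]
      refine mul_le_mul_of_nonneg_right ?_ (abs_nonneg _)
      have : d * (q⁻¹ * |F x|) ≤ D * 1 := mul_le_mul (hD _) hq2 (by positivity) hD0
      linarith
    have h2 := pow_le_pow_left₀ (abs_nonneg _) h1 2
    rw [sq_abs, mul_pow, sq_abs] at h2
    refine h2.trans (mul_le_mul_of_nonneg_right ?_ (sq_nonneg _))
    nlinarith [sq_nonneg D]
  · rw [indicator_of_notMem hx]
    refine le_of_eq (Finset.sum_eq_zero fun i _ => ?_)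
    rw [hd, deriv_smoothTransition_eq_zero]
    · ring
    · have e : q⁻¹ ^ 2 * F x ^ 2 = (|F x| / q) ^ 2 := by rw [div_pow, sq_abs]; field_simp
      rw [e]
      have h0 : 0 ≤ |F x| / q := by positivity
      rcases not_and_or.1 hx with h | h
      · left
        have : |F x| / q ≤ 1 / 2 := by rw [div_le_iff₀ hq]; linarith
        nlinarith
      · right
        have : 1 ≤ |F x| / q := by rw [le_div_iff₀ hq]; linarith
        nlinarith

end truncation

end

section

variable {U : Fin 3 → ℝ × E3 → ℝ} {p : ℝ × E3 → ℝ} {A : ℝ} {ζ φ : E3 → ℝ}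

lemma weak_level_le {Cs D q R : ℝ} {F : E3 → ℝ} (hC1 : 1 ≤ Cs)
    (hC : ∀ (f : E3 → ℝ) (R : ℝ), Bump f R →
      ∫⁻ x, ENNReal.ofReal |f x| ^ 6 ≤ ENNReal.ofReal Cs * (∫⁻ x, ENNReal.ofReal (gsq f x)) ^ 3)
    (hD : ∀ y, |deriv Real.smoothTransition y| ≤ D) (hF : Bump F R) (hq : 0 < q) :
    ENNReal.ofReal (q ^ 2) * volume {x | q ≤ |F x|} ^ (1 / 3 : ℝ) ≤ ENNReal.ofReal Cs *
      ∫⁻ x in {x | q / 2 ≤ |F x| ∧ |F x| < q}, ENNReal.ofReal (8 * D ^ 2 * gsq F x) := by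
  set X := ∫⁻ x in {x | q / 2 ≤ |F x| ∧ |F x| < q}, ENNReal.ofReal (8 * D ^ 2 * gsq F x) with hX
  have hFc := hF.smooth.continuous
  have hmeas : MeasurableSet {x | q / 2 ≤ |F x| ∧ |F x| < q} :=
    (measurableSet_le measurable_const hFc.abs.measurable).inter
      (measurableSet_lt hFc.abs.measurable measurable_const)
  have hm2 : MeasurableSet {x | q ≤ |F x|} := measurableSet_le measurable_const hFc.abs.measurable
  have h1 : ∫⁻ x, ENNReal.ofReal (gsq (trunc q F) x) ≤ X := by
    rw [hX, ← lintegral_indicator hmeas]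
    refine lintegral_mono fun x => ?_
    refine (ENNReal.ofReal_le_ofReal (gsq_trunc_le hD hF.smooth hq x)).trans (le_of_eq ?_)
    by_cases hx : x ∈ {x | q / 2 ≤ |F x| ∧ |F x| < q}
    · rw [indicator_of_mem hx, indicator_of_mem hx]
    · rw [indicator_of_notMem hx, indicator_of_notMem hx, ENNReal.ofReal_zero]
  have h2 : ENNReal.ofReal (q ^ 6) * volume {x | q ≤ |F x|} ≤
      ∫⁻ x, ENNReal.ofReal |trunc q F x| ^ 6 := by
    rw [← lintegral_indicator_const hm2]
    refine lintegral_mono fun x => ?_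
    by_cases hx : x ∈ {x | q ≤ |F x|}
    · rw [indicator_of_mem hx, trunc_eq hq hx, abs_of_pos hq, ENNReal.ofReal_pow hq.le]
    · rw [indicator_of_notMem hx]
      exact bot_le
  have h3 : ENNReal.ofReal (q ^ 6) * volume {x | q ≤ |F x|} ≤ (ENNReal.ofReal Cs * X) ^ 3 := by
    refine h2.trans ((hC _ _ (trunc_bump hF q)).trans ?_)
    rw [mul_pow]
    refine mul_le_mul' ?_ (pow_le_pow_left' h1 3)
    rw [← ENNReal.ofReal_pow (by linarith)]
    exact ENNReal.ofReal_le_ofReal (le_self_pow₀ hC1 (by norm_num))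
  refine (ENNReal.pow_le_pow_left_iff (n := 3) (by norm_num)).1 (le_trans (le_of_eq ?_) h3)
  rw [mul_pow, ← ENNReal.ofReal_pow (by positivity), ← ENNReal.rpow_natCast, ← ENNReal.rpow_mul]
  norm_num
  rw [← pow_mul]

lemma disjoint_levels (F : E3 → ℝ) :
    Pairwise (Function.onFun Disjoint fun k : ℤ => {x | (2 : ℝ) ^ k / 2 ≤ |F x| ∧ |F x| < 2 ^ k}) := by
  have key : ∀ j k : ℤ, j < k →
      Disjoint {x | (2 : ℝ) ^ j / 2 ≤ |F x| ∧ |F x| < 2 ^ j} {x | (2 : ℝ) ^ k / 2 ≤ |F x| ∧ |F x| < 2 ^ k} := by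
    intro j k hjk
    rw [Set.disjoint_left]
    rintro x ⟨-, h1⟩ ⟨h2, -⟩
    have h3 : (2 : ℝ) ^ j ≤ 2 ^ (k - 1) := zpow_le_zpow_right₀ one_le_two (by omega)
    rw [zpow_sub_one₀ two_ne_zero] at h3
    linarith [div_eq_mul_inv ((2 : ℝ) ^ k) 2]
  intro j k hjk
  rcases lt_or_gt_of_ne hjk with h | h
  · exact key j k h
  · exact (key k j h).symm

lemma weak_sum_bump_le {Cs D R : ℝ} {F : E3 → ℝ} (hC1 : 1 ≤ Cs)
    (hC : ∀ (f : E3 → ℝ) (R : ℝ), Bump f R →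
      ∫⁻ x, ENNReal.ofReal |f x| ^ 6 ≤ ENNReal.ofReal Cs * (∫⁻ x, ENNReal.ofReal (gsq f x)) ^ 3)
    (hD : ∀ y, |deriv Real.smoothTransition y| ≤ D) (hF : Bump F R) :
    ∑' k : ℤ, ENNReal.ofReal (((2 : ℝ) ^ k) ^ 2) * volume {x | (2 : ℝ) ^ k ≤ |F x|} ^ (1 / 3 : ℝ) ≤
      ENNReal.ofReal Cs * ∫⁻ x, ENNReal.ofReal (8 * D ^ 2 * gsq F x) := by
  refine (ENNReal.tsum_le_tsum fun k => weak_level_le hC1 hC hD hF (q := (2 : ℝ) ^ k)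
    (by positivity)).trans ?_
  have hFc := hF.smooth.continuous
  have hm : ∀ k : ℤ, MeasurableSet {x | (2 : ℝ) ^ k / 2 ≤ |F x| ∧ |F x| < 2 ^ k} := fun k =>
    (measurableSet_le measurable_const hFc.abs.measurable).inter
      (measurableSet_lt hFc.abs.measurable measurable_const)
  rw [ENNReal.tsum_mul_left, ← lintegral_iUnion hm (disjoint_levels F)]
  exact mul_le_mul' le_rfl (setLIntegral_le_lintegral _ _)

/-- The squared gradient controls the Lorentz norm `L^{6,2}`, for functions on the whole space. -/
lemma exists_lorentz : ∃ C : ℝ, 1 ≤ C ∧ ∀ f : E3 → ℝ, ContDiff ℝ ∞ f →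
    ∑' k : ℤ, ENNReal.ofReal (((2 : ℝ) ^ k) ^ 2) * volume {x | (2 : ℝ) ^ k ≤ |f x|} ^ (1 / 3 : ℝ) ≤
      ENNReal.ofReal C * ((∫⁻ x, ENNReal.ofReal (gsq f x)) + ∫⁻ x, ENNReal.ofReal (f x ^ 2)) := by
  obtain ⟨Cs, hC1, hC⟩ := exists_sobolev
  obtain ⟨D, hD0, hD⟩ := smoothTransition_deriv_bound
  obtain ⟨M, hM, hcut⟩ := exists_cutoff
  set C := Cs * (8 * D ^ 2 * (6 * M ^ 2)) with hCd
  refine ⟨max C 1, le_max_right _ _, fun f hf => ?_⟩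
  have hM2 : 1 ≤ M ^ 2 := one_le_pow₀ hM
  set B := ENNReal.ofReal (max C 1) *
    ((∫⁻ x, ENNReal.ofReal (gsq f x)) + ∫⁻ x, ENNReal.ofReal (f x ^ 2)) with hB
  have key : ∀ n : ℕ, ∑' k : ℤ, ENNReal.ofReal (((2 : ℝ) ^ k) ^ 2) *
      volume ({x : E3 | (2 : ℝ) ^ k ≤ |f x|} ∩ closedBall (0 : E3) n) ^ (1 / 3 : ℝ) ≤ B := by
    intro n
    obtain ⟨χ, hχ⟩ := hcut n 1 n.cast_nonneg one_pos
    have hF := hχ.bump.mul hf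
    refine le_trans (ENNReal.tsum_le_tsum fun k => mul_le_mul' le_rfl (ENNReal.rpow_le_rpow
      (measure_mono ?_) (by norm_num))) ((weak_sum_bump_le hC1 hC hD hF).trans ?_)
    · rintro x ⟨hx, hn⟩
      change (2 : ℝ) ^ k ≤ |χ x * f x|
      rw [hχ.one x (by simpa using hn), one_mul]
      exact hx
    · have h1 : ∀ x, ENNReal.ofReal (8 * D ^ 2 * gsq (fun z => χ z * f z) x) ≤
          ENNReal.ofReal (8 * D ^ 2 * (6 * M ^ 2)) *
            (ENNReal.ofReal (gsq f x) + ENNReal.ofReal (f x ^ 2)) := fun x => by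
        rw [← ENNReal.ofReal_add (gsq_nonneg _ _) (sq_nonneg _), ← ENNReal.ofReal_mul (by positivity),
          mul_assoc (8 * D ^ 2) (6 * M ^ 2)]
        have hD2 : 0 ≤ 8 * D ^ 2 := by positivity
        refine ENNReal.ofReal_le_ofReal (mul_le_mul_of_nonneg_left ?_ hD2)
        have := dder_bump_mul_sq_le hχ.bump.smooth hf (hχ.nonneg x) (hχ.le_one x) (fun i => hχ.slope i x)
        rw [inv_one, mul_one] at this
        have := gsq_nonneg f x
        nlinarith
      calc _ ≤ ENNReal.ofReal Cs * ∫⁻ x, ENNReal.ofReal (8 * D ^ 2 * (6 * M ^ 2)) *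
            (ENNReal.ofReal (gsq f x) + ENNReal.ofReal (f x ^ 2)) :=
            mul_le_mul' le_rfl (lintegral_mono h1)
        _ = ENNReal.ofReal C * ((∫⁻ x, ENNReal.ofReal (gsq f x)) + ∫⁻ x, ENNReal.ofReal (f x ^ 2)) := by
            rw [lintegral_const_mul' _ _ ENNReal.ofReal_ne_top,
              lintegral_add_left (gsq_cont hf).measurable.ennreal_ofReal, ← mul_assoc,
              ← ENNReal.ofReal_mul (by linarith)]
        _ ≤ _ := mul_le_mul' (ENNReal.ofReal_le_ofReal (le_max_left _ _)) le_rfl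
  rw [ENNReal.tsum_eq_iSup_sum]
  refine iSup_le fun s => ?_
  have hlim : Tendsto (fun n : ℕ => ∑ k ∈ s, ENNReal.ofReal (((2 : ℝ) ^ k) ^ 2) *
      volume ({x : E3 | (2 : ℝ) ^ k ≤ |f x|} ∩ closedBall (0 : E3) n) ^ (1 / 3 : ℝ)) atTop
      (𝓝 (∑ k ∈ s, ENNReal.ofReal (((2 : ℝ) ^ k) ^ 2) *
        volume {x | (2 : ℝ) ^ k ≤ |f x|} ^ (1 / 3 : ℝ))) := by
    refine tendsto_finsetSum _ fun k _ => ENNReal.Tendsto.const_mul ?_ (Or.inr ENNReal.ofReal_ne_top)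
    refine ((ENNReal.continuous_rpow_const).tendsto _).comp ?_
    have hmono : Monotone fun n : ℕ => {x : E3 | (2 : ℝ) ^ k ≤ |f x|} ∩ closedBall (0 : E3) n :=
      fun m n hmn => inter_subset_inter_right _ (closedBall_subset_closedBall (by exact_mod_cast hmn))
    have := tendsto_measure_iUnion_atTop (μ := volume) hmono
    rwa [← inter_iUnion, iUnion_closedBall_nat, inter_univ] at this
  exact le_of_tendsto' hlim fun n => (ENNReal.sum_le_tsum s).trans (key n)

end

section

variable {U : Fin 3 → ℝ × E3 → ℝ} {p : ℝ × E3 → ℝ} {A : ℝ} {ζ φ : E3 → ℝ}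

lemma lintegral_rpow_Ioi {s c : ℝ} (hs : s < -1) (hc : 0 < c) :
    ∫⁻ x in Ioi c, ENNReal.ofReal (x ^ s) = ENNReal.ofReal (-c ^ (s + 1) / (s + 1)) := by
  rw [← ofReal_integral_eq_lintegral_ofReal (integrableOn_Ioi_rpow_of_lt hs hc),
    integral_Ioi_rpow_of_lt hs hc]
  filter_upwards [self_mem_ae_restrict measurableSet_Ioi] with x hx
  exact Real.rpow_nonneg (hc.trans hx).le _

lemma lintegral_two_powers_le {f : ℝ → ℝ≥0∞} {α β b c : ℝ} (hα : -1 < α) (hβ : β < -1) (hb : 0 < b)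
    (hc : 0 ≤ c) (h1 : ∀ s ∈ Ioc 0 b, f s ≤ ENNReal.ofReal (s ^ α))
    (h2 : ∀ s ∈ Ioi b, f s ≤ ENNReal.ofReal (c * s ^ β)) :
    ∫⁻ s in Ioi (0 : ℝ), f s ≤
      ENNReal.ofReal (b ^ (α + 1) / (α + 1) + c * (-b ^ (β + 1) / (β + 1))) := by
  have hb1 := Real.rpow_nonneg hb.le (β + 1)
  have hb2 := Real.rpow_nonneg hb.le (α + 1)
  rw [← Ioc_union_Ioi_eq_Ioi hb.le]
  refine (lintegral_union_le _ _ _).trans ?_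
  rw [ENNReal.ofReal_add (div_nonneg hb2 (by linarith)) (mul_nonneg hc (div_nonneg_of_nonpos
    (by linarith) (by linarith)))]
  refine add_le_add ?_ ?_
  · exact (setLIntegral_mono' measurableSet_Ioc h1).trans (lintegral_rpow hα hb.le).le
  · refine (setLIntegral_mono' measurableSet_Ioi h2).trans (le_of_eq ?_)
    simp only [ENNReal.ofReal_mul hc]
    rw [lintegral_const_mul' _ _ ENNReal.ofReal_ne_top, lintegral_rpow_Ioi hβ hb]

/-- One-dimensional majorant of the kernel in the bound for the rough part. -/
def kh (a s : ℝ) : ℝ := s ^ (-(1 / 2) : ℝ) * (min 1 (a / s)) ^ (3 / 2 : ℝ)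

lemma kh_nonneg {a s : ℝ} (ha : 0 ≤ a) (hs : 0 ≤ s) : 0 ≤ kh a s :=
  mul_nonneg (Real.rpow_nonneg hs _) (Real.rpow_nonneg (le_min zero_le_one (div_nonneg ha hs)) _)

lemma kh_anti {a s r : ℝ} (ha : 0 ≤ a) (hs : 0 < s) (hsr : s ≤ r) : kh a r ≤ kh a s := by
  have hr := hs.trans_le hsr
  refine mul_le_mul (Real.rpow_le_rpow_of_nonpos hs hsr (by norm_num)) ?_
    (Real.rpow_nonneg (le_min zero_le_one (div_nonneg ha hr.le)) _) (Real.rpow_nonneg hs.le _)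
  refine Real.rpow_le_rpow (le_min zero_le_one (div_nonneg ha hr.le)) ?_ (by norm_num)
  exact min_le_min le_rfl (div_le_div_of_nonneg_left ha hs hsr)

lemma kh_sq {a r : ℝ} (ha : 0 ≤ a) (hr : 0 < r) :
    r⁻¹ * min 1 ((a / r) ^ 3) = kh a r * kh a r := by
  have h0 : 0 ≤ a / r := div_nonneg ha hr.le
  have h1 : 0 ≤ min 1 (a / r) := le_min zero_le_one h0
  have e : min 1 ((a / r) ^ 3) = (min 1 (a / r)) ^ 3 := by
    rcases le_total 1 (a / r) with h | h
    · rw [min_eq_left h, min_eq_left (one_le_pow₀ h), one_pow]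
    · rw [min_eq_right h, min_eq_right (pow_le_one₀ h0 h)]
  rw [e, kh, mul_mul_mul_comm, ← Real.rpow_add hr, ← Real.rpow_add_of_nonneg h1 (by norm_num) (by norm_num)]
  norm_num
  exact Or.inl (Real.rpow_neg_one r).symm

lemma kh_le_left {a s : ℝ} (ha : 0 ≤ a) (hs : 0 < s) : kh a s ≤ s ^ (-(1 / 2) : ℝ) :=
  mul_le_of_le_one_right (Real.rpow_nonneg hs.le _)
    (Real.rpow_le_one (le_min zero_le_one (div_nonneg ha hs.le)) (min_le_left _ _) (by norm_num))

lemma kh_le_right {a s : ℝ} (ha : 0 ≤ a) (hs : 0 < s) :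
    kh a s ≤ a ^ (3 / 2 : ℝ) * s ^ (-2 : ℝ) := by
  have h0 : 0 ≤ a / s := div_nonneg ha hs.le
  have h1 : (min 1 (a / s)) ^ (3 / 2 : ℝ) ≤ (a / s) ^ (3 / 2 : ℝ) :=
    Real.rpow_le_rpow (le_min zero_le_one h0) (min_le_right _ _) (by norm_num)
  refine (mul_le_mul_of_nonneg_left h1 (Real.rpow_nonneg hs.le _)).trans (le_of_eq ?_)
  rw [Real.div_rpow ha hs.le, div_eq_mul_inv (a ^ _), ← Real.rpow_neg hs.le, mul_left_comm,
    ← Real.rpow_add hs]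
  norm_num

lemma lintegral_kh {a : ℝ} (ha : 0 < a) :
    ∫⁻ s in Ioi (0 : ℝ), ENNReal.ofReal (kh a s) ≤ ENNReal.ofReal (3 * √a) := by
  refine (lintegral_two_powers_le (α := -(1 / 2)) (β := -2) (c := a ^ (3 / 2 : ℝ)) (by norm_num)
    (by norm_num) ha (by positivity) (fun s hs => ENNReal.ofReal_le_ofReal (kh_le_left ha.le hs.1))
    (fun s hs => ENNReal.ofReal_le_ofReal (kh_le_right ha.le (ha.trans hs)))).trans (le_of_eq ?_)
  congr 1
  have : a ^ (3 / 2 : ℝ) * a ^ (-1 : ℝ) = √a := by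
    rw [← Real.rpow_add ha, Real.sqrt_eq_rpow]; norm_num
  have h2 : a ^ (-(1 / 2) + 1 : ℝ) = √a := by rw [Real.sqrt_eq_rpow]; norm_num
  rw [h2, show (-2 : ℝ) + 1 = -1 by norm_num, neg_div_neg_eq, div_one, this]
  ring

lemma lintegral_kh_sqrt {a : ℝ} (ha : 0 < a) :
    ∫⁻ τ in Ioi (0 : ℝ), ENNReal.ofReal ((√τ)⁻¹ * kh a √τ) ≤ ENNReal.ofReal (6 * √a) := by
  have hr : ∀ τ : ℝ, 0 < τ → (√τ)⁻¹ = τ ^ (-(1 / 2) : ℝ) := fun τ hτ => by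
    rw [Real.sqrt_eq_rpow, Real.rpow_neg hτ.le]
  refine (lintegral_two_powers_le (α := -(3 / 4)) (β := -(3 / 2)) (c := a ^ (3 / 2 : ℝ)) (b := a ^ 2)
    (by norm_num) (by norm_num) (by positivity) (by positivity) (fun τ hτ => ENNReal.ofReal_le_ofReal ?_)
    (fun τ hτ => ENNReal.ofReal_le_ofReal ?_)).trans (le_of_eq ?_)
  · have h0 := hτ.1
    refine (mul_le_mul_of_nonneg_left (kh_le_left ha.le (Real.sqrt_pos.2 h0)) (by positivity)).trans
      (le_of_eq ?_)
    rw [hr τ h0, Real.sqrt_eq_rpow, ← Real.rpow_mul h0.le, ← Real.rpow_add h0]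
    norm_num
  · have h0 : 0 < τ := lt_trans (by positivity) hτ
    refine (mul_le_mul_of_nonneg_left (kh_le_right ha.le (Real.sqrt_pos.2 h0)) (by positivity)).trans
      (le_of_eq ?_)
    rw [hr τ h0, Real.sqrt_eq_rpow, ← Real.rpow_mul h0.le, mul_left_comm, ← Real.rpow_add h0]
    norm_num
  · congr 1
    have e : ∀ y : ℝ, (a ^ 2) ^ y = a ^ (2 * y) := fun y => by
      rw [← Real.rpow_natCast, ← Real.rpow_mul ha.le]; norm_num
    have h1 : (a ^ 2) ^ (-(3 / 4) + 1 : ℝ) = √a := by rw [e, Real.sqrt_eq_rpow]; norm_num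
    have h2 : a ^ (3 / 2 : ℝ) * (a ^ 2) ^ (-(1 / 2) : ℝ) = √a := by
      rw [e, ← Real.rpow_add ha, Real.sqrt_eq_rpow]; norm_num
    rw [h1, show -(3 / 2 : ℝ) + 1 = -(1 / 2) by norm_num, neg_div_neg_eq, ← mul_div_assoc, h2]
    ring

/-- The contribution to the bound of the rough part, at time lag `τ`, of a level set of volume `v`. -/
def kn (τ : ℝ) (v : ℝ≥0∞) : ℝ≥0∞ :=
  ∫⁻ σ in Ioc (0 : ℝ) 1, ENNReal.ofReal ((√τ)⁻¹ * (max (√τ) σ)⁻¹) *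
    min 1 (ENNReal.ofReal ((max (√τ) σ)⁻¹ ^ 3) * v)

lemma kn_zero (τ : ℝ) : kn τ 0 = 0 := by simp [kn]

lemma lintegral_kn (v : ℝ≥0∞) : ∫⁻ τ in Ioc (0 : ℝ) (1 / 8), kn τ v ≤ 18 * v ^ (1 / 3 : ℝ) := by
  by_cases hv : v = ⊤
  · rw [hv, ENNReal.top_rpow_of_pos (by norm_num), ENNReal.mul_top (by norm_num)]
    exact le_top
  by_cases hv0 : v = 0
  · simp only [hv0, kn_zero, lintegral_zero]
    exact bot_le
  set a := v.toReal ^ (1 / 3 : ℝ) with ha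
  have hvp : 0 < v.toReal := ENNReal.toReal_pos hv0 hv
  have hap : 0 < a := by positivity
  have ha3 : a ^ 3 = v.toReal := by
    rw [ha, ← Real.rpow_natCast, ← Real.rpow_mul hvp.le]; norm_num
  have hva : v = ENNReal.ofReal (a ^ 3) := by rw [ha3, ENNReal.ofReal_toReal hv]
  have hvr : v ^ (1 / 3 : ℝ) = ENNReal.ofReal a := by
    rw [ha, ← ENNReal.ofReal_rpow_of_pos hvp, ENNReal.ofReal_toReal hv]
  have h1 : ∀ τ ∈ Ioc (0 : ℝ) (1 / 8), kn τ v ≤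
      ENNReal.ofReal ((√τ)⁻¹ * kh a √τ) * ENNReal.ofReal (3 * √a) := by
    intro τ hτ
    have hs : 0 < √τ := Real.sqrt_pos.2 hτ.1
    refine le_trans ?_ (mul_le_mul' le_rfl (lintegral_kh hap))
    rw [← lintegral_const_mul' _ _ ENNReal.ofReal_ne_top]
    refine le_trans ?_ (lintegral_mono_set (s := Ioc (0 : ℝ) 1) Ioc_subset_Ioi_self)
    refine setLIntegral_mono' measurableSet_Ioc fun σ hσ => ?_
    have hr : 0 < max √τ σ := lt_max_of_lt_left hs
    rw [hva, ← ENNReal.ofReal_mul (by positivity), ← ENNReal.ofReal_one, ← ENNReal.ofReal_min,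
      ← ENNReal.ofReal_mul (by positivity),
      ← ENNReal.ofReal_mul (mul_nonneg (by positivity) (kh_nonneg hap.le hs.le))]
    refine ENNReal.ofReal_le_ofReal ?_
    rw [← mul_pow, inv_mul_eq_div (max √τ σ) a, mul_assoc, mul_assoc, kh_sq hap.le hr]
    refine mul_le_mul_of_nonneg_left ?_ (by positivity)
    exact mul_le_mul (kh_anti hap.le hs (le_max_left _ _)) (kh_anti hap.le hσ.1 (le_max_right _ _))
      (kh_nonneg hap.le hr.le) (kh_nonneg hap.le hs.le)
  refine (setLIntegral_mono' measurableSet_Ioc h1).trans ?_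
  rw [lintegral_mul_const' _ _ ENNReal.ofReal_ne_top, hvr]
  refine (mul_le_mul' ((lintegral_mono_set Ioc_subset_Ioi_self).trans (lintegral_kh_sqrt hap)) le_rfl).trans
    (le_of_eq ?_)
  rw [← ENNReal.ofReal_mul (by positivity), show (18 : ℝ≥0∞) = ENNReal.ofReal 18 by norm_num,
    ← ENNReal.ofReal_mul (by norm_num)]
  congr 1
  have := Real.mul_self_sqrt hap.le
  linear_combination 18 * this

end

section

variable {U : Fin 3 → ℝ × E3 → ℝ} {p : ℝ × E3 → ℝ} {A : ℝ} {ζ φ : E3 → ℝ}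

lemma kn_meas {v : ℝ → ℝ≥0∞} (hv : Measurable v) : Measurable fun q : ℝ × ℝ => kn q.1 (v q.2) := by
  have h : Measurable fun z : (ℝ × ℝ) × ℝ => ENNReal.ofReal ((√z.1.1)⁻¹ * (max (√z.1.1) z.2)⁻¹) *
      min 1 (ENNReal.ofReal ((max (√z.1.1) z.2)⁻¹ ^ 3) * v z.1.2) := by fun_prop
  exact h.lintegral_prod_right'

lemma lintegral_kn_shift {v : ℝ → ℝ≥0∞} (hv : Measurable v) :
    ∫⁻ t in Ioo (1 / 2 : ℝ) 1, ∫⁻ τ in Ioc (0 : ℝ) (1 / 8), kn τ (v (t - τ)) ≤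
      18 * ∫⁻ s in Ioo (3 / 8 : ℝ) 1, v s ^ (1 / 3 : ℝ) := by
  have hm := kn_meas hv
  have hm1 : Measurable fun q : ℝ × ℝ => kn q.2 (v (q.1 - q.2)) :=
    hm.comp (measurable_snd.prodMk (measurable_fst.sub measurable_snd))
  rw [lintegral_lintegral_swap hm1.aemeasurable]
  have h1 : ∀ τ ∈ Ioc (0 : ℝ) (1 / 8), ∫⁻ t in Ioo (1 / 2 : ℝ) 1, kn τ (v (t - τ)) ≤
      ∫⁻ s in Ioo (3 / 8 : ℝ) 1, kn τ (v s) := fun τ hτ => by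
    rw [← lintegral_indicator measurableSet_Ioo, ← lintegral_indicator measurableSet_Ioo,
      ← lintegral_sub_right_eq_self ((Ioo (3 / 8 : ℝ) 1).indicator fun s => kn τ (v s)) τ]
    refine lintegral_mono fun t => ?_
    by_cases ht : t ∈ Ioo (1 / 2 : ℝ) 1
    · have ht' : t - τ ∈ Ioo (3 / 8 : ℝ) 1 := ⟨by linarith [ht.1, hτ.2], by linarith [ht.2, hτ.1]⟩
      rw [indicator_of_mem ht, indicator_of_mem ht']
    · rw [indicator_of_notMem ht]
      exact bot_le
  refine (setLIntegral_mono' measurableSet_Ioc h1).trans ?_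
  rw [lintegral_lintegral_swap hm.aemeasurable, ← lintegral_const_mul' _ _ (by norm_num)]
  exact lintegral_mono fun s => lintegral_kn (v s)

lemma sq_le_level_sum (a : ℝ) : ENNReal.ofReal (a ^ 2) ≤
    ∑' k : ℤ, 4 * ENNReal.ofReal (((2 : ℝ) ^ k) ^ 2) * ({y | (2 : ℝ) ^ k ≤ |y|} : Set ℝ).indicator 1 a := by
  by_cases ha : a = 0
  · rw [ha, sq, zero_mul, ENNReal.ofReal_zero]
    exact bot_le
  obtain ⟨k, hk1, hk2⟩ := exists_mem_Ico_zpow (abs_pos.2 ha) one_lt_two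
  refine le_trans ?_ (ENNReal.le_tsum k)
  rw [indicator_of_mem (show a ∈ {y : ℝ | (2 : ℝ) ^ k ≤ |y|} from hk1), Pi.one_apply, mul_one,
    show (4 : ℝ≥0∞) = ENNReal.ofReal 4 by norm_num, ← ENNReal.ofReal_mul (by norm_num)]
  refine ENNReal.ofReal_le_ofReal ?_
  rw [zpow_add_one₀ two_ne_zero] at hk2
  have := pow_le_pow_left₀ (abs_nonneg a) hk2.le 2
  rw [sq_abs] at this
  linarith

lemma TT_const_le {τ : ℝ} (σ : ℝ) (hτ : 0 < τ) (c : ℝ≥0∞) (x : E3) :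
    TT τ σ (fun _ => c) x ≤ ENNReal.ofReal MT * c := by
  rw [TT, tr, lintegral_const, mul_comm]
  exact mul_le_mul' (TT_ok σ hτ).mass le_rfl

lemma TT_level_le {w : E3 → ℝ} (hw : Measurable w) {τ : ℝ} (σ : ℝ) (hτ : 0 < τ) (x : E3) :
    TT τ σ (fun y => ENNReal.ofReal (w y ^ 2)) x ≤ ∑' k : ℤ, ENNReal.ofReal (4 * MT) *
      (ENNReal.ofReal (((2 : ℝ) ^ k) ^ 2) * min 1 (ENNReal.ofReal ((max (√τ) σ)⁻¹ ^ 3) *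
        volume {y | (2 : ℝ) ^ k ≤ |w y|})) := by
  have hok := TT_ok σ hτ
  have hm : ∀ k : ℤ, MeasurableSet {y | (2 : ℝ) ^ k ≤ |w y|} := fun k =>
    measurableSet_le measurable_const (measurable_norm.comp hw)
  have hS := hok.meas
  have hr : 0 < max √τ σ := lt_max_of_lt_left (Real.sqrt_pos.2 hτ)
  have h1 : TT τ σ (fun y => ENNReal.ofReal (w y ^ 2)) x ≤ ∑' k : ℤ,
      4 * ENNReal.ofReal (((2 : ℝ) ^ k) ^ 2) *
        TT τ σ ({y | (2 : ℝ) ^ k ≤ |w y|}.indicator 1) x := by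
    have e : ∀ k : ℤ, 4 * ENNReal.ofReal (((2 : ℝ) ^ k) ^ 2) *
        TT τ σ ({y | (2 : ℝ) ^ k ≤ |w y|}.indicator 1) x = ∫⁻ z, 4 * ENNReal.ofReal (((2 : ℝ) ^ k) ^ 2) *
          {y | (2 : ℝ) ^ k ≤ |w y|}.indicator 1 (x - sh2 σ z) ∂(mu2 τ) := fun k => by
      rw [lintegral_const_mul' _ _ (ENNReal.mul_ne_top (by norm_num) ENNReal.ofReal_ne_top)]
      rfl
    have hmk : ∀ k : ℤ, Measurable fun z : E3 × E3 => 4 * ENNReal.ofReal (((2 : ℝ) ^ k) ^ 2) *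
        ({y | (2 : ℝ) ^ k ≤ |w y|} : Set E3).indicator (1 : E3 → ℝ≥0∞) (x - sh2 σ z) := fun k =>
      ((measurable_one.indicator (hm k)).comp (hS.const_sub x)).const_mul _
    simp only [e]
    rw [← lintegral_tsum fun k => (hmk k).aemeasurable]
    exact lintegral_mono fun z => sq_le_level_sum _
  refine h1.trans (ENNReal.tsum_le_tsum fun k => ?_)
  have h2 : TT τ σ ({y | (2 : ℝ) ^ k ≤ |w y|}.indicator 1) x ≤ ENNReal.ofReal MT *
      min 1 (ENNReal.ofReal ((max (√τ) σ)⁻¹ ^ 3) * volume {y | (2 : ℝ) ^ k ≤ |w y|}) := by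
    rcases le_total 1 (ENNReal.ofReal ((max (√τ) σ)⁻¹ ^ 3) * volume {y | (2 : ℝ) ^ k ≤ |w y|}) with h | h
    · rw [min_eq_left h]
      refine le_trans (lintegral_mono fun z => ?_) (TT_const_le σ hτ 1 x)
      exact indicator_le_self' (fun _ _ => bot_le) _
    · rw [min_eq_right h, ← mul_assoc, ← ENNReal.ofReal_mul MT_pos.le]
      refine (hok.dens _ (measurable_one.indicator (hm k)) x).trans (le_of_eq ?_)
      rw [lintegral_indicator_one (hm k)]
  refine (mul_le_mul' le_rfl h2).trans (le_of_eq ?_)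
  rw [ENNReal.ofReal_mul (by norm_num), show ENNReal.ofReal 4 = 4 by norm_num]
  ring

/-- Volume of a superlevel set of a component of the rough part. -/
def VW (φ : E3 → ℝ) (U : Fin 3 → ℝ × E3 → ℝ) (i : Fin 3) (k : ℤ) (s : ℝ) : ℝ≥0∞ :=
  volume {y | (2 : ℝ) ^ k ≤ |ww φ U i (s, y)|}

lemma VW_meas {i : Fin 3} (h : ContDiff ℝ ∞ (ww φ U i)) (k : ℤ) : Measurable (VW φ U i k) := by
  have hm : MeasurableSet {q : ℝ × E3 | (2 : ℝ) ^ k ≤ |ww φ U i q|} :=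
    measurableSet_le measurable_const h.continuous.abs.measurable
  exact measurable_measure_prodMk_left hm

lemma GG_sq_le {s K : ℝ} (hl : ∀ i x, |ll φ U i (s, x)| ≤ K) (y : E3) :
    GG U s y ^ 2 ≤ ENNReal.ofReal (6 * K ^ 2) + 2 * ∑ i, ENNReal.ofReal (ww φ U i (s, y) ^ 2) := by
  have h0 : ∀ i, 0 ≤ ww φ U i (s, y) ^ 2 := fun i => sq_nonneg _
  rw [GG, ← ENNReal.ofReal_pow (show 0 ≤ spd (slv U s) y from Real.sqrt_nonneg _), ← ENNReal.ofReal_sum_of_nonneg fun i _ => h0 i,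
    show (2 : ℝ≥0∞) = ENNReal.ofReal 2 by norm_num, ← ENNReal.ofReal_mul (by norm_num),
    ← ENNReal.ofReal_add (by positivity) (mul_nonneg two_pos.le (Finset.sum_nonneg fun i _ => h0 i))]
  refine ENNReal.ofReal_le_ofReal ?_
  rw [spd, Real.sq_sqrt (Finset.sum_nonneg fun i _ => sq_nonneg _)]
  have key : ∀ i, slv U s i y ^ 2 ≤ 2 * K ^ 2 + 2 * ww φ U i (s, y) ^ 2 := fun i => by
    have e : slv U s i y = ww φ U i (s, y) + ll φ U i (s, y) := (ww_add_ll i (s, y)).symm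
    have h1 := pow_le_pow_left₀ (abs_nonneg _) (hl i y) 2
    rw [sq_abs] at h1
    rw [e]
    nlinarith [sq_nonneg (ww φ U i (s, y) - ll φ U i (s, y))]
  refine (Finset.sum_le_sum fun i _ => key i).trans (le_of_eq ?_)
  rw [Finset.sum_add_distrib, Finset.mul_sum, Finset.sum_const, Finset.card_univ, Fintype.card_fin,
    nsmul_eq_mul]
  norm_num
  ring

end

section

variable {U : Fin 3 → ℝ × E3 → ℝ} {p : ℝ × E3 → ℝ} {A : ℝ} {ζ φ : E3 → ℝ}

/-- The integrand defining `kn`. -/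
def km (τ : ℝ) (v : ℝ≥0∞) (σ : ℝ) : ℝ≥0∞ := ENNReal.ofReal ((√τ)⁻¹ * (max (√τ) σ)⁻¹) *
  min 1 (ENNReal.ofReal ((max (√τ) σ)⁻¹ ^ 3) * v)

lemma km_meas (τ : ℝ) (v : ℝ≥0∞) : Measurable (km τ v) := by unfold km; fun_prop

lemma km_one {τ σ : ℝ} (hτ : τ ∈ Ioc (0 : ℝ) (1 / 8)) (hσ : σ ∈ Ioc (0 : ℝ) 1) :
    km τ 1 σ = ENNReal.ofReal ((√τ)⁻¹ * (max (√τ) σ)⁻¹) := by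
  have hr : 0 < max √τ σ := lt_max_of_lt_right hσ.1
  have h1 : max √τ σ ≤ 1 := max_le (Real.sqrt_le_one.2 (by linarith [hτ.2])) hσ.2
  rw [km, mul_one, min_eq_left, mul_one]
  rw [ENNReal.one_le_ofReal]
  exact one_le_pow₀ ((one_le_inv₀ hr).2 h1)

lemma TT_GG_le (hww : ∀ i, ContDiff ℝ ∞ (ww φ U i)) {s K τ : ℝ} (σ : ℝ)
    (hl : ∀ i x, |ll φ U i (s, x)| ≤ K) (hτ : 0 < τ) (x : E3) :
    TT τ σ (fun y => GG U s y ^ 2) x ≤ ENNReal.ofReal MT * ENNReal.ofReal (6 * K ^ 2) +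
      2 * ∑ i, ∑' k : ℤ, ENNReal.ofReal (4 * MT) * (ENNReal.ofReal (((2 : ℝ) ^ k) ^ 2) *
        min 1 (ENNReal.ofReal ((max (√τ) σ)⁻¹ ^ 3) * VW φ U i k s)) := by
  have hw : ∀ i, Measurable fun y => ww φ U i (s, y) := fun i =>
    ((hww i).continuous.comp (Continuous.prodMk_right s)).measurable
  have hS := (TT_ok σ hτ).meas
  have hq : ∀ i, Measurable fun z : E3 × E3 => ENNReal.ofReal (ww φ U i (s, x - sh2 σ z) ^ 2) := fun i =>
    (((hw i).comp (hS.const_sub x)).pow_const 2).ennreal_ofReal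
  calc TT τ σ (fun y => GG U s y ^ 2) x
      ≤ TT τ σ (fun y => ENNReal.ofReal (6 * K ^ 2) + 2 * ∑ i, ENNReal.ofReal (ww φ U i (s, y) ^ 2)) x :=
        lintegral_mono fun z => GG_sq_le hl _
    _ = TT τ σ (fun _ => ENNReal.ofReal (6 * K ^ 2)) x +
        2 * ∑ i, TT τ σ (fun y => ENNReal.ofReal (ww φ U i (s, y) ^ 2)) x := by
        simp only [TT, tr]
        rw [lintegral_add_left measurable_const, lintegral_const_mul' _ _ (by norm_num),
          lintegral_finsetSum _ fun i _ => hq i]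
    _ ≤ _ := add_le_add (TT_const_le σ hτ _ x) (mul_le_mul' le_rfl
        (Finset.sum_le_sum fun i _ => TT_level_le (hw i) σ hτ x))

/-- A bound for `WM` that does not depend on the position. -/
def YW (φ : E3 → ℝ) (U : Fin 3 → ℝ × E3 → ℝ) (K t : ℝ) : ℝ≥0∞ :=
  ∫⁻ τ in Ioc (0 : ℝ) (1 / 8), (ENNReal.ofReal MT * ENNReal.ofReal (6 * K ^ 2) * kn τ 1 +
    2 * ENNReal.ofReal (4 * MT) * ∑ i, ∑' k : ℤ, ENNReal.ofReal (((2 : ℝ) ^ k) ^ 2) *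
      kn τ (VW φ U i k (t - τ)))

lemma WM_le_YW (hww : ∀ i, ContDiff ℝ ∞ (ww φ U i)) {t K : ℝ}
    (hl : ∀ s ∈ Ioo (3 / 8 : ℝ) 1, ∀ i x, |ll φ U i (s, x)| ≤ K) (ht : t ∈ Ioo (1 / 2 : ℝ) 1) (x : E3) :
    WM U t x ≤ YW φ U K t := by
  refine setLIntegral_mono' measurableSet_Ioc fun τ hτ => ?_
  have hs : t - τ ∈ Ioo (3 / 8 : ℝ) 1 := ⟨by linarith [ht.1, hτ.2], by linarith [ht.2, hτ.1]⟩
  set a := ENNReal.ofReal MT * ENNReal.ofReal (6 * K ^ 2) with ha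
  set b := 2 * ENNReal.ofReal (4 * MT) with hb
  have h1 : ∀ σ ∈ Ioc (0 : ℝ) 1, ENNReal.ofReal ((√τ)⁻¹ * (max (√τ) σ)⁻¹) *
      TT τ σ (fun y => GG U (t - τ) y ^ 2) x ≤ a * km τ 1 σ + b * ∑ i, ∑' k : ℤ,
        ENNReal.ofReal (((2 : ℝ) ^ k) ^ 2) * km τ (VW φ U i k (t - τ)) σ := fun σ hσ => by
    refine (mul_le_mul' le_rfl (TT_GG_le hww σ (hl _ hs) hτ.1 x)).trans (le_of_eq ?_)
    rw [km_one hτ hσ, mul_add, mul_comm _ (_ * _)]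
    congr 1
    simp only [ENNReal.tsum_mul_left, hb, ← Finset.mul_sum]
    rw [← mul_assoc, ← mul_assoc, mul_comm _ (2 : ℝ≥0∞), mul_assoc 2, mul_comm _ (ENNReal.ofReal (4 * MT)),
      ← mul_assoc, mul_assoc (2 * _)]
    congr 1
    simp only [Finset.mul_sum, ← ENNReal.tsum_mul_left, km]
    refine Finset.sum_congr rfl fun i _ => tsum_congr fun k => ?_
    rw [mul_left_comm]
  refine (setLIntegral_mono' measurableSet_Ioc h1).trans (le_of_eq ?_)
  have hk : ∀ i k, Measurable fun σ => ENNReal.ofReal (((2 : ℝ) ^ k) ^ 2) * km τ (VW φ U i k (t - τ)) σ :=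
    fun i k => (km_meas _ _).const_mul _
  rw [lintegral_add_left ((km_meas _ _).const_mul _), lintegral_const_mul _ (km_meas _ _),
    lintegral_const_mul' _ _ (ENNReal.mul_ne_top (by norm_num) ENNReal.ofReal_ne_top),
    lintegral_finsetSum _ fun i _ => Measurable.tsum fun k => hk i k]
  congr 2
  refine Finset.sum_congr rfl fun i _ => ?_
  rw [lintegral_tsum fun k => (hk i k).aemeasurable]
  exact tsum_congr fun k => lintegral_const_mul _ (km_meas _ _)

lemma lintegral_YW_le (hww : ∀ i, ContDiff ℝ ∞ (ww φ U i)) (K : ℝ) :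
    ∫⁻ t in Ioo (1 / 2 : ℝ) 1, YW φ U K t ≤ 18 * (ENNReal.ofReal MT * ENNReal.ofReal (6 * K ^ 2)) +
      36 * ENNReal.ofReal (4 * MT) * ∫⁻ s in Ioo (3 / 8 : ℝ) 1, ∑ i, ∑' k : ℤ,
        ENNReal.ofReal (((2 : ℝ) ^ k) ^ 2) * VW φ U i k s ^ (1 / 3 : ℝ) := by
  set a := ENNReal.ofReal MT * ENNReal.ofReal (6 * K ^ 2) with ha
  set b := 2 * ENNReal.ofReal (4 * MT) with hb
  have hat : a ≠ ⊤ := ENNReal.mul_ne_top ENNReal.ofReal_ne_top ENNReal.ofReal_ne_top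
  have hbt : b ≠ ⊤ := ENNReal.mul_ne_top (by norm_num) ENNReal.ofReal_ne_top
  have hV := fun i k => VW_meas (hww i) k
  have h2 : ∀ i k, Measurable fun q : ℝ × ℝ => kn q.2 (VW φ U i k (q.1 - q.2)) := fun i k =>
    (kn_meas (hV i k)).comp (measurable_snd.prodMk (measurable_fst.sub measurable_snd))
  have h3 : ∀ i k t, Measurable fun τ => ENNReal.ofReal (((2 : ℝ) ^ k) ^ 2) *
      kn τ (VW φ U i k (t - τ)) := fun i k t =>
    ((h2 i k).comp (measurable_const.prodMk measurable_id)).const_mul _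
  have h4 : ∀ i k, Measurable fun t => ∫⁻ τ in Ioc (0 : ℝ) (1 / 8), kn τ (VW φ U i k (t - τ)) :=
    fun i k => (h2 i k).lintegral_prod_right'
  have h1m : Measurable fun τ => kn τ 1 :=
    (kn_meas (measurable_const (a := (1 : ℝ≥0∞)))).comp (measurable_id.prodMk (measurable_const (a := (0 : ℝ))))
  have e : ∀ t, YW φ U K t = a * (∫⁻ τ in Ioc (0 : ℝ) (1 / 8), kn τ 1) + b * ∑ i, ∑' k : ℤ,
      ENNReal.ofReal (((2 : ℝ) ^ k) ^ 2) * ∫⁻ τ in Ioc (0 : ℝ) (1 / 8), kn τ (VW φ U i k (t - τ)) := fun t => by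
    rw [YW, lintegral_add_left (h1m.const_mul _), lintegral_const_mul' _ _ hat, lintegral_const_mul' _ _ hbt,
      lintegral_finsetSum _ fun i _ => Measurable.tsum fun k => h3 i k t]
    congr 2
    refine Finset.sum_congr rfl fun i _ => ?_
    rw [lintegral_tsum fun k => (h3 i k t).aemeasurable]
    exact tsum_congr fun k => lintegral_const_mul' _ _ ENNReal.ofReal_ne_top
  simp only [e]
  rw [lintegral_add_left measurable_const, lintegral_const_mul' _ _ hbt,
    lintegral_finsetSum _ fun i _ => Measurable.tsum fun k => (h4 i k).const_mul _,
    lintegral_finsetSum _ fun i _ => Measurable.tsum fun k => ((hV i k).pow_const _).const_mul _]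
  refine add_le_add ?_ ?_
  · rw [lintegral_const, Measure.restrict_apply_univ, Real.volume_Ioo]
    have h1 := lintegral_kn 1
    rw [ENNReal.one_rpow, mul_one] at h1
    calc _ ≤ a * 18 * 1 := mul_le_mul' (mul_le_mul' le_rfl h1)
          (by rw [← ENNReal.ofReal_one]; exact ENNReal.ofReal_le_ofReal (by norm_num))
      _ = _ := by rw [mul_one, mul_comm]
  · have e2 : 36 * ENNReal.ofReal (4 * MT) = b * 18 := by rw [hb, mul_right_comm]; norm_num
    rw [e2, mul_assoc b 18, Finset.mul_sum _ _ (18 : ℝ≥0∞)]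
    refine mul_le_mul' le_rfl (Finset.sum_le_sum fun i _ => ?_)
    rw [lintegral_tsum fun k => ((h4 i k).const_mul _).aemeasurable,
      lintegral_tsum fun k => (((hV i k).pow_const _).const_mul _).aemeasurable, ← ENNReal.tsum_mul_left]
    refine ENNReal.tsum_le_tsum fun k => ?_
    rw [lintegral_const_mul' _ _ ENNReal.ofReal_ne_top, lintegral_const_mul' _ _ ENNReal.ofReal_ne_top,
      mul_left_comm]
    exact mul_le_mul' le_rfl (lintegral_kn_shift (hV i k))

end

section

variable {U : Fin 3 → ℝ × E3 → ℝ} {p : ℝ × E3 → ℝ} {A : ℝ} {ζ φ : E3 → ℝ}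

lemma spd_le_sum (V : Fin 3 → E3 → ℝ) (x : E3) : spd V x ≤ ∑ i, |V i x| := by
  refine Real.sqrt_le_iff.2 ⟨Finset.sum_nonneg fun i _ => abs_nonneg _, ?_⟩
  simp only [Fin.sum_univ_three]
  have h0 := abs_nonneg (V 0 x)
  have h1 := abs_nonneg (V 1 x)
  have h2 := abs_nonneg (V 2 x)
  rw [← sq_abs (V 0 x), ← sq_abs (V 1 x), ← sq_abs (V 2 x)]
  nlinarith [mul_nonneg h0 h1, mul_nonneg h0 h2, mul_nonneg h1 h2]

lemma KK_eq (C A : ℝ) : KK C A = KK C 1 * A ^ 6 := by simp [KK]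

lemma KC.spd_le {C : ℝ} (hC : KC ζ φ C) (h : NS U p A) {t : ℝ} (ht : t ∈ Ioo (1 / 2 : ℝ) 1) (x : E3) :
    ENNReal.ofReal (spd (slv U t) x) ≤
      3 * ENNReal.ofReal (18 * C ^ 2) * YW φ U (KK C A) t + 3 * ENNReal.ofReal (KK C A) := by
  have hww := fun i => ww_smooth hC.pair h.sU i
  have ht1 : t ∈ Ioo (1 / 8 : ℝ) 1 := ⟨by linarith [ht.1], ht.2⟩
  have hl : ∀ s ∈ Ioo (3 / 8 : ℝ) 1, ∀ i x, |ll φ U i (s, x)| ≤ KK C A := fun s hs i x =>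
    (hC.eSl h ⟨by linarith [hs.1], hs.2⟩).l0 i x
  have hi : ∀ i, ENNReal.ofReal |slv U t i x| ≤
      ENNReal.ofReal (18 * C ^ 2) * YW φ U (KK C A) t + ENNReal.ofReal (KK C A) := fun i => by
    have e : slv U t i x = ww φ U i (t, x) + ll φ U i (t, x) := (ww_add_ll i (t, x)).symm
    rw [e]
    refine (ofReal_abs_add_le _ _).trans (add_le_add ?_ ?_)
    · exact (hC.ww_le h i ⟨ht1.1, ht1.2.le⟩ x).trans (mul_le_mul' le_rfl (WM_le_YW hww hl ht x))
    · exact ENNReal.ofReal_le_ofReal ((hC.eSl h ht1).l0 i x)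
  refine (ENNReal.ofReal_le_ofReal (spd_le_sum _ x)).trans ?_
  rw [ENNReal.ofReal_sum_of_nonneg fun i _ => abs_nonneg _]
  refine (Finset.sum_le_sum fun i _ => hi i).trans (le_of_eq ?_)
  rw [Finset.sum_const, Finset.card_univ, Fintype.card_fin, nsmul_eq_mul]
  push_cast
  ring

lemma KC.lorentz_le {C L M D : ℝ} (hC : KC ζ φ C) (h : NS U p A) (hL1 : 1 ≤ L) (hL : Lad L)
    (hM : 1 ≤ M) (hcut : ∀ r δ, 0 ≤ r → 0 < δ → ∃ χ, Cut M r δ χ)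
    (hD : ∀ f : E3 → ℝ, ContDiff ℝ ∞ f →
      ∑' k : ℤ, ENNReal.ofReal (((2 : ℝ) ^ k) ^ 2) * volume {x | (2 : ℝ) ^ k ≤ |f x|} ^ (1 / 3 : ℝ) ≤
        ENNReal.ofReal D * ((∫⁻ x, ENNReal.ofReal (gsq f x)) + ∫⁻ x, ENNReal.ofReal (f x ^ 2))) :
    ∫⁻ s in Ioo (3 / 8 : ℝ) 1, ∑ i, ∑' k : ℤ,
        ENNReal.ofReal (((2 : ℝ) ^ k) ^ 2) * VW φ U i k s ^ (1 / 3 : ℝ) ≤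
      ENNReal.ofReal D * (ENNReal.ofReal (DB L M (KK C A)) + 3 * ENNReal.ofReal (KK C A)) := by
  have hww := fun i => ww_smooth hC.pair h.sU i
  have h1 : ∀ s ∈ Ioo (3 / 8 : ℝ) 1, ∑ i, ∑' k : ℤ,
      ENNReal.ofReal (((2 : ℝ) ^ k) ^ 2) * VW φ U i k s ^ (1 / 3 : ℝ) ≤
        ENNReal.ofReal D * ((∫⁻ x, ENNReal.ofReal (∑ i, gsq (sl (ww φ U i) s) x)) +
          3 * ENNReal.ofReal (KK C A)) := fun s hs => by
    have hE := hC.eSl h (t := s) ⟨by linarith [hs.1], hs.2⟩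
    refine (Finset.sum_le_sum fun i _ => (hD _ (sl_smooth (hww i) s)).trans
      (mul_le_mul' le_rfl (add_le_add le_rfl (hE.w2 i)))).trans (le_of_eq ?_)
    rw [← Finset.mul_sum, Finset.sum_add_distrib, Finset.sum_const, Finset.card_univ, Fintype.card_fin,
      nsmul_eq_mul, ← lintegral_finsetSum _ fun i _ => (gsq_cont (sl_smooth (hww i) s)).measurable.ennreal_ofReal]
    simp only [ENNReal.ofReal_sum_of_nonneg fun i _ => gsq_nonneg _ _]
    norm_num
  refine (setLIntegral_mono' measurableSet_Ioo h1).trans ?_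
  rw [lintegral_const_mul' _ _ ENNReal.ofReal_ne_top, lintegral_add_right _ measurable_const,
    lintegral_const, Measure.restrict_apply_univ, Real.volume_Ioo]
  refine mul_le_mul' le_rfl (add_le_add (hC.dissipation h hL1 hL hM hcut) ?_)
  refine mul_le_of_le_one_right' ?_
  rw [← ENNReal.ofReal_one]
  exact ENNReal.ofReal_le_ofReal (by norm_num)

/-- The bound on the total speed, in the unit time interval. -/
lemma exists_speed_bound : ∃ Z : ℝ, 1 ≤ Z ∧ ∀ (U : Fin 3 → ℝ × E3 → ℝ) (p : ℝ × E3 → ℝ) (A : ℝ),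
    NS U p A → ∫⁻ t in Icc (1 / 2 : ℝ) 1, ⨆ x, ENNReal.ofReal (spd (slv U t) x) ≤
      ENNReal.ofReal (Z * A ^ 36) := by
  obtain ⟨ζ, φ, C, hC⟩ := exists_KC
  obtain ⟨L, hL1, hL⟩ := exists_ladyzhenskaya
  obtain ⟨M, hM, hcut⟩ := exists_cutoff
  obtain ⟨D, hD1, hD⟩ := exists_lorentz
  have hMT := MT_pos
  have hZE : 0 ≤ ZE L M := by unfold ZE; positivity
  have hC1 := hC.pos
  set c := 54 * C ^ 2 * (108 * MT + 144 * MT * D * (8192 * (3 + 2 * ZE L M) + 3)) + 3 with hc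
  refine ⟨max 1 (c * KK C 1 ^ 6), le_max_left _ _, fun U p A h => ?_⟩
  have hA := h.hA
  set K := KK C A with hK
  have hK1 : 1 ≤ K := (hC.eSl h (t := 1 / 2) (by norm_num)).K1
  have hK0 : 0 ≤ K := by linarith
  have hD0 : 0 ≤ D := by linarith
  have hDB : 0 ≤ DB L M K := by unfold DB; positivity
  rw [← setLIntegral_congr (Ioo_ae_eq_Icc (a := (1 / 2 : ℝ)) (b := 1))]
  calc _ ≤ ∫⁻ t in Ioo (1 / 2 : ℝ) 1,
        (3 * ENNReal.ofReal (18 * C ^ 2) * YW φ U K t + 3 * ENNReal.ofReal K) :=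
        setLIntegral_mono' measurableSet_Ioo fun t ht => iSup_le fun x => hC.spd_le h ht x
    _ ≤ 3 * ENNReal.ofReal (18 * C ^ 2) * (18 * (ENNReal.ofReal MT * ENNReal.ofReal (6 * K ^ 2)) +
          36 * ENNReal.ofReal (4 * MT) * (ENNReal.ofReal D * (ENNReal.ofReal (DB L M K) +
            3 * ENNReal.ofReal K))) + 3 * ENNReal.ofReal K := by
        rw [lintegral_add_right _ measurable_const, lintegral_const_mul' _ _
          (ENNReal.mul_ne_top (by norm_num) ENNReal.ofReal_ne_top), lintegral_const,
          Measure.restrict_apply_univ, Real.volume_Ioo]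
        refine add_le_add (mul_le_mul' le_rfl ((lintegral_YW_le
          (fun i => ww_smooth hC.pair h.sU i) K).trans (add_le_add le_rfl (mul_le_mul' le_rfl
            (hC.lorentz_le h hL1 hL hM hcut hD))))) (mul_le_of_le_one_right' ?_)
        rw [← ENNReal.ofReal_one]
        exact ENNReal.ofReal_le_ofReal (by norm_num)
    _ = ENNReal.ofReal (3 * (18 * C ^ 2) * (18 * (MT * (6 * K ^ 2)) +
          36 * (4 * MT) * (D * (DB L M K + 3 * K))) + 3 * K) := by
        have e3 : (3 : ℝ≥0∞) = ENNReal.ofReal 3 := by norm_num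
        have e18 : (18 : ℝ≥0∞) = ENNReal.ofReal 18 := by norm_num
        have e36 : (36 : ℝ≥0∞) = ENNReal.ofReal 36 := by norm_num
        rw [e3, e18, e36, ← ENNReal.ofReal_mul (p := 3) (q := K) (by norm_num),
          ← ENNReal.ofReal_add hDB (by positivity), ← ENNReal.ofReal_mul hD0,
          ← ENNReal.ofReal_mul (p := 36) (by norm_num), ← ENNReal.ofReal_mul (by positivity),
          ← ENNReal.ofReal_mul hMT.le, ← ENNReal.ofReal_mul (p := 18) (by norm_num),
          ← ENNReal.ofReal_mul (p := 36 * (4 * MT)) (by positivity),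
          ← ENNReal.ofReal_add (by positivity) (by positivity),
          ← ENNReal.ofReal_mul (by positivity), ← ENNReal.ofReal_add (by positivity) (by positivity)]
    _ ≤ _ := by
        refine ENNReal.ofReal_le_ofReal ?_
        have h1 : K ≤ K ^ 6 := le_self_pow₀ hK1 (by norm_num)
        have h2 : K ^ 2 ≤ K ^ 6 := pow_le_pow_right₀ hK1 (by norm_num)
        have h6 : K ^ 6 = KK C 1 ^ 6 * A ^ 36 := by rw [hK, KK_eq, mul_pow, ← pow_mul]
        calc _ ≤ 3 * (18 * C ^ 2) * (18 * (MT * (6 * K ^ 6)) + 36 * (4 * MT) * (D *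
              (8192 * (3 * K ^ 6 + 2 * (ZE L M * K ^ 6)) + 3 * K ^ 6))) + 3 * K ^ 6 := by
              unfold DB
              gcongr
          _ = c * KK C 1 ^ 6 * A ^ 36 := by rw [mul_assoc c, ← h6, hc]; ring
          _ ≤ _ := mul_le_mul_of_nonneg_right (le_max_right _ _) (by positivity)

end

section

variable {U : Fin 3 → ℝ × E3 → ℝ} {p : ℝ × E3 → ℝ} {A : ℝ} {ζ φ : E3 → ℝ}

/-- The parabolic rescaling of a function of space and time. -/
def zoom (a σ : ℝ) (f : ℝ × E3 → ℝ) (q : ℝ × E3) : ℝ := f (a + σ ^ 2 * q.1, σ • q.2)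

/-- The linear part of the parabolic rescaling. -/
def zoomL (σ : ℝ) : ℝ × E3 →L[ℝ] ℝ × E3 :=
  (σ ^ 2 • ContinuousLinearMap.fst ℝ ℝ E3).prod (σ • ContinuousLinearMap.snd ℝ ℝ E3)

lemma zoom_eq (a σ : ℝ) (f : ℝ × E3 → ℝ) : zoom a σ f = fun q => f ((a, 0) + zoomL σ q) := by
  ext q
  simp [zoom, zoomL]

lemma zoom_smooth {f : ℝ × E3 → ℝ} (hf : ContDiff ℝ ∞ f) (a σ : ℝ) : ContDiff ℝ ∞ (zoom a σ f) := by
  rw [zoom_eq]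
  exact hf.comp (contDiff_const.add (zoomL σ).contDiff)

lemma dt_zoom {f : ℝ × E3 → ℝ} (hf : ContDiff ℝ ∞ f) (a σ : ℝ) (q : ℝ × E3) :
    dt (zoom a σ f) q = σ ^ 2 * zoom a σ (dt f) q := by
  have e : zoomL σ ((1 : ℝ), (0 : E3)) = σ ^ 2 • ((1 : ℝ), (0 : E3)) := by simp [zoomL]
  rw [zoom_eq, zoom_eq, dt, dder_comp_affine _ _ _ hf, e]
  simp only [dder, map_smul, smul_eq_mul, dt]

lemma dx_zoom {f : ℝ × E3 → ℝ} (hf : ContDiff ℝ ∞ f) (a σ : ℝ) (i : Fin 3) :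
    dx i (zoom a σ f) = fun q => σ * zoom a σ (dx i f) q := by
  ext q
  have e : zoomL σ ((0 : ℝ), ee i) = σ • ((0 : ℝ), ee i) := by simp [zoomL]
  rw [zoom_eq, zoom_eq, dx, dder_comp_affine _ _ _ hf, e]
  simp only [dder, map_smul, smul_eq_mul, dx]

lemma ffs_slv (hU : ∀ i, ContDiff ℝ ∞ (U i)) (hp : ContDiff ℝ ∞ p) (i : Fin 3) (t : ℝ) (x : E3) :
    ffs (slv U t) (sl p t) i x =
      ∑ j, (dx j (U i) (t, x) * U j (t, x) + U i (t, x) * dx j (U j) (t, x)) + dx i p (t, x) := by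
  unfold ffs dvt
  rw [← sl_dx hp]
  congr 1
  refine Finset.sum_congr rfl fun j _ => ?_
  change dder (ee j) (fun y => sl (U i) t y * sl (U j) t y) x = _
  rw [dder_mul _ (sl_smooth (hU i) t) (sl_smooth (hU j) t)]
  rw [← sl_dx (hU i), ← sl_dx (hU j)]
  rfl

lemma volume_dilate {σ : ℝ} (hσ : 0 < σ) (s : Set E3) :
    volume {x : E3 | σ • x ∈ s} = ENNReal.ofReal (σ⁻¹ ^ 3) * volume s := by
  have h := Measure.addHaar_preimage_smul (volume : Measure E3) hσ.ne' s
  have e : {x : E3 | σ • x ∈ s} = (σ • ·) ⁻¹' s := rfl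
  rw [e, h, finrank_euclideanSpace_fin, abs_of_nonneg (by positivity), inv_pow]

lemma wnorm3_weak {f : E3 → E3} {A l : ℝ} (h : wnorm3 f ≤ ENNReal.ofReal A) (hA : 0 ≤ A) (hl : 0 < l) :
    volume {x | l ≤ ‖f x‖} ≤ ENNReal.ofReal ((A / l) ^ 3) := by
  have h1 : ENNReal.ofReal l * volume {x | l ≤ ‖f x‖} ^ (1 / 3 : ℝ) ≤ ENNReal.ofReal A :=
    (le_iSup₂ (f := fun (l : ℝ) (_ : 0 < l) =>
      ENNReal.ofReal l * volume {x | l ≤ ‖f x‖} ^ (1 / 3 : ℝ)) l hl).trans h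
  have h2 : volume {x | l ≤ ‖f x‖} ^ (1 / 3 : ℝ) ≤ ENNReal.ofReal (A / l) := by
    rw [ENNReal.ofReal_div_of_pos hl, ENNReal.le_div_iff_mul_le (Or.inl (by simpa using hl))
      (Or.inl ENNReal.ofReal_ne_top), mul_comm]
    exact h1
  rw [ENNReal.ofReal_pow (by positivity)]
  calc volume {x | l ≤ ‖f x‖} = (volume {x | l ≤ ‖f x‖} ^ (1 / 3 : ℝ)) ^ 3 := by
        rw [← ENNReal.rpow_natCast, ← ENNReal.rpow_mul]
        norm_num
    _ ≤ _ := pow_le_pow_left' h2 3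

/-- The coordinates of a rescaled velocity field. -/
def zu (u : ℝ → E3 → E3) (a σ : ℝ) (i : Fin 3) : ℝ × E3 → ℝ :=
  fun q => σ * zoom a σ (fun q => u q.1 q.2 i) q

lemma spd_zu (u : ℝ → E3 → E3) (a : ℝ) {σ : ℝ} (hσ : 0 ≤ σ) (t : ℝ) (x : E3) :
    spd (slv (zu u a σ) t) x = σ * ‖u (a + σ ^ 2 * t) (σ • x)‖ := by
  simp only [spd, slv, sl, zu, zoom, EuclideanSpace.norm_eq, Real.norm_eq_abs, sq_abs, mul_pow]
  rw [← Finset.mul_sum, Real.sqrt_mul (by positivity), Real.sqrt_sq hσ]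

lemma IsNSSol.coord_smooth {u : ℝ → E3 → E3} {pr : ℝ → E3 → ℝ} {I : Set ℝ} (h : IsNSSol u pr I)
    (i : Fin 3) : ContDiff ℝ ∞ (fun q : ℝ × E3 => u q.1 q.2 i) :=
  (contDiff_euclidean (n := ∞)).1 h.1 i

lemma IsNSSol.zoom_NS {u : ℝ → E3 → E3} {pr : ℝ → E3 → ℝ} {a b : ℝ} (h : IsNSSol u pr (Icc a b))
    (hab : a < b) (hA : 1 ≤ A) (hw : ∀ t ∈ Icc a b, wnorm3 (u t) ≤ ENNReal.ofReal A) :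
    NS (zu u a √(b - a)) (fun q => √(b - a) ^ 2 * zoom a √(b - a) (fun q => pr q.1 q.2) q) A := by
  set σ := √(b - a) with hσd
  have hσ : 0 < σ := Real.sqrt_pos.2 (sub_pos.2 hab)
  have hσ2 : σ ^ 2 = b - a := Real.sq_sqrt (sub_pos.2 hab).le
  have hu := h.coord_smooth
  have hp : ContDiff ℝ ∞ (fun q : ℝ × E3 => pr q.1 q.2) := h.2.1
  have hzu : ∀ i, ContDiff ℝ ∞ (zu u a σ i) := fun i => contDiff_const.mul (zoom_smooth (hu i) a σ)
  have hzp : ContDiff ℝ ∞ (fun q => σ ^ 2 * zoom a σ (fun q => pr q.1 q.2) q) :=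
    contDiff_const.mul (zoom_smooth hp a σ)
  have hdx : ∀ i j, dx j (zu u a σ i) = fun q => σ * (σ * zoom a σ (dx j fun q => u q.1 q.2 i) q) :=
    fun i j => by
      rw [dx]
      unfold zu
      rw [dder_const_mul _ _ (zoom_smooth (hu i) a σ)]
      change (fun q => σ * dx j (zoom a σ fun q => u q.1 q.2 i) q) = _
      rw [dx_zoom (hu i)]
  have htI : ∀ t ∈ Icc (0 : ℝ) 1, a + σ ^ 2 * t ∈ Icc a b := fun t ht => by
    rw [hσ2]
    constructor <;> nlinarith [ht.1, ht.2]
  have hdiv : ∀ t ∈ Icc (0 : ℝ) 1, ∀ x, ∑ i, dx i (zu u a σ i) (t, x) = 0 := fun t ht x => by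
    have h1 := h.2.2.2 _ (htI t ht) (σ • x)
    simp only [pd_eq_dder] at h1
    simp only [hdx, ← Finset.mul_sum, zoom]
    convert mul_zero σ using 2
    convert mul_zero σ using 2
    rw [← h1]
    exact Finset.sum_congr rfl fun i _ => congrFun (sl_dx (hu i) i _) _
  refine ⟨hzu, hzp, hA, fun i t ht x => ?_, hdiv, fun t ht => ?_⟩
  · set q : ℝ × E3 := (a + σ ^ 2 * t, σ • x) with hq
    have h1 := h.2.2.1 _ (htI t ht) (σ • x) i
    have e1 : deriv (fun s => u s (σ • x) i) (a + σ ^ 2 * t) = dt (fun q => u q.1 q.2 i) q :=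
      (hasDerivAt_time (hu i) _ _).deriv
    have e2 : lap (fun y => u (a + σ ^ 2 * t) y i) (σ • x) =
        ∑ j, dx j (dx j fun q => u q.1 q.2 i) q := lapl_sl (hu i) _ _
    have e3 : ∀ j, pd (fun y => u (a + σ ^ 2 * t) y i) j (σ • x) = dx j (fun q => u q.1 q.2 i) q :=
      fun j => (congrFun (sl_dx (hu i) j _) _).symm
    have e4 : pd (pr (a + σ ^ 2 * t)) i (σ • x) = dx i (fun q => pr q.1 q.2) q :=
      (congrFun (sl_dx hp i _) _).symm
    rw [e1, e2, e4] at h1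
    simp only [e3] at h1
    have f1 : dt (zu u a σ i) (t, x) = σ ^ 3 * dt (fun q => u q.1 q.2 i) q := by
      rw [dt]
      unfold zu
      rw [dder_const_mul _ _ (zoom_smooth (hu i) a σ)]
      change σ * dt (zoom a σ fun q => u q.1 q.2 i) (t, x) = _
      rw [dt_zoom (hu i)]
      simp only [zoom, hq]
      ring
    have f2 : lapl (sl (zu u a σ i) t) x = σ ^ 3 * ∑ j, dx j (dx j fun q => u q.1 q.2 i) q := by
      rw [lapl_sl (hzu i), Finset.mul_sum]
      refine Finset.sum_congr rfl fun j _ => ?_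
      have hs := zoom_smooth (dx_smooth (hu i) j) a σ
      rw [hdx, dx, dder_const_mul _ _ (contDiff_const.mul hs), dder_const_mul _ _ hs]
      change σ * (σ * dx j (zoom a σ (dx j fun q => u q.1 q.2 i)) (t, x)) = _
      rw [dx_zoom (dx_smooth (hu i) j)]
      simp only [zoom, hq]
      ring
    have f3 : dx i (fun q => σ ^ 2 * zoom a σ (fun q => pr q.1 q.2) q) (t, x) =
        σ ^ 3 * dx i (fun q => pr q.1 q.2) q := by
      rw [dx, dder_const_mul _ _ (zoom_smooth hp a σ)]
      change σ ^ 2 * dx i (zoom a σ fun q => pr q.1 q.2) (t, x) = _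
      rw [dx_zoom hp]
      simp only [zoom, hq]
      ring
    have f4 : ∑ j, dx j (zu u a σ i) (t, x) * zu u a σ j (t, x) =
        σ ^ 3 * ∑ j, u (a + σ ^ 2 * t) (σ • x) j * dx j (fun q => u q.1 q.2 i) q := by
      rw [Finset.mul_sum]
      refine Finset.sum_congr rfl fun j _ => ?_
      rw [hdx]
      simp only [zu, zoom, hq]
      ring
    rw [ffs_slv hzu hzp, Finset.sum_add_distrib, ← Finset.mul_sum, hdiv t ht, f1, f2, f3, f4]
    linear_combination σ ^ 3 * h1
  · refine ⟨(spd_cont fun i => sl_smooth (hzu i) t).measurable, fun x => Real.sqrt_nonneg _,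
      fun l hl => ?_⟩
    have e : {x | l ≤ spd (slv (zu u a σ) t) x} =
        {x | σ • x ∈ {y | l / σ ≤ ‖u (a + σ ^ 2 * t) y‖}} := by
      ext x
      rw [mem_ofPred_eq, spd_zu u a hσ.le, mem_ofPred_eq, mem_ofPred_eq, div_le_iff₀' hσ]
    rw [e, volume_dilate hσ]
    refine (mul_le_mul' le_rfl (wnorm3_weak (hw _ (htI t ht)) (by linarith) (div_pos hl hσ))).trans ?_
    rw [← ENNReal.ofReal_mul (by positivity)]
    refine ENNReal.ofReal_le_ofReal (le_of_eq ?_)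
    field_simp

lemma setLIntegral_comp_affine {g : ℝ → ℝ≥0∞} (a : ℝ) {τ : ℝ} (hτ : 0 < τ) (c d : ℝ) :
    ∫⁻ t in Icc (a + τ * c) (a + τ * d), g t =
      ENNReal.ofReal τ * ∫⁻ s in Icc c d, g (a + τ * s) := by
  have h := lintegral_image_eq_lintegral_abs_deriv_mul (f := fun s => a + τ * s) (f' := fun _ => τ)
    (s := Icc c d) measurableSet_Icc
    (fun s _ => by simpa using (((hasDerivAt_id s).const_mul τ).const_add a).hasDerivWithinAt)
    (fun s _ r _ e => by simpa [hτ.ne'] using e) g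
  have e : (fun s => a + τ * s) '' Icc c d = Icc (a + τ * c) (a + τ * d) := by
    have := Set.image_affine_Icc' hτ a c d
    simpa [add_comm] using this
  rw [e] at h
  rw [h, abs_of_pos hτ, lintegral_const_mul' _ _ ENNReal.ofReal_ne_top]

end

end

/-- Bounded total speed. -/
theorem stmt8 :
    ∃ C : ℝ, 0 < C ∧
      ∀ (A a b : ℝ), 2 ≤ A → a < b →
        ∀ (u : ℝ → E3 → E3) (pr : ℝ → E3 → ℝ),
          IsNSSol u pr (Set.Icc a b) →
          (∀ t ∈ Set.Icc a b, wnorm3 (u t) ≤ ENNReal.ofReal A) →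
          (∫⁻ t in Set.Icc ((a + b) / 2) b, ⨆ x : E3, (‖u t x‖₊ : ℝ≥0∞)) ≤
            ENNReal.ofReal ((b - a) ^ ((1:ℝ)/2) * A ^ C) := by
  obtain ⟨Z, hZ1, hZ⟩ := exists_speed_bound
  obtain ⟨n, hn⟩ := pow_unbounded_of_one_lt Z (one_lt_two)
  refine ⟨((n + 36 : ℕ) : ℝ), by positivity, fun A a b hA hab u pr h hw => ?_⟩
  set σ := √(b - a) with hσd
  have hσ : 0 < σ := Real.sqrt_pos.2 (sub_pos.2 hab)
  have hσ2 : σ ^ 2 = b - a := Real.sq_sqrt (sub_pos.2 hab).le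
  have h1 := hZ _ _ A (h.zoom_NS hab (by linarith) hw)
  rw [← hσd] at h1
  have e : ∀ t, ⨆ x, ENNReal.ofReal (spd (slv (zu u a σ) t) x) =
      ENNReal.ofReal σ * ⨆ x : E3, (‖u (a + σ ^ 2 * t) x‖₊ : ℝ≥0∞) := fun t => by
    rw [ENNReal.mul_iSup, ← (Homeomorph.smulOfNeZero σ hσ.ne' : E3 ≃ₜ E3).surjective.iSup_comp
      fun y => ENNReal.ofReal σ * (‖u (a + σ ^ 2 * t) y‖₊ : ℝ≥0∞)]
    refine iSup_congr fun x => ?_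
    rw [spd_zu u a hσ.le, ENNReal.ofReal_mul hσ.le, ofReal_norm]
    rfl
  simp only [e] at h1
  rw [lintegral_const_mul' _ _ ENNReal.ofReal_ne_top] at h1
  have e1 : (a + b) / 2 = a + σ ^ 2 * (1 / 2) := by rw [hσ2]; ring
  have e2 : b = a + σ ^ 2 * 1 := by rw [hσ2]; ring
  have e3 : Icc ((a + b) / 2) b = Icc (a + σ ^ 2 * (1 / 2)) (a + σ ^ 2 * 1) := by rw [← e1, ← e2]
  rw [e3, setLIntegral_comp_affine a (by positivity), pow_two, ENNReal.ofReal_mul hσ.le, mul_assoc,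
    ← pow_two, ← Real.sqrt_eq_rpow, ← hσd, ENNReal.ofReal_mul hσ.le]
  refine mul_le_mul' le_rfl (h1.trans (ENNReal.ofReal_le_ofReal ?_))
  rw [Real.rpow_natCast, pow_add]
  have : Z ≤ A ^ n := hn.le.trans (by gcongr)
  gcongr
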